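/- There is an absolute constant C > 0 such that for all integers n ≥ 5 and all irreducible complex characters α ≠ 1 of the alternating group G = A_n, and for all irreducible characters χ₁, χ₂ of G, there exists an integer k with 1 ≤ k ≤ C · log|G| / log α(1) such that χ₂ is a constituent of α^k · χ₁; in particular, the McKay graph M(G, α) has diameter at most C · log|G| / log α(1). -/

import Mathlib

set_option linter.all false
open scoped BigOperators

namespace McKayGraphs

/-- The standard inner product of class functions on a finite group `G`:
`⟨φ,ψ⟩ = |G|⁻¹ Σ_{g∈G} φ(g)·conj(ψ(g))`. -/
noncomputable def charInner {G : Type*} [Group G] (φ ψ : G → ℂ) : ℂ :=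
  (Nat.card G : ℂ)⁻¹ * ∑ᶠ g, φ g * (starRingEnd ℂ) (ψ g)

/-- `χ : G → ℂ` is a character if it is the trace function of a finite-dimensional
complex representation of `G`. -/
def IsChar {G : Type*} [Group G] (χ : G → ℂ) : Prop :=
  ∃ (d : ℕ) (ρ : G →* Matrix.GeneralLinearGroup (Fin d) ℂ),
    ∀ g, χ g = Matrix.trace (ρ g : Matrix (Fin d) (Fin d) ℂ)

/-- An irreducible character of `G`: a character with `⟨χ,χ⟩ = 1`. -/
def IsIrrChar {G : Type*} [Group G] (χ : G → ℂ) : Prop :=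
  IsChar χ ∧ charInner χ χ = 1

/-- `ψ` is a constituent of `φ` if `⟨φ,ψ⟩ ≠ 0`. -/
def IsConstituent {G : Type*} [Group G] (ψ φ : G → ℂ) : Prop :=
  charInner φ ψ ≠ 0

end McKayGraphs

open scoped BigOperators
namespace McKayGraphs
open Equiv

section basics
variable {X : Type*} [Fintype X] [DecidableEq X]

lemma ais (c : Perm X) (x : X) : c (c⁻¹ x) = x := c.apply_symm_apply x
lemma ias (c : Perm X) (x : X) : c⁻¹ (c x) = x := c.symm_apply_apply x

/-- complex-valued sign -/
noncomputable def sg (c : Perm X) : ℂ := ((Perm.sign c : ℤ) : ℂ)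

@[simp] lemma sg_one : sg (1 : Perm X) = 1 := by simp [sg]
lemma sg_mul (a b : Perm X) : sg (a * b) = sg a * sg b := by simp [sg]
@[simp] lemma sg_inv (a : Perm X) : sg a⁻¹ = sg a := by simp [sg]
@[simp] lemma sg_sq (a : Perm X) : sg a * sg a = 1 := by
  rcases Int.units_eq_one_or (Perm.sign a) with h | h <;> simp [sg, h]
lemma sg_ne_zero (a : Perm X) : sg a ≠ 0 := fun h => by
  have := sg_sq a; rw [h] at this; simp at this
lemma sg_pm (a : Perm X) : sg a = 1 ∨ sg a = -1 := by
  rcases Int.units_eq_one_or (Perm.sign a) with h | h <;> simp [sg, h]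

/-- The alternating sum over the stabilizer of `p`. -/
noncomputable def Th (p q z : X → ℕ) : ℂ :=
  ∑ c : Perm X, if p ∘ c = p ∧ z ∘ c = q then sg c else 0

/-- The function attached to a tableau with columns `p` and rows `q`. -/
noncomputable def fT (p q : X → ℕ) (g : Perm X) : ℂ := Th p q (q ∘ ⇑g⁻¹)

/-- joint injectivity -/
def JI (p q : X → ℕ) : Prop := ∀ x y, p x = p y → q x = q y → x = y

lemma JI.symm {p q : X → ℕ} (h : JI p q) : JI q p := fun x y a b => h x y b a

lemma comp_inv_of {β : Type*} {p : X → β} {c : Perm X} (h : p ∘ c = p) : p ∘ ⇑c⁻¹ = p := by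
  funext x
  have := congrFun h (c⁻¹ x)
  simpa using this.symm

lemma comp_mul_of {β : Type*} {p : X → β} {c d : Perm X} (h : p ∘ c = p) (h' : p ∘ d = p) :
    p ∘ ⇑(c * d) = p := by
  rw [Perm.coe_mul, ← Function.comp_assoc, h, h']

lemma Th_comp {p q z : X → ℕ} {c : Perm X} (hc : p ∘ c = p) :
    Th p q (z ∘ c) = sg c * Th p q z := by
  unfold Th
  rw [Finset.mul_sum]
  refine Fintype.sum_equiv (Equiv.mulLeft c) _ _ fun d => ?_
  have h1 : (p ∘ ⇑(c * d) = p) ↔ p ∘ d = p := by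
    rw [Perm.coe_mul, ← Function.comp_assoc, hc]
  have h2 : (z ∘ c) ∘ d = z ∘ ⇑(c * d) := rfl
  rw [Equiv.coe_mulLeft, h2]
  by_cases h : p ∘ d = p ∧ z ∘ ⇑(c * d) = q
  · rw [if_pos h, if_pos ⟨h1.2 h.1, h.2⟩, sg_mul, ← mul_assoc, sg_sq, one_mul]
  · rw [if_neg h, if_neg (fun h' => h ⟨h1.1 h'.1, h'.2⟩), mul_zero]

lemma fT_left {p q : X → ℕ} {c : Perm X} (hc : p ∘ c = p) (g : Perm X) :
    fT p q (c * g) = sg c * fT p q g := by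
  unfold fT
  rw [mul_inv_rev, Perm.coe_mul, ← Function.comp_assoc, Th_comp (comp_inv_of hc), sg_inv]

lemma fT_right {p q : X → ℕ} {r : Perm X} (hr : q ∘ r = q) (g : Perm X) :
    fT p q (g * r) = fT p q g := by
  unfold fT
  rw [mul_inv_rev, Perm.coe_mul, ← Function.comp_assoc, comp_inv_of hr]

lemma Th_ne_zero {p q z : X → ℕ} (h : Th p q z ≠ 0) :
    ∃ c : Perm X, p ∘ c = p ∧ z ∘ c = q := by
  by_contra hc
  push Not at hc
  exact h (Finset.sum_eq_zero fun c _ => if_neg fun hh => hc c hh.1 hh.2)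

lemma Th_eq {p q z : X → ℕ} (hJ : JI p q) {c : Perm X} (hp : p ∘ c = p) (hz : z ∘ c = q) :
    Th p q z = sg c := by
  unfold Th
  rw [Finset.sum_eq_single c]
  · rw [if_pos ⟨hp, hz⟩]
  · intro d _ hd
    refine if_neg fun h => hd ?_
    ext x
    have e : c⁻¹ (d x) = x := by
      apply hJ
      · have := congrFun (comp_inv_of hp) (d x)
        simp only [Function.comp] at this
        rw [this]; exact congrFun h.1 x
      · have h1 := congrFun hz (c⁻¹ (d x))
        have h2 := congrFun h.2 x
        simp only [Function.comp, ais] at h1 h2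
        rw [← h1, h2]
    exact (Perm.inv_eq_iff_eq.1 e)
  · simp

lemma fT_one {p q : X → ℕ} (hJ : JI p q) : fT p q 1 = 1 := by
  unfold fT
  rw [Th_eq hJ (c := 1) (by rfl) (by rfl), sg_one]

lemma fT_ne_zero {p q : X → ℕ} {g : Perm X} (h : fT p q g ≠ 0) :
    ∃ c r : Perm X, p ∘ c = p ∧ q ∘ r = q ∧ g = c * r := by
  obtain ⟨c, hc, hz⟩ := Th_ne_zero h
  refine ⟨c, c⁻¹ * g, hc, ?_, by simp⟩
  have := comp_inv_of (p := q) (c := g⁻¹ * c) (by rw [Perm.coe_mul, ← Function.comp_assoc, hz])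
  simpa using this

lemma fT_eq {p q : X → ℕ} (hJ : JI p q) {c r : Perm X} (hc : p ∘ c = p) (hr : q ∘ r = q) :
    fT p q (c * r) = sg c := by
  rw [fT_right hr, ← mul_one c, fT_left hc, fT_one hJ]; simp

lemma fT_val {p q : X → ℕ} (hJ : JI p q) (g : Perm X) :
    fT p q g = 0 ∨ fT p q g = 1 ∨ fT p q g = -1 := by
  by_cases h : fT p q g = 0
  · exact Or.inl h
  · obtain ⟨c, r, hc, hr, rfl⟩ := fT_ne_zero h
    rw [fT_eq hJ hc hr]; exact Or.inr (sg_pm c)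

lemma fT_norm {p q : X → ℕ} (hJ : JI p q) (g : Perm X) : ‖fT p q g‖ ≤ 1 := by
  rcases fT_val hJ g with h | h | h <;> simp [h]

lemma fT_flip {p q : X → ℕ} (hJ : JI p q) (g : Perm X) :
    fT q p g = sg g * fT p q g⁻¹ := by
  by_cases h : fT p q g⁻¹ = 0
  · rw [h, mul_zero]
    by_contra h'
    obtain ⟨c, r, hc, hr, rfl⟩ := fT_ne_zero h'
    rw [mul_inv_rev, fT_eq hJ (comp_inv_of hr) (comp_inv_of hc)] at h
    exact sg_ne_zero _ h
  · obtain ⟨c, r, hc, hr, e⟩ := fT_ne_zero h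
    have e' : g = r⁻¹ * c⁻¹ := by rw [← mul_inv_rev, ← e, inv_inv]
    rw [e, fT_eq hJ hc hr, e', fT_eq hJ.symm (comp_inv_of hr) (comp_inv_of hc), sg_mul]
    simp [mul_assoc]

lemma fT_conj (p q : X → ℕ) (h g : Perm X) :
    fT (p ∘ h) (q ∘ h) g = fT p q (h * g * h⁻¹) := by
  unfold fT Th
  refine Fintype.sum_equiv (MulAut.conj h).toEquiv _ _ fun c => ?_
  have hs : sg (h * c * h⁻¹) = sg c := by
    rw [sg_mul, sg_mul, sg_inv, mul_comm (sg h), mul_assoc, sg_sq, mul_one]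
  simp only [MulEquiv.toEquiv_eq_coe, MulEquiv.coe_toEquiv, MulAut.conj_apply, hs]
  congr 1
  apply propext
  have key : ∀ u v : X → ℕ, ∀ k : Perm X, (u ∘ h) ∘ k = v ∘ h ↔ u ∘ ⇑(h * k * h⁻¹) = v := by
    intro u v k
    constructor
    · intro H; funext x
      have := congrFun H (h⁻¹ x)
      simpa using this
    · intro H; funext x
      have := congrFun H (h x)
      simpa using this
  rw [key p p c]
  refine and_congr Iff.rfl ?_
  have := key q q (g⁻¹ * c)
  rw [show h * (g⁻¹ * c) * h⁻¹ = (h * g * h⁻¹)⁻¹ * (h * c * h⁻¹) by group] at this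
  simpa [Function.comp_assoc] using this

/-- functions with equal fiber sizes differ by a permutation -/
lemma fiber_equiv {β : Type*} (u v : X → β)
    (h : ∀ b, Nat.card {x // u x = b} = Nat.card {x // v x = b}) :
    ∃ g : Perm X, v ∘ g = u := by
  classical
  have e : ∀ b, {x // u x = b} ≃ {x // v x = b} := fun b =>
    Classical.choice (Finite.card_eq.1 (h b))
  let g : Perm X := (Equiv.sigmaFiberEquiv u).symm.trans
    ((Equiv.sigmaCongrRight e).trans (Equiv.sigmaFiberEquiv v))
  refine ⟨g, funext fun x => ?_⟩
  exact (e (u x) ⟨x, rfl⟩).2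

end basics
end McKayGraphs

open scoped BigOperators
namespace McKayGraphs
open Equiv

section group
/-- pullback of functions as an algebra map -/
def pb {A B : Type*} (u : A → B) : (B → ℂ) →ₐ[ℂ] (A → ℂ) :=
  Pi.algHom ℂ _ (fun a => Pi.evalAlgHom ℂ _ (u a))
@[simp] lemma pb_apply {A B : Type*} (u : A → B) (F : B → ℂ) (a : A) : pb u F a = F (u a) := rfl

variable {G : Type*} [Group G]

/-- two-sided translation -/
def tl (h h' : G) : (G → ℂ) →ₐ[ℂ] (G → ℂ) := pb (fun g => h * g * h')
@[simp] lemma tl_apply (h h' : G) (F : G → ℂ) (g : G) : tl h h' F g = F (h * g * h') := rfl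

def BiInv (R : Submodule ℂ (G → ℂ)) : Prop := ∀ h h' F, F ∈ R → tl h h' F ∈ R

/-- span of two-sided translates -/
def tr (F : G → ℂ) : Submodule ℂ (G → ℂ) :=
  Submodule.span ℂ (Set.range (fun hh : G × G => tl hh.1 hh.2 F))

lemma tl_tl (a b c d : G) (F : G → ℂ) : tl a b (tl c d F) = tl (c * a) (b * d) F := by
  funext g; simp [mul_assoc]

lemma tr_biInv (F : G → ℂ) : BiInv (tr F) := by
  intro h h' K hK
  have : (tr F) ≤ (tr F).comap (tl h h').toLinearMap := by
    conv_lhs => unfold tr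
    rw [Submodule.span_le]
    rintro _ ⟨⟨a, b⟩, rfl⟩
    rw [SetLike.mem_coe, Submodule.mem_comap]
    show tl h h' (tl a b F) ∈ tr F
    rw [tl_tl]
    exact Submodule.subset_span ⟨(a * h, h' * b), rfl⟩
  exact this hK

lemma mem_tr (F : G → ℂ) : F ∈ tr F :=
  Submodule.subset_span ⟨(1, 1), by funext g; simp⟩

lemma tr_le {R : Submodule ℂ (G → ℂ)} (hR : BiInv R) {F : G → ℂ} (hF : F ∈ R) : tr F ≤ R := by
  unfold tr
  rw [Submodule.span_le]
  rintro _ ⟨⟨a, b⟩, rfl⟩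
  exact hR a b F hF

lemma biInv_iff {R : Submodule ℂ (G → ℂ)} :
    BiInv R ↔ ∀ h h', R.map (tl h h').toLinearMap ≤ R := by
  constructor
  · rintro H h h' _ ⟨F, hF, rfl⟩; exact H h h' F hF
  · intro H h h' F hF; exact H h h' ⟨F, hF, rfl⟩

lemma BiInv.pow {R : Submodule ℂ (G → ℂ)} (hR : BiInv R) (k : ℕ) : BiInv (R ^ k) := by
  rw [biInv_iff] at *
  intro h h'
  rw [Submodule.map_pow]
  exact pow_le_pow_left' (hR h h') k

lemma BiInv.mul {R S : Submodule ℂ (G → ℂ)} (hR : BiInv R) (hS : BiInv S) : BiInv (R * S) := by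
  rw [biInv_iff] at *
  intro h h'
  rw [Submodule.map_mul]
  exact mul_le_mul' (hR h h') (hS h h')

lemma pow_mem_pow' {R : Submodule ℂ (G → ℂ)} {F : G → ℂ} {k : ℕ} (h : F ∈ R) : F ^ k ∈ R ^ k :=
  Submodule.pow_mem_pow R h k

lemma mul_mem_pow {R : Submodule ℂ (G → ℂ)} {F K : G → ℂ} {a b : ℕ} (h : F ∈ R ^ a) (h' : K ∈ R ^ b) :
    F * K ∈ R ^ (a + b) := by
  rw [pow_add]; exact Submodule.mul_mem_mul h h'

end group

section vN
variable {X : Type*} [Fintype X] [DecidableEq X]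

/-- initial segment condition in classes of `p` -/
def Init (p q : X → ℕ) : Prop := ∀ x i, i < q x → ∃ y, p y = p x ∧ q y = i

lemma sum_finset_ge (t : Finset ℕ) : ∑ i ∈ Finset.range t.card, i ≤ ∑ i ∈ t, i ∧
    (∑ i ∈ Finset.range t.card, i = ∑ i ∈ t, i → t = Finset.range t.card) := by
  induction' hk : t.card with k ih generalizing t
  · have : t = ∅ := Finset.card_eq_zero.1 hk
    subst this; simp
  · have hne : t.Nonempty := by rw [← Finset.card_pos]; omega
    set m := t.max' hne with hm
    have hmt : m ∈ t := Finset.max'_mem _ _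
    have hsub : t ⊆ Finset.range (m + 1) := fun i hi => by
      rw [Finset.mem_range]; exact Nat.lt_succ_of_le (Finset.le_max' _ _ hi)
    have hkm : k ≤ m := by
      have := Finset.card_le_card hsub
      rw [Finset.card_range] at this; omega
    obtain ⟨h1, h2⟩ := ih (t.erase m) (by rw [Finset.card_erase_of_mem hmt]; omega)
    have hs : ∑ i ∈ t, i = ∑ i ∈ t.erase m, i + m := (Finset.sum_erase_add _ _ hmt).symm
    rw [Finset.sum_range_succ, hs]
    refine ⟨by omega, fun he => ?_⟩
    have e1 : m = k := by omega
    have := h2 (by omega)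
    rw [← Finset.insert_erase hmt, this, e1, Finset.range_add_one]

lemma downset_eq_range (t : Finset ℕ) (h : ∀ i ∈ t, ∀ j < i, j ∈ t) : t = Finset.range t.card := by
  induction' hk : t.card with k ih generalizing t
  · simpa using hk
  · have hne : t.Nonempty := by rw [← Finset.card_pos]; omega
    set m := t.max' hne with hm
    have hmt : m ∈ t := Finset.max'_mem _ _
    have : t = Finset.range (m + 1) := by
      ext i
      rw [Finset.mem_range]
      constructor
      · intro hi; exact Nat.lt_succ_of_le (Finset.le_max' _ _ hi)
      · intro hi
        rcases Nat.lt_succ_iff_lt_or_eq.1 hi with h' | h'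
        · exact h m hmt i h'
        · rw [h']; exact hmt
    have hc := congrArg Finset.card this
    rw [Finset.card_range, hk] at hc
    rw [hc]; exact this

/-- the class of `p` with value `j` -/
def cl (p : X → ℕ) (j : ℕ) : Finset X := Finset.univ.filter (fun x => p x = j)
@[simp] lemma mem_cl {p : X → ℕ} {j : ℕ} {x : X} : x ∈ cl p j ↔ p x = j := by simp [cl]

lemma image_cl {p q : X → ℕ} (hJ : JI p q) (hI : Init p q) (j : ℕ) :
    (cl p j).image q = Finset.range (cl p j).card := by
  have hc : ((cl p j).image q).card = (cl p j).card :=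
    Finset.card_image_of_injOn fun x hx y hy h => by
      simp at hx hy; exact hJ x y (hx.trans hy.symm) h
  rw [← hc]
  apply downset_eq_range
  intro i hi k hk
  rw [Finset.mem_image] at hi ⊢
  obtain ⟨x, hx, rfl⟩ := hi
  obtain ⟨y, hy, hq⟩ := hI x k hk
  exact ⟨y, by simp at hx ⊢; rw [hy, hx], hq⟩

lemma sum_cl (p : X → ℕ) (u : X → ℕ) :
    ∑ x, u x = ∑ j ∈ Finset.univ.image p, ∑ x ∈ cl p j, u x := by
  rw [← Finset.sum_fiberwise_of_maps_to (g := p) (t := Finset.univ.image p)]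
  · rfl
  · intro x _; exact Finset.mem_image_of_mem _ (Finset.mem_univ _)

lemma vN_sum {p q z : X → ℕ} (hJ : JI p q) (hI : Init p q)
    (hz : JI p z) : ∑ x, q x ≤ ∑ x, z x ∧
    (∑ x, q x = ∑ x, z x → ∃ c : Perm X, p ∘ c = p ∧ z ∘ c = q) := by
  have im : ∀ j, ((cl p j).image z).card = (cl p j).card := fun j =>
    Finset.card_image_of_injOn fun x hx y hy h => by
      simp at hx hy; exact hz x y (hx.trans hy.symm) h
  have sz : ∀ j, ∑ x ∈ cl p j, z x = ∑ i ∈ (cl p j).image z, i := fun j => by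
    rw [Finset.sum_image]
    intro x hx y hy h
    simp at hx hy; exact hz x y (hx.trans hy.symm) h
  have sq : ∀ j, ∑ x ∈ cl p j, q x = ∑ i ∈ Finset.range (cl p j).card, i := fun j => by
    rw [← image_cl hJ hI, Finset.sum_image]
    intro x hx y hy h
    simp at hx hy; exact hJ x y (hx.trans hy.symm) h
  have le : ∀ j, ∑ x ∈ cl p j, q x ≤ ∑ x ∈ cl p j, z x := fun j => by
    rw [sq, sz, ← im j]; exact (sum_finset_ge _).1
  refine ⟨?_, fun he => ?_⟩
  · rw [sum_cl p q, sum_cl p z]; exact Finset.sum_le_sum fun j _ => le j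
  · rw [sum_cl p q, sum_cl p z] at he
    have heq := (Finset.sum_eq_sum_iff_of_le (fun j _ => le j)).1 he
    have hset : ∀ x, (cl p (p x)).image z = (cl p (p x)).image q := fun x => by
      have h1 := heq (p x) (Finset.mem_image_of_mem _ (Finset.mem_univ _))
      rw [sq, sz, ← im] at h1
      rw [image_cl hJ hI, (sum_finset_ge _).2 h1, im]
    obtain ⟨c, hc⟩ := fiber_equiv (fun x => (p x, q x)) (fun x => (p x, z x)) (by
      rintro ⟨a, b⟩
      have s1 : Subsingleton {x // (fun x => (p x, q x)) x = (a, b)} :=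
        ⟨fun ⟨x, hx⟩ ⟨y, hy⟩ => by
          simp at hx hy
          exact Subtype.ext (hJ x y (hx.1.trans hy.1.symm) (hx.2.trans hy.2.symm))⟩
      have s2 : Subsingleton {x // (fun x => (p x, z x)) x = (a, b)} :=
        ⟨fun ⟨x, hx⟩ ⟨y, hy⟩ => by
          simp at hx hy
          exact Subtype.ext (hz x y (hx.1.trans hy.1.symm) (hx.2.trans hy.2.symm))⟩
      refine Nat.card_congr (equivOfSubsingletonOfSubsingleton ?_ ?_)
      · intro x
        have : ∃ y, (p y, z y) = (a, b) := by
          obtain ⟨x, hx⟩ := x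
          simp at hx
          have : b ∈ (cl p (p x)).image q := Finset.mem_image.2 ⟨x, by simp, hx.2⟩
          rw [← hset] at this
          obtain ⟨y, hy, e⟩ := Finset.mem_image.1 this
          simp at hy
          exact ⟨y, by rw [hy, hx.1, e]⟩
        exact ⟨this.choose, this.choose_spec⟩
      · intro x
        have : ∃ y, (p y, q y) = (a, b) := by
          obtain ⟨x, hx⟩ := x
          simp at hx
          have : b ∈ (cl p (p x)).image z := Finset.mem_image.2 ⟨x, by simp, hx.2⟩
          rw [hset] at this
          obtain ⟨y, hy, e⟩ := Finset.mem_image.1 this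
          simp at hy
          exact ⟨y, by rw [hy, hx.1, e]⟩
        exact ⟨this.choose, this.choose_spec⟩)
    refine ⟨c, ?_, ?_⟩ <;> funext x <;> have := congrFun hc x <;> simp at this
    · exact this.1
    · exact this.2

/-- left-signed for columns -/
def LS (p : X → ℕ) (F : Perm X → ℂ) : Prop := ∀ c g : Perm X, p ∘ ⇑c = p → F (c * g) = sg c * F g
/-- right-invariant for rows -/
def RI (q : X → ℕ) (F : Perm X → ℂ) : Prop := ∀ r g : Perm X, q ∘ ⇑r = q → F (g * r) = F g

lemma vN_inj {p q : X → ℕ} {F : Perm X → ℂ} (hl : LS p F) (hr : RI q F) {g : Perm X}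
    (h : F g ≠ 0) : JI p (q ∘ ⇑g⁻¹) := by
  intro x y hp hq
  by_contra hxy
  have h1 : p ∘ ⇑(swap x y) = p := by
    funext w
    simp only [Function.comp, swap_apply_def]
    split_ifs with h1 h2
    · rw [h1, hp]
    · rw [h2, hp]
    · rfl
  have h2 : q ∘ ⇑(swap (g⁻¹ x) (g⁻¹ y)) = q := by
    funext w
    simp only [Function.comp, swap_apply_def]
    split_ifs with h1 h2
    · rw [h1]; exact hq.symm
    · rw [h2]; exact hq
    · rfl
  have h3 : swap x y * g = g * swap (g⁻¹ x) (g⁻¹ y) := by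
    have := Equiv.mul_swap_eq_swap_mul g (g⁻¹ x) (g⁻¹ y)
    rw [ais, ais] at this; exact this.symm
  have h4 := hl (swap x y) g h1
  rw [h3, hr _ _ h2] at h4
  have : sg (swap x y) = -1 := by simp [sg, Perm.sign_swap hxy]
  rw [this] at h4
  apply h
  have : (2:ℂ) * F g = 0 := by linear_combination h4
  simpa using this

lemma vN_ge {p q q' : X → ℕ} (hJ : JI p q) (hI : Init p q) {F : Perm X → ℂ} (hl : LS p F)
    (hr : RI q' F) (hF : F ≠ 0) : ∑ x, q x ≤ ∑ x, q' x := by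
  obtain ⟨g, hg⟩ := Function.ne_iff.1 hF
  have := (vN_sum hJ hI (vN_inj hl hr hg)).1
  refine this.trans (le_of_eq ?_)
  exact Equiv.sum_comp g⁻¹ q'

lemma vN_eq {p q q' : X → ℕ} (hJ : JI p q) (hI : Init p q) {F : Perm X → ℂ} (hl : LS p F)
    (hr : RI q' F) (hF : F ≠ 0) (he : ∑ x, q x = ∑ x, q' x) : ∃ g : Perm X, q' ∘ ⇑g = q := by
  obtain ⟨g, hg⟩ := Function.ne_iff.1 hF
  obtain ⟨c, -, hc⟩ := (vN_sum hJ hI (vN_inj hl hr hg)).2 (he.trans (Equiv.sum_comp g⁻¹ q').symm)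
  exact ⟨g⁻¹ * c, by rw [Perm.coe_mul, ← Function.comp_assoc, hc]⟩

lemma vN_fT {p q : X → ℕ} (hJ : JI p q) (hI : Init p q) {F : Perm X → ℂ} (hl : LS p F)
    (hr : RI q F) (g : Perm X) : F g = F 1 * fT p q g := by
  by_cases hg : F g = 0
  · rw [hg]
    by_cases hf : fT p q g = 0
    · rw [hf, mul_zero]
    · obtain ⟨c, r, hc, hr', rfl⟩ := fT_ne_zero hf
      rw [hr _ _ hr', ← mul_one c, hl _ _ hc] at hg
      have : F 1 = 0 := by simpa [sg_ne_zero] using hg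
      rw [this, zero_mul]
  · obtain ⟨c, hc, hz⟩ := (vN_sum hJ hI (vN_inj hl hr hg)).2 (Equiv.sum_comp g⁻¹ q).symm
    have hr2 : q ∘ ⇑(c⁻¹ * g) = q := by
      have := comp_inv_of (p := q) (c := g⁻¹ * c) (by rw [Perm.coe_mul, ← Function.comp_assoc, hz])
      simpa using this
    have e : g = c * (c⁻¹ * g) := by simp
    rw [e, fT_eq hJ hc hr2, hr _ _ hr2, ← mul_one c, hl _ _ hc, mul_one, mul_comm]

lemma fT_LS (p q : X → ℕ) : LS p (fT p q) := fun c g hc => fT_left hc g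
lemma fT_RI (p q : X → ℕ) : RI q (fT p q) := fun c g hc => fT_right hc g


lemma ML {p q : X → ℕ} (hJ : JI p q) (hI : Init p q) {R : Submodule ℂ (Perm X → ℂ)} (hR : BiInv R)
    {F : Perm X → ℂ} (hF : F ∈ R) (h : ∑ g, F g * fT p q g ≠ 0) : fT p q ∈ R := by
  classical
  let C : Finset (Perm X) := Finset.univ.filter (fun c => p ∘ c = p)
  let Q : Finset (Perm X) := Finset.univ.filter (fun c => q ∘ c = q)
  let F' : Perm X → ℂ := fun g => ∑ c ∈ C, ∑ r ∈ Q, sg c * F (c * g * r)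
  have hF' : F' ∈ R := by
    have : F' = ∑ c ∈ C, ∑ r ∈ Q, sg c • tl c r F := by
      funext g; simp [F', Finset.sum_apply]
    rw [this]
    exact Submodule.sum_mem _ fun c _ => Submodule.sum_mem _ fun r _ =>
      Submodule.smul_mem _ _ (hR c r F hF)
  have hl : LS p F' := by
    intro c g hc
    simp only [F', Finset.mul_sum]
    refine Finset.sum_bij' (fun d _ => d * c) (fun d _ => d * c⁻¹) ?_ ?_ ?_ ?_ ?_
    · intro d hd; simp only [C, Finset.mem_filter, Finset.mem_univ, true_and] at hd ⊢
      exact comp_mul_of hd hc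
    · intro d hd; simp only [C, Finset.mem_filter, Finset.mem_univ, true_and] at hd ⊢
      exact comp_mul_of hd (comp_inv_of hc)
    · intro d _; simp
    · intro d _; simp
    · intro d _
      refine Finset.sum_congr rfl fun r _ => ?_
      rw [sg_mul, mul_assoc d c g]
      linear_combination (-(sg d * F (d * (c * g) * r))) * sg_sq c
  have hr : RI q F' := by
    intro c g hc
    refine Finset.sum_congr rfl fun d _ => ?_
    refine Finset.sum_bij' (fun d _ => c * d) (fun d _ => c⁻¹ * d) ?_ ?_ ?_ ?_ ?_
    · intro d hd; simp only [Q, Finset.mem_filter, Finset.mem_univ, true_and] at hd ⊢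
      exact comp_mul_of hc hd
    · intro d hd; simp only [Q, Finset.mem_filter, Finset.mem_univ, true_and] at hd ⊢
      exact comp_mul_of (comp_inv_of hc) hd
    · intro d _; simp
    · intro d _; simp
    · intro r _
      simp only [mul_assoc]
  have hsum : ∑ g, F' g * fT p q g = (C.card * Q.card : ℂ) * ∑ g, F g * fT p q g := by
    simp only [F', Finset.sum_mul]
    rw [Finset.sum_comm]
    have : ∀ c ∈ C, ∑ g, ∑ r ∈ Q, sg c * F (c * g * r) * fT p q g
        = (Q.card : ℂ) * ∑ g, F g * fT p q g := by
      intro c hc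
      rw [Finset.sum_comm]
      have : ∀ r ∈ Q, ∑ g, sg c * F (c * g * r) * fT p q g = ∑ g, F g * fT p q g := by
        intro r hr
        simp only [C, Q, Finset.mem_filter, Finset.mem_univ, true_and] at hc hr
        refine Fintype.sum_equiv ((Equiv.mulLeft c).trans (Equiv.mulRight r)) _ _ fun g => ?_
        simp only [Equiv.trans_apply, Equiv.coe_mulLeft, Equiv.coe_mulRight]
        rw [fT_right hr, fT_left hc]; ring
      rw [Finset.sum_congr rfl this, Finset.sum_const, nsmul_eq_mul]
    rw [Finset.sum_congr rfl this, Finset.sum_const, nsmul_eq_mul, ← mul_assoc]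
  have hC : (C.card : ℂ) ≠ 0 := by
    have : (1 : Perm X) ∈ C := by simp [C]
    exact_mod_cast (Finset.card_pos.2 ⟨_, this⟩).ne'
  have hQ : (Q.card : ℂ) ≠ 0 := by
    have : (1 : Perm X) ∈ Q := by simp [Q]
    exact_mod_cast (Finset.card_pos.2 ⟨_, this⟩).ne'
  have key := vN_fT hJ hI hl hr
  have h1 : F' 1 ≠ 0 := by
    intro h0
    have : ∑ g, F' g * fT p q g = 0 := Finset.sum_eq_zero fun g _ => by rw [key g, h0]; simp
    rw [hsum] at this
    exact (mul_ne_zero (mul_ne_zero hC hQ) h) this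
  have : fT p q = (F' 1)⁻¹ • F' := by
    funext g
    rw [Pi.smul_apply, key g, smul_eq_mul, ← mul_assoc, inv_mul_cancel₀ h1, one_mul]
  rw [this]
  exact Submodule.smul_mem _ _ hF'

lemma kap_ne {p q : X → ℕ} (hJ : JI p q) (hI : Init p q) :
    ∑ h, fT p q h⁻¹ * fT p q h ≠ 0 := by
  intro h0
  let f := fT p q
  have conv : ∀ m, ∑ h, f (m * h⁻¹) * f h = 0 := by
    let K : Perm X → ℂ := fun m => ∑ h, f (m * h⁻¹) * f h
    have hl : LS p K := by
      intro c g hc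
      simp only [K, Finset.mul_sum]
      refine Finset.sum_congr rfl fun h _ => ?_
      rw [mul_assoc c, show f (c * (g * h⁻¹)) = _ from fT_left hc _, mul_assoc]
    have hr : RI q K := by
      intro r g hr
      simp only [K]
      refine Fintype.sum_equiv (Equiv.mulRight r⁻¹) _ _ fun h => ?_
      simp only [Equiv.coe_mulRight]
      rw [show f (h * r⁻¹) = f h from fT_right (comp_inv_of hr) h]
      simp [mul_assoc]
    intro m
    have := vN_fT hJ hI hl hr m
    have k1 : K 1 = 0 := by simpa [K] using h0
    rw [k1, zero_mul] at this
    exact this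
  let A : Matrix (Perm X) (Perm X) ℂ := Matrix.of fun g k => f (g * k⁻¹)
  have hA : A * A = 0 := by
    ext g k
    rw [Matrix.mul_apply]
    simp only [A, Matrix.of_apply, Matrix.zero_apply]
    rw [← conv (g * k⁻¹)]
    refine Fintype.sum_equiv (Equiv.mulRight k⁻¹) _ _ fun h => ?_
    simp [mul_assoc]
  have hn : IsNilpotent A := ⟨2, by rw [pow_two, hA]⟩
  have ht := Matrix.isNilpotent_trace_of_isNilpotent hn
  have : A.trace = (Fintype.card (Perm X) : ℂ) := by
    simp [Matrix.trace, A, f, fT_one hJ]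
  rw [this] at ht
  have := ht.eq_zero
  exact Fintype.card_ne_zero (by exact_mod_cast this)

end vN
end McKayGraphs

open scoped BigOperators
namespace McKayGraphs
open Equiv

section classif
variable {X : Type*} [Fintype X] [DecidableEq X]

/-- Young tableau: joint injectivity and lower-set property -/
def YT (p q : X → ℕ) : Prop :=
  JI p q ∧ ∀ x i j, i ≤ q x → j ≤ p x → ∃ y, q y = i ∧ p y = j

lemma YT.hin {p q : X → ℕ} (h : YT p q) : Init p q := fun x i hi => by
  obtain ⟨y, a, b⟩ := h.2 x i (p x) hi.le le_rfl
  exact ⟨y, b, a⟩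

lemma YT.flip {p q : X → ℕ} (h : YT p q) : YT q p := ⟨h.1.symm, fun x i j hi hj => by
  obtain ⟨y, a, b⟩ := h.2 x j i hj hi
  exact ⟨y, b, a⟩⟩

lemma YT.comp {Y : Type*} {p q : X → ℕ} (h : YT p q) (e : Y ≃ X) : YT (p ∘ e) (q ∘ e) :=
  ⟨fun x y a b => e.injective (h.1 _ _ a b), fun x i j hi hj => by
    obtain ⟨y, a, b⟩ := h.2 (e x) i j hi hj
    exact ⟨e.symm y, by simpa using a, by simpa using b⟩⟩

lemma stab_conj {q : X → ℕ} {h r : Perm X} (hr : (q ∘ ⇑h) ∘ ⇑r = q ∘ ⇑h) :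
    q ∘ ⇑(h * r * h⁻¹) = q := by
  funext x
  have := congrFun hr (h⁻¹ x)
  simp only [Function.comp] at this
  simp only [Function.comp, Perm.coe_mul]
  rw [this, ais]

lemma offdiag {p q p' q' : X → ℕ} (hT : YT p q) (hS : YT p' q') (h : Perm X)
    (hne : ∑ g, fT p' q' (h * g⁻¹ * h⁻¹) * fT p q g ≠ 0) : ∃ g : Perm X, q' ∘ ⇑g = q := by
  let F1 : Perm X → ℂ := fun x => ∑ g, fT p' q' (h * g⁻¹ * h⁻¹) * fT p q (x * g)
  let F2 : Perm X → ℂ := fun x => ∑ g, fT p' q' (x * (h * g⁻¹ * h⁻¹)) * fT p q g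
  have l1 : LS p F1 := by
    intro c g hc
    simp only [F1, Finset.mul_sum]
    refine Finset.sum_congr rfl fun k _ => ?_
    rw [mul_assoc c, fT_left hc]; ring
  have l2 : LS p' F2 := by
    intro c g hc
    simp only [F2, Finset.mul_sum]
    refine Finset.sum_congr rfl fun k _ => ?_
    rw [mul_assoc c, fT_left hc]; ring
  have r1 : RI (q' ∘ ⇑h) F1 := by
    intro r g hr
    simp only [F1]
    refine Fintype.sum_equiv (Equiv.mulLeft r) _ _ fun k => ?_
    simp only [Equiv.coe_mulLeft]
    have e1 : fT p' q' (h * k⁻¹ * h⁻¹) = fT p' q' (h * (r * k)⁻¹ * h⁻¹) := by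
      rw [← fT_right (stab_conj (comp_inv_of hr))]
      congr 1; group
    rw [e1, mul_assoc g]
  have r2 : RI (q ∘ ⇑h⁻¹) F2 := by
    intro r g hr
    have hr' : q ∘ ⇑(h⁻¹ * r * h) = q := by simpa using stab_conj (h := h⁻¹) hr
    simp only [F2]
    refine Fintype.sum_equiv (Equiv.mulRight (h⁻¹ * r * h)⁻¹) _ _ fun k => ?_
    simp only [Equiv.coe_mulRight]
    congr 1
    · congr 1; group
    · rw [fT_right (comp_inv_of hr')]
  have n1 : F1 ≠ 0 := fun h0 => hne (by simpa [F1] using congrFun h0 1)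
  have n2 : F2 ≠ 0 := fun h0 => hne (by simpa [F2] using congrFun h0 1)
  have e1 := vN_ge hT.1 hT.hin l1 r1 n1
  have e2 := vN_ge hS.1 hS.hin l2 r2 n2
  have s1 : ∑ x, (q' ∘ ⇑h) x = ∑ x, q' x := Equiv.sum_comp h q'
  have s2 : ∑ x, (q ∘ ⇑h⁻¹) x = ∑ x, q x := Equiv.sum_comp h⁻¹ q
  obtain ⟨g, hg⟩ := vN_eq hT.1 hT.hin l1 r1 n1 (by omega)
  exact ⟨h * g, by rw [Perm.coe_mul, ← Function.comp_assoc, hg]⟩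

lemma diag_conv {p q : X → ℕ} (hT : YT p q) (h : Perm X) :
    ∑ g, fT p q (h * g⁻¹ * h⁻¹) * fT p q g =
      (∑ g, fT p q g⁻¹ * fT p q g) * (fT p q h * fT p q h⁻¹) := by
  let H : Perm X → ℂ := fun x => ∑ g, fT p q (x * g⁻¹) * fT p q g
  let F : Perm X → ℂ := fun x => ∑ g, fT p q (h * g⁻¹ * x) * fT p q g
  have lH : LS p H := by
    intro c g hc
    simp only [H, Finset.mul_sum]
    refine Finset.sum_congr rfl fun k _ => ?_
    rw [mul_assoc c, fT_left hc]; ring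
  have rH : RI q H := by
    intro r g hr
    simp only [H]
    refine Fintype.sum_equiv (Equiv.mulRight r⁻¹) _ _ fun k => ?_
    simp only [Equiv.coe_mulRight]
    rw [fT_right (comp_inv_of hr)]
    have : g * r * k⁻¹ = g * (k * r⁻¹)⁻¹ := by group
    rw [this]
  have lF : LS p F := by
    intro c g hc
    simp only [F, Finset.mul_sum]
    refine Fintype.sum_equiv (Equiv.mulLeft c⁻¹) _ _ fun k => ?_
    simp only [Equiv.coe_mulLeft]
    rw [show fT p q (c⁻¹ * k) = sg c⁻¹ * fT p q k from fT_left (comp_inv_of hc) k, sg_inv]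
    have : h * k⁻¹ * (c * g) = h * (c⁻¹ * k)⁻¹ * g := by group
    rw [this, ← mul_assoc, ← mul_assoc, mul_right_comm (sg c), sg_sq, one_mul]
  have rF : RI q F := by
    intro r g hr
    simp only [F]
    refine Finset.sum_congr rfl fun k _ => ?_
    rw [← mul_assoc, fT_right hr]
  have e1 := vN_fT hT.1 hT.hin lF rF h⁻¹
  have e2 := vN_fT hT.1 hT.hin lH rH h
  have e3 : F 1 = H h := by simp [F, H]
  have e4 : H 1 = ∑ g, fT p q g⁻¹ * fT p q g := by simp [H]
  rw [← e4, ← mul_assoc, ← e2, ← e3]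
  exact e1

/-- abstract completeness statement -/
lemma complete_of_family (pp qq : ConjClasses (Perm X) → X → ℕ) (hY : ∀ S, YT (pp S) (qq S))
    (hinj : ∀ S T (g : Perm X), qq S ∘ ⇑g = qq T → S = T)
    (ξ : Perm X → ℂ) (hcl : ∀ g h, ξ (h * g * h⁻¹) = ξ g) (hξ : ξ ≠ 0) :
    ∃ T, ∑ g, ξ g * fT (pp T) (qq T) g ≠ 0 := by
  classical
  by_contra hcon
  push Not at hcon
  let Z : ConjClasses (Perm X) → Perm X → ℂ := fun S g =>
    ∑ h : Perm X, fT (pp S) (qq S) (h * g⁻¹ * h⁻¹)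
  have Zcl : ∀ S g h, Z S (h * g * h⁻¹) = Z S g := by
    intro S g h
    simp only [Z]
    refine Fintype.sum_equiv (Equiv.mulRight h) _ _ fun k => ?_
    simp only [Equiv.coe_mulRight]
    have : k * (h * g * h⁻¹)⁻¹ * k⁻¹ = k * h * g⁻¹ * (k * h)⁻¹ := by group
    rw [this]
  have M0 : ∀ S T, S ≠ T → ∑ g, Z S g * fT (pp T) (qq T) g = 0 := by
    intro S T hST
    simp only [Z, Finset.sum_mul]
    rw [Finset.sum_comm]
    refine Finset.sum_eq_zero fun h _ => ?_
    by_contra hne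
    obtain ⟨g, hg⟩ := offdiag (hY T) (hY S) h hne
    exact hST (hinj _ _ g hg)
  have M1 : ∀ T, ∑ g, Z T g * fT (pp T) (qq T) g ≠ 0 := by
    intro T
    simp only [Z, Finset.sum_mul]
    rw [Finset.sum_comm]
    simp only [diag_conv (hY T)]
    rw [← Finset.mul_sum]
    refine mul_ne_zero (kap_ne (hY T).1 (hY T).hin) ?_
    have := kap_ne (hY T).1 (hY T).hin
    simpa only [mul_comm] using this
  have lin : ∀ c : ConjClasses (Perm X) → ℂ, ∀ T,
      ∑ g, (∑ S, c S * Z S g) * fT (pp T) (qq T) g = c T * ∑ g, Z T g * fT (pp T) (qq T) g := by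
    intro c T
    simp only [Finset.sum_mul]
    rw [Finset.sum_comm]
    rw [Finset.sum_eq_single T]
    · rw [Finset.mul_sum]; exact Finset.sum_congr rfl fun g _ => by ring
    · intro S _ hS
      simp only [mul_assoc]
      rw [← Finset.mul_sum, M0 S T hS, mul_zero]
    · simp
  have conjOut : ∀ F : Perm X → ℂ, (∀ g h, F (h * g * h⁻¹) = F g) →
      ∀ g, F (Quotient.out (ConjClasses.mk g)) = F g := by
    intro F hF g
    have : ConjClasses.mk (Quotient.out (ConjClasses.mk g)) = ConjClasses.mk g := Quotient.out_eq _
    rw [ConjClasses.mk_eq_mk_iff_isConj, isConj_iff] at this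
    obtain ⟨c, hc⟩ := this
    rw [← hF _ c, hc]
  let Φ : (ConjClasses (Perm X) → ℂ) →ₗ[ℂ] (ConjClasses (Perm X) → ℂ) :=
    { toFun := fun c C => ∑ S, c S * Z S (Quotient.out C)
      map_add' := by intro a b; funext C; simp [add_mul, Finset.sum_add_distrib]
      map_smul' := by intro a b; funext C; simp [Finset.mul_sum, mul_assoc] }
  have Φa : ∀ c g, Φ c (ConjClasses.mk g) = ∑ S, c S * Z S g := by
    intro c g
    simp only [Φ, LinearMap.coe_mk, AddHom.coe_mk]
    exact Finset.sum_congr rfl fun S _ => by rw [conjOut (Z S) (Zcl S)]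
  have inj : Function.Injective Φ := by
    rw [injective_iff_map_eq_zero]
    intro c hc
    funext T
    have h1 := lin c T
    have : ∀ g, ∑ S, c S * Z S g = 0 := fun g => by rw [← Φa, hc]; rfl
    simp only [this, zero_mul, Finset.sum_const_zero] at h1
    exact (mul_eq_zero.1 h1.symm).resolve_right (M1 T)
  have sur : Function.Surjective Φ := LinearMap.injective_iff_surjective.1 inj
  obtain ⟨c, hc⟩ := sur (fun C => ξ (Quotient.out C))
  have hx : ∀ g, ξ g = ∑ S, c S * Z S g := fun g => by
    rw [← Φa, hc]; exact (conjOut ξ hcl g).symm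
  apply hξ
  funext g
  rw [hx]
  refine Finset.sum_eq_zero fun T _ => ?_
  have h1 := hcon T
  simp only [hx] at h1
  rw [lin] at h1
  rw [(mul_eq_zero.1 h1).resolve_right (M1 T)]
  simp

lemma card_cells_eq (μ : YoungDiagram) : μ.cells.card = μ.rowLens.sum := by
  rw [Finset.card_eq_sum_card_fiberwise (f := Prod.fst) (t := Finset.range (μ.colLen 0))]
  · rw [YoungDiagram.rowLens, ← List.sum_toFinset _ (List.nodup_range), List.toFinset_range]
    refine Finset.sum_congr rfl fun i _ => ?_
    rw [YoungDiagram.rowLen_eq_card]; rfl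
  · intro c hc
    have hc' : (c.1, c.2) ∈ μ := hc
    simp only [Finset.coe_range, Set.mem_Iio]
    rw [← YoungDiagram.mem_iff_lt_colLen]
    exact μ.up_left_mem le_rfl (Nat.zero_le _) hc'

theorem exists_YT (ξ : Perm X → ℂ) (hcl : ∀ g h, ξ (h * g * h⁻¹) = ξ g) (hξ : ξ ≠ 0) :
    ∃ p q : X → ℕ, YT p q ∧ ∑ g, ξ g * fT p q g ≠ 0 := by
  classical
  let D : ConjClasses (Perm X) → YoungDiagram := fun C =>
    YoungDiagram.ofRowLens ((Quotient.out C).partition.parts.sort (· ≥ ·))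
      (Multiset.pairwise_sort _ _).sortedGE
  have pos : ∀ C : ConjClasses (Perm X), ∀ x ∈ (Quotient.out C).partition.parts.sort (· ≥ ·), 0 < x := by
    intro C x hx
    rw [Multiset.mem_sort] at hx
    exact (Quotient.out C).partition.parts_pos hx
  have Drl : ∀ C, (D C).rowLens = (Quotient.out C).partition.parts.sort (· ≥ ·) := fun C =>
    YoungDiagram.rowLens_ofRowLens_eq_self (pos C)
  have Dcard : ∀ C, (D C).cells.card = Fintype.card X := by
    intro C
    rw [card_cells_eq, Drl, ← Multiset.sum_coe, Multiset.sort_eq]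
    exact (Quotient.out C).partition.parts_sum
  have Dinj : Function.Injective D := by
    intro C C' h
    have h1 : (D C).rowLens = (D C').rowLens := by rw [h]
    rw [Drl, Drl] at h1
    have h2 : (Quotient.out C).partition.parts = (Quotient.out C').partition.parts := by
      rw [← Multiset.sort_eq (Quotient.out C).partition.parts (· ≥ ·), h1, Multiset.sort_eq]
    have h3 := Equiv.Perm.partition_eq_of_isConj.2 (Nat.Partition.ext h2)
    have := ConjClasses.mk_eq_mk_iff_isConj.2 h3
    have e : ∀ C : ConjClasses (Perm X), ConjClasses.mk (Quotient.out C) = C := fun C => Quotient.out_eq _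
    rwa [e, e] at this
  have eqv : ∀ C, Nonempty (X ≃ (D C).cells) := fun C =>
    ⟨Fintype.equivOfCardEq (by rw [Fintype.card_coe, Dcard])⟩
  let e : ∀ C, X ≃ (D C).cells := fun C => (eqv C).some
  let qq : ConjClasses (Perm X) → X → ℕ := fun C x => (e C x).1.1
  let pp : ConjClasses (Perm X) → X → ℕ := fun C x => (e C x).1.2
  have hY : ∀ S, YT (pp S) (qq S) := by
    intro S
    refine ⟨fun x y a b => (e S).injective (Subtype.ext (Prod.ext b a)), fun x i j hi hj => ?_⟩
    have hm : (i, j) ∈ (D S).cells := (D S).up_left_mem hi hj (e S x).2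
    exact ⟨(e S).symm ⟨(i, j), hm⟩, by simp [qq], by simp [pp]⟩
  suffices hinj : ∀ S T (g : Perm X), qq S ∘ ⇑g = qq T → S = T by
    obtain ⟨T, hT⟩ := complete_of_family pp qq hY hinj ξ hcl hξ
    exact ⟨_, _, hY T, hT⟩
  · intro S T g hg
    apply Dinj
    have rl : ∀ C i, (D C).rowLen i = Fintype.card {x // qq C x = i} := by
      intro C i
      rw [YoungDiagram.rowLen_eq_card, ← Fintype.card_coe]
      refine Fintype.card_congr ?_
      exact
        { toFun := fun c => ⟨(e C).symm ⟨c.1, (YoungDiagram.mem_row_iff.1 c.2).1⟩, by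
            simp [qq]; exact (YoungDiagram.mem_row_iff.1 c.2).2⟩
          invFun := fun x => ⟨(e C x.1).1, YoungDiagram.mem_row_iff.2 ⟨(e C x.1).2, x.2⟩⟩
          left_inv := fun c => by simp
          right_inv := fun x => by simp }
    have rr : ∀ i, (D S).rowLen i = (D T).rowLen i := by
      intro i
      rw [rl, rl]
      refine Fintype.card_congr (Equiv.symm ?_)
      refine Equiv.subtypeEquiv g fun x => ?_
      rw [← hg]; rfl
    ext ⟨i, j⟩
    have := rr i
    change (i, j) ∈ D S ↔ (i, j) ∈ D T
    rw [YoungDiagram.mem_iff_lt_rowLen, YoungDiagram.mem_iff_lt_rowLen, this]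

end classif
end McKayGraphs

open scoped BigOperators
namespace McKayGraphs
open Equiv

section cut
variable {X : Type*} [Fintype X] [DecidableEq X]

/-- indicator of the stabilizer of a coloring -/
noncomputable def ind (u : X → ℕ) (g : Perm X) : ℂ := if u ∘ ⇑g = u then 1 else 0

lemma ind_mem {R : Submodule ℂ (Perm X → ℂ)} (hR : BiInv R) {F : Perm X → ℂ} (hF : F ∈ R)
    {u : X → ℕ} (hs : ∀ g, F g ≠ 0 → u ∘ ⇑g = u) (hne : ∑ g, F g ≠ 0) : ind u ∈ R := by
  classical
  let Q : Finset (Perm X) := Finset.univ.filter (fun c => u ∘ c = u)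
  have h1 : (∑ c ∈ Q, tl c 1 F) ∈ R := Submodule.sum_mem _ fun c _ => hR c 1 F hF
  have h2 : ind u = (∑ g, F g)⁻¹ • (∑ c ∈ Q, tl c 1 F) := by
    funext g
    simp only [Pi.smul_apply, Finset.sum_apply, tl_apply, mul_one, smul_eq_mul]
    unfold ind
    by_cases hg : u ∘ ⇑g = u
    · rw [if_pos hg]
      have : ∑ c ∈ Q, F (c * g) = ∑ g, F g := by
        rw [← Equiv.sum_comp (Equiv.mulRight g) F]
        simp only [Equiv.coe_mulRight]
        refine Finset.sum_subset (Finset.subset_univ _) fun c _ hc => ?_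
        by_contra hn
        apply hc
        have := hs _ hn
        simp only [Q, Finset.mem_filter, Finset.mem_univ, true_and]
        have h3 := comp_mul_of this (comp_inv_of hg)
        simpa using h3
      rw [this, inv_mul_cancel₀ hne]
    · rw [if_neg hg]
      suffices h0 : ∑ c ∈ Q, F (c * g) = 0 by rw [h0, mul_zero]
      refine Finset.sum_eq_zero fun c hc => ?_
      by_contra hn
      apply hg
      have := hs _ hn
      simp only [Q, Finset.mem_filter, Finset.mem_univ, true_and] at hc
      have h3 := comp_mul_of (comp_inv_of hc) this
      simpa using h3
  rw [h2]
  exact Submodule.smul_mem _ _ h1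

/-- row length -/
def rl (q : X → ℕ) (i : ℕ) : ℕ := (cl q i).card

lemma YT.col_lt {p q : X → ℕ} (h : YT p q) (x : X) : p x < rl q (q x) := by
  have := image_cl h.flip.1 h.flip.hin (q x)
  have hx : p x ∈ (cl q (q x)).image p := Finset.mem_image_of_mem _ (by simp)
  rw [this] at hx
  exact Finset.mem_range.1 hx

lemma YT.exists_cell {p q : X → ℕ} (h : YT p q) {i j : ℕ} (hj : j < rl q i) : ∃ x, q x = i ∧ p x = j := by
  have := image_cl h.flip.1 h.flip.hin i
  have hx : j ∈ (cl q i).image p := by rw [this]; exact Finset.mem_range.2 hj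
  obtain ⟨x, hx, e⟩ := Finset.mem_image.1 hx
  exact ⟨x, by simpa using hx, e⟩

lemma YT.rl_anti {p q : X → ℕ} (h : YT p q) {i j : ℕ} (hij : i ≤ j) : rl q j ≤ rl q i := by
  by_contra hlt
  push Not at hlt
  obtain ⟨x, a, b⟩ := h.exists_cell (i := j) (j := rl q i) hlt
  obtain ⟨y, c, d⟩ := h.2 x i (p x) (by omega) le_rfl
  have := h.col_lt y
  rw [c, d, b] at this
  exact lt_irrefl _ this

lemma row_zero_of {p q : X → ℕ} (h : YT p q) {x : X} (hx : rl q 1 ≤ p x) : q x = 0 := by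
  by_contra h0
  have := h.col_lt x
  have := h.rl_anti (i := 1) (j := q x) (by omega)
  omega

lemma stab_of_maps {s : X → ℕ} {g : Perm X} (h : ∀ x, s x = 0 → s (g x) = 0) (hs : ∀ x, s x = 0 ∨ s x = 1) :
    s ∘ ⇑g = s := by
  have hb : ∀ x, s (g x) = 0 → s x = 0 := by
    let S : Finset X := cl s 0
    have him : S.image g = S := by
      apply Finset.eq_of_subset_of_card_le
      · intro y hy
        obtain ⟨x, hx, rfl⟩ := Finset.mem_image.1 hy
        simp only [S, mem_cl] at hx ⊢
        exact h x hx
      · rw [Finset.card_image_of_injective _ g.injective]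
    intro x hx
    have : g x ∈ S.image g := by rw [him]; simpa [S] using hx
    obtain ⟨y, hy, e⟩ := Finset.mem_image.1 this
    rw [← g.injective e]; simpa [S] using hy
  funext x
  simp only [Function.comp]
  rcases hs x with h0 | h0
  · rw [h x h0, h0]
  · rcases hs (g x) with h1 | h1
    · rw [hb x h1] at h0; omega
    · rw [h0, h1]

/-- the two-part coloring -/
def two (q : X → ℕ) (x : X) : ℕ := if q x = 0 then 0 else 1

theorem cut_mem {p q : X → ℕ} (h : YT p q) (h2 : 2 * rl q 1 ≤ rl q 0) :
    ind (two q) ∈ (tr (fT p q)) ^ 4 := by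
  classical
  rcases isEmpty_or_nonempty X with hX | hX
  · have : ind (two q) = fT p q ^ 4 := by
      funext g
      have hg : g = 1 := Subsingleton.elim _ _
      subst hg
      rw [Pi.pow_apply, fT_one h.1]
      simp [ind]
    rw [this]
    exact pow_mem_pow' (mem_tr _)
  set a := rl q 1 with ha
  have ex : ∀ j, j < rl q 0 → ∃ x, q x = 0 ∧ p x = j := fun j hj => h.exists_cell hj
  choose! cell hc1 hc2 using ex
  have cu : ∀ x, q x = 0 → cell (p x) = x := fun x hx => by
    have := h.col_lt x
    rw [hx] at this
    exact h.1 _ _ (hc2 _ this) ((hc1 _ this).trans hx.symm)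
  have hlt : ∀ x, q x = 0 → p x < rl q 0 := fun x hx => by have := h.col_lt x; rwa [hx] at this
  let φ : X → X := fun x => if q x = 0 then (if p x < a then cell (p x + a) else
    if p x < 2 * a then cell (p x - a) else x) else x
  have hφ : Function.Involutive φ := by
    intro x
    by_cases hx : q x = 0
    · have hl := hlt x hx
      by_cases h1 : p x < a
      · have e1 : φ x = cell (p x + a) := by simp only [φ]; rw [if_pos hx, if_pos h1]
        have q1 : q (φ x) = 0 := by rw [e1]; exact hc1 _ (by omega)
        have p1 : p (φ x) = p x + a := by rw [e1]; exact hc2 _ (by omega)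
        conv_lhs => rw [show φ (φ x) = cell (p (φ x) - a) by
          change (if q (φ x) = 0 then _ else _) = _; rw [if_pos q1, if_neg (by omega), if_pos (by omega)]]
        rw [p1, Nat.add_sub_cancel, cu x hx]
      · by_cases h3 : p x < 2 * a
        · have e1 : φ x = cell (p x - a) := by simp only [φ]; rw [if_pos hx, if_neg h1, if_pos h3]
          have q1 : q (φ x) = 0 := by rw [e1]; exact hc1 _ (by omega)
          have p1 : p (φ x) = p x - a := by rw [e1]; exact hc2 _ (by omega)
          conv_lhs => rw [show φ (φ x) = cell (p (φ x) + a) by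
            change (if q (φ x) = 0 then _ else _) = _; rw [if_pos q1, if_pos (by omega)]]
          rw [p1, Nat.sub_add_cancel (by omega), cu x hx]
        · have e1 : φ x = x := by simp only [φ]; rw [if_pos hx, if_neg h1, if_neg h3]
          rw [e1, e1]
    · have e1 : φ x = x := by simp only [φ]; rw [if_neg hx]
      rw [e1, e1]
  let k : Perm X := hφ.toPerm
  have kq : q ∘ ⇑k = q := by
    funext x
    change q (φ x) = q x
    by_cases hx : q x = 0
    · have hl := hlt x hx
      simp only [φ]
      rw [if_pos hx]
      split_ifs with h1 h3
      · rw [hc1 _ (by omega), hx]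
      · rw [hc1 _ (by omega), hx]
      · rfl
    · simp only [φ]; rw [if_neg hx]
  have kp : ∀ x, q x = 0 → p x < a → a ≤ p (k x) := by
    intro x hx h1
    have hl := hlt x hx
    change a ≤ p (φ x)
    simp only [φ]
    rw [if_pos hx, if_pos h1, hc2 _ (by omega)]; omega
  -- the key support claim
  have key : ∀ g, fT p q g ≠ 0 → ∀ x, a ≤ p x → q (g⁻¹ x) = 0 := by
    intro g hg x hx
    obtain ⟨c, r, hc, hr, rfl⟩ := fT_ne_zero hg
    have e : q ((c * r)⁻¹ x) = q (c⁻¹ x) := by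
      rw [mul_inv_rev]
      exact congrFun (comp_inv_of hr) (c⁻¹ x)
    rw [e]
    apply row_zero_of h
    have := congrFun (comp_inv_of hc) x
    simp only [Function.comp] at this
    rw [this]; exact hx
  let F : Perm X → ℂ := (fT p q) ^ 2 * (tl k k⁻¹ (fT p q)) ^ 2
  have hF : F ∈ (tr (fT p q)) ^ 4 :=
    mul_mem_pow (a := 2) (b := 2) (pow_mem_pow' (mem_tr _))
      (pow_mem_pow' (tr_biInv _ _ _ _ (mem_tr _)))
  refine ind_mem ((tr_biInv _).pow 4) hF ?_ ?_
  · intro g hg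
    have h1 : fT p q g ≠ 0 := fun h0 => hg (by simp [F, h0])
    have h3 : fT p q (k * g * k⁻¹) ≠ 0 := fun h0 => hg (by simp [F, h0])
    have : two q ∘ ⇑g⁻¹ = two q := by
      apply stab_of_maps
      · intro x hx
        have hx : q x = 0 := by by_contra hn; simp [two, hn] at hx
        suffices q (g⁻¹ x) = 0 by unfold two; rw [if_pos this]
        by_cases hxa : a ≤ p x
        · exact key g h1 x hxa
        · have := key _ h3 (k x) (kp x hx (by omega))
          rw [show (k * g * k⁻¹)⁻¹ (k x) = k (g⁻¹ x) by
            simp only [mul_inv_rev, inv_inv, Perm.coe_mul, Function.comp, ias]] at this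
          rwa [show q (k (g⁻¹ x)) = q (g⁻¹ x) from congrFun kq _] at this
      · intro x; unfold two; split_ifs <;> simp
    simpa using comp_inv_of this
  · have hv : ∀ g, F g = ((F g).re : ℂ) ∧ 0 ≤ (F g).re := by
      intro g
      simp only [F, Pi.mul_apply, Pi.pow_apply, tl_apply]
      rcases fT_val h.1 g with a | a | a <;> rcases fT_val h.1 (k * g * k⁻¹) with b | b | b <;>
        rw [a, b] <;> norm_num
    have h1 : F 1 = 1 := by
      simp [F, fT_one h.1]
    intro h0
    have h3 : ∑ g, (F g).re = 0 := by
      have := congrArg Complex.re h0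
      simpa using this
    have h4 := (Finset.sum_eq_zero_iff_of_nonneg (fun g _ => (hv g).2)).1 h3 1 (Finset.mem_univ _)
    rw [h1] at h4
    simp at h4

end cut
end McKayGraphs

open scoped BigOperators
namespace McKayGraphs
open Equiv

section hadamard
variable {X : Type*} [Fintype X] [DecidableEq X]

open scoped ComplexOrder in
lemma hada_one (M : Matrix X X ℂ) (h : ∀ x, ∑ y, ‖M x y‖ ^ 2 ≤ 1) : ‖M.det‖ ≤ 1 := by
  classical
  have hps : (M * M.conjTranspose).PosSemidef := Matrix.posSemidef_self_mul_conjTranspose M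
  have hH := hps.1
  have hd : (M * M.conjTranspose).det = ((∏ i, hH.eigenvalues i : ℝ) : ℂ) := by
    rw [hH.det_eq_prod_eigenvalues]; simp
  have ht : (M * M.conjTranspose).trace = ((∑ i, hH.eigenvalues i : ℝ) : ℂ) := by
    rw [hH.trace_eq_sum_eigenvalues]; simp
  have ht2 : (M * M.conjTranspose).trace = ((∑ x, ∑ y, ‖M x y‖ ^ 2 : ℝ) : ℂ) := by
    simp only [Matrix.trace, Matrix.diag, Matrix.mul_apply, Matrix.conjTranspose_apply]
    push_cast
    refine Finset.sum_congr rfl fun x _ => Finset.sum_congr rfl fun y _ => ?_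
    rw [RCLike.star_def, Complex.mul_conj, Complex.normSq_eq_norm_sq]; push_cast; rfl
  have hs : ∑ i, hH.eigenvalues i ≤ Fintype.card X := by
    have : (∑ i, hH.eigenvalues i : ℝ) = ∑ x, ∑ y, ‖M x y‖ ^ 2 := by
      rw [ht] at ht2; exact_mod_cast ht2
    rw [this]
    calc ∑ x, ∑ y, ‖M x y‖ ^ 2 ≤ ∑ x : X, (1 : ℝ) := Finset.sum_le_sum fun x _ => h x
      _ = _ := by simp
  have hp : ∏ i, hH.eigenvalues i ≤ 1 := by
    calc ∏ i, hH.eigenvalues i ≤ ∏ i, Real.exp (hH.eigenvalues i - 1) :=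
          Finset.prod_le_prod (fun i _ => hps.eigenvalues_nonneg i) fun i _ => by
            have := Real.add_one_le_exp (hH.eigenvalues i - 1); linarith
      _ = Real.exp (∑ i, hH.eigenvalues i - Fintype.card X) := by
          rw [← Real.exp_sum, Finset.sum_sub_distrib]; simp
      _ ≤ 1 := Real.exp_le_one_iff.2 (by linarith)
  have h2 : ‖M.det‖ ^ 2 = ∏ i, hH.eigenvalues i := by
    have : (M * M.conjTranspose).det = ((‖M.det‖ ^ 2 : ℝ) : ℂ) := by
      rw [Matrix.det_mul, Matrix.det_conjTranspose, RCLike.star_def, Complex.mul_conj, Complex.normSq_eq_norm_sq]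
    rw [hd] at this
    exact_mod_cast this.symm
  have : ‖M.det‖ ^ 2 ≤ 1 := h2 ▸ hp
  nlinarith [norm_nonneg M.det]

lemma hada (M : Matrix X X ℂ) (w : X → ℝ) (hw : ∀ x, 0 < w x) (h : ∀ x, ∑ y, ‖M x y‖ ^ 2 ≤ w x) :
    ‖M.det‖ ≤ ∏ x, Real.sqrt (w x) := by
  have hq : ∀ x, 0 < Real.sqrt (w x) := fun x => Real.sqrt_pos.2 (hw x)
  have h1 := hada_one (Matrix.of fun x y => ((Real.sqrt (w x))⁻¹ : ℂ) * M x y) (fun x => by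
    simp only [Matrix.of_apply, norm_mul, mul_pow, ← Finset.mul_sum]
    rw [norm_inv, Complex.norm_real, Real.norm_of_nonneg (hq x).le, inv_pow, Real.sq_sqrt (hw x).le,
      inv_mul_le_iff₀ (hw x), mul_one]
    exact h x)
  rw [show (Matrix.of fun x y => ((Real.sqrt (w x))⁻¹ : ℂ) * M x y).det =
    (∏ x, ((Real.sqrt (w x))⁻¹ : ℂ)) * M.det from Matrix.det_mul_column _ _, norm_mul] at h1
  rw [norm_prod] at h1
  simp only [norm_inv, Complex.norm_real] at h1
  rw [Finset.prod_inv_distrib] at h1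
  have h3 : ∏ x, ‖Real.sqrt (w x)‖ = ∏ x, Real.sqrt (w x) :=
    Finset.prod_congr rfl fun x _ => Real.norm_of_nonneg (hq x).le
  rw [h3, inv_mul_le_iff₀ (Finset.prod_pos fun x _ => hq x), mul_one] at h1
  exact h1

/-- number of elements in a fibre -/
def fc {κ : Type*} [DecidableEq κ] (a : X → κ) (k : κ) : ℕ := (Finset.univ.filter (fun x => a x = k)).card

/-- phase extraction -/
lemma phase {κ : Type*} [Fintype κ] [DecidableEq κ] (N : ℕ) [NeZero N] (hN : Fintype.card X < N)
    (a b : X → κ) :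
    ∑ u : κ → ZMod N, (∏ x, ZMod.stdAddChar (u (a x))) * (∏ x, ZMod.stdAddChar (- u (b x))) =
      if (∀ k, fc a k = fc b k)
      then ((Fintype.card (κ → ZMod N) : ℕ) : ℂ) else 0 := by
  classical
  unfold fc
  have e1 : ∀ (v : κ → ZMod N) (a : X → κ), ∏ x, ZMod.stdAddChar (v (a x)) =
      ∏ k, (ZMod.stdAddChar (((Finset.univ.filter (fun x => a x = k)).card : ZMod N) * v k) : ℂ) := by
    intro v a
    rw [← Finset.prod_fiberwise_of_maps_to (g := a) (t := Finset.univ) (fun _ _ => Finset.mem_univ _)]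
    refine Finset.prod_congr rfl fun k _ => ?_
    rw [Finset.prod_congr rfl (g := fun _ => (ZMod.stdAddChar (v k) : ℂ)) (fun x hx => by
      rw [(Finset.mem_filter.1 hx).2]), Finset.prod_const, ← nsmul_eq_mul, AddChar.map_nsmul_eq_pow]
  have e2 : ∀ u : κ → ZMod N, (∏ x, (ZMod.stdAddChar (u (a x)) : ℂ)) * (∏ x, ZMod.stdAddChar (- u (b x))) =
      ∏ k, (ZMod.stdAddChar (u k * (((Finset.univ.filter (fun x => a x = k)).card : ZMod N) -
        ((Finset.univ.filter (fun x => b x = k)).card : ZMod N))) : ℂ) := by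
    intro u
    rw [e1 u a, e1 (fun k => - u k) b, ← Finset.prod_mul_distrib]
    refine Finset.prod_congr rfl fun k _ => ?_
    rw [← AddChar.map_add_eq_mul]; congr 1; ring
  simp only [e2]
  rw [← Fintype.piFinset_univ, ← Finset.prod_univ_sum (fun _ => (Finset.univ : Finset (ZMod N)))
    (fun k v => (ZMod.stdAddChar (v * (((Finset.univ.filter (fun x => a x = k)).card : ZMod N) -
        ((Finset.univ.filter (fun x => b x = k)).card : ZMod N))) : ℂ))]
  simp only [AddChar.sum_mulShift _ (ZMod.isPrimitive_stdAddChar N)]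
  have hz : ∀ k, ((((Finset.univ.filter (fun x => a x = k)).card : ZMod N) -
        ((Finset.univ.filter (fun x => b x = k)).card : ZMod N)) = 0 ↔
        (Finset.univ.filter (fun x => a x = k)).card = (Finset.univ.filter (fun x => b x = k)).card) := by
    intro k
    rw [sub_eq_zero, ZMod.natCast_eq_natCast_iff']
    rw [Nat.mod_eq_of_lt (lt_of_le_of_lt (Finset.card_le_univ _) hN),
      Nat.mod_eq_of_lt (lt_of_le_of_lt (Finset.card_le_univ _) hN)]
  by_cases h : (∀ k, (Finset.univ.filter (fun x => a x = k)).card = (Finset.univ.filter (fun x => b x = k)).card)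
  · rw [if_pos h]
    rw [Finset.prod_congr rfl (g := fun _ => (N : ℂ)) (fun k _ => by
      rw [if_pos ((hz k).2 (h k)), ZMod.card])]
    simp [ZMod.card]
  · rw [if_neg h]
    push Not at h
    obtain ⟨k, hk⟩ := h
    exact Finset.prod_eq_zero (Finset.mem_univ k) (by rw [if_neg (fun h' => hk ((hz k).1 h'))]; simp)

lemma prod_of_fc {κ M : Type*} [Fintype κ] [DecidableEq κ] [CommMonoid M] {a b : X → κ}
    (h : ∀ k, fc a k = fc b k) (F : κ → M) : ∏ x, F (a x) = ∏ x, F (b x) := by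
  have e : ∀ a : X → κ, ∏ x, F (a x) = ∏ k, F k ^ fc a k := by
    intro a
    rw [← Finset.prod_fiberwise_of_maps_to (g := a) (t := Finset.univ) (fun _ _ => Finset.mem_univ _)]
    refine Finset.prod_congr rfl fun k _ => ?_
    rw [Finset.prod_congr rfl (g := fun _ => F k) (fun x hx => by
      rw [(Finset.mem_filter.1 hx).2]), Finset.prod_const]
    rfl
  rw [e, e]
  exact Finset.prod_congr rfl fun k _ => by rw [h]

/-- alternating sum over the column stabilizer with prescribed contingency table -/
noncomputable def Aval {κ : Type*} [DecidableEq κ] [Fintype κ] (p : X → ℕ) (q z : X → κ) : ℂ :=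
  ∑ c : Perm X, if p ∘ c = p ∧ (∀ k, fc (fun x => (q x, q (c⁻¹ x))) k = fc (fun x => (q x, z x)) k)
    then sg c else 0

lemma Aval_le {κ : Type*} [DecidableEq κ] [Fintype κ] (p : X → ℕ) (q z : X → κ)
    (hJ : ∀ x y, p x = p y → q x = q y → x = y) :
    ‖Aval p q z‖ * ∏ x, Real.sqrt (fc (fun x => (q x, z x)) (q x, z x)) ≤
      ∏ x, Real.sqrt (fc q (q x)) := by
  classical
  let N := Fintype.card X + 1
  let J : κ × κ → ℕ := fun k => fc (fun x => (q x, z x)) k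
  let M : (κ × κ → ZMod N) → Matrix X X ℂ := fun u => Matrix.of fun x y =>
    if p x = p y then ((Real.sqrt (J (q x, q y)) : ℝ) : ℂ) * ZMod.stdAddChar (u (q x, q y)) else 0
  have hdet : ∀ u, ‖(M u).det‖ ≤ ∏ x, Real.sqrt (fc q (q x)) := by
    intro u
    refine hada (M u) (fun x => (fc q (q x) : ℝ)) (fun x => ?_) (fun x => ?_)
    · have : 0 < fc q (q x) := Finset.card_pos.2 ⟨x, by simp⟩
      exact_mod_cast this
    · have e1 : ∀ y, ‖M u x y‖ ^ 2 = if p x = p y then (J (q x, q y) : ℝ) else 0 := by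
        intro y
        simp only [M, Matrix.of_apply]
        split_ifs with h
        · rw [norm_mul, AddChar.norm_apply, mul_one, Complex.norm_real,
            Real.norm_of_nonneg (Real.sqrt_nonneg _), Real.sq_sqrt (by positivity)]
        · simp
      simp only [e1]
      rw [← Finset.sum_filter]
      have e2 : ∑ y ∈ Finset.univ.filter (fun y => p x = p y), (J (q x, q y) : ℝ) =
          ∑ j ∈ (Finset.univ.filter (fun y => p x = p y)).image q, (J (q x, j) : ℝ) := by
        rw [Finset.sum_image]
        intro y hy y' hy' h
        simp at hy hy'
        exact hJ y y' (hy.symm.trans hy') h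
      rw [e2]
      have e3 : (fc q (q x) : ℝ) = ∑ j : κ, (J (q x, j) : ℝ) := by
        have : fc q (q x) = ∑ j : κ, J (q x, j) := by
          unfold fc
          rw [Finset.card_eq_sum_card_fiberwise (f := z) (t := Finset.univ) (fun _ _ => Finset.mem_coe.2 (Finset.mem_univ _))]
          refine Finset.sum_congr rfl fun j _ => ?_
          simp only [J, fc]
          congr 1
          ext y; simp
        rw [this]; push_cast; rfl
      rw [e3]
      exact Finset.sum_le_sum_of_subset_of_nonneg (Finset.subset_univ _) fun _ _ _ => by positivity
  have hexp : ∀ u, (M u).det = ∑ c : Perm X, if p ∘ c = p then sg c *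
      ((∏ x, ((Real.sqrt (J (q x, q (c⁻¹ x))) : ℝ) : ℂ)) * ∏ x, (ZMod.stdAddChar (u (q x, q (c⁻¹ x))) : ℂ)) else 0 := by
    intro u
    rw [Matrix.det_apply]
    refine Finset.sum_congr rfl fun c _ => ?_
    have e1 : Perm.sign c • ∏ i, M u (c i) i = sg c * ∏ i, M u (c i) i := by
      rw [Units.smul_def, zsmul_eq_mul]; rfl
    have e2 : ∏ i, M u (c i) i = ∏ x, M u x (c⁻¹ x) := by
      rw [← Equiv.prod_comp c (fun x => M u x (c⁻¹ x))]
      exact Finset.prod_congr rfl fun x _ => by rw [ias]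
    rw [e1, e2]
    by_cases h : p ∘ c = p
    · rw [if_pos h, ← Finset.prod_mul_distrib]
      congr 1
      refine Finset.prod_congr rfl fun x _ => ?_
      simp only [M, Matrix.of_apply]
      have hpx : p x = p (c⁻¹ x) := (congrFun (comp_inv_of h) x).symm
      rw [if_pos hpx]
    · rw [if_neg h]
      have : ∃ x, p x ≠ p (c⁻¹ x) := by
        by_contra hn
        push Not at hn
        exact h (by simpa using comp_inv_of (c := c⁻¹) (funext fun x => (hn x).symm))
      obtain ⟨x, hx⟩ := this
      rw [Finset.prod_eq_zero (Finset.mem_univ x), mul_zero]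
      simp only [M, Matrix.of_apply]
      rw [if_neg hx]
  let B : ℂ := ∏ x, ((Real.sqrt (J (q x, z x)) : ℝ) : ℂ)
  have hsum : ∑ u : κ × κ → ZMod N, (M u).det * ∏ x, (ZMod.stdAddChar (- u (q x, z x)) : ℂ) =
      (Fintype.card (κ × κ → ZMod N) : ℂ) * (Aval p q z * B) := by
    simp only [hexp, Finset.sum_mul]
    rw [Finset.sum_comm]
    unfold Aval
    rw [Finset.sum_mul, Finset.mul_sum]
    refine Finset.sum_congr rfl fun c _ => ?_
    by_cases h : p ∘ c = p
    · simp only [if_pos h]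
      have e3 : ∀ u : κ × κ → ZMod N, sg c * ((∏ x, ((Real.sqrt (J (q x, q (c⁻¹ x))) : ℝ) : ℂ)) *
          ∏ x, (ZMod.stdAddChar (u (q x, q (c⁻¹ x))) : ℂ)) * ∏ x, (ZMod.stdAddChar (- u (q x, z x)) : ℂ) =
          (sg c * ∏ x, ((Real.sqrt (J (q x, q (c⁻¹ x))) : ℝ) : ℂ)) *
          ((∏ x, (ZMod.stdAddChar (u (q x, q (c⁻¹ x))) : ℂ)) * ∏ x, (ZMod.stdAddChar (- u (q x, z x)) : ℂ)) := by
        intro u; ring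
      simp only [e3]
      rw [← Finset.mul_sum, phase N (Nat.lt_succ_self _) (fun x => (q x, q (c⁻¹ x))) (fun x => (q x, z x))]
      by_cases h2 : ∀ k, fc (fun x => (q x, q (c⁻¹ x))) k = fc (fun x => (q x, z x)) k
      · rw [if_pos h2, if_pos ⟨h, h2⟩]
        have : ∏ x, ((Real.sqrt (J (q x, q (c⁻¹ x))) : ℝ) : ℂ) = B :=
          prod_of_fc h2 (fun k => ((Real.sqrt (J k) : ℝ) : ℂ))
        rw [this]; ring
      · rw [if_neg h2, if_neg (fun h' => h2 h'.2)]; ring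
    · have h' : ¬ (p ∘ c = p ∧ (∀ k, fc (fun x => (q x, q (c⁻¹ x))) k = fc (fun x => (q x, z x)) k)) :=
        fun h' => h h'.1
      simp only [if_neg h, if_neg h']
      simp
  have hB : ‖B‖ = ∏ x, Real.sqrt (J (q x, z x)) := by
    simp only [B, norm_prod, Complex.norm_real]
    exact Finset.prod_congr rfl fun x _ => Real.norm_of_nonneg (Real.sqrt_nonneg _)
  have hn := congrArg norm hsum
  rw [norm_mul, norm_mul, hB, Complex.norm_natCast] at hn
  have hle : ‖∑ u : κ × κ → ZMod N, (M u).det * ∏ x, (ZMod.stdAddChar (- u (q x, z x)) : ℂ)‖ ≤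
      (Fintype.card (κ × κ → ZMod N) : ℝ) * ∏ x, Real.sqrt (fc q (q x)) := by
    refine (norm_sum_le _ _).trans ?_
    calc _ ≤ ∑ u : κ × κ → ZMod N, ∏ x, Real.sqrt (fc q (q x)) := by
          refine Finset.sum_le_sum fun u _ => ?_
          rw [norm_mul, norm_prod]
          simp only [AddChar.norm_apply, Finset.prod_const_one, mul_one]
          exact hdet u
      _ = _ := by simp
  rw [hn] at hle
  have hpos : (0 : ℝ) < (Fintype.card (κ × κ → ZMod N) : ℝ) := by exact_mod_cast Fintype.card_pos
  exact le_of_mul_le_mul_left hle hpos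

end hadamard
end McKayGraphs

open scoped BigOperators
namespace McKayGraphs
open Equiv

section dd
variable {G : Type*} [Group G] [Fintype G]

/-- diagonal dominance -/
theorem diag_dom (N : Subgroup G) (ψ : G → ℂ) (hinv : ∀ n ∈ N, ∀ g, ψ (n * g) = ψ g)
    (h1 : ψ 1 = 1) [DecidablePred (· ∈ N)]
    (hs : ∑ g, (if g ∈ N then 0 else ‖ψ g‖) < ((Finset.univ.filter (· ∈ N)).card : ℝ))
    {V : Submodule ℂ (G → ℂ)} (hV : BiInv V) (hψ : ψ ∈ V) :
    (fun g => if g ∈ N then (1 : ℂ) else 0) ∈ V := by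
  classical
  let E : Submodule ℂ (G → ℂ) :=
    { carrier := {x | ∀ n ∈ N, ∀ g, x (n * g) = x g}
      zero_mem' := fun _ _ _ => rfl
      add_mem' := fun {a b} ha hb n hn g => by simp [ha n hn g, hb n hn g]
      smul_mem' := fun c a ha n hn g => by simp [ha n hn g] }
  let T : E →ₗ[ℂ] E :=
    { toFun := fun x => ⟨fun g => ∑ h, ψ (g * h⁻¹) * x.1 h, fun n hn g => by
          simp only [mul_assoc, hinv n hn]⟩
      map_add' := fun x y => by
        ext g; simp [mul_add, Finset.sum_add_distrib]
      map_smul' := fun c x => by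
        ext g; simp [Finset.mul_sum]
        exact Finset.sum_congr rfl fun _ _ => by ring }
  have hψN : ∀ n ∈ N, ψ n = 1 := fun n hn => by have := hinv n hn 1; rw [mul_one, h1] at this; exact this
  have hinj : Function.Injective T := by
    rw [← LinearMap.ker_eq_bot, LinearMap.ker_eq_bot']
    intro x hx
    obtain ⟨g, -, hg⟩ := Finset.exists_max_image Finset.univ (fun g => ‖x.1 g‖) ⟨1, Finset.mem_univ _⟩
    have h0 : ∑ h, ψ (g * h⁻¹) * x.1 h = 0 := congrFun (congrArg Subtype.val hx) g
    have h2 : ∑ u, ψ u * x.1 (u⁻¹ * g) = 0 := by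
      rw [← h0]
      refine Fintype.sum_equiv ((Equiv.inv G).trans (Equiv.mulRight g)) _ _ fun u => ?_
      simp
    have h3 : ∑ u, ψ u * x.1 (u⁻¹ * g) = ((Finset.univ.filter (· ∈ N)).card : ℂ) * x.1 g +
        ∑ u, (if u ∈ N then 0 else ψ u * x.1 (u⁻¹ * g)) := by
      rw [Finset.card_filter]
      push_cast
      rw [Finset.sum_mul, ← Finset.sum_add_distrib]
      refine Finset.sum_congr rfl fun u _ => ?_
      by_cases hu : u ∈ N
      · simp only [if_pos hu]
        rw [hψN u hu, x.2 u⁻¹ (N.inv_mem hu) g]; ring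
      · simp only [if_neg hu]; ring
    rw [h2] at h3
    have h4 : ((Finset.univ.filter (· ∈ N)).card : ℝ) * ‖x.1 g‖ ≤
        (∑ g, (if g ∈ N then 0 else ‖ψ g‖)) * ‖x.1 g‖ := by
      have : ((Finset.univ.filter (· ∈ N)).card : ℂ) * x.1 g = -
        ∑ u, (if u ∈ N then 0 else ψ u * x.1 (u⁻¹ * g)) := by linear_combination -h3
      have hn := congrArg norm this
      rw [norm_mul, Complex.norm_natCast, norm_neg] at hn
      rw [hn, Finset.sum_mul]
      refine (norm_sum_le _ _).trans (Finset.sum_le_sum fun u _ => ?_)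
      by_cases hu : u ∈ N
      · simp [if_pos hu]
      · simp only [if_neg hu, norm_mul]
        exact mul_le_mul_of_nonneg_left (hg _ (Finset.mem_univ _)) (norm_nonneg _)
    have h5 : ‖x.1 g‖ = 0 := by
      by_contra hne
      have : 0 < ‖x.1 g‖ := lt_of_le_of_ne (norm_nonneg _) (Ne.symm hne)
      nlinarith
    ext g'
    have := hg g' (Finset.mem_univ _)
    rw [h5] at this
    simpa using le_antisymm this (norm_nonneg _)
  have hsurj : Function.Surjective T := LinearMap.injective_iff_surjective.1 hinj
  obtain ⟨x, hx⟩ := hsurj ⟨fun g => if g ∈ N then (1 : ℂ) else 0, fun n hn g => by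
    simp only [N.mul_mem_cancel_left hn]⟩
  have : (fun g => if g ∈ N then (1 : ℂ) else 0) = ∑ h, x.1 h • tl 1 h⁻¹ ψ := by
    have hx' := congrArg Subtype.val hx
    refine Eq.trans hx'.symm ?_
    funext g
    simp only [T, LinearMap.coe_mk, AddHom.coe_mk, Finset.sum_apply, Pi.smul_apply, tl_apply, smul_eq_mul]
    exact Finset.sum_congr rfl fun h _ => by rw [one_mul]; ring
  rw [this]
  exact Submodule.sum_mem _ fun h _ => V.smul_mem _ (hV _ _ _ hψ)

end dd

section numeric

noncomputable def PP (m : ℕ) : ℝ := (m.factorial : ℝ) ^ 3 / ((m : ℝ) ^ m) ^ 2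

noncomputable def rr (m : ℕ) : ℝ := ((m : ℝ) + 1) * ((m : ℝ) / (m + 1)) ^ (2 * m)

lemma PP_pos (m : ℕ) : 0 < PP m := by
  unfold PP
  rcases Nat.eq_zero_or_pos m with h | h
  · subst h; norm_num
  · have : (0 : ℝ) < m := by exact_mod_cast h
    positivity

lemma PP_succ (m : ℕ) : PP (m + 1) = rr m * PP m := by
  unfold PP rr
  rcases Nat.eq_zero_or_pos m with h | h
  · subst h; norm_num
  · have : (0 : ℝ) < m := by exact_mod_cast h
    rw [Nat.factorial_succ]
    push_cast
    rw [div_pow]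
    field_simp
    ring

lemma rr_mono_succ (k : ℕ) (hk : 1 ≤ k) : rr k ≤ rr (k + 1) := by
  unfold rr
  have hk' : (1 : ℝ) ≤ k := by exact_mod_cast hk
  push_cast
  obtain ⟨x, hx⟩ : ∃ x : ℝ, x = (k : ℝ) := ⟨_, rfl⟩
  rw [← hx] at hk' ⊢
  have h0 : 0 < x := by linarith
  set t : ℝ := 1 / (x + 1) ^ 2 with ht
  have ht0 : 0 < t := by positivity
  have ht1 : t ≤ 1 := by
    rw [ht, div_le_one (by positivity)]; nlinarith
  have e1 : (x / (x + 1)) = (1 - t) * ((x + 1) / (x + 2)) := by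
    rw [ht]; field_simp; ring
  have e2 : (1 - t) ^ (2 * k) * (1 + 2 * x * t) ≤ 1 := by
    have hb : 1 + 2 * x * t ≤ (1 + t) ^ (2 * k) := by
      have := one_add_mul_le_pow (a := t) (by linarith) (2 * k)
      push_cast at this; rw [← hx] at this; exact this
    calc (1 - t) ^ (2 * k) * (1 + 2 * x * t) ≤ (1 - t) ^ (2 * k) * (1 + t) ^ (2 * k) :=
          mul_le_mul_of_nonneg_left hb (pow_nonneg (by linarith) _)
      _ = ((1 - t) * (1 + t)) ^ (2 * k) := by rw [mul_pow]
      _ ≤ 1 := pow_le_one₀ (mul_nonneg (by linarith) (by linarith)) (by nlinarith)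
  have e3 : (x + 2) / (x + 1) ≤ 1 + 2 * x * t := by
    rw [ht, div_le_iff₀ (by positivity)]
    field_simp
    nlinarith
  have e4 : (1 - t) ^ (2 * k) ≤ (x + 1) / (x + 2) := by
    have hA : 0 ≤ (1 - t) ^ (2 * k) := pow_nonneg (by linarith) _
    have : (1 - t) ^ (2 * k) * ((x + 2) / (x + 1)) ≤ 1 :=
      (mul_le_mul_of_nonneg_left e3 hA).trans e2
    rw [le_div_iff₀ (by positivity)]
    rw [← mul_div_assoc, div_le_one (by positivity)] at this
    exact this
  rw [e1, mul_pow]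
  have e5 : ((x + 1) / (x + 1 + 1)) ^ (2 * (k + 1)) = ((x + 1) / (x + 2)) ^ (2 * k) * ((x + 1) / (x + 2)) ^ 2 := by
    rw [show x + 1 + 1 = x + 2 by ring, show 2 * (k + 1) = 2 * k + 2 by ring, pow_add]
  rw [e5]
  have hB : 0 < ((x + 1) / (x + 2)) ^ (2 * k) := by positivity
  have e6 : (x + 1 + 1) * ((x + 1) / (x + 2)) ^ 2 = (x + 1) * ((x + 1) / (x + 2)) := by
    field_simp; ring
  calc (x + 1) * ((1 - t) ^ (2 * k) * ((x + 1) / (x + 2)) ^ (2 * k))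
      ≤ (x + 1) * ((x + 1) / (x + 2) * ((x + 1) / (x + 2)) ^ (2 * k)) := by gcongr
    _ = (x + 1 + 1) * (((x + 1) / (x + 2)) ^ (2 * k) * ((x + 1) / (x + 2)) ^ 2) := by
      linear_combination (-(((x + 1) / (x + 2)) ^ (2 * k))) * e6

lemma rr_mono {k l : ℕ} (hk : 1 ≤ k) (hl : k ≤ l) : rr k ≤ rr l := by
  induction l, hl using Nat.le_induction with
  | base => exact le_rfl
  | succ n hn ih => exact ih.trans (rr_mono_succ n (hk.trans hn))

lemma rr_six {l : ℕ} (hl : 6 ≤ l) : 1 ≤ rr l := by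
  refine le_trans ?_ (rr_mono (by norm_num) hl)
  unfold rr; norm_num

lemma rr_nonneg (k : ℕ) : 0 ≤ rr k := by unfold rr; positivity

lemma PP_add {M : ℕ} (hM : 6 ≤ M) (m : ℕ) : PP M * PP m ≤ PP (M + m) := by
  induction m with
  | zero => simp [PP]
  | succ m ih =>
    rw [← add_assoc, PP_succ, PP_succ]
    have : rr m ≤ rr (M + m) := by
      rcases Nat.eq_zero_or_pos m with h | h
      · subst h
        have : rr 0 = 1 := by unfold rr; norm_num
        rw [this]; exact rr_six (by omega)
      · exact rr_mono h (by omega)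
    calc PP M * (rr m * PP m) = rr m * (PP M * PP m) := by ring
      _ ≤ rr (M + m) * PP (M + m) := by
        apply mul_le_mul this ih (mul_pos (PP_pos _) (PP_pos _)).le (rr_nonneg _)

lemma PP_add_prod {ι : Type*} (s : Finset ι) (m : ι → ℕ) {M : ℕ} (hM : 6 ≤ M) :
    PP M * ∏ i ∈ s, PP (m i) ≤ PP (M + ∑ i ∈ s, m i) := by
  classical
  induction s using Finset.induction_on with
  | empty => simp
  | insert i s hi ih =>
    rw [Finset.prod_insert hi, Finset.sum_insert hi]
    calc PP M * (PP (m i) * ∏ j ∈ s, PP (m j)) = (PP M * ∏ j ∈ s, PP (m j)) * PP (m i) := by ring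
      _ ≤ PP (M + ∑ i ∈ s, m i) * PP (m i) := mul_le_mul_of_nonneg_right ih (PP_pos _).le
      _ ≤ PP (M + ∑ i ∈ s, m i + m i) := PP_add (by omega) _
      _ = _ := by congr 1; ring

lemma PP_small {m : ℕ} (h : m < 6) : PP m ≤ 1 := by
  unfold PP
  interval_cases m <;> norm_num [Nat.factorial]

lemma PP_large {b : ℕ} (h : 12 ≤ b) : 1 ≤ PP b := by
  induction b, h using Nat.le_induction with
  | base => unfold PP; norm_num [Nat.factorial]
  | succ n hn ih =>
    rw [PP_succ]
    have := rr_six (l := n) (by omega)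
    nlinarith

theorem PP_prod {ι : Type*} [Fintype ι] (m : ι → ℕ) (h : 12 ≤ ∑ i, m i) :
    ∏ i, PP (m i) ≤ PP (∑ i, m i) := by
  classical
  by_cases hs : ∃ i, 6 ≤ m i
  · obtain ⟨i, hi⟩ := hs
    have := PP_add_prod (Finset.univ.erase i) m hi
    rwa [Finset.mul_prod_erase _ (fun i => PP (m i)) (Finset.mem_univ i),
      Finset.add_sum_erase _ m (Finset.mem_univ i)] at this
  · push Not at hs
    exact (Finset.prod_le_one (fun i _ => (PP_pos _).le) fun i _ => PP_small (hs i)).trans (PP_large h)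

/-- multinomial lower bound -/
lemma fact_merge (k l : ℕ) : (k + 1).factorial * (l + 1).factorial ≤ (k + l + 1).factorial := by
  induction l with
  | zero => simp
  | succ l ih =>
    rw [Nat.factorial_succ (l + 1), show k + (l + 1) + 1 = (k + l + 1) + 1 by ring, Nat.factorial_succ (k + l + 1)]
    calc (k + 1).factorial * ((l + 1 + 1) * (l + 1).factorial) = (l + 1 + 1) * ((k + 1).factorial * (l + 1).factorial) := by ring
      _ ≤ _ := Nat.mul_le_mul (by omega) ih

lemma fact_merge_prod {ι : Type*} (s : Finset ι) (m : ι → ℕ) (hm : ∀ i ∈ s, 1 ≤ m i) :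
    ∏ i ∈ s, (m i).factorial ≤ (∑ i ∈ s, m i - s.card + 1).factorial ∧ s.card ≤ ∑ i ∈ s, m i := by
  classical
  induction s using Finset.induction_on with
  | empty => simp
  | insert i s hi ih =>
    obtain ⟨h1, h2⟩ := ih fun j hj => hm j (Finset.mem_insert_of_mem hj)
    have h3 := hm i (Finset.mem_insert_self _ _)
    rw [Finset.prod_insert hi, Finset.sum_insert hi, Finset.card_insert_of_notMem hi]
    refine ⟨?_, by omega⟩
    obtain ⟨k, hk⟩ : ∃ k, m i = k + 1 := ⟨m i - 1, by omega⟩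
    calc (m i).factorial * ∏ j ∈ s, (m j).factorial
        ≤ (k + 1).factorial * (∑ i ∈ s, m i - s.card + 1).factorial := by
          rw [hk]; exact Nat.mul_le_mul_left _ h1
      _ ≤ _ := (fact_merge _ _).trans (le_of_eq (by congr 1; omega))

lemma pow_le_fact_sq (b : ℕ) : b ^ b ≤ b.factorial ^ 2 := by
  have h1 : b.factorial = ∏ k ∈ Finset.range b, (k + 1) := (Finset.prod_range_add_one_eq_factorial b).symm
  have h2 : b.factorial = ∏ k ∈ Finset.range b, (b - 1 - k + 1) := by
    rw [h1, ← Finset.prod_range_reflect]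
  calc b ^ b = ∏ k ∈ Finset.range b, b := by simp
    _ ≤ ∏ k ∈ Finset.range b, ((k + 1) * (b - 1 - k + 1)) := by
        refine Finset.prod_le_prod' fun k hk => ?_
        rw [Finset.mem_range] at hk
        obtain ⟨j, rfl⟩ : ∃ j, b = k + 1 + j := ⟨b - k - 1, by omega⟩
        rw [show k + 1 + j - 1 - k + 1 = j + 1 by omega]
        nlinarith [Nat.zero_le (k * j)]
    _ = _ := by rw [Finset.prod_mul_distrib, ← h1, ← h2, sq]

lemma fact_ratio {b c : ℕ} (hc : c ≤ b) (hc1 : 1 ≤ c) : b ^ (b - c) * c.factorial ^ 2 ≤ b.factorial ^ 2 := by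
  by_cases h : c ^ 2 ≤ b
  · have h1 : c.factorial ^ 2 ≤ b ^ c := by
      calc c.factorial ^ 2 ≤ (c ^ c) ^ 2 := Nat.pow_le_pow_left (Nat.factorial_le_pow c) 2
        _ = (c ^ 2) ^ c := by rw [← pow_mul, ← pow_mul, mul_comm]
        _ ≤ b ^ c := Nat.pow_le_pow_left h c
    calc b ^ (b - c) * c.factorial ^ 2 ≤ b ^ (b - c) * b ^ c := Nat.mul_le_mul_left _ h1
      _ = b ^ b := by rw [← pow_add, Nat.sub_add_cancel hc]
      _ ≤ _ := pow_le_fact_sq b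
  · push Not at h
    have key : ∀ d, c ≤ d → b ^ (d - c) * c.factorial ^ 2 ≤ d.factorial ^ 2 := by
      intro d hd
      induction d, hd using Nat.le_induction with
      | base => simp
      | succ d hd ih =>
        rw [Nat.factorial_succ, show d + 1 - c = (d - c) + 1 by omega, pow_succ, mul_pow]
        have : b ≤ (d + 1) ^ 2 := by nlinarith
        calc b ^ (d - c) * b * c.factorial ^ 2 = b * (b ^ (d - c) * c.factorial ^ 2) := by ring
          _ ≤ _ := Nat.mul_le_mul this ih
    exact key b hc

/-- `b ^ (number of parts - 1) ≤ multinomial^2` -/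
theorem multi_lower {ι : Type*} [Fintype ι] [DecidableEq ι] (m : ι → ℕ) (hb : 1 ≤ ∑ i, m i) :
    (∑ i, m i) ^ ((Finset.univ.filter (fun i => m i ≠ 0)).card - 1) * (∏ i, (m i).factorial) ^ 2 ≤
      (∑ i, m i).factorial ^ 2 := by
  set s := Finset.univ.filter (fun i => m i ≠ 0) with hs
  have hsum : ∑ i, m i = ∑ i ∈ s, m i := by
    rw [hs, Finset.sum_filter]
    exact Finset.sum_congr rfl fun i _ => by by_cases h : m i = 0 <;> simp [h]
  have hprod : ∏ i, (m i).factorial = ∏ i ∈ s, (m i).factorial := by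
    rw [hs, Finset.prod_filter]
    exact Finset.prod_congr rfl fun i _ => by by_cases h : m i = 0 <;> simp [h]
  rw [hprod]
  obtain ⟨h1, h2⟩ := fact_merge_prod s m (fun i hi => by
    have := (Finset.mem_filter.1 hi).2; omega)
  have hpos : 1 ≤ s.card := by
    by_contra hn
    have : s = ∅ := Finset.card_eq_zero.1 (by omega)
    rw [hsum, this] at hb; simp at hb
  rw [hsum]
  set b := ∑ i ∈ s, m i
  calc b ^ (s.card - 1) * (∏ i ∈ s, (m i).factorial) ^ 2
      ≤ b ^ (s.card - 1) * ((b - s.card + 1).factorial) ^ 2 := Nat.mul_le_mul_left _ (Nat.pow_le_pow_left h1 2)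
    _ = b ^ (b - (b - s.card + 1)) * ((b - s.card + 1).factorial) ^ 2 := by
        congr 2; omega
    _ ≤ _ := fact_ratio (by omega) (by omega)

end numeric
end McKayGraphs

open scoped BigOperators
namespace McKayGraphs
open Equiv

section count
variable {X : Type*} [Fintype X] [DecidableEq X]

lemma fc_eq_card {β : Type*} [DecidableEq β] (u : X → β) (k : β) : fc u k = Nat.card {x // u x = k} := by
  rw [Nat.card_eq_fintype_card, Fintype.card_subtype]; rfl

lemma fc_comp {β : Type*} [DecidableEq β] (u : X → β) (r : Perm X) (k : β) : fc (u ∘ r) k = fc u k := by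
  rw [fc_eq_card, fc_eq_card]
  exact Nat.card_congr (r.subtypeEquiv fun x => Iff.rfl)

/-- number of stabilizing permutations -/
def stc {β : Type*} [DecidableEq β] (u : X → β) : ℕ := (Finset.univ.filter (fun r : Perm X => u ∘ r = u)).card

lemma stc_pos {β : Type*} [DecidableEq β] (u : X → β) : 0 < stc u :=
  Finset.card_pos.2 ⟨1, by simp⟩

lemma stc_eq {β : Type*} [DecidableEq β] [Fintype β] (u : X → β) : stc u = ∏ k, (fc u k).factorial := by
  have := DomMulAct.stabilizer_card u
  rw [Fintype.card_subtype] at this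
  unfold stc
  rw [this]
  exact Finset.prod_congr rfl fun k _ => by rw [fc_eq_card, Nat.card_eq_fintype_card]

lemma cnt {β : Type*} [DecidableEq β] (u v : X → β) :
    (Finset.univ.filter (fun r : Perm X => v ∘ r = u)).card = (if ∃ r : Perm X, v ∘ r = u then stc v else 0) := by
  split_ifs with h
  · obtain ⟨r0, h0⟩ := h
    unfold stc
    refine (Finset.card_bij (fun r _ => r * r0) ?_ ?_ ?_).symm
    · intro r hr
      simp only [Finset.mem_filter, Finset.mem_univ, true_and] at hr ⊢
      rw [Perm.coe_mul, ← Function.comp_assoc, hr, h0]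
    · intro r _ r' _ h; exact mul_right_cancel h
    · intro r hr
      simp only [Finset.mem_filter, Finset.mem_univ, true_and] at hr
      refine ⟨r * r0⁻¹, ?_, by simp⟩
      simp only [Finset.mem_filter, Finset.mem_univ, true_and]
      rw [Perm.coe_mul, ← Function.comp_assoc, hr, ← h0, Function.comp_assoc, ← Perm.coe_mul, mul_inv_cancel]
      rfl
  · rw [Finset.card_eq_zero, Finset.filter_eq_empty_iff]
    intro r _ hr; exact h ⟨r, hr⟩

lemma ex_iff {β : Type*} [DecidableEq β] (u v : X → β) :
    (∃ r : Perm X, v ∘ r = u) ↔ ∀ k, fc u k = fc v k := by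
  constructor
  · rintro ⟨r, rfl⟩ k; exact fc_comp v r k
  · intro h
    exact fiber_equiv u v fun b => by rw [← fc_eq_card, ← fc_eq_card, h]

variable {κ : Type*} [DecidableEq κ] [Fintype κ]

/-- pairing of colorings -/
def pr {β γ : Type*} (q : X → β) (z : X → γ) : X → β × γ := fun x => (q x, z x)

lemma pr_comp {β γ : Type*} {q q' : X → β} {z z' : X → γ} {r : Perm X} : pr q z ∘ r = pr q' z' ↔ q ∘ r = q' ∧ z ∘ r = z' := by
  constructor
  · intro h
    exact ⟨funext fun x => congrArg Prod.fst (congrFun h x), funext fun x => congrArg Prod.snd (congrFun h x)⟩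
  · rintro ⟨rfl, rfl⟩; rfl

/-- number of colorings with the same table -/
lemma orbit_count (q z : X → κ) :
    (Finset.univ.filter (fun z' : X → κ => ∀ k, fc (pr q z') k = fc (pr q z) k)).card * stc (pr q z) = stc q := by
  have h1 : stc q = ∑ z' : X → κ, (Finset.univ.filter (fun r : Perm X => pr q z ∘ r = pr q z')).card := by
    unfold stc
    rw [Finset.card_eq_sum_card_fiberwise (f := fun r : Perm X => z ∘ r) (t := Finset.univ)
      (fun _ _ => Finset.mem_coe.2 (Finset.mem_univ _))]
    refine Finset.sum_congr rfl fun z' _ => ?_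
    congr 1
    ext r
    simp only [Finset.mem_filter, Finset.mem_univ, true_and]
    exact pr_comp.symm
  rw [h1, Finset.card_filter, Finset.sum_mul]
  refine Finset.sum_congr rfl fun z' _ => ?_
  rw [cnt]
  by_cases h : ∀ k, fc (pr q z') k = fc (pr q z) k
  · rw [if_pos h, if_pos ((ex_iff _ _).2 h), one_mul]
  · rw [if_neg h, if_neg (fun h' => h ((ex_iff _ _).1 h')), zero_mul]

/-- averaged function -/
noncomputable def Phi (p : X → ℕ) (q z : X → κ) : ℂ := (stc q : ℂ)⁻¹ *
  ∑ r : Perm X, if q ∘ r = q then (∑ c : Perm X, if p ∘ c = p ∧ (z ∘ r) ∘ c = q then sg c else 0) else 0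

lemma Phi_eq (p : X → ℕ) (q z : X → κ) :
    Phi p q z = (stc q : ℂ)⁻¹ * ((stc (pr q z) : ℂ) * Aval p q z) := by
  unfold Phi
  congr 1
  have e1 : ∀ r : Perm X, (if q ∘ r = q then (∑ c : Perm X, if p ∘ c = p ∧ (z ∘ r) ∘ c = q then sg c else 0) else 0)
      = ∑ c : Perm X, if p ∘ c = p then (if pr q z ∘ r = pr q (q ∘ ⇑c⁻¹) then sg c else 0) else 0 := by
    intro r
    by_cases h : q ∘ r = q
    · rw [if_pos h]
      refine Finset.sum_congr rfl fun c _ => ?_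
      by_cases hp : p ∘ c = p
      · rw [if_pos hp]
        have : (p ∘ c = p ∧ (z ∘ r) ∘ c = q) ↔ pr q z ∘ r = pr q (q ∘ ⇑c⁻¹) := by
          rw [pr_comp]
          constructor
          · rintro ⟨_, h2⟩
            refine ⟨h, ?_⟩
            rw [← h2, Function.comp_assoc, ← Perm.coe_mul, mul_inv_cancel]; rfl
          · rintro ⟨_, h2⟩
            refine ⟨hp, ?_⟩
            rw [h2, Function.comp_assoc, ← Perm.coe_mul, inv_mul_cancel]; rfl
        simp only [this]
      · rw [if_neg hp, if_neg (fun h' => hp h'.1)]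
    · rw [if_neg h]
      symm
      refine Finset.sum_eq_zero fun c _ => ?_
      rw [if_neg (fun h' => h (pr_comp.1 h').1)]; simp
  simp only [e1]
  rw [Finset.sum_comm]
  unfold Aval
  rw [Finset.mul_sum]
  refine Finset.sum_congr rfl fun c _ => ?_
  by_cases hp : p ∘ c = p
  · simp only [if_pos hp]
    rw [← Finset.sum_filter, Finset.sum_const, cnt, nsmul_eq_mul]
    have : (p ∘ c = p ∧ ∀ k, fc (fun x => (q x, q (c⁻¹ x))) k = fc (fun x => (q x, z x)) k) ↔
        ∃ r : Perm X, pr q z ∘ r = pr q (q ∘ ⇑c⁻¹) := by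
      rw [ex_iff]; exact ⟨fun h => h.2, fun h => ⟨hp, h⟩⟩
    simp only [this]
    split_ifs <;> simp
  · simp only [if_neg hp]
    rw [if_neg (fun h' => hp h'.1)]; simp

lemma sum_row (q z : X → κ) (i : κ) : fc q i = ∑ j, fc (pr q z) (i, j) := by
  unfold fc
  rw [Finset.card_eq_sum_card_fiberwise (f := z) (t := Finset.univ) (fun _ _ => Finset.mem_coe.2 (Finset.mem_univ _))]
  refine Finset.sum_congr rfl fun j _ => ?_
  congr 1
  ext y; simp [pr]

lemma sum_col (q z : X → κ) (j : κ) : fc z j = ∑ i, fc (pr q z) (i, j) := by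
  unfold fc
  rw [Finset.card_eq_sum_card_fiberwise (f := q) (t := Finset.univ) (fun _ _ => Finset.mem_coe.2 (Finset.mem_univ _))]
  refine Finset.sum_congr rfl fun j _ => ?_
  congr 1
  ext y; simp [pr, and_comm]

lemma prod_fc {β M : Type*} [Fintype β] [DecidableEq β] [CommMonoid M] (u : X → β) (F : β → M) :
    ∏ x, F (u x) = ∏ k, F k ^ fc u k := by
  rw [← Finset.prod_fiberwise_of_maps_to (g := u) (t := Finset.univ) (fun _ _ => Finset.mem_univ _)]
  refine Finset.prod_congr rfl fun k _ => ?_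
  rw [Finset.prod_congr rfl (g := fun _ => F k) (fun x hx => by
    rw [(Finset.mem_filter.1 hx).2]), Finset.prod_const]
  rfl

theorem Phi_le (p : X → ℕ) (q z : X → κ) (hJ : ∀ x y, p x = p y → q x = q y → x = y)
    (hb : ∀ i, 12 ≤ fc q i) : ‖Phi p q z‖ ^ 4 * stc q ≤ stc (pr q z) := by
  have h1 := Aval_le p q z hJ
  have eA : (∏ x, Real.sqrt (fc q (q x))) ^ 4 = (∏ i, ((fc q i : ℝ) ^ fc q i)) ^ 2 := by
    rw [show (4 : ℕ) = 2 * 2 by norm_num, pow_mul, ← Finset.prod_pow]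
    congr 1
    simp only [Real.sq_sqrt (Nat.cast_nonneg _)]
    exact prod_fc q (fun i => (fc q i : ℝ))
  have eB : (∏ x, Real.sqrt (fc (fun x => (q x, z x)) (q x, z x))) ^ 4 =
      (∏ k, ((fc (pr q z) k : ℝ) ^ fc (pr q z) k)) ^ 2 := by
    rw [show (4 : ℕ) = 2 * 2 by norm_num, pow_mul, ← Finset.prod_pow]
    congr 1
    simp only [Real.sq_sqrt (Nat.cast_nonneg _)]
    exact prod_fc (pr q z) (fun i => (fc (pr q z) i : ℝ))
  have h2 : ‖Aval p q z‖ ^ 4 * (∏ k, ((fc (pr q z) k : ℝ) ^ fc (pr q z) k)) ^ 2 ≤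
      (∏ i, ((fc q i : ℝ) ^ fc q i)) ^ 2 := by
    rw [← eA, ← eB, ← mul_pow]
    refine pow_le_pow_left₀ (mul_nonneg (norm_nonneg _) (Finset.prod_nonneg fun _ _ => Real.sqrt_nonneg _)) h1 4
  have h3 : ∏ k, PP (fc (pr q z) k) ≤ ∏ i, PP (fc q i) := by
    rw [Fintype.prod_prod_type]
    refine Finset.prod_le_prod (fun i _ => Finset.prod_nonneg fun j _ => (PP_pos _).le) fun i _ => ?_
    rw [sum_row q z i]
    exact PP_prod _ (by rw [← sum_row q z i]; exact hb i)
  have hpp : ∀ m : ℕ, (0 : ℝ) < (m : ℝ) ^ m := fun m => by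
    rcases Nat.eq_zero_or_pos m with h | h
    · subst h; norm_num
    · have : (0 : ℝ) < m := by exact_mod_cast h
      positivity
  have e1 : ∏ k, PP (fc (pr q z) k) = (stc (pr q z) : ℝ) ^ 3 / (∏ k, ((fc (pr q z) k : ℝ) ^ fc (pr q z) k)) ^ 2 := by
    unfold PP
    rw [Finset.prod_div_distrib, Finset.prod_pow, Finset.prod_pow, stc_eq]; push_cast; rfl
  have e2 : ∏ k, PP (fc q k) = (stc q : ℝ) ^ 3 / (∏ k, ((fc q k : ℝ) ^ fc q k)) ^ 2 := by
    unfold PP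
    rw [Finset.prod_div_distrib, Finset.prod_pow, Finset.prod_pow, stc_eq]; push_cast; rfl
  rw [e1, e2] at h3
  have hA : (0 : ℝ) < (∏ k, ((fc q k : ℝ) ^ fc q k)) ^ 2 := by
    have := Finset.prod_pos (s := Finset.univ) (fun k _ => hpp (fc q k)); positivity
  have hB : (0 : ℝ) < (∏ k, ((fc (pr q z) k : ℝ) ^ fc (pr q z) k)) ^ 2 := by
    have := Finset.prod_pos (s := Finset.univ) (fun k _ => hpp (fc (pr q z) k)); positivity
  set A := (∏ k, ((fc q k : ℝ) ^ fc q k)) ^ 2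
  set B := (∏ k, ((fc (pr q z) k : ℝ) ^ fc (pr q z) k)) ^ 2
  rw [div_le_div_iff₀ hB hA] at h3
  have hS : (0 : ℝ) < stc q := by exact_mod_cast stc_pos q
  have hM : (0 : ℝ) < stc (pr q z) := by exact_mod_cast stc_pos (pr q z)
  rw [Phi_eq, norm_mul, norm_mul, norm_inv, Complex.norm_natCast, Complex.norm_natCast]
  generalize ((stc q : ℕ) : ℝ) = S at *
  generalize ((stc (pr q z) : ℕ) : ℝ) = M at *
  set a := ‖Aval p q z‖
  have ha : a ^ 4 ≤ A / B := by rw [le_div_iff₀ hB]; exact h2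
  calc (S⁻¹ * (M * a)) ^ 4 * S = M ^ 4 / S ^ 3 * a ^ 4 := by field_simp
    _ ≤ M ^ 4 / S ^ 3 * (A / B) := by gcongr
    _ = M * (M ^ 3 * A) / (S ^ 3 * B) := by field_simp
    _ ≤ M * (S ^ 3 * B) / (S ^ 3 * B) := by gcongr
    _ = M := by field_simp

end count
end McKayGraphs

open scoped BigOperators
namespace McKayGraphs
open Equiv

section comb
variable {κ : Type*} [DecidableEq κ] [Fintype κ]

lemma ext_perm (b : κ → ℕ) (τ : κ → κ) (D : Finset κ) (hinj : ∀ i ∈ D, ∀ j ∈ D, τ i = τ j → i = j)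
    (hb : ∀ i ∈ D, b (τ i) = b i) :
    ∃ σ : Perm κ, (∀ j, b (σ j) = b j) ∧ ∀ i ∈ D, σ (τ i) = i := by
  induction D using Finset.induction_on with
  | empty => exact ⟨1, by simp, by simp⟩
  | insert i D hi ih =>
    obtain ⟨σ, h1, h2⟩ := ih (fun i hi j hj => hinj i (Finset.mem_insert_of_mem hi) j (Finset.mem_insert_of_mem hj))
      (fun i hi => hb i (Finset.mem_insert_of_mem hi))
    have hbi := hb i (Finset.mem_insert_self _ _)
    refine ⟨swap (σ (τ i)) i * σ, fun j => ?_, fun i' hi' => ?_⟩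
    · rw [Perm.mul_apply]
      rw [← h1 j]
      by_cases e1 : σ j = σ (τ i)
      · rw [e1, swap_apply_left, h1, hbi]
      · by_cases e2 : σ j = i
        · rw [e2, swap_apply_right, h1, hbi]
        · rw [swap_apply_of_ne_of_ne e1 e2]
    · rw [Perm.mul_apply]
      rcases Finset.mem_insert.1 hi' with h | h
      · subst h; rw [swap_apply_left]
      · rw [h2 i' h, swap_apply_of_ne_of_ne]
        · intro he
          have : τ i' = τ i := σ.injective (by rw [h2 i' h, ← he])
          have := hinj i' hi' i (Finset.mem_insert_self _ _) this
          exact hi (this ▸ h)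
        · intro he; exact hi (he ▸ h)

/-- isolated pure rows -/
def isoD (e : κ → κ → Prop) : κ → Prop :=
  fun i => ∃ j, e i j ∧ (∀ j', e i j' → j' = j) ∧ ∀ i', e i' j → i' = i

open Classical in
lemma iso_count (e : κ → κ → Prop) (hr : ∀ i, ∃ j, e i j) (hc : ∀ j, ∃ i, e i j) :
    2 * (Finset.univ.filter (fun i => ¬ isoD e i)).card +
      4 * ∑ i ∈ Finset.univ.filter (fun i => ¬ isoD e i), (Finset.univ.filter (e i)).card ≤
      22 * ∑ i, ((Finset.univ.filter (e i)).card - 1) := by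
  set π : κ → ℕ := fun i => (Finset.univ.filter (e i)).card with hπ
  set ρ : κ → ℕ := fun j => (Finset.univ.filter (fun i => e i j)).card with hρ
  have hπ1 : ∀ i, 1 ≤ π i := fun i => Finset.card_pos.2 (by
    obtain ⟨j, hj⟩ := hr i; exact ⟨j, by simpa using hj⟩)
  have hρ1 : ∀ j, 1 ≤ ρ j := fun j => Finset.card_pos.2 (by
    obtain ⟨i, hi⟩ := hc j; exact ⟨i, by simpa using hi⟩)
  have hE : ∑ i, π i = ∑ j, ρ j := by
    simp only [hπ, hρ, Finset.card_filter]
    rw [Finset.sum_comm]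
  set P := ∑ i, (π i - 1) with hP
  have hP1 : P + Fintype.card κ = ∑ i, π i := by
    rw [hP, Fintype.card_eq_sum_ones, ← Finset.sum_add_distrib]
    exact Finset.sum_congr rfl fun i _ => by have := hπ1 i; omega
  have hP2 : ∑ j, (ρ j - 1) = P := by
    have : ∑ j, (ρ j - 1) + Fintype.card κ = ∑ j, ρ j := by
      rw [Fintype.card_eq_sum_ones, ← Finset.sum_add_distrib]
      exact Finset.sum_congr rfl fun i _ => by have := hρ1 i; omega
    omega
  have h1 : ∀ i, ¬ isoD e i → 1 ≤ (π i - 1) + ∑ j, if e i j ∧ 2 ≤ ρ j then 1 else 0 := by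
    intro i hi
    by_contra hlt
    have a1 : π i = 1 := by have := hπ1 i; omega
    have a2 : ∑ j, (if e i j ∧ 2 ≤ ρ j then 1 else 0) = 0 := by omega
    obtain ⟨j, hj⟩ := Finset.card_eq_one.1 a1
    have hej : e i j := by
      have : j ∈ Finset.univ.filter (e i) := by rw [hj]; simp
      simpa using this
    apply hi
    refine ⟨j, hej, fun j' hj' => ?_, fun i' hi' => ?_⟩
    · have : j' ∈ Finset.univ.filter (e i) := by simpa using hj'
      rw [hj] at this; simpa using this
    · have := (Finset.sum_eq_zero_iff.1 a2) j (Finset.mem_univ _)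
      by_contra hne
      have h2 : 2 ≤ ρ j := by
        have : ({i', i} : Finset κ) ⊆ Finset.univ.filter (fun i => e i j) := by
          intro x hx; rcases Finset.mem_insert.1 hx with h | h
          · subst h; simpa using hi'
          · rw [Finset.mem_singleton] at h; subst h; simpa using hej
        have := Finset.card_le_card this
        rwa [Finset.card_pair hne] at this
      rw [if_pos ⟨hej, h2⟩] at this
      exact one_ne_zero this
  have h2 : (Finset.univ.filter (fun i => ¬ isoD e i)).card ≤ 3 * P := by
    calc (Finset.univ.filter (fun i => ¬ isoD e i)).card
        = ∑ i ∈ Finset.univ.filter (fun i => ¬ isoD e i), 1 := by simp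
      _ ≤ ∑ i ∈ Finset.univ.filter (fun i => ¬ isoD e i), ((π i - 1) + ∑ j, if e i j ∧ 2 ≤ ρ j then 1 else 0) :=
          Finset.sum_le_sum fun i hi => h1 i (Finset.mem_filter.1 hi).2
      _ ≤ ∑ i, ((π i - 1) + ∑ j, if e i j ∧ 2 ≤ ρ j then 1 else 0) :=
          Finset.sum_le_sum_of_subset (Finset.subset_univ _)
      _ = P + ∑ j, ∑ i, (if e i j ∧ 2 ≤ ρ j then 1 else 0) := by
          rw [Finset.sum_add_distrib]; congr 1; exact Finset.sum_comm
      _ ≤ P + ∑ j, 2 * (ρ j - 1) := by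
          refine Nat.add_le_add_left (Finset.sum_le_sum fun j _ => ?_) _
          by_cases h : 2 ≤ ρ j
          · have : ∑ i, (if e i j ∧ 2 ≤ ρ j then 1 else 0) = ρ j := by
              refine Eq.trans ?_ (Finset.card_filter (fun i => e i j) Finset.univ).symm
              refine Finset.sum_congr rfl fun i _ => ?_
              by_cases h' : e i j
              · rw [if_pos ⟨h', h⟩, if_pos h']
              · rw [if_neg (fun hh => h' hh.1), if_neg h']
            rw [this]; omega
          · rw [Finset.sum_eq_zero]
            · omega
            · intro i _; rw [if_neg (fun hh => h hh.2)]
      _ = 3 * P := by rw [← Finset.mul_sum, hP2]; ring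
  have h3 : ∑ i ∈ Finset.univ.filter (fun i => ¬ isoD e i), π i ≤ P + (Finset.univ.filter (fun i => ¬ isoD e i)).card := by
    calc ∑ i ∈ Finset.univ.filter (fun i => ¬ isoD e i), π i
        = ∑ i ∈ Finset.univ.filter (fun i => ¬ isoD e i), ((π i - 1) + 1) :=
          Finset.sum_congr rfl fun i _ => by have := hπ1 i; omega
      _ = ∑ i ∈ Finset.univ.filter (fun i => ¬ isoD e i), (π i - 1) + (Finset.univ.filter (fun i => ¬ isoD e i)).card := by
          rw [Finset.sum_add_distrib]; simp
      _ ≤ _ := Nat.add_le_add_right (Finset.sum_le_sum_of_subset (Finset.subset_univ _)) _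
  change 2 * _ + 4 * ∑ i ∈ _, π i ≤ 22 * P
  omega

end comb

section table
variable {X : Type*} [Fintype X] [DecidableEq X] {κ : Type*} [DecidableEq κ] [Fintype κ]

lemma fc_le (u : X → κ) (k : κ) : fc u k ≤ Fintype.card X := Finset.card_le_univ _

/-- number of colors in row i -/
def npi (q z : X → κ) (i : κ) : ℕ := (Finset.univ.filter (fun j => fc (pr q z) (i, j) ≠ 0)).card

/-- table -/
def tb (q z : X → κ) : κ → κ → Fin (Fintype.card X + 1) :=
  fun i j => ⟨fc (pr q z) (i, j), Nat.lt_succ_of_le (Finset.card_le_univ _)⟩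

lemma tb_eq {q z z' : X → κ} : tb q z' = tb q z ↔ ∀ k, fc (pr q z') k = fc (pr q z) k := by
  constructor
  · intro h k
    have := congrArg Fin.val (congrFun (congrFun h k.1) k.2)
    exact this
  · intro h; funext i j; exact Fin.ext (h (i, j))

lemma fc_ne_zero {β : Type*} [DecidableEq β] {u : X → β} {k : β} : fc u k ≠ 0 ↔ ∃ x, u x = k := by
  unfold fc
  rw [← Nat.pos_iff_ne_zero, Finset.card_pos]
  constructor
  · rintro ⟨x, hx⟩; exact ⟨x, by simpa using hx⟩
  · rintro ⟨x, hx⟩; exact ⟨x, by simpa using hx⟩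

lemma tb_self {q z : X → κ} (h : tb q z = tb q q) : z = q := by
  rw [tb_eq] at h
  funext x
  have : fc (pr q z) (q x, z x) ≠ 0 := fc_ne_zero.2 ⟨x, rfl⟩
  rw [h] at this
  obtain ⟨y, hy⟩ := fc_ne_zero.1 this
  have h1 : q y = q x := congrArg Prod.fst hy
  have h2 : q y = z x := congrArg Prod.snd hy
  exact h2.symm.trans h1

/-- weights on rows -/
noncomputable def wt (q : X → κ) (i : κ) (v : κ → Fin (Fintype.card X + 1)) : ℝ :=
  if v = tb q q i then 1 else
    ((Fintype.card X : ℝ) ^ 2)⁻¹ * ∏ j, (if v j = 0 then 1 else ((Fintype.card X : ℝ) ^ 4)⁻¹)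

lemma wt_nonneg (q : X → κ) (i : κ) (v) : 0 ≤ wt q i v := by
  unfold wt
  split_ifs
  · exact zero_le_one
  · refine mul_nonneg (by positivity) (Finset.prod_nonneg fun j _ => ?_)
    split_ifs <;> positivity

lemma wt_sum (q : X → κ) (i : κ) (ha : Fintype.card κ ≤ Fintype.card X) (hn : 1 ≤ Fintype.card X) :
    ∑ v, wt q i v ≤ 1 + 3 * ((Fintype.card X : ℝ) ^ 2)⁻¹ := by
  set n := Fintype.card X with hnn
  have hn' : (1 : ℝ) ≤ n := by exact_mod_cast hn
  have h1 : ∀ v, wt q i v ≤ (if v = tb q q i then 1 else 0) +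
      ((n : ℝ) ^ 2)⁻¹ * ∏ j, (if v j = 0 then 1 else ((n : ℝ) ^ 4)⁻¹) := by
    intro v
    have : 0 ≤ ((n : ℝ) ^ 2)⁻¹ * ∏ j, (if v j = 0 then 1 else ((n : ℝ) ^ 4)⁻¹) := by
      refine mul_nonneg (by positivity) (Finset.prod_nonneg fun j _ => ?_)
      split_ifs <;> positivity
    unfold wt
    split_ifs
    · linarith
    · rw [zero_add]
  have h2 : ∑ v : κ → Fin (n + 1), ∏ j, (if v j = 0 then (1 : ℝ) else ((n : ℝ) ^ 4)⁻¹) ≤ 3 := by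
    rw [← Fintype.piFinset_univ, ← Finset.prod_univ_sum (fun _ => (Finset.univ : Finset (Fin (n + 1))))
      (fun _ v => (if v = 0 then (1 : ℝ) else ((n : ℝ) ^ 4)⁻¹))]
    have e : ∑ v : Fin (n + 1), (if v = 0 then (1 : ℝ) else ((n : ℝ) ^ 4)⁻¹) = 1 + n * ((n : ℝ) ^ 4)⁻¹ := by
      rw [Fin.sum_univ_succ]; simp
    rw [e, Finset.prod_const, Finset.card_univ]
    have e2 : 1 + n * ((n : ℝ) ^ 4)⁻¹ ≤ Real.exp ((n : ℝ)⁻¹) := by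
      have := Real.add_one_le_exp ((n : ℝ)⁻¹)
      have e3 : n * ((n : ℝ) ^ 4)⁻¹ ≤ (n : ℝ)⁻¹ := by
        have : n * ((n : ℝ) ^ 4)⁻¹ = (n : ℝ)⁻¹ * ((n : ℝ) ^ 2)⁻¹ := by field_simp
        rw [this]
        exact mul_le_of_le_one_right (by positivity) (inv_le_one_of_one_le₀ (one_le_pow₀ hn'))
      linarith
    calc (1 + n * ((n : ℝ) ^ 4)⁻¹) ^ Fintype.card κ ≤ (Real.exp ((n : ℝ)⁻¹)) ^ Fintype.card κ :=
          pow_le_pow_left₀ (by positivity) e2 _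
      _ ≤ (Real.exp ((n : ℝ)⁻¹)) ^ n := pow_le_pow_right₀ (Real.one_le_exp (by positivity)) ha
      _ = Real.exp 1 := by rw [← Real.exp_nat_mul, mul_inv_cancel₀ (by positivity)]
      _ ≤ 3 := by have := Real.exp_one_lt_d9; linarith
  calc ∑ v, wt q i v ≤ ∑ v, ((if v = tb q q i then 1 else 0) +
      ((n : ℝ) ^ 2)⁻¹ * ∏ j, (if v j = 0 then 1 else ((n : ℝ) ^ 4)⁻¹)) := Finset.sum_le_sum fun v _ => h1 v
    _ = 1 + ((n : ℝ) ^ 2)⁻¹ * ∑ v : κ → Fin (n + 1), ∏ j, (if v j = 0 then (1 : ℝ) else ((n : ℝ) ^ 4)⁻¹) := by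
        rw [Finset.sum_add_distrib, ← Finset.mul_sum, Finset.sum_ite_eq' Finset.univ (tb q q i), if_pos (Finset.mem_univ _)]
    _ ≤ 1 + ((n : ℝ) ^ 2)⁻¹ * 3 := by gcongr
    _ = _ := by ring

/-- comparison function -/
noncomputable def HH (q z : X → κ) : ℝ := (stc (pr q z) : ℝ) / stc q * ∏ i, wt q i (tb q z i)

lemma HH_nonneg (q z : X → κ) : 0 ≤ HH q z :=
  mul_nonneg (by positivity) (Finset.prod_nonneg fun i _ => wt_nonneg _ _ _)

theorem HH_sum (q : X → κ) (ha : Fintype.card κ ≤ Fintype.card X) (hn : 12 ≤ Fintype.card X) :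
    ∑ z ∈ Finset.univ.filter (fun z : X → κ => z ≠ q), HH q z < 1 := by
  classical
  set S := Finset.univ.filter (fun z : X → κ => z ≠ q) with hS
  have h1 : ∑ z ∈ S, HH q z ≤ ∑ m ∈ S.image (tb q), ∏ i, wt q i (m i) := by
    rw [← Finset.sum_fiberwise_of_maps_to (g := tb q) (t := S.image (tb q)) (fun z hz => Finset.mem_image_of_mem _ hz)]
    refine Finset.sum_le_sum fun m hm => ?_
    obtain ⟨z0, hz0, rfl⟩ := Finset.mem_image.1 hm
    have hw : 0 ≤ ∏ i, wt q i (tb q z0 i) := Finset.prod_nonneg fun i _ => wt_nonneg _ _ _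
    calc ∑ z ∈ S.filter (fun z => tb q z = tb q z0), HH q z
        = ∑ z ∈ S.filter (fun z => tb q z = tb q z0), (stc (pr q z0) : ℝ) / stc q * ∏ i, wt q i (tb q z0 i) := by
          refine Finset.sum_congr rfl fun z hz => ?_
          have hz' := (Finset.mem_filter.1 hz).2
          unfold HH
          rw [hz']
          have : stc (pr q z) = stc (pr q z0) := by
            rw [stc_eq, stc_eq]
            exact Finset.prod_congr rfl fun k _ => by rw [tb_eq.1 hz' k]
          rw [this]
      _ ≤ ∑ z ∈ Finset.univ.filter (fun z => ∀ k, fc (pr q z) k = fc (pr q z0) k),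
            (stc (pr q z0) : ℝ) / stc q * ∏ i, wt q i (tb q z0 i) := by
          refine Finset.sum_le_sum_of_subset_of_nonneg ?_ fun _ _ _ => mul_nonneg (by positivity) hw
          intro z hz
          rw [Finset.mem_filter]
          exact ⟨Finset.mem_univ _, tb_eq.1 (Finset.mem_filter.1 hz).2⟩
      _ = ∏ i, wt q i (tb q z0 i) := by
          rw [Finset.sum_const, nsmul_eq_mul]
          have := orbit_count q z0
          have h' : ((Finset.univ.filter (fun z' : X → κ => ∀ k, fc (pr q z') k = fc (pr q z0) k)).card : ℝ) *
            stc (pr q z0) = stc q := by exact_mod_cast this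
          have hp : (stc q : ℝ) ≠ 0 := by have := stc_pos q; positivity
          rw [← mul_assoc, ← mul_div_assoc, h', div_self hp, one_mul]
  have h2 : S.image (tb q) ⊆ Finset.univ.erase (tb q q) := by
    intro m hm
    obtain ⟨z, hz, rfl⟩ := Finset.mem_image.1 hm
    rw [Finset.mem_erase]
    refine ⟨fun h => (Finset.mem_filter.1 hz).2 (tb_self h), Finset.mem_univ _⟩
  have h3 : ∑ m ∈ Finset.univ.erase (tb q q), ∏ i, wt q i (m i) = (∏ i, ∑ v, wt q i v) - 1 := by
    have e1 : ∏ i, ∑ v, wt q i v = ∑ m : κ → κ → Fin (Fintype.card X + 1), ∏ i, wt q i (m i) := by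
      rw [Finset.prod_univ_sum, Fintype.piFinset_univ]
    have e2 : ∏ i, wt q i (tb q q i) = 1 := Finset.prod_eq_one fun i _ => by unfold wt; rw [if_pos rfl]
    have := Finset.add_sum_erase Finset.univ (fun m : κ → κ → Fin (Fintype.card X + 1) => ∏ i, wt q i (m i)) (Finset.mem_univ (tb q q))
    rw [e1, ← this]; simp only [e2]; ring
  have hn' : (12 : ℝ) ≤ Fintype.card X := by exact_mod_cast hn
  have h4 : ∏ i, ∑ v, wt q i v < 2 := by
    set n : ℝ := (Fintype.card X : ℝ) with hnn
    calc ∏ i, ∑ v, wt q i v ≤ ∏ i : κ, Real.exp (3 * (n ^ 2)⁻¹) := by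
          refine Finset.prod_le_prod (fun i _ => Finset.sum_nonneg fun v _ => wt_nonneg _ _ _) fun i _ => ?_
          refine (wt_sum q i ha (by omega)).trans ?_
          have := Real.add_one_le_exp (3 * (n ^ 2)⁻¹)
          linarith
      _ = Real.exp (3 * (n ^ 2)⁻¹) ^ Fintype.card κ := by simp
      _ ≤ Real.exp (3 * (n ^ 2)⁻¹) ^ Fintype.card X := pow_le_pow_right₀ (Real.one_le_exp (by positivity)) ha
      _ = Real.exp (3 / n) := by
          rw [← Real.exp_nat_mul, ← hnn]; congr 1; field_simp
      _ ≤ Real.exp (1 / 4) := Real.exp_le_exp.2 (by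
          rw [div_le_div_iff₀ (by linarith) (by norm_num)]; linarith)
      _ < 2 := by
          have h := Real.exp_one_lt_d9
          have : Real.exp (1 / 4) ^ 4 = Real.exp 1 := by rw [← Real.exp_nat_mul]; norm_num
          by_contra hge
          push Not at hge
          have : (2 : ℝ) ^ 4 ≤ Real.exp (1 / 4) ^ 4 := pow_le_pow_left₀ (by norm_num) hge 4
          linarith
  have h5 := Finset.sum_le_sum_of_subset_of_nonneg h2
    (f := fun m => ∏ i, wt q i (m i)) fun m _ _ => Finset.prod_nonneg fun i _ => wt_nonneg _ _ _
  linarith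

end table
end McKayGraphs

open scoped BigOperators
namespace McKayGraphs
open Equiv

section ninv
variable {X : Type*} [Fintype X] [DecidableEq X] {κ : Type*} [DecidableEq κ] [Fintype κ]

lemma npi_pos (q z : X → κ) (hb : ∀ i, 1 ≤ fc q i) (i : κ) : 1 ≤ npi q z i := by
  unfold npi
  rw [Nat.one_le_iff_ne_zero, ← Nat.pos_iff_ne_zero, Finset.card_pos]
  obtain ⟨x, hx⟩ := fc_ne_zero.1 (Nat.one_le_iff_ne_zero.1 (hb i))
  exact ⟨z x, by
    rw [Finset.mem_filter]
    exact ⟨Finset.mem_univ _, fc_ne_zero.2 ⟨x, Prod.ext hx rfl⟩⟩⟩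

lemma SR_bound (q z : X → κ) (hb : ∀ i, 1 ≤ fc q i) (hn : ∀ i, Fintype.card X ≤ (fc q i) ^ 4) :
    (Fintype.card X) ^ (∑ i, (npi q z i - 1)) * (stc (pr q z)) ^ 8 ≤ (stc q) ^ 8 := by
  rw [stc_eq, stc_eq, Fintype.prod_prod_type, ← Finset.prod_pow_eq_pow_sum, ← Finset.prod_pow,
    ← Finset.prod_pow, ← Finset.prod_mul_distrib]
  refine Finset.prod_le_prod' fun i _ => ?_
  have h := multi_lower (fun j => fc (pr q z) (i, j)) (by rw [← sum_row]; exact hb i)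
  rw [← sum_row] at h
  have h' := Nat.pow_le_pow_left h 4
  calc (Fintype.card X) ^ (npi q z i - 1) * (∏ j, (fc (pr q z) (i, j)).factorial) ^ 8
      ≤ ((fc q i) ^ 4) ^ (npi q z i - 1) * (∏ j, (fc (pr q z) (i, j)).factorial) ^ 8 :=
        Nat.mul_le_mul_right _ (Nat.pow_le_pow_left (hn i) _)
    _ = ((fc q i) ^ (npi q z i - 1) * (∏ j, (fc (pr q z) (i, j)).factorial) ^ 2) ^ 4 := by
        rw [mul_pow, ← pow_mul, ← pow_mul, ← pow_mul]; congr 2; ring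
    _ ≤ _ := h'
    _ = _ := by rw [← pow_mul]

lemma stc_pr_le (q z : X → κ) : stc (pr q z) ≤ stc q := by
  have := orbit_count q z
  have hp := stc_pos q
  rcases Nat.eq_zero_or_pos (Finset.univ.filter (fun z' : X → κ => ∀ k, fc (pr q z') k = fc (pr q z) k)).card with h | h
  · rw [h, zero_mul] at this; omega
  · rw [← this]; exact Nat.le_mul_of_pos_left _ h

lemma Phi_pow (p : X → ℕ) (q z : X → κ) (hJ : ∀ x y, p x = p y → q x = q y → x = y)
    (hb : ∀ i, 12 ≤ fc q i) (hn : ∀ i, Fintype.card X ≤ (fc q i) ^ 4) (hX : 1 ≤ Fintype.card X) :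
    ‖Phi p q z‖ ^ 708 ≤ (stc (pr q z) : ℝ) / stc q *
      ((Fintype.card X : ℝ) ^ (22 * ∑ i, (npi q z i - 1)))⁻¹ := by
  have h1 := Phi_le p q z hJ hb
  have h2 : ((Fintype.card X : ℕ) : ℝ) ^ (∑ i, (npi q z i - 1)) * (stc (pr q z) : ℝ) ^ 8 ≤ (stc q : ℝ) ^ 8 := by
    exact_mod_cast SR_bound q z (fun i => by have := hb i; omega) hn
  have hq : (0 : ℝ) < stc q := by exact_mod_cast stc_pos q
  have hm : (0 : ℝ) < stc (pr q z) := by exact_mod_cast stc_pos (pr q z)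
  have hX' : (0 : ℝ) < Fintype.card X := by exact_mod_cast hX
  generalize ((stc q : ℕ) : ℝ) = S at *
  generalize ((stc (pr q z) : ℕ) : ℝ) = M at *
  generalize ((Fintype.card X : ℕ) : ℝ) = n at *
  generalize ∑ i, (npi q z i - 1) = P at *
  have h3 : ‖Phi p q z‖ ^ 4 ≤ M / S := by rw [le_div_iff₀ hq]; exact h1
  have h4 : (M / S) ^ 8 ≤ (n ^ P)⁻¹ := by
    rw [div_pow, div_le_iff₀ (by positivity), inv_mul_eq_div, le_div_iff₀ (by positivity), mul_comm]
    exact h2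
  calc ‖Phi p q z‖ ^ 708 = (‖Phi p q z‖ ^ 4) ^ 177 := by rw [← pow_mul]
    _ ≤ (M / S) ^ 177 := pow_le_pow_left₀ (by positivity) h3 _
    _ = (M / S) * ((M / S) ^ 8) ^ 22 := by rw [← pow_mul]; ring
    _ ≤ (M / S) * ((n ^ P)⁻¹) ^ 22 := by
        refine mul_le_mul_of_nonneg_left (pow_le_pow_left₀ (by positivity) h4 _) (by positivity)
    _ = _ := by rw [inv_pow, ← pow_mul, mul_comm P]

lemma fc_pr_sigma (q z : X → κ) (σ : Perm κ) (i j : κ) :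
    fc (pr q (σ ∘ z)) (i, σ j) = fc (pr q z) (i, j) := by
  unfold fc
  congr 1
  ext x
  simp [pr]

lemma stc_pr_sigma (q z : X → κ) (σ : Perm κ) : stc (pr q (σ ∘ z)) = stc (pr q z) := by
  unfold stc
  congr 1
  ext r
  simp only [Finset.mem_filter, Finset.mem_univ, true_and, pr_comp]
  refine and_congr_right fun _ => ?_
  constructor
  · intro h; funext x; exact σ.injective (congrFun h x)
  · intro h; rw [Function.comp_assoc, h]

lemma wt_ge (q z : X → κ) (i : κ) (hX : 1 ≤ Fintype.card X) (σ : Perm κ) :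
    ((Fintype.card X : ℝ) ^ (2 + 4 * npi q z i))⁻¹ ≤ wt q i (tb q (σ ∘ z) i) := by
  have hX' : (1 : ℝ) ≤ Fintype.card X := by exact_mod_cast hX
  unfold wt
  split_ifs with h
  · exact inv_le_one_of_one_le₀ (one_le_pow₀ hX')
  · have e : ∏ j, (if tb q (σ ∘ z) i j = 0 then 1 else ((Fintype.card X : ℝ) ^ 4)⁻¹) =
        (((Fintype.card X : ℝ) ^ 4)⁻¹) ^ npi q z i := by
      rw [← Equiv.prod_comp σ]
      have : ∀ j, (if tb q (σ ∘ z) i (σ j) = 0 then 1 else ((Fintype.card X : ℝ) ^ 4)⁻¹) =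
          (if fc (pr q z) (i, j) ≠ 0 then ((Fintype.card X : ℝ) ^ 4)⁻¹ else 1) := by
        intro j
        have : tb q (σ ∘ z) i (σ j) = 0 ↔ fc (pr q z) (i, j) = 0 := by
          rw [← fc_pr_sigma q z σ, Fin.ext_iff]; rfl
        by_cases h : fc (pr q z) (i, j) = 0
        · rw [if_pos (this.2 h), if_neg (not_not.2 h)]
        · rw [if_neg (fun hh => h (this.1 hh)), if_pos h]
      simp only [this]
      rw [Finset.prod_ite, Finset.prod_const, Finset.prod_const_one, mul_one]
      rfl
    rw [e, pow_add, mul_inv, pow_mul, inv_pow]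

lemma fc_pr_self (q : X → κ) (i j : κ) : fc (pr q q) (i, j) = if j = i then fc q i else 0 := by
  split_ifs with h
  · subst h; unfold fc; congr 1; ext x; simp [pr]
  · by_contra hne
    obtain ⟨x, hx⟩ := fc_ne_zero.1 hne
    exact h ((congrArg Prod.snd hx).symm.trans (congrArg Prod.fst hx))

theorem Phi_HH (p : X → ℕ) (q z : X → κ) (hJ : ∀ x y, p x = p y → q x = q y → x = y)
    (hb : ∀ i, 12 ≤ fc q i) (hn : ∀ i, Fintype.card X ≤ (fc q i) ^ 4) (hX : 1 ≤ Fintype.card X)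
    (hz : ∀ k, fc z k = fc q k) :
    ∃ σ : Perm κ, (∀ j, fc q (σ j) = fc q j) ∧ ‖Phi p q z‖ ^ 708 ≤ HH q (σ ∘ z) := by
  classical
  have hX' : (1 : ℝ) ≤ Fintype.card X := by exact_mod_cast hX
  set e : κ → κ → Prop := fun i j => fc (pr q z) (i, j) ≠ 0 with he
  have hr : ∀ i, ∃ j, e i j := by
    intro i
    obtain ⟨x, hx⟩ := fc_ne_zero.1 (show fc q i ≠ 0 by have := hb i; omega)
    exact ⟨z x, fc_ne_zero.2 ⟨x, Prod.ext hx rfl⟩⟩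
  have hc : ∀ j, ∃ i, e i j := by
    intro j
    obtain ⟨x, hx⟩ := fc_ne_zero.1 (show fc z j ≠ 0 by have := hb j; rw [hz]; omega)
    exact ⟨q x, fc_ne_zero.2 ⟨x, Prod.ext rfl hx⟩⟩
  set D := Finset.univ.filter (fun i => isoD e i) with hD
  have hτ' : ∀ i, ∃ j, isoD e i → e i j ∧ (∀ j', e i j' → j' = j) ∧ ∀ i', e i' j → i' = i := by
    intro i
    by_cases h : isoD e i
    · obtain ⟨j, hj⟩ := h; exact ⟨j, fun _ => hj⟩
    · exact ⟨i, fun h' => absurd h' h⟩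
  choose τ hτ using hτ'
  have hrow : ∀ i, isoD e i → fc (pr q z) (i, τ i) = fc q i := by
    intro i hi
    rw [sum_row q z i, Finset.sum_eq_single (τ i)]
    · intro j _ hj
      by_contra hne
      exact hj ((hτ i hi).2.1 j hne)
    · intro h; exact absurd (Finset.mem_univ _) h
  have hcol : ∀ i, isoD e i → fc (pr q z) (i, τ i) = fc z (τ i) := by
    intro i hi
    rw [sum_col q z (τ i), Finset.sum_eq_single i]
    · intro j _ hj
      by_contra hne
      exact hj ((hτ i hi).2.2 j hne)
    · intro h; exact absurd (Finset.mem_univ _) h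
  obtain ⟨σ, hσ1, hσ2⟩ := ext_perm (fc q) τ D (by
    intro i hi j hj hij
    have hi := (Finset.mem_filter.1 hi).2
    have hj := (Finset.mem_filter.1 hj).2
    exact (hτ j hj).2.2 i (hij ▸ (hτ i hi).1)) (by
    intro i hi
    have hi := (Finset.mem_filter.1 hi).2
    rw [← hz, ← hcol i hi, hrow i hi])
  refine ⟨σ, hσ1, (Phi_pow p q z hJ hb hn hX).trans ?_⟩
  unfold HH
  rw [stc_pr_sigma]
  refine mul_le_mul_of_nonneg_left ?_ (by positivity)
  have hw : ∀ i, isoD e i → wt q i (tb q (σ ∘ z) i) = 1 := by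
    intro i hi
    unfold wt
    rw [if_pos]
    funext j
    apply Fin.ext
    change fc (pr q (σ ∘ z)) (i, j) = fc (pr q q) (i, j)
    obtain ⟨j', rfl⟩ := σ.surjective j
    rw [fc_pr_sigma, fc_pr_self]
    have hs := hσ2 i (Finset.mem_filter.2 ⟨Finset.mem_univ _, hi⟩)
    by_cases h : j' = τ i
    · subst h; rw [if_pos hs, hrow i hi]
    · rw [if_neg]
      · by_contra hne; exact h ((hτ i hi).2.1 j' hne)
      · intro h'; rw [← hs] at h'; exact h (σ.injective h')
  have hnpi : ∀ i (inst : DecidablePred (e i)), (@Finset.filter _ (e i) inst Finset.univ).card = npi q z i :=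
    fun i inst => by
      unfold npi; congr 1; ext j; simp [he]
  have hcnt : 2 * (Finset.univ.filter (fun i => ¬ isoD e i)).card +
      4 * ∑ i ∈ Finset.univ.filter (fun i => ¬ isoD e i), npi q z i ≤ 22 * ∑ i, (npi q z i - 1) := by
    have := iso_count e hr hc
    simp only [hnpi] at this
    exact this
  calc ((Fintype.card X : ℝ) ^ (22 * ∑ i, (npi q z i - 1)))⁻¹
      ≤ ((Fintype.card X : ℝ) ^ (∑ i ∈ Finset.univ.filter (fun i => ¬ isoD e i), (2 + 4 * npi q z i)))⁻¹ := by
        refine inv_anti₀ (by positivity) (pow_le_pow_right₀ hX' ?_)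
        rw [Finset.sum_add_distrib, ← Finset.mul_sum, Finset.sum_const, smul_eq_mul, mul_comm _ 2]
        exact hcnt
    _ = ∏ i ∈ Finset.univ.filter (fun i => ¬ isoD e i), ((Fintype.card X : ℝ) ^ (2 + 4 * npi q z i))⁻¹ := by
        rw [Finset.prod_inv_distrib, Finset.prod_pow_eq_pow_sum]
    _ ≤ ∏ i ∈ Finset.univ.filter (fun i => ¬ isoD e i), wt q i (tb q (σ ∘ z) i) :=
        Finset.prod_le_prod (fun i _ => by positivity) fun i _ => wt_ge q z i hX σ
    _ = ∏ i, wt q i (tb q (σ ∘ z) i) := by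
        refine Finset.prod_subset (Finset.subset_univ _) fun i _ hi => hw i ?_
        by_contra h; exact hi (Finset.mem_filter.2 ⟨Finset.mem_univ _, h⟩)

/-- the block group -/
def NN (q : X → κ) : Subgroup (Perm X) where
  carrier := {g | ∃ σ : Perm κ, q ∘ g = σ ∘ q}
  mul_mem' := by
    rintro g h ⟨σ, hσ⟩ ⟨τ, hτ⟩
    refine ⟨σ * τ, ?_⟩
    funext x
    have h1 := congrFun hσ (h x)
    have h2 := congrFun hτ x
    simp only [Function.comp_apply] at h1 h2
    simp [h1, h2]
  one_mem' := ⟨1, rfl⟩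
  inv_mem' := by
    rintro g ⟨σ, hσ⟩
    refine ⟨σ⁻¹, ?_⟩
    funext x
    have h1 := congrFun hσ (g⁻¹ x)
    simp only [Function.comp_apply, ais] at h1
    simp [h1]

lemma sig_fc {q : X → κ} {g : Perm X} {σ : Perm κ} (h : q ∘ g = σ ∘ q) (j : κ) : fc q (σ j) = fc q j := by
  rw [← fc_comp q g (σ j), h]
  unfold fc; congr 1; ext x; simp

theorem sum_off (p : X → ℕ) (q : X → κ) (hJ : ∀ x y, p x = p y → q x = q y → x = y)
    (hb : ∀ i, 12 ≤ fc q i) (hn : ∀ i, Fintype.card X ≤ (fc q i) ^ 4) (hX : 12 ≤ Fintype.card X)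
    [DecidablePred (· ∈ NN q)] :
    ∑ g : Perm X, (if g ∈ NN q then 0 else ‖Phi p q (q ∘ ⇑g⁻¹)‖ ^ 708) <
      ((Finset.univ.filter (· ∈ NN q)).card : ℝ) := by
  have hsurj : ∀ i, ∃ x, q x = i := fun i => fc_ne_zero.1 (by have := hb i; omega)
  have ha : Fintype.card κ ≤ Fintype.card X := Fintype.card_le_of_surjective q hsurj
  set Sg : Finset (Perm κ) := Finset.univ.filter (fun σ => ∀ j, fc q (σ j) = fc q j) with hSg
  have h1 : ∀ g : Perm X, (if g ∈ NN q then 0 else ‖Phi p q (q ∘ ⇑g⁻¹)‖ ^ 708) ≤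
      ∑ σ ∈ Sg, (if g ∈ NN q then 0 else HH q (σ ∘ (q ∘ ⇑g⁻¹))) := by
    intro g
    by_cases h : g ∈ NN q
    · simp [h]
    · simp only [if_neg h]
      obtain ⟨σ, hs, hle⟩ := Phi_HH p q (q ∘ ⇑g⁻¹) hJ hb hn (by omega) (fun k => fc_comp q g⁻¹ k)
      exact hle.trans (Finset.single_le_sum (f := fun σ : Perm κ => HH q (σ ∘ (q ∘ ⇑g⁻¹)))
        (fun _ _ => HH_nonneg _ _) (Finset.mem_filter.2 ⟨Finset.mem_univ _, hs⟩))
  have hsg : ∀ σ ∈ Sg, ∃ ν : Perm X, q ∘ ν = σ ∘ q := by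
    intro σ hσ
    rw [ex_iff]
    intro k
    obtain ⟨j, rfl⟩ := σ.surjective k
    rw [(Finset.mem_filter.1 hσ).2 j]
    unfold fc; congr 1; ext x; simp
  set T : ℝ := ∑ z ∈ Finset.univ.filter (fun z : X → κ => z ≠ q), HH q z with hT
  have hT1 : T < 1 := HH_sum q ha hX
  have hq : (0 : ℝ) < stc q := by exact_mod_cast stc_pos q
  have h2 : ∑ g : Perm X, (if q ∘ ⇑g⁻¹ = q then 0 else HH q (q ∘ ⇑g⁻¹)) ≤ stc q * T := by
    rw [← Equiv.sum_comp (Equiv.inv (Perm X))]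
    simp only [Equiv.inv_apply, inv_inv]
    rw [← Finset.sum_fiberwise_of_maps_to (g := fun g : Perm X => q ∘ ⇑g) (t := Finset.univ)
      (fun _ _ => Finset.mem_univ _), hT, Finset.mul_sum, Finset.sum_filter]
    refine Finset.sum_le_sum fun z _ => ?_
    by_cases hz : z = q
    · rw [if_neg (not_not.2 hz), Finset.sum_eq_zero]
      intro g hg
      rw [if_pos ((Finset.mem_filter.1 hg).2.trans hz)]
    · rw [if_pos hz]
      calc ∑ g ∈ Finset.univ.filter (fun g : Perm X => q ∘ ⇑g = z), (if q ∘ ⇑g = q then 0 else HH q (q ∘ ⇑g))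
          = ∑ g ∈ Finset.univ.filter (fun g : Perm X => q ∘ ⇑g = z), HH q z := by
            refine Finset.sum_congr rfl fun g hg => ?_
            have := (Finset.mem_filter.1 hg).2
            rw [this, if_neg hz]
        _ = ((Finset.univ.filter (fun g : Perm X => q ∘ ⇑g = z)).card : ℝ) * HH q z := by
            rw [Finset.sum_const, nsmul_eq_mul]
        _ ≤ stc q * HH q z := by
            refine mul_le_mul_of_nonneg_right ?_ (HH_nonneg _ _)
            rw [cnt]; split_ifs
            · exact le_rfl
            · simp
  have h3 : ∀ σ ∈ Sg, ∑ g : Perm X, (if g ∈ NN q then 0 else HH q (σ ∘ (q ∘ ⇑g⁻¹))) ≤ stc q * T := by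
    intro σ hσ
    obtain ⟨ν, hν⟩ := hsg σ hσ
    refine le_trans ?_ h2
    obtain ⟨V, hV⟩ : ∃ V : Perm X → ℝ, V = fun g : Perm X => (if q ∘ ⇑g⁻¹ = q then 0 else HH q (q ∘ ⇑g⁻¹)) := ⟨_, rfl⟩
    have hV0 : ∀ g : Perm X, 0 ≤ V g := fun g => by
      rw [hV]; dsimp only; split_ifs
      · exact le_rfl
      · exact HH_nonneg _ _
    have hV1 : ∀ g : Perm X, q ∘ ⇑g⁻¹ ≠ q → V g = HH q (q ∘ ⇑g⁻¹) :=
      fun g h => by rw [hV]; exact if_neg h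
    have hV2 : ∑ g : Perm X, (if q ∘ ⇑g⁻¹ = q then 0 else HH q (q ∘ ⇑g⁻¹)) = ∑ g, V g := by rw [hV]
    rw [hV2]
    rw [← Equiv.sum_comp (Equiv.mulRight ν⁻¹) V]
    refine Finset.sum_le_sum fun g _ => ?_
    have e : q ∘ ⇑(g * ν⁻¹)⁻¹ = σ ∘ (q ∘ ⇑g⁻¹) := by
      rw [mul_inv_rev, inv_inv, ← Function.comp_assoc, ← hν]; rfl
    simp only [Equiv.coe_mulRight]
    by_cases hg : g ∈ NN q
    · rw [if_pos hg]; exact hV0 _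
    · rw [if_neg hg, hV1, e]
      rw [e]
      intro h
      apply hg
      rw [← inv_mem_iff]
      refine ⟨σ⁻¹, ?_⟩
      funext x
      have := congrFun h x
      simp only [Function.comp_apply] at this ⊢
      rw [← this, ias]
  have h4 : (Sg.card : ℝ) * stc q ≤ ((Finset.univ.filter (· ∈ NN q)).card : ℝ) := by
    have : Sg.card * stc q ≤ (Finset.univ.filter (· ∈ NN q)).card := by
      calc Sg.card * stc q = ∑ σ ∈ Sg, (Finset.univ.filter (fun r : Perm X => q ∘ r = σ ∘ q)).card := by
            rw [Finset.sum_congr rfl (fun σ hσ => by rw [cnt, if_pos (hsg σ hσ)]), Finset.sum_const, smul_eq_mul]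
        _ = (Sg.biUnion (fun σ => Finset.univ.filter (fun r : Perm X => q ∘ r = σ ∘ q))).card := by
            rw [Finset.card_biUnion]
            intro σ _ τ _ hne
            change Disjoint _ _
            rw [Finset.disjoint_left]
            intro r hr hr'
            apply hne
            have a := (Finset.mem_filter.1 hr).2
            have b := (Finset.mem_filter.1 hr').2
            ext i
            obtain ⟨x, rfl⟩ := hsurj i
            exact congrFun (a.symm.trans b) x
        _ ≤ _ := by
            refine Finset.card_le_card fun r hr => ?_
            obtain ⟨σ, _, hσ⟩ := Finset.mem_biUnion.1 hr
            exact Finset.mem_filter.2 ⟨Finset.mem_univ _, σ, (Finset.mem_filter.1 hσ).2⟩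
    exact_mod_cast this
  have h5 : 0 < (Sg.card : ℝ) := by
    have : 0 < Sg.card := Finset.card_pos.2 ⟨1, Finset.mem_filter.2 ⟨Finset.mem_univ _, fun j => rfl⟩⟩
    exact_mod_cast this
  calc _ ≤ ∑ g : Perm X, ∑ σ ∈ Sg, (if g ∈ NN q then 0 else HH q (σ ∘ (q ∘ ⇑g⁻¹))) := Finset.sum_le_sum fun g _ => h1 g
    _ = ∑ σ ∈ Sg, ∑ g : Perm X, (if g ∈ NN q then 0 else HH q (σ ∘ (q ∘ ⇑g⁻¹))) := Finset.sum_comm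
    _ ≤ ∑ σ ∈ Sg, stc q * T := Finset.sum_le_sum h3
    _ = Sg.card * (stc q * T) := by rw [Finset.sum_const, nsmul_eq_mul]
    _ < Sg.card * (stc q * 1) := by gcongr
    _ ≤ _ := by rw [mul_one]; exact h4

end ninv
end McKayGraphs

open scoped BigOperators
namespace McKayGraphs
open Equiv

section main4
variable {X : Type*} [Fintype X] [DecidableEq X]

/-- averaged function -/
noncomputable def phi (p q : X → ℕ) (g : Perm X) : ℂ :=
  (stc q : ℂ)⁻¹ * ∑ r : Perm X, if q ∘ r = q then fT p q (r⁻¹ * g) else 0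

lemma phi_mem (p q : X → ℕ) : phi p q ∈ tr (fT p q) := by
  have : phi p q = (stc q : ℂ)⁻¹ • ∑ r : Perm X, (if q ∘ r = q then (1 : ℂ) else 0) • tl r⁻¹ 1 (fT p q) := by
    funext g
    simp only [phi, Pi.smul_apply, Finset.sum_apply, smul_eq_mul, tl_apply, mul_one]
    congr 1
    refine Finset.sum_congr rfl fun r _ => ?_
    split_ifs <;> simp
  rw [this]
  refine Submodule.smul_mem _ _ (Submodule.sum_mem _ fun r _ => Submodule.smul_mem _ _ ?_)
  exact Submodule.subset_span ⟨(r⁻¹, 1), rfl⟩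

lemma phi_one {p q : X → ℕ} (hJ : JI p q) : phi p q 1 = 1 := by
  unfold phi
  have : ∀ r : Perm X, (if q ∘ r = q then fT p q (r⁻¹ * 1) else 0) = if q ∘ r = q then 1 else 0 := by
    intro r
    by_cases h : q ∘ r = q
    · rw [if_pos h, if_pos h]
      have := fT_right (p := p) (comp_inv_of h) 1
      rw [one_mul] at this
      rw [mul_one, this, fT_one hJ]
    · rw [if_neg h, if_neg h]
  rw [Finset.sum_congr rfl (fun r _ => this r), Finset.sum_boole]
  have : ((Finset.univ.filter (fun r : Perm X => q ∘ r = q)).card : ℂ) = stc q := rfl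
  rw [this, inv_mul_cancel₀]
  have := stc_pos q
  exact_mod_cast this.ne'

lemma phi_left {p q : X → ℕ} (hT : YT p q) {σ : ℕ → ℕ} (hσi : ∀ x y, σ (q x) = σ (q y) → q x = q y)
    (hσ : ∀ x, rl q (σ (q x)) = rl q (q x)) {n : Perm X} (hn : q ∘ n = σ ∘ q) (g : Perm X) :
    ∃ s : ℂ, s * s = 1 ∧ phi p q (n * g) = s * phi p q g := by
  have h1 : ∀ x, ∃ y, q y = σ (q x) ∧ p y = p x := fun x =>
    hT.exists_cell (by rw [hσ]; exact hT.col_lt x)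
  choose m hm1 hm2 using h1
  have hinj : Function.Injective m := by
    intro x y hxy
    refine hT.1 x y ?_ (hσi x y ?_)
    · rw [← hm2 x, ← hm2 y, hxy]
    · rw [← hm1 x, ← hm1 y, hxy]
  set n0 : Perm X := Equiv.ofBijective m (Finite.injective_iff_bijective.1 hinj) with hn0
  have e1 : p ∘ n0 = p := funext hm2
  have e2 : q ∘ n0 = σ ∘ q := funext hm1
  refine ⟨sg n0, sg_sq n0, ?_⟩
  unfold phi
  rw [mul_left_comm]
  congr 1
  rw [Finset.mul_sum]
  symm
  refine Fintype.sum_equiv ((Equiv.mulLeft n).trans (Equiv.mulRight n0⁻¹)) _ _ fun r => ?_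
  have hiff : q ∘ ⇑(n * r * n0⁻¹) = q ↔ q ∘ ⇑r = q := by
    constructor
    · intro h
      funext x
      have a := congrFun h (n0 x)
      have b := congrFun hn (r x)
      have c := congrFun e2 x
      simp only [Function.comp_apply, Perm.mul_apply, ias] at a b c
      exact hσi _ _ (b.symm.trans (a.trans c))
    · intro h
      funext x
      have b := congrFun hn (r (n0⁻¹ x))
      have c := congrFun e2 (n0⁻¹ x)
      have d := congrFun h (n0⁻¹ x)
      simp only [Function.comp_apply, Perm.mul_apply, ais] at b c d ⊢
      rw [b, d, ← c]
  change _ = if q ∘ ⇑(n * r * n0⁻¹) = q then fT p q ((n * r * n0⁻¹)⁻¹ * (n * g)) else 0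
  by_cases h : q ∘ ⇑r = q
  · rw [if_pos h, if_pos (hiff.2 h), ← fT_left e1]
    congr 1; group
  · rw [if_neg h, if_neg (fun hh => h (hiff.1 hh)), mul_zero]

/-- block-preserving permutations -/
def Bl (q : X → ℕ) (g : Perm X) : Prop := ∀ x y, q x = q y ↔ q (g x) = q (g y)

open Classical in
theorem block_mem {p q : X → ℕ} (hT : YT p q) (hX : 12 ≤ Fintype.card X) (hb : ∀ x, 12 ≤ rl q (q x))
    (hn : ∀ x, Fintype.card X ≤ (rl q (q x)) ^ 4) :
    (fun g : Perm X => if Bl q g then (1 : ℂ) else 0) ∈ (tr (fT p q)) ^ 708 := by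
  let κ := {i // i ∈ Finset.univ.image q}
  letI : Fintype κ := inferInstanceAs (Fintype {i // i ∈ Finset.univ.image q})
  let qf : X → κ := fun x => ⟨q x, Finset.mem_image_of_mem _ (Finset.mem_univ _)⟩
  have hqf : ∀ x y, qf x = qf y ↔ q x = q y := fun x y => Subtype.ext_iff
  have hqc : ∀ (u v : X → X), qf ∘ u = qf ∘ v ↔ q ∘ u = q ∘ v := by
    intro u v
    constructor
    · intro h; funext x; exact (hqf _ _).1 (congrFun h x)
    · intro h; funext x; exact (hqf _ _).2 (congrFun h x)
  have hsurj : ∀ i : κ, ∃ x, qf x = i := by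
    rintro ⟨i, hi⟩
    obtain ⟨x, _, hx⟩ := Finset.mem_image.1 hi
    exact ⟨x, Subtype.ext hx⟩
  have hfc : ∀ i : κ, fc qf i = rl q i.1 := by
    intro i
    unfold fc rl cl
    congr 1
    ext x
    simp only [Finset.mem_filter, Finset.mem_univ, true_and]
    exact Subtype.ext_iff
  have hb' : ∀ i, 12 ≤ fc qf i := by
    intro i; obtain ⟨x, rfl⟩ := hsurj i; rw [hfc]; exact hb x
  have hn' : ∀ i, Fintype.card X ≤ (fc qf i) ^ 4 := by
    intro i; obtain ⟨x, rfl⟩ := hsurj i; rw [hfc]; exact hn x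
  have hstc : stc qf = stc q := by
    unfold stc; congr 1; ext r
    simp only [Finset.mem_filter, Finset.mem_univ, true_and]
    exact hqc r id
  have hphi : ∀ g, phi p q g = Phi p qf (qf ∘ ⇑g⁻¹) := by
    intro g
    unfold phi Phi
    rw [hstc]
    congr 1
    refine Finset.sum_congr rfl fun r _ => ?_
    have : (q ∘ r = q) ↔ (qf ∘ r = qf) := (hqc r id).symm
    by_cases h : q ∘ r = q
    · rw [if_pos h, if_pos (this.1 h)]
      unfold fT Th
      refine Finset.sum_congr rfl fun c _ => ?_
      have : (p ∘ c = p ∧ (q ∘ ⇑(r⁻¹ * g)⁻¹) ∘ c = q) ↔ (p ∘ c = p ∧ ((qf ∘ ⇑g⁻¹) ∘ r) ∘ c = qf) := by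
        rw [mul_inv_rev, inv_inv]
        exact and_congr_right fun _ => (hqc (fun x => g⁻¹ (r (c x))) id).symm
      by_cases h' : (p ∘ c = p ∧ (q ∘ ⇑(r⁻¹ * g)⁻¹) ∘ c = q)
      · rw [if_pos h', if_pos (this.1 h')]
      · rw [if_neg h', if_neg (fun hh => h' (this.2 hh))]
    · rw [if_neg h, if_neg (fun hh => h (this.2 hh))]
  have hmem : ∀ g, g ∈ NN qf ↔ Bl q g := by
    intro g
    constructor
    · rintro ⟨σ, hσ⟩ x y
      have a := congrFun hσ x
      have b := congrFun hσ y
      simp only [Function.comp_apply] at a b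
      rw [← hqf, ← hqf, a, b, σ.injective.eq_iff]
    · intro h
      choose s hs using hsurj
      have hinj : Function.Injective (fun i => qf (g (s i))) := by
        intro i j hij
        have := (h (s i) (s j)).2 ((hqf _ _).1 hij)
        rw [← hs i, ← hs j]; exact (hqf _ _).2 this
      refine ⟨Equiv.ofBijective _ (Finite.injective_iff_bijective.1 hinj), funext fun x => ?_⟩
      change qf (g x) = qf (g (s (qf x)))
      exact (hqf _ _).2 ((h _ _).1 ((hqf _ _).1 (hs (qf x)).symm))
  have hinv : ∀ n ∈ NN qf, ∀ g, (phi p q (n * g)) ^ 708 = (phi p q g) ^ 708 := by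
    rintro n ⟨σ, hσ⟩ g
    let σ' : ℕ → ℕ := fun i => if h : i ∈ Finset.univ.image q then (σ ⟨i, h⟩).1 else i
    have hσ' : ∀ x, σ' (q x) = (σ (qf x)).1 := fun x =>
      dif_pos (Finset.mem_image_of_mem _ (Finset.mem_univ _))
    obtain ⟨s, hs, he⟩ := phi_left (σ := σ') hT (n := n) (by
      intro x y hxy
      rw [hσ', hσ'] at hxy
      exact (hqf _ _).1 (σ.injective (Subtype.ext hxy))) (by
      intro x
      rw [hσ', ← hfc, sig_fc hσ, hfc]) (by
      funext x
      have := congrFun hσ x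
      simp only [Function.comp_apply] at this ⊢
      rw [hσ', ← this]) g
    rw [he, mul_pow]
    have : s ^ 708 = 1 := by
      have : s ^ 708 = (s * s) ^ 354 := by rw [← pow_two, ← pow_mul]
      rw [this, hs, one_pow]
    rw [this, one_mul]
  have hsum := sum_off p qf (fun x y h1 h2 => hT.1 x y h1 ((hqf _ _).1 h2)) hb' hn' hX
  have hfin := diag_dom (NN qf) ((phi p q) ^ 708) (fun n hn g => hinv n hn g)
    (by simp only [Pi.pow_apply, phi_one hT.1, one_pow]) (by
      convert hsum using 2 with g
      by_cases h : g ∈ NN qf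
      · rw [if_pos h, if_pos h]
      · rw [if_neg h, if_neg h, Pi.pow_apply, norm_pow, hphi]) ((tr_biInv (fT p q)).pow 708)
    (pow_mem_pow' (phi_mem p q))
  convert hfin using 3 with g
  exact (hmem g).symm

end main4
end McKayGraphs

open scoped BigOperators
namespace McKayGraphs
open Equiv

section rows
variable {X : Type*} [Fintype X] [DecidableEq X]

lemma Bl_conj {q : X → ℕ} {h g : Perm X} : Bl q (h * g * h⁻¹) ↔ Bl (q ∘ h) g := by
  constructor
  · intro H x y
    have := H (h x) (h y)
    simpa only [Perm.mul_apply, ias, Function.comp_apply] using this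
  · intro H x y
    have := H (h⁻¹ x) (h⁻¹ y)
    simpa only [Perm.mul_apply, ais, Function.comp_apply] using this

lemma YT.exists_rot {p q : X → ℕ} (hT : YT p q) [Nonempty X] : ∃ (M : ℕ) (h : Perm X), (∀ x, q x ≤ M) ∧
    (∀ x, p x ≠ 0 → q (h x) = q x) ∧ (∀ x, p x = 0 → q (h x) = if q x = 0 then M else q x - 1) := by
  obtain ⟨xM, hxM⟩ := Finite.exists_max q
  have h1 : ∀ x, ∃ y, q y = (if p x = 0 then (if q x = 0 then q xM else q x - 1) else q x) ∧ p y = p x := by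
    intro x
    by_cases hp : p x = 0
    · by_cases hq : q x = 0
      · obtain ⟨y, a, b⟩ := hT.2 xM (q xM) 0 le_rfl (Nat.zero_le _)
        exact ⟨y, by rw [if_pos hp, if_pos hq, a], by rw [b, hp]⟩
      · obtain ⟨y, a, b⟩ := hT.2 x (q x - 1) 0 (by omega) (Nat.zero_le _)
        exact ⟨y, by rw [if_pos hp, if_neg hq, a], by rw [b, hp]⟩
    · exact ⟨x, by rw [if_neg hp], rfl⟩
  choose m hm1 hm2 using h1
  have hinj : Function.Injective m := by
    intro x y hxy
    have a : p x = p y := by rw [← hm2 x, ← hm2 y, hxy]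
    have b : q (m x) = q (m y) := by rw [hxy]
    rw [hm1, hm1, ← a] at b
    refine hT.1 x y a ?_
    have := hxM x
    have := hxM y
    split_ifs at b <;> omega
  refine ⟨q xM, Equiv.ofBijective m (Finite.injective_iff_bijective.1 hinj), hxM, ?_, ?_⟩
  · intro x hx
    change q (m x) = _
    rw [hm1, if_neg hx]
  · intro x hx
    change q (m x) = _
    rw [hm1, if_pos hx]

lemma fix_u {q : X → ℕ} {u v : X} (huv : q u ≠ q v) (h3 : ∀ x, 3 ≤ rl q (q x)) {g : Perm X}
    (h1 : Bl q g) (h2 : Bl (q ∘ swap u v) g) : g u = u ∨ g u = v := by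
  by_contra hne
  push Not at hne
  set w := g u with hw
  -- find y ≠ w, same row, not u, v
  have : ∃ y, q y = q w ∧ y ≠ w ∧ y ≠ u ∧ y ≠ v := by
    have hc := h3 w
    unfold rl at hc
    by_contra hno
    push Not at hno
    have hsub : cl q (q w) ⊆ {w, if q w = q u then u else v} := by
      intro y hy
      have hy' : q y = q w := by simpa [cl] using hy
      rw [Finset.mem_insert, Finset.mem_singleton]
      by_cases a : y = w
      · exact Or.inl a
      right
      by_cases b : y = u
      · subst b; rw [if_pos hy'.symm]
      · have c := hno y hy' a b
        subst c
        rw [if_neg (fun hh => huv (hh.symm.trans hy'.symm))]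
    have := (Finset.card_le_card hsub).trans Finset.card_le_two
    omega
  obtain ⟨y, hy1, hy2, hy3, hy4⟩ := this
  obtain ⟨t, rfl⟩ := g.surjective y
  have htu : t ≠ u := fun h => hy2 (by rw [hw, h])
  have e1 : q t = q u := (h1 t u).2 hy1
  have e2 : (q ∘ swap u v) t = (q ∘ swap u v) u := (h2 t u).2 (by
    simp only [Function.comp_apply]
    rw [swap_apply_of_ne_of_ne hy3 hy4, swap_apply_of_ne_of_ne hne.1 hne.2, hy1])
  simp only [Function.comp_apply, swap_apply_left] at e2
  have htv : t ≠ v := fun h => huv (by rw [← e1, h])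
  rw [swap_apply_of_ne_of_ne htu htv] at e2
  exact huv (e1.symm.trans e2)

open Classical in
theorem rows_mem {p q : X → ℕ} (hT : YT p q) (hX : 12 ≤ Fintype.card X) (hb : ∀ x, 12 ≤ rl q (q x))
    (hn : ∀ x, Fintype.card X ≤ (rl q (q x)) ^ 4) : ind q ∈ (tr (fT p q)) ^ 2832 := by
  haveI : Nonempty X := Fintype.card_pos_iff.1 (by omega)
  have hblock := block_mem hT hX hb hn
  obtain ⟨K, hK⟩ : ∃ K, K = 708 := ⟨_, rfl⟩
  rw [← hK] at hblock
  rw [show 2832 = (K + K) + (K + K) by omega]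
  by_cases h0 : ∀ x, q x = 0
  · have : ind q = (fT p q) ^ ((K + K) + (K + K)) := by
      funext g
      have hg : q ∘ g = q := funext fun x => by simp [h0]
      have := fT_eq hT.1 (c := 1) (r := g) rfl hg
      rw [one_mul, sg_one] at this
      rw [Pi.pow_apply, this, one_pow]
      unfold ind
      rw [if_pos hg]
    rw [this]
    exact pow_mem_pow' (mem_tr _)
  push Not at h0
  obtain ⟨x0, hx0⟩ := h0
  obtain ⟨u, hu1, hu2⟩ := hT.2 x0 0 0 (Nat.zero_le _) (Nat.zero_le _)
  obtain ⟨v, hv1, hv2⟩ := hT.2 x0 1 0 (by omega) (Nat.zero_le _)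
  have hv12 := hb v
  rw [hv1] at hv12
  obtain ⟨v', hv'1, hv'2⟩ := hT.exists_cell (i := 1) (j := 1) (by omega)
  obtain ⟨M, h, hM, hh1, hh2⟩ := hT.exists_rot
  set β : Perm X → ℂ := fun g : Perm X => if Bl q g then (1 : ℂ) else 0 with hβ
  have hβm : β ∈ (tr (fT p q)) ^ K := hblock
  have hBI := (tr_biInv (fT p q)).pow K
  set F : Perm X → ℂ := (β * tl h h⁻¹ β) * (tl (swap u v) (swap u v)⁻¹ β * tl (swap u v') (swap u v')⁻¹ β) with hF
  have hFm : F ∈ (tr (fT p q)) ^ ((K + K) + (K + K)) := by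
    exact mul_mem_pow (mul_mem_pow hβm (hBI _ _ _ hβm)) (mul_mem_pow (hBI _ _ _ hβm) (hBI _ _ _ hβm))
  have hval : ∀ k g : Perm X, tl k k⁻¹ β g = if Bl (q ∘ k) g then 1 else 0 := by
    intro k g
    rw [tl_apply, hβ]
    simp only [Bl_conj]
  have hFv : ∀ g, F g = if Bl q g ∧ Bl (q ∘ h) g ∧ Bl (q ∘ swap u v) g ∧ Bl (q ∘ swap u v') g then 1 else 0 := by
    intro g
    simp only [hF, Pi.mul_apply, hval]
    simp only [hβ]
    split_ifs <;> simp_all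
  refine ind_mem ((tr_biInv (fT p q)).pow _) hFm ?_ ?_
  · intro g hg
    rw [hFv] at hg
    have hg' : Bl q g ∧ Bl (q ∘ h) g ∧ Bl (q ∘ swap u v) g ∧ Bl (q ∘ swap u v') g := by
      by_contra hh; rw [if_neg hh] at hg; exact hg rfl
    obtain ⟨b0, b1, b2, b3⟩ := hg'
    have hgu : g u = u := by
      have a := fix_u (by rw [hu1, hv1]; norm_num) (fun x => by have := hb x; omega) b0 b2
      have b := fix_u (by rw [hu1, hv'1]; norm_num) (fun x => by have := hb x; omega) b0 b3
      rcases a with a | a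
      · exact a
      · rcases b with b | b
        · exact b
        · exfalso
          have : v = v' := a.symm.trans b
          rw [this] at hv2; omega
    have key : ∀ i x, q x = i → q (g x) = i := by
      intro i
      induction i with
      | zero =>
        intro x hx
        have := (b0 x u).1 (by rw [hx, hu1])
        rw [this, hgu, hu1]
      | succ i ih =>
        intro x hx
        obtain ⟨x1, hx1, hx1'⟩ := hT.2 x (i + 1) 0 (by omega) (Nat.zero_le _)
        obtain ⟨z0, hz0, _⟩ := hT.2 x i 0 (by omega) (Nat.zero_le _)
        have hbz := hb z0
        rw [hz0] at hbz
        obtain ⟨y, hy, hy'⟩ := hT.exists_cell (i := i) (j := 1) (by omega)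
        obtain ⟨z, hz, hz'⟩ := hT.exists_cell (i := i) (j := 2) (by omega)
        have e1 : q (h x1) = i := by
          rw [hh2 x1 hx1', if_neg (by omega)]; omega
        have e2 : q (h y) = i := by rw [hh1 y (by omega), hy]
        have e3 : q (h z) = i := by rw [hh1 z (by omega), hz]
        have f1 : q (h (g x1)) = q (h (g y)) := (b1 x1 y).1 (e1.trans e2.symm)
        have f2 : q (h (g x1)) = q (h (g z)) := (b1 x1 z).1 (e1.trans e3.symm)
        have gy := ih y hy
        have gz := ih z hz
        have f3 : q (h (g x1)) = i := by
          by_cases c : p (g y) = 0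
          · by_cases d : p (g z) = 0
            · exfalso
              have := g.injective (hT.1 _ _ (c.trans d.symm) (gy.trans gz.symm))
              rw [this] at hy'; omega
            · rw [f2, hh1 _ d, gz]
          · rw [f1, hh1 _ c, gy]
        have f4 : q (g x1) ≠ i := by
          intro hh
          have := (b0 x1 y).2 (hh.trans gy.symm)
          omega
        have f5 : q (g x1) = i + 1 := by
          by_cases c : p (g x1) = 0
          · rw [hh2 _ c] at f3
            have := hM x1
            split_ifs at f3 <;> omega
          · rw [hh1 _ c] at f3; exact absurd f3 f4
        rw [← f5]
        exact (b0 x x1).1 (hx.trans hx1.symm)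
    exact funext fun x => key _ x rfl
  · have h1 : F 1 = 1 := by
      rw [hFv, if_pos]
      refine ⟨?_, ?_, ?_, ?_⟩ <;> intro x y <;> simp
    have : ∑ g, F g = ((Finset.univ.filter (fun g => Bl q g ∧ Bl (q ∘ h) g ∧ Bl (q ∘ swap u v) g ∧ Bl (q ∘ swap u v') g)).card : ℂ) := by
      rw [Finset.sum_congr rfl (fun g _ => hFv g), Finset.sum_boole]
    rw [this, Nat.cast_ne_zero, ← Nat.pos_iff_ne_zero, Finset.card_pos]
    refine ⟨1, Finset.mem_filter.2 ⟨Finset.mem_univ _, ?_⟩⟩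
    refine ⟨?_, ?_, ?_, ?_⟩ <;> intro x y <;> simp

end rows
end McKayGraphs

open scoped BigOperators
namespace McKayGraphs
open Equiv

section flip
variable {X : Type*} [Fintype X] [DecidableEq X]

lemma flip_mem {p q : X → ℕ} (hJ : JI p q) {k : ℕ} (hk : Even k) {F : Perm X → ℂ} (hF : ∀ g, F g⁻¹ = F g)
    (h : F ∈ (tr (fT p q)) ^ k) : F ∈ (tr (fT q p)) ^ k := by
  set Λ := (pb (fun g : Perm X => g⁻¹)).toLinearMap with hΛ
  have h1 : (tr (fT p q)).map Λ ≤ Submodule.span ℂ {(sg : Perm X → ℂ)} * tr (fT q p) := by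
    rw [Submodule.map_le_iff_le_comap]
    refine Submodule.span_le.2 ?_
    rintro _ ⟨⟨a, b⟩, rfl⟩
    change Λ (tl a b (fT p q)) ∈ Submodule.span ℂ {(sg : Perm X → ℂ)} * tr (fT q p)
    have : Λ (tl a b (fT p q)) = (sg a * sg b) • (sg * tl b⁻¹ a⁻¹ (fT q p)) := by
      funext g
      have e := fT_flip hJ (b⁻¹ * g * a⁻¹)
      have hinv : (b⁻¹ * g * a⁻¹)⁻¹ = a * g⁻¹ * b := by group
      rw [hinv, sg_mul, sg_mul, sg_inv, sg_inv] at e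
      change fT p q (a * g⁻¹ * b) = (sg a * sg b) * (sg g * fT q p (b⁻¹ * g * a⁻¹))
      rw [e]
      have ha := sg_sq a
      have hb := sg_sq b
      have hg := sg_sq g
      linear_combination (-(fT p q (a * g⁻¹ * b))) * (ha * (sg b * sg b * (sg g * sg g)) + hb * (sg g * sg g) + hg)
    rw [this]
    refine Submodule.smul_mem _ _ (Submodule.mul_mem_mul (Submodule.subset_span rfl) (Submodule.subset_span ⟨(b⁻¹, a⁻¹), rfl⟩))
  have h2 : F ∈ ((tr (fT p q)) ^ k).map Λ := ⟨F, h, funext fun g => hF g⟩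
  rw [hΛ, Submodule.map_pow] at h2
  have h3 := pow_le_pow_left' h1 k h2
  rw [mul_pow, Submodule.span_pow, Set.singleton_pow] at h3
  have : (sg : Perm X → ℂ) ^ k = 1 := by
    obtain ⟨m, rfl⟩ := hk
    funext g
    rw [Pi.pow_apply, pow_add, ← mul_pow, sg_sq, one_pow, Pi.one_apply]
  rw [this, ← Submodule.one_eq_span, one_mul] at h3
  exact h3

lemma ind_inv (u : X → ℕ) (g : Perm X) : ind u g⁻¹ = ind u g := by
  unfold ind
  by_cases h : u ∘ g = u
  · rw [if_pos h, if_pos (comp_inv_of h)]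
  · rw [if_neg h, if_neg]
    intro hh; have := comp_inv_of hh; rw [inv_inv] at this; exact h this

/-- a functional nonzero on a power is nonzero on a product of translates -/
lemma exists_translates {G : Type*} [Group G] [Fintype G] (f K : G → ℂ) {k : ℕ} {F : G → ℂ} (hF : F ∈ (tr f) ^ k)
    (hne : ∑ g, F g * K g ≠ 0) : ∃ a b : Fin k → G, ∑ g, (∏ j, f (a j * g * b j)) * K g ≠ 0 := by
  by_contra hno
  push Not at hno
  apply hne
  let ℓ : (G → ℂ) →ₗ[ℂ] ℂ :=
    { toFun := fun F => ∑ g, F g * K g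
      map_add' := fun x y => by simp [add_mul, Finset.sum_add_distrib]
      map_smul' := fun c x => by simp [Finset.mul_sum, mul_assoc] }
  have : (tr f) ^ k ≤ LinearMap.ker ℓ := by
    unfold tr
    rw [Submodule.span_pow, Submodule.span_le]
    intro F hF
    rw [Set.mem_pow] at hF
    obtain ⟨w, hw⟩ := hF
    rw [List.prod_ofFn] at hw
    have hc : ∀ j, ∃ ab : G × G, tl ab.1 ab.2 f = (w j).1 := fun j => (w j).2
    choose ab hab using hc
    have := hno (fun j => (ab j).1) (fun j => (ab j).2)
    change ∑ g, F g * K g = 0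
    rw [← this]
    refine Finset.sum_congr rfl fun g _ => ?_
    rw [← hw, Finset.prod_apply]
    congr 1
    refine Finset.prod_congr rfl fun j _ => ?_
    rw [← hab j]; rfl
  exact this hF

end flip

section poly
variable {X : Type*} [Fintype X] [DecidableEq X] {ι : Type} [Fintype ι] [DecidableEq ι]

noncomputable def cf (P : ι → X → ℕ) (c : ι → Perm X) : ℂ :=
  ∏ i, if P i ∘ c i = P i then sg (c i) else 0

def vc (Q : ι → X → ℕ) (c : ι → Perm X) (x : X) : ι → ℕ := fun i => Q i (c i x)

noncomputable def poly (P Q : ι → X → ℕ) : MvPolynomial (ι → ℕ) ℂ :=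
  ∑ c : ι → Perm X, MvPolynomial.C (cf P c) * ∏ x, MvPolynomial.X (vc Q c x)

noncomputable def mon (v : X → ι → ℕ) : (ι → ℕ) →₀ ℕ := ∑ x, Finsupp.single (v x) 1

lemma mon_apply (v : X → ι → ℕ) (k : ι → ℕ) : mon v k = fc v k := by
  unfold mon fc
  rw [Finsupp.finset_sum_apply, Finset.card_filter]
  refine Finset.sum_congr rfl fun x _ => ?_
  rw [Finsupp.single_apply]

lemma poly_coeff (P Q : ι → X → ℕ) (m) : MvPolynomial.coeff m (poly P Q) =
    ∑ c : ι → Perm X, if mon (vc Q c) = m then cf P c else 0 := by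
  unfold poly
  rw [MvPolynomial.coeff_sum]
  refine Finset.sum_congr rfl fun c _ => ?_
  have : ∏ x, (MvPolynomial.X (vc Q c x) : MvPolynomial (ι → ℕ) ℂ) = MvPolynomial.monomial (mon (vc Q c)) 1 := by
    unfold mon
    rw [MvPolynomial.monomial_sum_one]
    rfl
  rw [this, MvPolynomial.coeff_C_mul, MvPolynomial.coeff_monomial]
  split_ifs <;> simp

lemma fT_expand (p q : X → ℕ) (g h : Perm X) : fT p q (g * h) =
    ∑ c : Perm X, (if p ∘ c = p then sg c else 0) * (if (q ∘ ⇑h⁻¹) ∘ ⇑g⁻¹ = q ∘ c then 1 else 0) := by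
  unfold fT Th
  rw [← Equiv.sum_comp (Equiv.inv (Perm X))]
  refine Finset.sum_congr rfl fun c _ => ?_
  simp only [Equiv.inv_apply]
  have e1 : (p ∘ ⇑c⁻¹ = p) ↔ p ∘ c = p := by
    constructor
    · intro h; have := comp_inv_of h; rwa [inv_inv] at this
    · exact comp_inv_of
  have e2 : (q ∘ ⇑(g * h)⁻¹) ∘ ⇑c⁻¹ = q ↔ (q ∘ ⇑h⁻¹) ∘ ⇑g⁻¹ = q ∘ c := by
    rw [mul_inv_rev]
    constructor
    · intro hh; funext x
      have := congrFun hh (c x)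
      simpa only [Function.comp_apply, Perm.mul_apply, ias] using this
    · intro hh; funext x
      have := congrFun hh (c⁻¹ x)
      simpa only [Function.comp_apply, Perm.mul_apply, ais] using this
  by_cases h1 : p ∘ c = p
  · by_cases h2 : (q ∘ ⇑h⁻¹) ∘ ⇑g⁻¹ = q ∘ c
    · rw [if_pos ⟨e1.2 h1, e2.2 h2⟩, if_pos h1, if_pos h2, sg_inv, mul_one]
    · rw [if_neg (fun hh => h2 (e2.1 hh.2)), if_neg h2, mul_zero]
  · rw [if_neg (fun hh => h1 (e1.1 hh.1)), if_neg h1, zero_mul]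

lemma pos_coeff (P Q : ι → X → ℕ) (h : ι → Perm X) :
    ∑ g : Perm X, ∏ i, fT (P i) (Q i) (g * h i) =
      (stc (vc Q (fun i => (h i)⁻¹)) : ℂ) * MvPolynomial.coeff (mon (vc Q (fun i => (h i)⁻¹))) (poly P Q) := by
  simp only [fT_expand]
  have e : ∀ g : Perm X, ∏ i, ∑ c : Perm X, (if P i ∘ c = P i then sg c else 0) * (if (Q i ∘ ⇑(h i)⁻¹) ∘ ⇑g⁻¹ = Q i ∘ c then (1 : ℂ) else 0)
      = ∑ c : ι → Perm X, cf P c * (if vc Q (fun i => (h i)⁻¹) ∘ ⇑g⁻¹ = vc Q c then 1 else 0) := by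
    intro g
    rw [Finset.prod_univ_sum, Fintype.piFinset_univ]
    refine Finset.sum_congr rfl fun c _ => ?_
    rw [Finset.prod_mul_distrib]
    congr 1
    by_cases hh : vc Q (fun i => (h i)⁻¹) ∘ ⇑g⁻¹ = vc Q c
    · rw [if_pos hh]
      refine Finset.prod_eq_one fun i _ => if_pos ?_
      funext x
      exact congrFun (congrFun hh x) i
    · rw [if_neg hh]
      by_contra hne
      apply hh
      funext x; funext i
      have := Finset.prod_ne_zero_iff.1 hne i (Finset.mem_univ _)
      by_contra hx
      apply this
      rw [if_neg]
      intro h'; exact hx (congrFun h' x)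
  rw [Finset.sum_congr rfl (fun g _ => e g), Finset.sum_comm, poly_coeff, Finset.mul_sum]
  refine Finset.sum_congr rfl fun c _ => ?_
  rw [← Finset.mul_sum, ← Equiv.sum_comp (Equiv.inv (Perm X))]
  simp only [Equiv.inv_apply, inv_inv]
  rw [Finset.sum_boole, cnt]
  have hm : (mon (vc Q c) = mon (vc Q (fun i => (h i)⁻¹))) ↔ (∃ r : Perm X, vc Q (fun i => (h i)⁻¹) ∘ r = vc Q c) := by
    rw [ex_iff, Finsupp.ext_iff]
    simp only [mon_apply]
  by_cases hh : ∃ r : Perm X, vc Q (fun i => (h i)⁻¹) ∘ r = vc Q c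
  · rw [if_pos hh, if_pos (hm.2 hh)]; ring
  · rw [if_neg hh, if_neg (fun h' => hh (hm.1 h'))]; simp

lemma poly_ne_zero_iff (P Q : ι → X → ℕ) : poly P Q ≠ 0 ↔
    ∃ h : ι → Perm X, ∑ g : Perm X, ∏ i, fT (P i) (Q i) (g * h i) ≠ 0 := by
  constructor
  · intro hne
    obtain ⟨m, hm⟩ := MvPolynomial.ne_zero_iff.1 hne
    have hm' := hm
    rw [poly_coeff] at hm'
    obtain ⟨c, _, hc⟩ := Finset.exists_ne_zero_of_sum_ne_zero hm'
    have hcm : mon (vc Q c) = m := by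
      by_contra h; rw [if_neg h] at hc; exact hc rfl
    refine ⟨fun i => (c i)⁻¹, ?_⟩
    rw [pos_coeff]
    simp only [inv_inv]
    rw [hcm]
    refine mul_ne_zero ?_ hm
    exact_mod_cast (stc_pos _).ne'
  · rintro ⟨h, hh⟩ h0
    rw [pos_coeff, h0] at hh
    simp at hh

lemma poly_split (s : X → Prop) [DecidablePred s] (P Q : ι → X → ℕ)
    (hP : ∀ i x y, P i x = P i y → (s x ↔ s y)) :
    poly P Q = poly (fun i (x : {x // s x}) => P i x) (fun i x => Q i x) *
      poly (fun i (x : {x // ¬ s x}) => P i x) (fun i x => Q i x) := by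
  unfold poly
  rw [Finset.sum_mul_sum, ← Finset.sum_product', Finset.univ_product_univ]
  symm
  refine Fintype.sum_of_injective (fun (cc : (ι → Perm {x // s x}) × (ι → Perm {x // ¬ s x})) i =>
    Equiv.Perm.subtypeCongr (cc.1 i) (cc.2 i)) ?_ _ _ ?_ ?_
  · intro a b hab
    have h1 : ∀ i, (a.1 i, a.2 i) = (b.1 i, b.2 i) := fun i =>
      Equiv.Perm.subtypeCongrHom_injective s (congrFun hab i)
    refine Prod.ext (funext fun i => ?_) (funext fun i => ?_)
    · exact congrArg Prod.fst (h1 i)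
    · exact congrArg Prod.snd (h1 i)
  · intro c hc
    rw [show cf P c = 0 from ?_, map_zero, zero_mul]
    by_contra hne
    apply hc
    have hst : ∀ i, P i ∘ c i = P i := by
      intro i
      have := Finset.prod_ne_zero_iff.1 hne i (Finset.mem_univ _)
      by_contra h; rw [if_neg h] at this; exact this rfl
    have hs : ∀ i x, s x ↔ s (c i x) := fun i x => hP i _ _ (congrFun (hst i) x).symm
    refine ⟨(fun i => (c i).subtypePerm (fun x => (hs i x).symm), fun i => (c i).subtypePerm (fun x => not_congr (hs i x).symm)), ?_⟩
    funext i
    ext x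
    by_cases hx : s x
    · simp [Equiv.Perm.subtypeCongr.left_apply, hx]
    · simp [Equiv.Perm.subtypeCongr.right_apply, hx]
  · rintro ⟨a, b⟩
    dsimp only
    have hcf : cf P (fun i => Equiv.Perm.subtypeCongr (a i) (b i)) =
        cf (fun i (x : {x // s x}) => P i x) a * cf (fun i (x : {x // ¬ s x}) => P i x) b := by
      unfold cf
      rw [← Finset.prod_mul_distrib]
      refine Finset.prod_congr rfl fun i _ => ?_
      have hiff : P i ∘ ⇑(Equiv.Perm.subtypeCongr (a i) (b i)) = P i ↔
          ((fun x : {x // s x} => P i x) ∘ a i = (fun x : {x // s x} => P i x)) ∧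
          ((fun x : {x // ¬ s x} => P i x) ∘ b i = (fun x : {x // ¬ s x} => P i x)) := by
        constructor
        · intro h
          constructor
          · funext x
            have := congrFun h x.1
            simpa [Equiv.Perm.subtypeCongr.left_apply, x.2] using this
          · funext x
            have := congrFun h x.1
            simpa [Equiv.Perm.subtypeCongr.right_apply, x.2] using this
        · rintro ⟨h1, h2⟩
          funext x
          by_cases hx : s x
          · have := congrFun h1 ⟨x, hx⟩
            simpa [Equiv.Perm.subtypeCongr.left_apply, hx] using this
          · have := congrFun h2 ⟨x, hx⟩
            simpa [Equiv.Perm.subtypeCongr.right_apply, hx] using this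
      have hsg : sg (Equiv.Perm.subtypeCongr (a i) (b i)) = sg (a i) * sg (b i) := by
        unfold sg; rw [Equiv.Perm.sign_subtypeCongr]; push_cast; rfl
      by_cases h1 : ((fun x : {x // s x} => P i x) ∘ a i = (fun x : {x // s x} => P i x))
      · by_cases h2 : ((fun x : {x // ¬ s x} => P i x) ∘ b i = (fun x : {x // ¬ s x} => P i x))
        · rw [if_pos (hiff.2 ⟨h1, h2⟩), if_pos h1, if_pos h2, hsg]
        · rw [if_neg (fun h => h2 (hiff.1 h).2), if_neg h2, mul_zero]
      · rw [if_neg (fun h => h1 (hiff.1 h).1), if_neg h1, zero_mul]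
    have hpr : ∏ x, (MvPolynomial.X (vc Q (fun i => Equiv.Perm.subtypeCongr (a i) (b i)) x) : MvPolynomial (ι → ℕ) ℂ) =
        (∏ x, MvPolynomial.X (vc (fun i (x : {x // s x}) => Q i x) a x)) *
        ∏ x, MvPolynomial.X (vc (fun i (x : {x // ¬ s x}) => Q i x) b x) := by
      rw [← Fintype.prod_subtype_mul_prod_subtype s]
      congr 1
      · refine Finset.prod_congr rfl fun x _ => ?_
        congr 1; funext i
        simp [vc, Equiv.Perm.subtypeCongr.left_apply, x.2]
      · refine Finset.prod_congr rfl fun x _ => ?_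
        congr 1; funext i
        simp [vc, Equiv.Perm.subtypeCongr.right_apply, x.2]
    rw [hcf, hpr, map_mul]
    ring

end poly
end McKayGraphs

open scoped BigOperators
namespace McKayGraphs
open Equiv

section trunc
universe uu
variable {X : Type uu} [Fintype X] [DecidableEq X]

lemma prod_mem_pow {G : Type*} [Group G] {R : Submodule ℂ (G → ℂ)} {k : ℕ} {F : Fin k → G → ℂ} (h : ∀ j, F j ∈ R) :
    ∏ j, F j ∈ R ^ k := by
  induction k with
  | zero => simp only [Finset.univ_eq_empty, Finset.prod_empty, pow_zero]; exact Submodule.one_le.1 le_rfl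
  | succ k ih =>
    rw [Fin.prod_univ_succ, pow_succ']
    exact Submodule.mul_mem_mul (h 0) (ih fun j => h _)

/-- merge the short rows into row `0` -/
def trn (q : X → ℕ) (L : ℕ) (x : X) : ℕ := if L ≤ rl q (q x) then q x else 0

lemma rl_pos_of (q : X → ℕ) (x : X) : 0 < rl q (q x) :=
  Finset.card_pos.2 ⟨x, mem_cl.2 rfl⟩

lemma exists_nu {p q : X → ℕ} (hT : YT p q) {L : ℕ} (hL : L ≤ rl q 0) :
    ∃ pν : X → ℕ, YT pν (trn q L) ∧ (∀ x, L ≤ rl q (q x) → pν x = p x) ∧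
      (∀ x, ¬ L ≤ rl q (q x) → rl q 0 ≤ pν x) := by
  classical
  obtain ⟨e⟩ : Nonempty ({x : X // ¬ L ≤ rl q (q x)} ≃ Fin (Fintype.card {x : X // ¬ L ≤ rl q (q x)})) :=
    ⟨Fintype.equivFin _⟩
  refine ⟨fun x => if h : L ≤ rl q (q x) then p x else rl q 0 + (e ⟨x, h⟩ : ℕ), ⟨?_, ?_⟩, ?_, ?_⟩
  · intro x y hp hq
    have hlt : ∀ z, p z < rl q 0 := fun z => (hT.col_lt z).trans_le (hT.rl_anti (Nat.zero_le _))
    by_cases hx : L ≤ rl q (q x) <;> by_cases hy : L ≤ rl q (q y)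
    · simp only [dif_pos hx, dif_pos hy] at hp
      simp only [trn, if_pos hx, if_pos hy] at hq
      exact hT.1 x y hp hq
    · simp only [dif_pos hx, dif_neg hy] at hp
      have := hlt x; omega
    · simp only [dif_neg hx, dif_pos hy] at hp
      have := hlt y; omega
    · simp only [dif_neg hx, dif_neg hy] at hp
      have : e ⟨x, hx⟩ = e ⟨y, hy⟩ := Fin.ext (by omega)
      exact congrArg Subtype.val (e.injective this)
  · intro x i j hi hj
    by_cases hx : L ≤ rl q (q x)
    · simp only [dif_pos hx] at hj
      simp only [trn, if_pos hx] at hi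
      obtain ⟨y, hy1, hy2⟩ := hT.2 x i j hi hj
      have hy : L ≤ rl q (q y) := by rw [hy1]; exact hx.trans (hT.rl_anti hi)
      refine ⟨y, ?_, ?_⟩
      · simp only [trn, if_pos hy]; exact hy1
      · simp only [dif_pos hy]; exact hy2
    · simp only [dif_neg hx] at hj
      simp only [trn, if_neg hx] at hi
      obtain rfl : i = 0 := by omega
      by_cases hj0 : j < rl q 0
      · obtain ⟨y, hy1, hy2⟩ := hT.exists_cell hj0
        have hy : L ≤ rl q (q y) := by rw [hy1]; exact hL
        refine ⟨y, ?_, ?_⟩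
        · simp only [trn, if_pos hy]; exact hy1
        · simp only [dif_pos hy]; exact hy2
      · have hlt : j - rl q 0 < Fintype.card {x : X // ¬ L ≤ rl q (q x)} := by
          have := (e ⟨x, hx⟩).2; omega
        have hy := (e.symm ⟨j - rl q 0, hlt⟩).2
        refine ⟨(e.symm ⟨j - rl q 0, hlt⟩ : X), ?_, ?_⟩
        · simp only [trn, if_neg hy]
        · simp only [dif_neg hy, Subtype.coe_eta, apply_symm_apply]; omega
  · intro x hx; simp only [dif_pos hx]
  · intro x hx; simp only [dif_neg hx]; omega

lemma rl_trn {p q : X → ℕ} (hT : YT p q) {L : ℕ} (hL : L ≤ rl q 0) (x : X) :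
    L ≤ rl (trn q L) (trn q L x) := by
  have key : ∀ i, L ≤ rl q i → L ≤ rl (trn q L) i := by
    intro i hi
    refine hi.trans (Finset.card_le_card fun y hy => ?_)
    rw [mem_cl] at hy ⊢
    rw [trn, hy, if_pos hi]
  by_cases hx : L ≤ rl q (q x)
  · have : trn q L x = q x := if_pos hx
    rw [this]; exact key _ hx
  · have : trn q L x = 0 := if_neg hx
    rw [this]; exact key _ hL

lemma sum_ind_fT {p q : X → ℕ} (hJ : JI p q) : ∑ g, ind q g * fT p q g ≠ 0 := by
  have : ∀ g, ind q g * fT p q g = ((if q ∘ g = q then 1 else 0 : ℕ) : ℂ) := by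
    intro g
    unfold ind
    by_cases h : q ∘ g = q
    · have := fT_eq hJ (c := 1) (r := g) rfl h
      rw [one_mul, sg_one] at this
      rw [if_pos h, if_pos h, this]; simp
    · rw [if_neg h, if_neg h]; simp
  simp only [this]
  rw [← Nat.cast_sum, Finset.sum_boole]
  have := stc_pos q
  unfold stc at this
  exact_mod_cast this.ne'

lemma fT_trans (p q : X → ℕ) (a g b : Perm X) :
    fT (p ∘ a) (q ∘ a) (g * (b * a)) = fT p q (a * g * b) := by
  rw [fT_conj]; congr 1; group

lemma fT_inj_zero {p q : X → ℕ} (hp : Function.Injective p) (hq : ∀ x, q x = 0) (g : Perm X) : fT p q g = 1 := by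
  have hJ : JI p q := fun x y h _ => hp h
  have := fT_eq hJ (c := 1) (r := g) rfl (funext fun x => by simp [hq])
  rwa [one_mul, sg_one] at this

lemma sum_even_ne {p q : X → ℕ} (hJ : JI p q) {k : ℕ} (hk : Even k) : ∑ g, (fT p q g) ^ k ≠ 0 := by
  have h1 : ∀ g, ∃ m : ℕ, (fT p q g) ^ k = m := by
    intro g
    rcases fT_val hJ g with h | h | h
    · rw [h]; exact ⟨0 ^ k, by simp⟩
    · rw [h]; exact ⟨1, by simp⟩
    · rw [h, hk.neg_one_pow]; exact ⟨1, by simp⟩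
  choose m hm using h1
  simp only [hm]
  rw [← Nat.cast_sum]
  have h2 : m 1 = 1 := by
    have := hm 1
    rw [fT_one hJ, one_pow] at this
    exact_mod_cast this.symm
  have h3 : m 1 ≤ ∑ g, m g := Finset.single_le_sum (f := m) (fun _ _ => Nat.zero_le _) (Finset.mem_univ 1)
  exact_mod_cast (by omega : ∑ g, m g ≠ 0)

theorem fT_nu_mem {p q pν : X → ℕ} (hT : YT p q) {L K : ℕ} (hK : Even K) (hL12 : 12 ≤ L)
    (hn : Fintype.card X ≤ L ^ 4)
    (hKr : ∀ (Y : Type uu) [Fintype Y] [DecidableEq Y] (p q : Y → ℕ), YT p q → 12 ≤ Fintype.card Y → (∀ x, 12 ≤ rl q (q x)) →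
      (∀ x, Fintype.card Y ≤ (rl q (q x)) ^ 4) → ind q ∈ (tr (fT p q)) ^ K)
    (hL : L ≤ rl q 0) (hν : YT pν (trn q L)) (h1 : ∀ x, L ≤ rl q (q x) → pν x = p x)
    (h2 : ∀ x, ¬ L ≤ rl q (q x) → rl q 0 ≤ pν x) :
    fT pν (trn q L) ∈ (tr (fT q p)) ^ K := by
  classical
  let s : X → Prop := fun x => L ≤ rl q (q x)
  let pA : {x // s x} → ℕ := fun x => p x
  let qA : {x // s x} → ℕ := fun x => q x
  have hrl : ∀ x : {x // s x}, rl qA (qA x) = rl q (q x) := by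
    intro x
    unfold rl
    refine Finset.card_bij (fun y _ => (y : X)) ?_ ?_ ?_
    · intro y hy; rw [mem_cl] at hy ⊢; exact hy
    · intro y _ z _ h; exact Subtype.ext h
    · intro y hy
      rw [mem_cl] at hy
      refine ⟨⟨y, ?_⟩, ?_, rfl⟩
      · change L ≤ rl q (q y); rw [hy]; exact x.2
      · rw [mem_cl]; exact hy
  have hTA : YT pA qA := by
    refine ⟨fun x y a b => Subtype.ext (hT.1 x y a b), fun x i j hi hj => ?_⟩
    obtain ⟨y, hy1, hy2⟩ := hT.2 x i j hi hj
    refine ⟨⟨y, ?_⟩, hy1, hy2⟩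
    change L ≤ rl q (q y)
    rw [hy1]; exact x.2.trans (hT.rl_anti hi)
  have hcA : L ≤ Fintype.card {x // s x} := by
    rw [Fintype.card_subtype]
    refine hL.trans (Finset.card_le_card fun y hy => ?_)
    rw [mem_cl] at hy
    simp only [Finset.mem_filter, Finset.mem_univ, true_and]
    change L ≤ rl q (q y); rw [hy]; exact hL
  have hrows := hKr {x // s x} pA qA hTA (by omega) (fun x => by rw [hrl]; exact hL12.trans x.2) (fun x => by
    rw [hrl]
    refine (Fintype.card_subtype_le _).trans (hn.trans ?_)
    gcongr
    exact x.2)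
  have hflip := flip_mem hTA.1 hK (ind_inv qA) hrows
  obtain ⟨a, b, hab⟩ := exists_translates _ _ hflip (sum_ind_fT hTA.1)
  -- the polynomial on X
  let at' : Fin K → Perm X := fun j => Equiv.Perm.subtypeCongr (a j) (1 : Perm {x // ¬ s x})
  have hatA : ∀ j (x : {x // s x}), at' j x = a j x := fun j x => by
    simp only [at']; rw [Equiv.Perm.subtypeCongr.left_apply _ _ x.2]
  have hatB : ∀ j (x : {x // ¬ s x}), at' j x = x := fun j x => by
    simp only [at']; rw [Equiv.Perm.subtypeCongr.right_apply _ _ x.2]; rfl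
  have hats : ∀ j x, s x ↔ s (at' j x) := by
    intro j x
    by_cases hx : s x
    · have := hatA j ⟨x, hx⟩
      simp only at this
      rw [this]; exact ⟨fun _ => (a j ⟨x, hx⟩).2, fun _ => hx⟩
    · have := hatB j ⟨x, hx⟩
      simp only at this
      rw [this]
  let P : Option (Fin K) → X → ℕ := fun i => Option.elim i pν (fun j => q ∘ at' j)
  let Q : Option (Fin K) → X → ℕ := fun i => Option.elim i (trn q L) (fun j => p ∘ at' j)
  have hpoly : poly P Q ≠ 0 := by
    rw [poly_split s P Q]
    · refine mul_ne_zero ?_ ?_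
      · rw [poly_ne_zero_iff]
        refine ⟨fun i => Option.elim i 1 (fun j => b j * a j), ?_⟩
        convert hab using 1
        refine Finset.sum_congr rfl fun g _ => ?_
        rw [Fintype.prod_option, mul_comm]
        congr 1
        · refine Finset.prod_congr rfl fun j _ => ?_
          rw [← fT_trans]
          congr 1
          · funext x; change q (at' j x) = q (a j x); rw [hatA]
          · funext x; change p (at' j x) = p (a j x); rw [hatA]
        · have e1 : (fun x : {x // s x} => P none x) = pA := funext fun x => h1 x x.2
          have e2 : (fun x : {x // s x} => Q none x) = qA := funext fun x => if_pos x.2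
          rw [e1, e2]
          simp
      · rw [poly_ne_zero_iff]
        refine ⟨fun i => 1, ?_⟩
        have hJB : JI (fun x : {x // ¬ s x} => q x) (fun x => p x) :=
          fun x y a b => Subtype.ext (hT.1 x y b a)
        convert sum_even_ne hJB hK using 1
        refine Finset.sum_congr rfl fun g _ => ?_
        rw [Fintype.prod_option]
        have e1 : fT (fun x : {x // ¬ s x} => P none x) (fun x => Q none x) (g * 1) = 1 := by
          apply fT_inj_zero
          · intro x y hxy
            have hq : trn q L x = trn q L y := by
              rw [trn, trn, if_neg x.2, if_neg y.2]
            exact Subtype.ext (hν.1 x y hxy hq)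
          · intro x; exact if_neg x.2
        rw [e1, one_mul]
        have e2 : ∀ j : Fin K, fT (fun x : {x // ¬ s x} => P (some j) x) (fun x => Q (some j) x) (g * 1) =
            fT (fun x : {x // ¬ s x} => q x) (fun x => p x) g := by
          intro j
          rw [mul_one]
          congr 1
          · funext x; change q (at' j x) = _; rw [hatB]
          · funext x; change p (at' j x) = _; rw [hatB]
        simp only [e2]
        rw [Finset.prod_const, Finset.card_univ, Fintype.card_fin]
    · intro i x y hxy
      cases i with
      | none =>
        have hxy' : pν x = pν y := hxy
        have hlt : ∀ z, p z < rl q 0 := fun z => (hT.col_lt z).trans_le (hT.rl_anti (Nat.zero_le _))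
        by_cases hx : s x <;> by_cases hy : s y
        · exact ⟨fun _ => hy, fun _ => hx⟩
        · have := h1 x hx; have := h2 y hy; have := hlt x; omega
        · have := h1 y hy; have := h2 x hx; have := hlt y; omega
        · exact ⟨fun h => absurd h hx, fun h => absurd h hy⟩
      | some j =>
        have hxy' : q (at' j x) = q (at' j y) := hxy
        rw [hats j x, hats j y]
        change L ≤ rl q (q (at' j x)) ↔ L ≤ rl q (q (at' j y))
        rw [hxy']
  rw [poly_ne_zero_iff] at hpoly
  obtain ⟨h, hh⟩ := hpoly
  let c : Fin K → Perm X := fun j => (h none)⁻¹ * h (some j) * (at' j)⁻¹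
  have hmem : (∏ j : Fin K, tl (at' j) (c j) (fT q p)) ∈ (tr (fT q p)) ^ K := by
    exact prod_mem_pow fun j => tr_biInv _ _ _ _ (mem_tr _)
  refine ML hν.1 hν.hin ((tr_biInv (fT q p)).pow K) hmem ?_
  convert hh using 1
  rw [← Equiv.sum_comp (Equiv.mulRight (h none))]
  refine Finset.sum_congr rfl fun g _ => ?_
  rw [Fintype.prod_option, mul_comm]
  congr 1
  rw [Finset.prod_apply]
  refine Finset.prod_congr rfl fun j _ => ?_
  change fT q p (at' j * (g * h none) * c j) = fT (q ∘ at' j) (p ∘ at' j) (g * h (some j))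
  rw [fT_conj]
  congr 1
  simp only [c]
  group

theorem trunc_mem {p q : X → ℕ} (hT : YT p q) {L : ℕ} (hL12 : 12 ≤ L) (hn : Fintype.card X ≤ L ^ 4)
    (hL : L ≤ rl q 0) : ind (trn q L) ∈ (tr (fT q p)) ^ (2832 * 2832) := by
  obtain ⟨pν, hν, h1, h2⟩ := exists_nu hT hL
  have hr : ∀ (Y : Type uu) [Fintype Y] [DecidableEq Y] (p q : Y → ℕ), YT p q → 12 ≤ Fintype.card Y → (∀ x, 12 ≤ rl q (q x)) →
      (∀ x, Fintype.card Y ≤ (rl q (q x)) ^ 4) → ind q ∈ (tr (fT p q)) ^ 2832 :=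
    fun Y _ _ p q a b c d => rows_mem a b c d
  have hev : Even 2832 := by decide
  obtain ⟨K, hK⟩ : ∃ K, K = 2832 := ⟨_, rfl⟩
  rw [← hK] at hr hev ⊢
  have hm := fT_nu_mem hT hev hL12 hn hr hL hν h1 h2
  have hrl := fun x => rl_trn hT hL x
  have hX : 12 ≤ Fintype.card X := hL12.trans (hL.trans (Finset.card_le_univ _))
  have := hr X pν (trn q L) hν hX (fun x => hL12.trans (hrl x)) (fun x => hn.trans (by gcongr; exact hrl x))
  rw [pow_mul]
  exact pow_le_pow_left' (tr_le ((tr_biInv (fT q p)).pow K) hm) K this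
end trunc
end McKayGraphs

open scoped BigOperators
namespace McKayGraphs
open Equiv

section ent
variable {X : Type*} [Fintype X] [DecidableEq X]

/-- information of a cell in a coloring -/
noncomputable def wv (u : X → ℕ) (x : X) : ℝ := Real.log ((Fintype.card X : ℝ) / rl u (u x))
noncomputable def Ent (u : X → ℕ) : ℝ := ∑ x, wv u x

lemma rl_le_card (u : X → ℕ) (i : ℕ) : rl u i ≤ Fintype.card X := Finset.card_le_univ _

lemma wv_nonneg (u : X → ℕ) (x : X) : 0 ≤ wv u x := by
  have h1 : (0:ℝ) < rl u (u x) := by exact_mod_cast rl_pos_of u x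
  have h2 : (rl u (u x) : ℝ) ≤ Fintype.card X := by exact_mod_cast rl_le_card u _
  exact Real.log_nonneg ((one_le_div h1).2 h2)

lemma Ent_nonneg (u : X → ℕ) : 0 ≤ Ent u := Finset.sum_nonneg fun x _ => wv_nonneg u x

lemma sum_le_Ent (u : X → ℕ) (s : Finset X) : ∑ x ∈ s, wv u x ≤ Ent u :=
  Finset.sum_le_sum_of_subset_of_nonneg (Finset.subset_univ _) fun x _ _ => wv_nonneg u x

lemma two_rl_le {p q : X → ℕ} (hT : YT p q) {x : X} (hx : q x ≠ 0) : 2 * rl q (q x) ≤ Fintype.card X := by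
  have h1 : rl q (q x) ≤ rl q 0 := hT.rl_anti (Nat.zero_le _)
  have h2 : rl q (q x) + rl q 0 ≤ Fintype.card X := by
    unfold rl
    rw [← Finset.card_union_of_disjoint]
    · exact Finset.card_le_univ _
    · rw [Finset.disjoint_left]; intro y hy hy'
      rw [mem_cl] at hy hy'; exact hx (hy.symm.trans hy')
  omega

lemma log_ge_half {n a : ℝ} (ha : 0 < a) (h : 2 * a ≤ n) : 1 / 2 ≤ Real.log (n / a) := by
  have : Real.log 2 ≤ Real.log (n / a) := Real.log_le_log (by norm_num) (by rw [le_div_iff₀ ha]; exact h)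
  have := Real.log_two_gt_d9
  linarith

lemma row_facts {p q : X → ℕ} (hT : YT p q) {L : ℕ} {M : ℝ} (hM : 0 ≤ M)
    (H1 : L ≤ rl q 0 → Ent (trn q L) ≤ M) (H2 : 2 * rl q 1 ≤ rl q 0 → Ent (two q) ≤ M) (hL1 : 1 ≤ L) :
    (∑ x ∈ Finset.univ.filter (fun x => q x ≠ 0 ∧ L ≤ rl q (q x)), wv q x ≤ M) ∧
    (((Finset.univ.filter (fun x => q x ≠ 0 ∧ L ≤ rl q (q x))).card : ℝ) ≤ 2 * M) ∧
    (2 * L ≤ rl q 0 → (rl q 0 : ℝ) * Real.log ((Fintype.card X : ℝ) / rl q 0) ≤ 2 * M) := by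
  have hF1 : ∑ x ∈ Finset.univ.filter (fun x => q x ≠ 0 ∧ L ≤ rl q (q x)), wv q x ≤ M := by
    by_cases hL : L ≤ rl q 0
    · refine le_trans (le_of_eq ?_) ((sum_le_Ent (trn q L) (Finset.univ.filter (fun x => q x ≠ 0 ∧ L ≤ rl q (q x)))).trans (H1 hL))
      refine Finset.sum_congr rfl fun x hx => ?_
      rw [Finset.mem_filter] at hx
      have h1 : trn q L x = q x := if_pos hx.2.2
      unfold wv
      rw [h1]
      congr 3
      unfold rl
      congr 1
      ext y
      rw [mem_cl, mem_cl]
      constructor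
      · intro hy; rw [trn, hy, if_pos hx.2.2]
      · intro hy
        rw [trn] at hy
        by_cases hh : L ≤ rl q (q y)
        · rwa [if_pos hh] at hy
        · rw [if_neg hh] at hy; exact absurd hy.symm hx.2.1
    · rw [Finset.filter_false_of_mem, Finset.sum_empty]
      · exact hM
      · rintro x _ ⟨_, h2⟩
        exact hL (h2.trans (hT.rl_anti (Nat.zero_le _)))
  have hhalf : ∀ x, q x ≠ 0 → 1 / 2 ≤ wv q x := by
    intro x hx
    refine log_ge_half (by exact_mod_cast rl_pos_of q x) ?_
    exact_mod_cast two_rl_le hT hx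
  refine ⟨hF1, ?_, ?_⟩
  · have : ((Finset.univ.filter (fun x => q x ≠ 0 ∧ L ≤ rl q (q x))).card : ℝ) * (1 / 2) ≤
        ∑ x ∈ Finset.univ.filter (fun x => q x ≠ 0 ∧ L ≤ rl q (q x)), wv q x := by
      rw [← nsmul_eq_mul]
      exact Finset.card_nsmul_le_sum _ _ _ fun x hx => hhalf x (Finset.mem_filter.1 hx).2.1
    linarith
  · intro h2L
    have hpos : 0 < rl q 0 := by omega
    by_cases h2 : 2 * rl q 1 ≤ rl q 0
    · have hh := H2 h2
      have h3 := sum_le_Ent (two q) (cl q 0)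
      have h4 : ∑ x ∈ cl q 0, wv (two q) x = (rl q 0 : ℝ) * Real.log ((Fintype.card X : ℝ) / rl q 0) := by
        have : ∀ x ∈ cl q 0, wv (two q) x = Real.log ((Fintype.card X : ℝ) / rl q 0) := by
          intro x hx
          rw [mem_cl] at hx
          unfold wv
          have h0 : two q x = 0 := if_pos hx
          rw [h0]
          congr 3
          unfold rl; congr 1; ext y; rw [mem_cl, mem_cl, two]
          by_cases hy : q y = 0
          · simp [hy]
          · simp [hy]
        rw [Finset.sum_congr rfl this, Finset.sum_const, nsmul_eq_mul]; rfl
      linarith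
    · push Not at h2
      have hs : cl q 1 ⊆ Finset.univ.filter (fun x => q x ≠ 0 ∧ L ≤ rl q (q x)) := by
        intro x hx
        rw [mem_cl] at hx
        simp only [Finset.mem_filter, Finset.mem_univ, true_and, hx]
        omega
      have h3 : ∑ x ∈ cl q 1, wv q x ≤ M :=
        (Finset.sum_le_sum_of_subset_of_nonneg hs fun x _ _ => wv_nonneg q x).trans hF1
      have h4 : ∑ x ∈ cl q 1, wv q x = (rl q 1 : ℝ) * Real.log ((Fintype.card X : ℝ) / rl q 1) := by
        have : ∀ x ∈ cl q 1, wv q x = Real.log ((Fintype.card X : ℝ) / rl q 1) := by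
          intro x hx
          rw [mem_cl] at hx
          unfold wv; rw [hx]
        rw [Finset.sum_congr rfl this, Finset.sum_const, nsmul_eq_mul]; rfl
      have h1pos : 0 < rl q 1 := by omega
      have h01 : rl q 1 ≤ rl q 0 := hT.rl_anti (Nat.zero_le _)
      have h5 : Real.log ((Fintype.card X : ℝ) / rl q 0) ≤ Real.log ((Fintype.card X : ℝ) / rl q 1) := by
        have hc : (0:ℝ) < Fintype.card X := by exact_mod_cast hpos.trans_le (rl_le_card q 0)
        have h1' : (0:ℝ) < rl q 1 := by exact_mod_cast h1pos
        have h0' : (0:ℝ) < rl q 0 := by exact_mod_cast hpos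
        apply Real.log_le_log (by positivity)
        apply div_le_div_of_nonneg_left hc.le h1'
        exact_mod_cast h01
      have h6 : (0:ℝ) ≤ Real.log ((Fintype.card X : ℝ) / rl q 0) := by
        apply Real.log_nonneg
        rw [one_le_div (by exact_mod_cast hpos)]
        exact_mod_cast rl_le_card q 0
      have h7 : (rl q 0 : ℝ) ≤ 2 * rl q 1 := by exact_mod_cast h2.le
      have h8 : (0:ℝ) ≤ rl q 1 := Nat.cast_nonneg _
      rw [h4] at h3
      nlinarith [mul_le_mul h7 h5 h6 (by positivity)]

lemma two_ent {p q : X → ℕ} (hq0 : 0 < rl q 0) : 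
    ((Fintype.card X : ℝ) - rl q 0) * Real.log ((Fintype.card X : ℝ) / ((Fintype.card X : ℝ) - rl q 0)) ≤ Ent (two q) := by
  have hcard : (((Finset.univ.filter (fun x => q x ≠ 0)).card : ℕ) : ℝ) = (Fintype.card X : ℝ) - rl q 0 := by
    have : (Finset.univ.filter (fun x => q x = 0)).card + (Finset.univ.filter (fun x => ¬ q x = 0)).card = Fintype.card X := by
      rw [Finset.card_filter_add_card_filter_not]; rfl
    have h2 : rl q 0 = (Finset.univ.filter (fun x => q x = 0)).card := by
      unfold rl; congr 1
    rw [h2, ← this]; push_cast; ring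
  refine le_trans (le_of_eq ?_) (sum_le_Ent (two q) (Finset.univ.filter (fun x => q x ≠ 0)))
  have : ∀ x ∈ Finset.univ.filter (fun x => q x ≠ 0), wv (two q) x =
      Real.log ((Fintype.card X : ℝ) / ((Fintype.card X : ℝ) - rl q 0)) := by
    intro x hx
    rw [Finset.mem_filter] at hx
    unfold wv
    have h0 : two q x = 1 := if_neg hx.2
    rw [h0, ← hcard]
    congr 3
    unfold rl; congr 1; ext y
    rw [mem_cl, two]
    by_cases hy : q y = 0
    · simp [hy]
    · simp [hy]
  rw [Finset.sum_congr rfl this, Finset.sum_const, nsmul_eq_mul, hcard]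

/-- size of the chosen block -/
def sz (p q : X → ℕ) (L : ℕ) (x : X) : ℕ :=
  if 2 * L ≤ rl q (q x) then rl q (q x) else if 2 * L ≤ rl p (p x) then rl p (p x) else 1

lemma sum_row0 (q : X → ℕ) : ∑ x ∈ cl q 0, wv q x = (rl q 0 : ℝ) * Real.log ((Fintype.card X : ℝ) / rl q 0) := by
  have : ∀ x ∈ cl q 0, wv q x = Real.log ((Fintype.card X : ℝ) / rl q 0) := by
    intro x hx
    rw [mem_cl] at hx
    unfold wv; rw [hx]
  rw [Finset.sum_congr rfl this, Finset.sum_const, nsmul_eq_mul]; rfl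

lemma sum_long {p q : X → ℕ} (hT : YT p q) {L : ℕ} {M : ℝ} (hM : 0 ≤ M)
    (H1 : L ≤ rl q 0 → Ent (trn q L) ≤ M) (H2 : 2 * rl q 1 ≤ rl q 0 → Ent (two q) ≤ M) (hL1 : 1 ≤ L) :
    ∑ x ∈ Finset.univ.filter (fun x => 2 * L ≤ rl q (q x)), wv q x ≤ 3 * M := by
  obtain ⟨h1, h2, h3⟩ := row_facts hT hM H1 H2 hL1
  by_cases hlong : 2 * L ≤ rl q 0
  · have hs : Finset.univ.filter (fun x => 2 * L ≤ rl q (q x)) ⊆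
        cl q 0 ∪ Finset.univ.filter (fun x => q x ≠ 0 ∧ L ≤ rl q (q x)) := by
      intro x hx
      rw [Finset.mem_filter] at hx
      rw [Finset.mem_union, mem_cl, Finset.mem_filter]
      by_cases h : q x = 0
      · exact Or.inl h
      · exact Or.inr ⟨Finset.mem_univ _, h, by omega⟩
    refine (Finset.sum_le_sum_of_subset_of_nonneg hs fun x _ _ => wv_nonneg q x).trans ?_
    rw [Finset.sum_union, sum_row0]
    · linarith [h3 hlong]
    · rw [Finset.disjoint_left]; intro y hy hy'
      rw [mem_cl] at hy
      rw [Finset.mem_filter] at hy'; exact hy'.2.1 hy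
  · rw [Finset.filter_false_of_mem, Finset.sum_empty]
    · linarith
    · intro x _ h2
      exact hlong (h2.trans (hT.rl_anti (Nat.zero_le _)))

lemma fin_row {q : X → ℕ} {M e : ℝ} (H2 : 2 * rl q 1 ≤ rl q 0 → Ent (two q) ≤ M) (he : 0 < e)
    (hle : e ≤ (Fintype.card X : ℝ) - rl q 0) (hs : (Fintype.card X : ℝ) - rl q 0 ≤ (Fintype.card X : ℝ) ^ (3 / 4 : ℝ))
    (hnum2 : (Fintype.card X : ℝ) ^ (3 / 4 : ℝ) ≤ (Fintype.card X : ℝ) / 4) (hn8 : 8 ≤ Fintype.card X) :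
    e * Real.log (Fintype.card X) / 4 ≤ M := by
  have hn : (8:ℝ) ≤ Fintype.card X := by exact_mod_cast hn8
  have hadd : rl q 1 + rl q 0 ≤ Fintype.card X := by
    unfold rl
    rw [← Finset.card_union_of_disjoint]
    · exact Finset.card_le_univ _
    · rw [Finset.disjoint_left]; intro y hy hy'
      rw [mem_cl] at hy hy'; omega
  have hadd' : (rl q 1 : ℝ) + rl q 0 ≤ Fintype.card X := by exact_mod_cast hadd
  have h2 : 2 * rl q 1 ≤ rl q 0 := by
    have : (2:ℝ) * rl q 1 ≤ rl q 0 := by linarith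
    exact_mod_cast this
  have h0 : 0 < rl q 0 := by
    have : (0:ℝ) < rl q 0 := by linarith
    exact_mod_cast this
  have h3 := (two_ent h0 (p := q)).trans (H2 h2)
  refine le_trans ?_ h3
  set ℓ := (Fintype.card X : ℝ) - rl q 0
  have hl : 0 < ℓ := by linarith
  have h4 : Real.log (Fintype.card X) / 4 ≤ Real.log ((Fintype.card X : ℝ) / ℓ) := by
    rw [Real.log_div (by positivity) hl.ne']
    have h5 : Real.log ℓ ≤ Real.log ((Fintype.card X : ℝ) ^ (3 / 4 : ℝ)) := Real.log_le_log hl hs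
    rw [Real.log_rpow (by positivity)] at h5
    linarith
  have h6 : 0 ≤ Real.log (Fintype.card X) := Real.log_nonneg (by linarith)
  calc e * Real.log (Fintype.card X) / 4 = e * (Real.log (Fintype.card X) / 4) := by ring
    _ ≤ ℓ * Real.log ((Fintype.card X : ℝ) / ℓ) := mul_le_mul hle h4 (by positivity) hl.le

theorem ent_bound {p q : X → ℕ} (hT : YT p q) {L : ℕ} {M : ℝ} (hM : 0 ≤ M) (hL1 : 1 ≤ L)
    (H1 : L ≤ rl q 0 → Ent (trn q L) ≤ M) (H2 : 2 * rl q 1 ≤ rl q 0 → Ent (two q) ≤ M)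
    (H3 : L ≤ rl p 0 → Ent (trn p L) ≤ M) (H4 : 2 * rl p 1 ≤ rl p 0 → Ent (two p) ≤ M)
    (hnum : 2 * ((2 * (L:ℝ)) ^ 2 * Real.log (Fintype.card X)) ≤ (Fintype.card X : ℝ) ^ (3 / 4 : ℝ))
    (hnum2 : (Fintype.card X : ℝ) ^ (3 / 4 : ℝ) ≤ (Fintype.card X : ℝ) / 4) (hn8 : 8 ≤ Fintype.card X) :
    (∑ x, Real.log ((Fintype.card X : ℝ) / sz p q L x) +
      ((Finset.univ.filter (fun x => 2 * L ≤ rl q (q x) ∧ 2 * L ≤ rl p (p x))).card : ℝ) ≤ 200 * M) ∧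
    (2 * rl q 0 ≤ Fintype.card X + 1 → 2 * rl p 0 ≤ Fintype.card X + 1 → (Fintype.card X : ℝ) ≤ 200 * M) := by
  obtain ⟨n, hnN⟩ : ∃ n : ℕ, n = Fintype.card X := ⟨_, rfl⟩
  have hn : (8:ℝ) ≤ Fintype.card X := by exact_mod_cast hn8
  obtain ⟨fa1, fa2, fa3⟩ := row_facts hT hM H1 H2 hL1
  obtain ⟨fb1, fb2, fb3⟩ := row_facts hT.flip hM H3 H4 hL1
  have sa := sum_long hT hM H1 H2 hL1
  have sb := sum_long hT.flip hM H3 H4 hL1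
  set E := Finset.univ.filter (fun x => ¬ 2 * L ≤ rl q (q x) ∧ ¬ 2 * L ≤ rl p (p x)) with hE
  have hlogn : 0 ≤ Real.log (Fintype.card X) := Real.log_nonneg (by linarith)
  -- size of E
  have hEc : (E.card : ℝ) ≤ (2 * (L:ℝ)) ^ 2 := by
    have : E.card ≤ ((Finset.range (2 * L)) ×ˢ (Finset.range (2 * L))).card := by
      refine Finset.card_le_card_of_injOn (fun x => (p x, q x)) ?_ ?_
      · intro x hx
        have hx' := (Finset.mem_filter.1 hx).2
        have h1 := hT.col_lt x
        have h2 := hT.flip.col_lt x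
        simp only [Finset.coe_product, Set.mem_prod, Finset.mem_coe, Finset.mem_range]
        omega
      · intro x _ y _ hxy
        exact hT.1 x y (congrArg Prod.fst hxy) (congrArg Prod.snd hxy)
    rw [Finset.card_product, Finset.card_range] at this
    have : (E.card : ℝ) ≤ ((2 * L * (2 * L) : ℕ) : ℝ) := by exact_mod_cast this
    push_cast at this
    linarith
  have hElog : (E.card : ℝ) * Real.log (Fintype.card X) ≤ (2 * (L:ℝ)) ^ 2 * Real.log (Fintype.card X) :=
    mul_le_mul_of_nonneg_right hEc hlogn
  -- pointwise sum
  have hsum : ∑ x, Real.log ((Fintype.card X : ℝ) / sz p q L x) ≤ 3 * M + 3 * M + E.card * Real.log (Fintype.card X) := by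
    have hpt : ∀ x, Real.log ((Fintype.card X : ℝ) / sz p q L x) ≤
        ((if 2 * L ≤ rl q (q x) then wv q x else 0) + (if 2 * L ≤ rl p (p x) then wv p x else 0)) +
        (if ¬ 2 * L ≤ rl q (q x) ∧ ¬ 2 * L ≤ rl p (p x) then Real.log (Fintype.card X) else 0) := by
      intro x
      have := wv_nonneg q x
      have := wv_nonneg p x
      unfold sz
      by_cases h1 : 2 * L ≤ rl q (q x) <;> by_cases h2 : 2 * L ≤ rl p (p x)
      · simp only [h1, h2, if_true, not_true, false_and, if_false]
        change wv q x ≤ _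
        linarith
      · simp only [h1, h2, if_true, not_true, false_and, if_false]
        change wv q x ≤ _
        linarith
      · simp only [h1, h2, if_true, not_true, and_false, if_false]
        change wv p x ≤ _
        linarith
      · simp [h1, h2]
    refine (Finset.sum_le_sum fun x _ => hpt x).trans ?_
    rw [Finset.sum_add_distrib, Finset.sum_add_distrib, ← Finset.sum_filter, ← Finset.sum_filter, ← Finset.sum_filter,
      Finset.sum_const, nsmul_eq_mul]
    linarith
  -- corner
  have hcorner : rl q 0 + rl p 0 ≤ Fintype.card X + 1 := by
    have h1 := Finset.card_union_add_card_inter (cl q 0) (cl p 0)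
    have h2 : (cl q 0 ∪ cl p 0).card ≤ Fintype.card X := Finset.card_le_univ _
    have h3 : (cl q 0 ∩ cl p 0).card ≤ 1 := by
      rw [Finset.card_le_one]
      intro a ha b hb
      rw [Finset.mem_inter, mem_cl, mem_cl] at ha hb
      exact hT.1 a b (by omega) (by omega)
    unfold rl; omega
  have hhalf : ∀ m : ℕ, 0 < m → 2 * m ≤ Fintype.card X + 1 → (m:ℝ) * Real.log ((Fintype.card X : ℝ) / m) ≤ 2 * M → (m:ℝ) ≤ 4 * M := by
    intro m hm h2 h3
    have hm' : (0:ℝ) < m := by exact_mod_cast hm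
    have h2' : (2:ℝ) * m ≤ Fintype.card X + 1 := by exact_mod_cast h2
    have h4 : (1:ℝ) / 2 ≤ Real.log ((Fintype.card X : ℝ) / m) := by
      have h5 : (16 / 9 : ℝ) ≤ (Fintype.card X : ℝ) / m := by
        rw [le_div_iff₀ hm']; linarith
      have h6 := Real.one_sub_inv_le_log_of_pos (show (0:ℝ) < 4 / 3 by norm_num)
      have h7 : Real.log (16 / 9) = 2 * Real.log (4 / 3) := by
        rw [show (16 / 9 : ℝ) = (4 / 3) ^ 2 by norm_num, Real.log_pow]; norm_num
      have h8 := Real.log_le_log (by norm_num) h5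
      norm_num at h6
      linarith
    nlinarith
  set A : ℝ := if 2 * L ≤ rl q 0 then (rl q 0 : ℝ) else 0 with hA
  set B : ℝ := if 2 * L ≤ rl p 0 then (rl p 0 : ℝ) else 0 with hB
  have hcount : (Fintype.card X : ℝ) ≤ A + B + 4 * M + E.card := by
    have hcov : (Finset.univ : Finset X) ⊆ (((if 2 * L ≤ rl q 0 then cl q 0 else ∅) ∪ (if 2 * L ≤ rl p 0 then cl p 0 else ∅)) ∪
        (Finset.univ.filter (fun x => q x ≠ 0 ∧ L ≤ rl q (q x)) ∪ Finset.univ.filter (fun x => p x ≠ 0 ∧ L ≤ rl p (p x)))) ∪ E := by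
      intro x _
      simp only [Finset.mem_union, Finset.mem_filter, Finset.mem_univ, true_and, hE]
      by_cases h1 : 2 * L ≤ rl q (q x)
      · by_cases h0 : q x = 0
        · left; left; left
          rw [h0] at h1
          rw [if_pos h1, mem_cl]; exact h0
        · left; right; left; exact ⟨h0, by omega⟩
      · by_cases h2 : 2 * L ≤ rl p (p x)
        · by_cases h0 : p x = 0
          · left; left; right
            rw [h0] at h2
            rw [if_pos h2, mem_cl]; exact h0
          · left; right; right; exact ⟨h0, by omega⟩
        · right; exact ⟨h1, h2⟩
    have hc1 := Finset.card_le_card hcov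
    have hc2 := hc1.trans (Finset.card_union_le _ _)
    have hc3 := hc2.trans (Nat.add_le_add_right (Finset.card_union_le _ _) _)
    have hc4 := hc3.trans (Nat.add_le_add_right (Nat.add_le_add (Finset.card_union_le _ _) (Finset.card_union_le _ _)) _)
    have hA' : (((if 2 * L ≤ rl q 0 then cl q 0 else ∅ : Finset X).card : ℕ) : ℝ) = A := by
      rw [hA]; split_ifs <;> simp [rl]
    have hB' : (((if 2 * L ≤ rl p 0 then cl p 0 else ∅ : Finset X).card : ℕ) : ℝ) = B := by
      rw [hB]; split_ifs <;> simp [rl]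
    rw [Finset.card_univ] at hc4
    have hc5 := (Nat.cast_le (α := ℝ)).2 hc4
    push_cast at hc5
    rw [hA', hB'] at hc5
    linarith
  have hAB : (A ≤ 4 * M ∨ B ≤ 4 * M) ∧ (2 * L ≤ rl q 0 → 2 * L ≤ rl p 0 → 1 ≤ 4 * M) := by
    by_cases h1 : 2 * L ≤ rl q 0
    · by_cases h2 : 2 * L ≤ rl p 0
      · rw [hA, hB, if_pos h1, if_pos h2]
        have e1 : (1:ℝ) ≤ rl q 0 := by exact_mod_cast (by omega : 1 ≤ rl q 0)
        have e2 : (1:ℝ) ≤ rl p 0 := by exact_mod_cast (by omega : 1 ≤ rl p 0)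
        by_cases hle : rl q 0 ≤ rl p 0
        · have := hhalf (rl q 0) (by omega) (by omega) (fa3 h1)
          exact ⟨Or.inl this, fun _ _ => by linarith⟩
        · have := hhalf (rl p 0) (by omega) (by omega) (fb3 h2)
          exact ⟨Or.inr this, fun _ _ => by linarith⟩
      · exact ⟨Or.inr (by rw [hB, if_neg h2]; linarith), fun _ h => absurd h h2⟩
    · exact ⟨Or.inl (by rw [hA, if_neg h1]; linarith), fun h => absurd h h1⟩
  have hA0 : A ≤ rl q 0 := by
    rw [hA]; split_ifs
    · exact le_rfl
    · exact Nat.cast_nonneg _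
  have hB0 : B ≤ rl p 0 := by
    rw [hB]; split_ifs
    · exact le_rfl
    · exact Nat.cast_nonneg _
  have hlog2 : 2 ≤ Real.log (Fintype.card X) := by
    have h1 : Real.log 8 ≤ Real.log (Fintype.card X) := Real.log_le_log (by norm_num) hn
    have h2 : Real.log 8 = 3 * Real.log 2 := by
      rw [show (8:ℝ) = 2 ^ 3 by norm_num, Real.log_pow]; norm_num
    have := Real.log_two_gt_d9
    linarith
  have hEfin : (E.card : ℝ) * Real.log (Fintype.card X) ≤ 100 * M := by
    by_contra hcon
    push Not at hcon
    have hEpos : (0:ℝ) < E.card := by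
      by_contra h
      have : (E.card : ℝ) = 0 := le_antisymm (not_lt.1 h) (Nat.cast_nonneg _)
      rw [this, zero_mul] at hcon
      linarith
    have he2 : 2 * (E.card : ℝ) ≤ E.card * Real.log (Fintype.card X) := by nlinarith
    have hsmall : 8 * M + E.card ≤ (Fintype.card X : ℝ) ^ (3 / 4 : ℝ) := by linarith
    have hfin : (E.card : ℝ) * Real.log (Fintype.card X) / 4 ≤ M := by
      rcases hAB.1 with h | h
      · have hlong : 2 * L ≤ rl p 0 := by
          by_contra hh
          rw [hB, if_neg hh] at hcount
          linarith
        refine fin_row H4 hEpos ?_ (by linarith) hnum2 hn8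
        have : E.card + rl p 0 ≤ Fintype.card X := by
          unfold rl
          rw [← Finset.card_union_of_disjoint]
          · exact Finset.card_le_univ _
          · rw [Finset.disjoint_left]; intro y hy hy'
            rw [mem_cl] at hy'
            have := (Finset.mem_filter.1 hy).2.2
            rw [hy'] at this; exact this hlong
        have : (E.card : ℝ) + rl p 0 ≤ Fintype.card X := by exact_mod_cast this
        linarith
      · have hlong : 2 * L ≤ rl q 0 := by
          by_contra hh
          rw [hA, if_neg hh] at hcount
          linarith
        refine fin_row H2 hEpos ?_ (by linarith) hnum2 hn8
        have : E.card + rl q 0 ≤ Fintype.card X := by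
          unfold rl
          rw [← Finset.card_union_of_disjoint]
          · exact Finset.card_le_univ _
          · rw [Finset.disjoint_left]; intro y hy hy'
            rw [mem_cl] at hy'
            have := (Finset.mem_filter.1 hy).2.1
            rw [hy'] at this; exact this hlong
        have : (E.card : ℝ) + rl q 0 ≤ Fintype.card X := by exact_mod_cast this
        linarith
    linarith
  constructor
  · have hov : ((Finset.univ.filter (fun x => 2 * L ≤ rl q (q x) ∧ 2 * L ≤ rl p (p x))).card : ℝ) ≤ 8 * M := by
      have hcov : Finset.univ.filter (fun x => 2 * L ≤ rl q (q x) ∧ 2 * L ≤ rl p (p x)) ⊆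
        (Finset.univ.filter (fun x => q x ≠ 0 ∧ L ≤ rl q (q x)) ∪ Finset.univ.filter (fun x => p x ≠ 0 ∧ L ≤ rl p (p x))) ∪
        Finset.univ.filter (fun x => (q x = 0 ∧ p x = 0) ∧ (2 * L ≤ rl q 0 ∧ 2 * L ≤ rl p 0)) := by
        intro x hx
        simp only [Finset.mem_union, Finset.mem_filter, Finset.mem_univ, true_and] at hx ⊢
        by_cases h1 : q x = 0
        · by_cases h2 : p x = 0
          · right; rw [h1, h2] at hx; exact ⟨⟨h1, h2⟩, hx⟩
          · left; right; exact ⟨h2, by omega⟩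
        · left; left; exact ⟨h1, by omega⟩
      have hc2 := (Finset.card_le_card hcov).trans (Finset.card_union_le _ _)
      have hc3 := hc2.trans (Nat.add_le_add_right (Finset.card_union_le _ _) _)
      have hlast : ((Finset.univ.filter (fun x => (q x = 0 ∧ p x = 0) ∧ (2 * L ≤ rl q 0 ∧ 2 * L ≤ rl p 0))).card : ℝ) ≤ 4 * M := by
        by_cases hb : 2 * L ≤ rl q 0 ∧ 2 * L ≤ rl p 0
        · refine le_trans ?_ (hAB.2 hb.1 hb.2)
          have : (Finset.univ.filter (fun x => (q x = 0 ∧ p x = 0) ∧ (2 * L ≤ rl q 0 ∧ 2 * L ≤ rl p 0))).card ≤ 1 := by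
            rw [Finset.card_le_one]
            intro a ha b hb
            rw [Finset.mem_filter] at ha hb
            exact hT.1 a b (by omega) (by omega)
          exact_mod_cast this
        · rw [Finset.filter_false_of_mem]
          · simpa using hM
          · rintro x _ ⟨_, h⟩; exact hb h
      have hc4 := (Nat.cast_le (α := ℝ)).2 hc3
      push_cast at hc4
      linarith
    linarith
  · intro hq hp
    have hA4 : A ≤ 4 * M := by
      by_cases h1 : 2 * L ≤ rl q 0
      · rw [hA, if_pos h1]; exact hhalf _ (by omega) hq (fa3 h1)
      · rw [hA, if_neg h1]; linarith
    have hB4 : B ≤ 4 * M := by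
      by_cases h1 : 2 * L ≤ rl p 0
      · rw [hB, if_pos h1]; exact hhalf _ (by omega) hp (fb3 h1)
      · rw [hB, if_neg h1]; linarith
    have : (E.card : ℝ) ≤ E.card * Real.log (Fintype.card X) := by
      have : (0:ℝ) ≤ E.card := Nat.cast_nonneg _
      nlinarith
    linarith
end ent
end McKayGraphs

open scoped BigOperators
namespace McKayGraphs
open Equiv
variable {X : Type*} [Fintype X] [DecidableEq X]

lemma stc_lower {β : Type*} [DecidableEq β] (κ : X → β) (w : β → ℝ) (hw : ∀ b, 0 ≤ w b)
    (hs : ∑ b ∈ Finset.univ.image κ, w b ≤ 1) :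
    ((Fintype.card X).factorial : ℝ) * ∏ x, w (κ x) ≤ stc κ := by
  classical
  set S := Finset.univ.image κ with hS
  have h1 : ∑ f ∈ Fintype.piFinset (fun _ : X => S), ∏ x, w (f x) ≤ 1 := by
    rw [← Finset.prod_univ_sum (fun _ : X => S) (fun _ b => w b)]
    exact Finset.prod_le_one (fun _ _ => Finset.sum_nonneg (fun b _ => hw b)) (fun _ _ => hs)
  have h2 : ∑ g : Perm X, ∏ x, w (κ (g x)) = ((Fintype.card X).factorial : ℝ) * ∏ x, w (κ x) := by
    have : ∀ g : Perm X, ∏ x, w (κ (g x)) = ∏ x, w (κ x) := fun g => Equiv.prod_comp g (fun x => w (κ x))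
    rw [Finset.sum_congr rfl (fun g _ => this g), Finset.sum_const, Finset.card_univ, Fintype.card_perm,
      nsmul_eq_mul]
  rw [← h2]
  have h3 : ∑ g : Perm X, ∏ x, w (κ (g x)) =
      ∑ f ∈ Fintype.piFinset (fun _ : X => S), ∑ g ∈ Finset.univ.filter (fun g : Perm X => κ ∘ g = f), ∏ x, w (κ (g x)) := by
    rw [Finset.sum_fiberwise_of_maps_to (g := fun g : Perm X => κ ∘ g)]
    intro g _
    rw [Fintype.mem_piFinset]
    intro x
    exact Finset.mem_image_of_mem _ (Finset.mem_univ _)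
  rw [h3]
  calc _ ≤ ∑ f ∈ Fintype.piFinset (fun _ : X => S), (stc κ : ℝ) * ∏ x, w (f x) := by
        refine Finset.sum_le_sum (fun f _ => ?_)
        have : ∀ g ∈ Finset.univ.filter (fun g : Perm X => κ ∘ g = f), ∏ x, w (κ (g x)) = ∏ x, w (f x) := by
          intro g hg
          rw [Finset.mem_filter] at hg
          rw [← hg.2]; rfl
        rw [Finset.sum_congr rfl this, Finset.sum_const, nsmul_eq_mul, cnt f κ]
        refine mul_le_mul_of_nonneg_right ?_ (Finset.prod_nonneg (fun _ _ => hw _))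
        split_ifs <;> simp
    _ = (stc κ : ℝ) * ∑ f ∈ Fintype.piFinset (fun _ : X => S), ∏ x, w (f x) := by rw [Finset.mul_sum]
    _ ≤ (stc κ : ℝ) * 1 := mul_le_mul_of_nonneg_left h1 (by positivity)
    _ = _ := mul_one _

/-- the colouring: long row, else long column, else unique -/
def kap (p q : X → ℕ) (L : ℕ) (x : X) : ℕ ⊕ (ℕ ⊕ X) :=
  if 2 * L ≤ rl q (q x) then Sum.inl (q x) else if 2 * L ≤ rl p (p x) then Sum.inr (Sum.inl (p x))
  else Sum.inr (Sum.inr x)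

noncomputable def wtk (p q : X → ℕ) (T : ℝ) : ℕ ⊕ (ℕ ⊕ X) → ℝ
  | Sum.inl i => rl q i / T
  | Sum.inr (Sum.inl j) => rl p j / T
  | Sum.inr (Sum.inr _) => 1 / T

lemma sum_rl_image (q : X → ℕ) (P : ℕ → Prop) [DecidablePred P] :
    ∑ i ∈ (Finset.univ.filter (fun x => P (q x))).image q, (rl q i : ℝ) =
      (Finset.univ.filter (fun x => P (q x))).card := by
  rw [Finset.card_eq_sum_card_image q (Finset.univ.filter (fun x => P (q x)))]
  push_cast
  refine Finset.sum_congr rfl (fun i hi => ?_)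
  congr 1
  unfold rl cl
  congr 1
  obtain ⟨x, hx, rfl⟩ := Finset.mem_image.1 hi
  ext y
  simp only [Finset.mem_filter, Finset.mem_univ, true_and]
  constructor
  · intro h; refine ⟨?_, h⟩
    rw [h]; exact (Finset.mem_filter.1 hx).2
  · exact fun h => h.2

lemma log_stc (p q : X → ℕ) (L : ℕ) (hn : 0 < Fintype.card X) :
    Real.log (((Fintype.card X).factorial : ℝ) / stc (kap p q L)) ≤
      ∑ x, Real.log ((Fintype.card X : ℝ) / sz p q L x) +
        ((Finset.univ.filter (fun x => 2 * L ≤ rl q (q x) ∧ 2 * L ≤ rl p (p x))).card : ℝ) := by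
  classical
  set n := Fintype.card X with hnn
  set ov := (Finset.univ.filter (fun x => 2 * L ≤ rl q (q x) ∧ 2 * L ≤ rl p (p x))).card with hov
  have hn0 : (0:ℝ) < n := by exact_mod_cast hn
  set T : ℝ := n + ov with hT
  have hT0 : 0 < T := by positivity
  have hwn : ∀ b : ℕ ⊕ (ℕ ⊕ X), 0 ≤ wtk p q T b := by
    rintro (i | j | x) <;> (simp only [wtk]; positivity)
  have hwk : ∀ x, wtk p q T (kap p q L x) = sz p q L x / T := by
    intro x
    unfold kap sz
    by_cases h1 : 2 * L ≤ rl q (q x)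
    · rw [if_pos h1, if_pos h1]; rfl
    · rw [if_neg h1, if_neg h1]
      by_cases h2 : 2 * L ≤ rl p (p x)
      · rw [if_pos h2, if_pos h2]; rfl
      · rw [if_neg h2, if_neg h2]; simp [wtk]
  have hsz : ∀ x, (0:ℝ) < sz p q L x := by
    intro x
    have := rl_pos_of q x
    have := rl_pos_of p x
    unfold sz
    split_ifs <;> simpa
  have hsum : ∑ b ∈ Finset.univ.image (kap p q L), wtk p q T b ≤ 1 := by
    set A := Finset.univ.filter (fun x => 2 * L ≤ rl q (q x)) with hA
    set B := Finset.univ.filter (fun x => 2 * L ≤ rl p (p x)) with hB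
    set E := Finset.univ.filter (fun x => ¬ (2 * L ≤ rl q (q x) ∨ 2 * L ≤ rl p (p x))) with hE
    have hsub : Finset.univ.image (kap p q L) ⊆ (A.image q).image Sum.inl ∪
        ((B.image p).image (fun j => Sum.inr (Sum.inl j)) ∪ E.image (fun x => Sum.inr (Sum.inr x))) := by
      intro b hb
      obtain ⟨x, -, rfl⟩ := Finset.mem_image.1 hb
      rw [Finset.mem_union, Finset.mem_union]
      unfold kap
      by_cases h1 : 2 * L ≤ rl q (q x)
      · rw [if_pos h1]; left
        exact Finset.mem_image_of_mem _ (Finset.mem_image_of_mem _ (Finset.mem_filter.2 ⟨Finset.mem_univ _, h1⟩))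
      · rw [if_neg h1]
        by_cases h2 : 2 * L ≤ rl p (p x)
        · rw [if_pos h2]; right; left
          exact Finset.mem_image_of_mem (fun j => Sum.inr (Sum.inl j)) (Finset.mem_image_of_mem _ (Finset.mem_filter.2 ⟨Finset.mem_univ _, h2⟩))
        · rw [if_neg h2]; right; right
          exact Finset.mem_image_of_mem (fun x => Sum.inr (Sum.inr x)) (Finset.mem_filter.2 ⟨Finset.mem_univ _, by tauto⟩)
    have e1 : ∑ b ∈ (A.image q).image (Sum.inl : ℕ → ℕ ⊕ (ℕ ⊕ X)), wtk p q T b = A.card / T := by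
      rw [Finset.sum_image (by intro a _ b _ h; exact Sum.inl.inj h), hA, ← sum_rl_image q (fun i => 2 * L ≤ rl q i), Finset.sum_div]
      rfl
    have e2 : ∑ b ∈ (B.image p).image (fun j => (Sum.inr (Sum.inl j) : ℕ ⊕ (ℕ ⊕ X))), wtk p q T b = B.card / T := by
      rw [Finset.sum_image (by intro a _ b _ h; exact Sum.inl.inj (Sum.inr.inj h)), hB, ← sum_rl_image p (fun i => 2 * L ≤ rl p i), Finset.sum_div]
      rfl
    have e3 : ∑ b ∈ E.image (fun x => (Sum.inr (Sum.inr x) : ℕ ⊕ (ℕ ⊕ X))), wtk p q T b = E.card / T := by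
      rw [Finset.sum_image (by intro a _ b _ h; exact Sum.inr.inj (Sum.inr.inj h))]
      simp only [wtk]
      rw [Finset.sum_const, nsmul_eq_mul]; ring
    have hcard : A.card + B.card + E.card = n + ov := by
      have a1 := Finset.card_union_add_card_inter A B
      have a2 : (A ∪ B).card + E.card = n := by
        rw [hA, hB, ← Finset.filter_or, hE, hnn, ← Finset.card_univ]
        exact Finset.card_filter_add_card_filter_not _
      have a3 : (A ∩ B).card = ov := by rw [hA, hB, ← Finset.filter_and]
      omega
    have hcard' : (A.card : ℝ) + B.card + E.card = T := by rw [hT]; exact_mod_cast hcard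
    have hun : ∀ S S' : Finset (ℕ ⊕ (ℕ ⊕ X)), ∑ b ∈ S ∪ S', wtk p q T b ≤ ∑ b ∈ S, wtk p q T b + ∑ b ∈ S', wtk p q T b := by
      intro S S'
      rw [← Finset.sum_union_inter]
      have := Finset.sum_nonneg (fun b (_ : b ∈ S ∩ S') => hwn b)
      linarith
    calc _ ≤ _ := Finset.sum_le_sum_of_subset_of_nonneg hsub (fun b _ _ => hwn b)
      _ ≤ A.card / T + (B.card / T + E.card / T) := by
          rw [← e1, ← e2, ← e3]
          exact (hun _ _).trans (add_le_add le_rfl (hun _ _))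
      _ = 1 := by rw [← add_div, ← add_div, ← add_assoc, hcard', div_self hT0.ne']
  have hmain := stc_lower (kap p q L) (wtk p q T) hwn hsum
  rw [Finset.prod_congr rfl (fun x _ => hwk x)] at hmain
  have hstc : (0:ℝ) < stc (kap p q L) := by exact_mod_cast stc_pos _
  have hP : 0 < ∏ x, ((sz p q L x : ℝ) / T) := Finset.prod_pos (fun x _ => div_pos (hsz x) hT0)
  have h1 : (n.factorial : ℝ) / stc (kap p q L) ≤ ∏ x, (T / sz p q L x) := by
    rw [div_le_iff₀ hstc]
    have : (∏ x, (T / sz p q L x)) * ∏ x, ((sz p q L x : ℝ) / T) = 1 := by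
      rw [← Finset.prod_mul_distrib]
      exact Finset.prod_eq_one (fun x _ => by have := (hsz x).ne'; field_simp)
    have hQ : 0 < ∏ x, (T / sz p q L x) := Finset.prod_pos (fun x _ => div_pos hT0 (hsz x))
    have := mul_le_mul_of_nonneg_left hmain hQ.le
    nlinarith
  have hf : (0:ℝ) < n.factorial := by exact_mod_cast n.factorial_pos
  refine (Real.log_le_log (by positivity) h1).trans ?_
  rw [Real.log_prod (fun x _ => (div_pos hT0 (hsz x)).ne')]
  have h2 : ∀ x, Real.log (T / sz p q L x) ≤ Real.log ((n:ℝ) / sz p q L x) + ov / n := by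
    intro x
    have : T / sz p q L x = ((n:ℝ) / sz p q L x) * (1 + ov / n) := by
      have := (hsz x).ne'
      rw [hT]; field_simp
    rw [this, Real.log_mul (by have := hsz x; positivity) (by positivity)]
    have := Real.log_le_sub_one_of_pos (show (0:ℝ) < 1 + ov / n by positivity)
    linarith
  refine (Finset.sum_le_sum (fun x _ => h2 x)).trans ?_
  rw [Finset.sum_add_distrib, Finset.sum_const, Finset.card_univ, nsmul_eq_mul, ← hnn]
  have : (n:ℝ) * (ov / n) = ov := by field_simp
  rw [this]

lemma kap_split {p q : X → ℕ} {L : ℕ} {y : Perm X} (hy : kap p q L ∘ y = kap p q L) :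
    ∃ c r : Perm X, y = c * r ∧ p ∘ c = p ∧ q ∘ r = q ∧
      (∀ x, 2 * L ≤ rl q (q x) → c x = x) ∧ (∀ x, ¬ 2 * L ≤ rl q (q x) → r x = x) ∧
      (∀ x, 2 * L ≤ rl q (q x) → 2 * L ≤ rl q (q (r x))) ∧
      (∀ x, ¬ 2 * L ≤ rl q (q x) → ¬ 2 * L ≤ rl q (q (c x))) := by
  classical
  have hy' : ∀ x, kap p q L (y x) = kap p q L x := fun x => congrFun hy x
  have hiff : ∀ x, 2 * L ≤ rl q (q (y x)) ↔ 2 * L ≤ rl q (q x) := by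
    intro x
    have := hy' x
    unfold kap at this
    constructor
    · intro h; by_contra h'
      rw [if_pos h, if_neg h'] at this
      split_ifs at this
    · intro h; by_contra h'
      rw [if_pos h, if_neg h'] at this
      split_ifs at this
  have hiff' : ∀ x, ¬ 2 * L ≤ rl q (q (y x)) ↔ ¬ 2 * L ≤ rl q (q x) := fun x => not_congr (hiff x)
  set r := Perm.ofSubtype (y.subtypePerm (p := fun x => 2 * L ≤ rl q (q x)) hiff) with hr
  set c := Perm.ofSubtype (y.subtypePerm (p := fun x => ¬ 2 * L ≤ rl q (q x)) hiff') with hc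
  have r1 : ∀ x, 2 * L ≤ rl q (q x) → r x = y x := fun x hx => Perm.ofSubtype_apply_of_mem (y.subtypePerm (p := fun x => 2 * L ≤ rl q (q x)) hiff) hx
  have r2 : ∀ x, ¬ 2 * L ≤ rl q (q x) → r x = x := fun x hx => Perm.ofSubtype_apply_of_not_mem (y.subtypePerm (p := fun x => 2 * L ≤ rl q (q x)) hiff) hx
  have c1 : ∀ x, ¬ 2 * L ≤ rl q (q x) → c x = y x := fun x hx => Perm.ofSubtype_apply_of_mem (y.subtypePerm (p := fun x => ¬ 2 * L ≤ rl q (q x)) hiff') hx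
  have c2 : ∀ x, 2 * L ≤ rl q (q x) → c x = x := fun x hx => Perm.ofSubtype_apply_of_not_mem (y.subtypePerm (p := fun x => ¬ 2 * L ≤ rl q (q x)) hiff') (not_not.2 hx)
  refine ⟨c, r, ?_, ?_, ?_, c2, r2, ?_, ?_⟩
  · ext x
    by_cases h : 2 * L ≤ rl q (q x)
    · rw [Perm.mul_apply, r1 x h, c2 _ ((hiff x).2 h)]
    · rw [Perm.mul_apply, r2 x h, c1 x h]
  · funext x
    by_cases h : 2 * L ≤ rl q (q x)
    · simp only [Function.comp, c2 x h]
    · simp only [Function.comp, c1 x h]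
      have := hy' x
      unfold kap at this
      rw [if_neg h, if_neg ((hiff' x).2 h)] at this
      split_ifs at this with h1 h2
      · exact Sum.inl.inj (Sum.inr.inj this)
      · exact absurd (Sum.inr.inj this) (by simp)
      · exact absurd (Sum.inr.inj this) (by simp)
      · rw [Sum.inr.inj (Sum.inr.inj this)]
  · funext x
    by_cases h : 2 * L ≤ rl q (q x)
    · simp only [Function.comp, r1 x h]
      have := hy' x
      unfold kap at this
      rw [if_pos h, if_pos ((hiff x).2 h)] at this
      exact Sum.inl.inj this
    · simp only [Function.comp, r2 x h]
  · intro x h; rw [r1 x h]; exact (hiff x).2 h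
  · intro x h; rw [c1 x h]; exact (hiff' x).2 h

lemma fT_kap_ne {p q : X → ℕ} (hJ : JI p q) {L : ℕ} {y : Perm X} (hy : kap p q L ∘ y = kap p q L) :
    fT p q y * fT p q y = 1 := by
  obtain ⟨c, r, rfl, hc, hr, -⟩ := kap_split hy
  rw [fT_eq hJ hc hr, sg_sq]

lemma fT_kap_mul {p q : X → ℕ} (hJ : JI p q) {L : ℕ} {y z : Perm X} (hy : kap p q L ∘ y = kap p q L)
    (hz : kap p q L ∘ z = kap p q L) : fT p q (y * z) = fT p q y * fT p q z := by
  obtain ⟨c, r, rfl, hc, hr, hc1, hr1, hr2, hc2⟩ := kap_split hy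
  obtain ⟨c', r', rfl, hc', hr', hc1', hr1', hr2', hc2'⟩ := kap_split hz
  have hcomm : r * c' = c' * r := by
    ext x
    by_cases h : 2 * L ≤ rl q (q x)
    · rw [Perm.mul_apply, Perm.mul_apply, hc1' x h, hc1' _ (hr2 x h)]
    · rw [Perm.mul_apply, Perm.mul_apply, hr1 x h, hr1 _ (hc2' x h)]
  have : c * r * (c' * r') = c * (c' * (r * r')) := by
    rw [mul_assoc, ← mul_assoc r, hcomm, mul_assoc]
  rw [this, fT_left hc, fT_eq hJ hc' (comp_mul_of hr hr'), fT_eq hJ hc hr, fT_eq hJ hc' hr']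

end McKayGraphs

open scoped BigOperators
namespace McKayGraphs
open Equiv

lemma descFact_ge (k a : ℕ) (h : a ≤ k) : ((k:ℝ) / Real.exp 1) ^ a ≤ (k.descFactorial a : ℝ) := by
  induction k generalizing a with
  | zero => obtain rfl : a = 0 := by omega
            simp
  | succ k ih =>
    cases a with
    | zero => simp
    | succ a =>
      rw [Nat.succ_descFactorial_succ]
      push_cast
      have hak : a ≤ k := by omega
      have h1 := ih a hak
      have he : 0 < Real.exp 1 := Real.exp_pos 1
      have h2 : ((k:ℝ) + 1) ^ a ≤ Real.exp 1 * (k:ℝ) ^ a := by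
        rcases Nat.eq_zero_or_pos k with rfl | hk
        · obtain rfl : a = 0 := by omega
          simp
        · have hk' : (0:ℝ) < k := by exact_mod_cast hk
          have h3 : ((k:ℝ) + 1) = k * (1 / k + 1) := by field_simp; ring
          rw [h3, mul_pow, mul_comm]
          refine mul_le_mul_of_nonneg_right ?_ (by positivity)
          calc (1 / (k:ℝ) + 1) ^ a ≤ (Real.exp (1 / k)) ^ a :=
                pow_le_pow_left₀ (by positivity) (Real.add_one_le_exp _) _
            _ = Real.exp (a * (1 / k)) := by rw [← Real.exp_nat_mul]
            _ ≤ Real.exp 1 := by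
                apply Real.exp_le_exp.2
                rw [mul_one_div, div_le_one hk']
                exact_mod_cast hak
      calc (((k:ℝ) + 1) / Real.exp 1) ^ (a+1) = ((k:ℝ) + 1) * ((k:ℝ) + 1) ^ a / (Real.exp 1 ^ a * Real.exp 1) := by
            rw [div_pow, pow_succ, pow_succ]; ring
        _ ≤ ((k:ℝ) + 1) * (Real.exp 1 * (k:ℝ) ^ a) / (Real.exp 1 ^ a * Real.exp 1) := by gcongr
        _ = ((k:ℝ) + 1) * ((k:ℝ) / Real.exp 1) ^ a := by rw [div_pow]; field_simp
        _ ≤ _ := by gcongr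

lemma card_fix {Y : Type*} [Fintype Y] [DecidableEq Y] (S : Finset Y) :
    (Finset.univ.filter (fun τ : Perm Y => ∀ t ∈ S, τ t = t)).card = (Fintype.card Y - S.card).factorial := by
  classical
  have h := Fintype.card_congr (Equiv.Perm.subtypeEquivSubtypePerm (fun y : Y => y ∉ S))
  rw [Fintype.card_perm, Fintype.card_subtype] at h
  rw [← Fintype.card_subtype]
  have h2 : Fintype.card {f : Perm Y // ∀ a, ¬ (a ∉ S) → f a = a} = Fintype.card {τ : Perm Y // ∀ t ∈ S, τ t = t} :=
    Fintype.card_congr (Equiv.subtypeEquivRight (fun f => by simp))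
  rw [← h2, ← h]
  congr 1
  rw [Finset.filter_not, Finset.card_sdiff_of_subset (Finset.filter_subset _ _), Finset.card_univ]
  congr 2
  ext; simp

lemma perm_sum_le {Y : Type*} [Fintype Y] [DecidableEq Y] (S : Finset Y) (A : Y → Y → ℕ) :
    ∑ τ : Perm Y, ∏ t ∈ S, A (τ t) t ≤ (Fintype.card Y - S.card).factorial * ∏ t ∈ S, ∑ j, A j t := by
  classical
  have h1 : ∏ t ∈ S, ∑ j, A j t = ∑ f ∈ Fintype.piFinset (fun _ : S => (Finset.univ : Finset Y)), ∏ t : S, A (f t) t := by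
    rw [← Finset.prod_univ_sum (fun _ : S => (Finset.univ : Finset Y)) (fun (t : S) j => A j t)]
    rw [← Finset.prod_coe_sort]
  rw [h1, Fintype.piFinset_univ, Finset.mul_sum]
  rw [← Finset.sum_fiberwise (s := Finset.univ) (g := fun (τ : Perm Y) (t : S) => τ t)]
  refine Finset.sum_le_sum (fun f _ => ?_)
  have h2 : ∀ τ ∈ Finset.univ.filter (fun τ : Perm Y => (fun t : S => τ t) = f),
      ∏ t ∈ S, A (τ t) t = ∏ t : S, A (f t) t := by
    intro τ hτ
    rw [Finset.mem_filter] at hτ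
    rw [← hτ.2, Finset.prod_coe_sort S (fun t => A (τ t) t)]
  rw [Finset.sum_congr rfl h2, Finset.sum_const, smul_eq_mul]
  refine Nat.mul_le_mul_right _ ?_
  by_cases hne : ∃ τ₀ : Perm Y, (fun t : S => τ₀ t) = f
  · obtain ⟨τ₀, h0⟩ := hne
    rw [← card_fix S]
    refine Finset.card_le_card_of_injOn (fun τ => τ₀⁻¹ * τ) ?_ ?_
    · intro τ hτ
      simp only [Finset.coe_filter, Finset.mem_univ, true_and, Set.mem_setOf_eq] at hτ ⊢
      intro t ht
      have := congrFun (hτ.trans h0.symm) ⟨t, ht⟩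
      simp only at this
      rw [Perm.mul_apply, this, ias]
    · intro a _ b _ h; exact mul_left_cancel h
  · rw [Finset.filter_false_of_mem]
    · simp
    · intro τ _ h; exact hne ⟨τ, h⟩

section core
variable {k N : ℕ} [NeZero k] (V : Fin k → Fin N → ℕ)

abbrev Om (k N : ℕ) := (Fin k → Perm (Fin N)) × (Fin N → Perm (Fin k))

def wrd (ω : Om k N) (m : Fin N) (t : Fin k) : ℕ := V (ω.2 m t) (ω.1 (ω.2 m t) m)

def actE (m' : Fin N) (τ : Perm (Fin k)) (z : Fin k → Fin N) : Om k N ≃ Om k N :=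
  Equiv.prodCongr (Equiv.piCongrRight fun j => Equiv.mulRight (swap m' (z j)))
    (Equiv.piCongrRight fun m'' => Equiv.mulRight (if m'' = m' then τ else 1))

lemma wrd_act_ne (ω : Om k N) {m m' : Fin N} (hm : m ≠ m') (τ : Perm (Fin k)) (z : Fin k → Fin N)
    (hz : ∀ j, z j ≠ m) (t : Fin k) : wrd V (actE m' τ z ω) m t = wrd V ω m t := by
  have h1 : (actE m' τ z ω).2 m = ω.2 m := by
    change ω.2 m * (if m = m' then τ else 1) = _
    rw [if_neg hm, mul_one]
  have h2 : ∀ j, (actE m' τ z ω).1 j m = ω.1 j m := by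
    intro j
    change ω.1 j (swap m' (z j) m) = _
    rw [swap_apply_of_ne_of_ne hm (hz j).symm]
  unfold wrd
  rw [h1, h2]

lemma wrd_act_eq (ω : Om k N) (m' : Fin N) (τ : Perm (Fin k)) (z : Fin k → Fin N) (t : Fin k) :
    wrd V (actE m' τ z ω) m' t = V (ω.2 m' (τ t)) (ω.1 (ω.2 m' (τ t)) (z (ω.2 m' (τ t)))) := by
  have h1 : (actE m' τ z ω).2 m' t = ω.2 m' (τ t) := by
    change (ω.2 m' * (if m' = m' then τ else 1)) t = _
    rw [if_pos rfl]; rfl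
  have h2 : ∀ j, (actE m' τ z ω).1 j m' = ω.1 j (z j) := by
    intro j
    change ω.1 j (swap m' (z j) m') = _
    rw [swap_apply_left]
  unfold wrd
  rw [h1, h2]

def cntV (c : ℕ) : ℕ := (Finset.univ.filter (fun jx : Fin k × Fin N => V jx.1 jx.2 = c)).card

/-- number of modifications producing a prescribed word -/
lemma mod_count (ω : Om k N) {m m' : Fin N} (w : Fin k → ℕ) :
    (∑ τ : Perm (Fin k), ∑ z ∈ Fintype.piFinset (fun _ : Fin k => Finset.univ.erase m),
      if (∀ t, wrd V (actE m' τ z ω) m' t = w t) then 1 else 0) ≤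
    (N - 1) ^ (k - (Finset.univ.filter (fun t => w t ≠ 0)).card) *
      ((k - (Finset.univ.filter (fun t => w t ≠ 0)).card).factorial *
        ∏ t ∈ Finset.univ.filter (fun t => w t ≠ 0), cntV V (w t)) := by
  classical
  set Act := Finset.univ.filter (fun t => w t ≠ 0) with hAct
  set σ := ω.2 m' with hσ
  set A : Fin k → Fin k → ℕ := fun j t => ∑ x ∈ Finset.univ.erase m, if V j (ω.1 j x) = w t then 1 else 0 with hA
  have hAle : ∀ j t, A j t ≤ N - 1 := by
    intro j t
    refine (Finset.sum_le_card_nsmul _ _ 1 (fun x _ => by split_ifs <;> simp)).trans ?_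
    rw [Finset.card_erase_of_mem (Finset.mem_univ _), Finset.card_univ, Fintype.card_fin]; simp
  have hAsum : ∀ t, ∑ j, A j t ≤ cntV V (w t) := by
    intro t
    unfold cntV
    rw [Finset.card_filter, Fintype.sum_prod_type]
    refine Finset.sum_le_sum (fun j _ => ?_)
    refine (Finset.sum_le_sum_of_subset (Finset.subset_univ _)).trans ?_
    exact le_of_eq (Equiv.sum_comp (ω.1 j) (fun x => if V j x = w t then 1 else 0))
  have hz : ∀ τ : Perm (Fin k), (∑ z ∈ Fintype.piFinset (fun _ : Fin k => Finset.univ.erase m),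
      if (∀ t, wrd V (actE m' τ z ω) m' t = w t) then 1 else 0) = ∏ t, A ((σ * τ) t) t := by
    intro τ
    have h1 : ∏ t, A ((σ * τ) t) t = ∏ j, A j ((σ * τ)⁻¹ j) := by
      rw [← Equiv.prod_comp (σ * τ) (fun j => A j ((σ * τ)⁻¹ j))]
      refine Finset.prod_congr rfl (fun t _ => ?_)
      rw [ias]
    rw [h1, hA]
    simp only
    rw [Finset.prod_univ_sum (fun _ : Fin k => Finset.univ.erase m) (fun j x => if V j (ω.1 j x) = w ((σ * τ)⁻¹ j) then 1 else 0)]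
    refine Finset.sum_congr rfl (fun z _ => ?_)
    have h2 : (∀ t, wrd V (actE m' τ z ω) m' t = w t) ↔ ∀ j ∈ Finset.univ, V j (ω.1 j (z j)) = w ((σ * τ)⁻¹ j) := by
      constructor
      · intro h j _
        have := h ((σ * τ)⁻¹ j)
        rw [wrd_act_eq] at this
        have e : ω.2 m' (τ ((σ * τ)⁻¹ j)) = j := by
          change (σ * τ) ((σ * τ)⁻¹ j) = j
          rw [ais]
        rw [e] at this
        exact this
      · intro h t
        rw [wrd_act_eq]
        have := h ((σ * τ) t) (Finset.mem_univ _)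
        rw [ias] at this
        exact this
    rw [Finset.prod_ite_zero, Finset.prod_const_one]
    by_cases hh : ∀ t, wrd V (actE m' τ z ω) m' t = w t
    · rw [if_pos hh, if_pos (h2.1 hh)]
    · rw [if_neg hh, if_neg (fun h => hh (h2.2 h))]
  rw [Finset.sum_congr rfl (fun τ _ => hz τ)]
  refine (le_of_eq (Equiv.sum_comp (Equiv.mulLeft σ) (fun τ : Perm (Fin k) => ∏ t, A (τ t) t))).trans ?_
  have hsplit : ∀ τ : Perm (Fin k), ∏ t, A (τ t) t ≤ (N-1)^(k - Act.card) * ∏ t ∈ Act, A (τ t) t := by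
    intro τ
    rw [← Finset.prod_sdiff (Finset.subset_univ Act)]
    refine Nat.mul_le_mul_right _ ?_
    refine (Finset.prod_le_pow_card _ _ (N-1) (fun t _ => hAle _ _)).trans (le_of_eq ?_)
    rw [Finset.card_sdiff_of_subset (Finset.subset_univ _), Finset.card_univ, Fintype.card_fin]
  refine (Finset.sum_le_sum (fun τ _ => hsplit τ)).trans ?_
  rw [← Finset.mul_sum]
  refine Nat.mul_le_mul_left _ ?_
  refine (perm_sum_le Act A).trans ?_
  rw [Fintype.card_fin]
  exact Nat.mul_le_mul_left _ (Finset.prod_le_prod' (fun t _ => hAsum t))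


lemma sum_word (W : ℕ → ℝ) (ω : Om k N) (m : Fin N) (i : Fin k) :
    ∑ t, W (wrd V ω m (t + i)) = ∑ j, W (V j (ω.1 j m)) := by
  refine (Equiv.sum_comp (Equiv.addRight i) (fun t => W (wrd V ω m t))).trans ?_
  exact Equiv.sum_comp (ω.2 m) (fun j => W (V j (ω.1 j m)))

lemma bad_count {W : ℕ → ℝ} {H : ℝ} (hW0 : W 0 = 0)
    (hc : ∀ c, c ≠ 0 → Real.exp 1 * cntV V c ≤ k * ((N:ℝ) - 1) * Real.exp (- W c / 2))
    (hH : ∀ f : Fin k → Fin N, H ≤ ∑ j, W (V j (f j)))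
    {m m' : Fin N} (hm : m ≠ m') (i : Fin k) :
    ((Finset.univ.filter (fun ω : Om k N => ∀ t, wrd V ω m' t = wrd V ω m (t + i))).card : ℝ) ≤
      Fintype.card (Om k N) * Real.exp (- H / 2) := by
  classical
  have hk : 0 < k := Nat.pos_of_ne_zero (NeZero.ne k)
  have hN : 2 ≤ N := by
    by_contra h
    apply hm
    have h1 := m.isLt
    have h2 := m'.isLt
    ext; omega
  have hNr : (0:ℝ) < (N:ℝ) - 1 := by
    have : (2:ℝ) ≤ N := by exact_mod_cast hN
    linarith
  have hkr : (0:ℝ) < k := by exact_mod_cast hk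
  set Z := Fintype.piFinset (fun _ : Fin k => Finset.univ.erase m) with hZ
  have hZc : Z.card = (N-1)^k := by
    rw [hZ, Fintype.card_piFinset]; simp
  set B : Om k N → ℕ := fun ω => if (∀ t, wrd V ω m' t = wrd V ω m (t + i)) then 1 else 0 with hB
  have hper : ∀ ω : Om k N, ((∑ τ : Perm (Fin k), ∑ z ∈ Z, B (actE m' τ z ω) : ℕ) : ℝ) ≤
      (k.factorial : ℝ) * ((N:ℝ) - 1) ^ k * Real.exp (- H / 2) := by
    intro ω
    have h1 : ∑ τ : Perm (Fin k), ∑ z ∈ Z, B (actE m' τ z ω) =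
        ∑ τ : Perm (Fin k), ∑ z ∈ Z, if (∀ t, wrd V (actE m' τ z ω) m' t = wrd V ω m (t + i)) then 1 else 0 := by
      refine Finset.sum_congr rfl (fun τ _ => Finset.sum_congr rfl (fun z hz => ?_))
      have hz' : ∀ j, z j ≠ m := by
        intro j
        exact Finset.ne_of_mem_erase (Fintype.mem_piFinset.1 hz j)
      simp only [hB]
      have : ∀ t, wrd V (actE m' τ z ω) m (t + i) = wrd V ω m (t + i) := fun t => wrd_act_ne V ω hm τ z hz' _
      simp only [this]
    rw [h1]
    have h2 := mod_count V ω (m := m) (m' := m') (fun t => wrd V ω m (t + i))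
    set Act := Finset.univ.filter (fun t => wrd V ω m (t + i) ≠ 0) with hAct
    have hak : Act.card ≤ k := by
      have := Finset.card_le_univ Act
      rwa [Fintype.card_fin] at this
    refine (Nat.cast_le (α := ℝ).2 h2).trans ?_
    push_cast [Nat.cast_sub (show 1 ≤ N by omega)]
    have h3 : ∏ t ∈ Act, (cntV V (wrd V ω m (t + i)) : ℝ) ≤
        (k / Real.exp 1) ^ Act.card * ((N:ℝ) - 1) ^ Act.card * Real.exp (- H / 2) := by
      have h4 : ∀ t ∈ Act, (cntV V (wrd V ω m (t + i)) : ℝ) ≤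
          (k / Real.exp 1) * ((N:ℝ) - 1) * Real.exp (- W (wrd V ω m (t + i)) / 2) := by
        intro t ht
        have := hc _ (Finset.mem_filter.1 ht).2
        have he := Real.exp_pos 1
        rw [mul_assoc, div_mul_eq_mul_div, le_div_iff₀ he]
        linarith
      refine (Finset.prod_le_prod (fun _ _ => by positivity) h4).trans ?_
      rw [Finset.prod_mul_distrib, Finset.prod_const, mul_pow, ← Real.exp_sum]
      refine mul_le_mul_of_nonneg_left (Real.exp_le_exp.2 ?_) (by positivity)
      have h5 : ∑ t ∈ Act, W (wrd V ω m (t + i)) = ∑ t, W (wrd V ω m (t + i)) := by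
        rw [hAct, Finset.sum_filter]
        refine Finset.sum_congr rfl (fun t _ => ?_)
        by_cases h : wrd V ω m (t + i) = 0
        · rw [if_neg (by simpa using h), h, hW0]
        · rw [if_pos h]
      have h6 := hH (fun j => ω.1 j m)
      rw [← sum_word V W ω m i, ← h5] at h6
      rw [← Finset.sum_div, Finset.sum_neg_distrib]
      linarith
    have h7 := descFact_ge k Act.card hak
    have h8 : ((k - Act.card).factorial : ℝ) * k.descFactorial Act.card = k.factorial := by
      exact_mod_cast Nat.factorial_mul_descFactorial hak
    have hp : ((N:ℝ)-1)^(k - Act.card) * ((N:ℝ)-1)^Act.card = ((N:ℝ)-1)^k := by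
      rw [← pow_add]; congr 1; omega
    calc _ ≤ ((N:ℝ)-1)^(k - Act.card) * (((k - Act.card).factorial : ℝ) *
            ((k.descFactorial Act.card : ℝ) * ((N:ℝ) - 1) ^ Act.card * Real.exp (- H / 2))) := by
          gcongr
          refine h3.trans ?_
          gcongr
      _ = _ := by rw [← h8, ← hp]; ring
  have htot : ((∑ ω : Om k N, ∑ τ : Perm (Fin k), ∑ z ∈ Z, B (actE m' τ z ω) : ℕ) : ℝ) ≤
      Fintype.card (Om k N) * ((k.factorial : ℝ) * ((N:ℝ) - 1) ^ k * Real.exp (- H / 2)) := by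
    rw [Nat.cast_sum]
    refine (Finset.sum_le_card_nsmul _ _ _ (fun ω _ => hper ω)).trans (le_of_eq ?_)
    rw [nsmul_eq_mul, Finset.card_univ]
  have heq : ∑ ω : Om k N, ∑ τ : Perm (Fin k), ∑ z ∈ Z, B (actE m' τ z ω) =
      k.factorial * (N-1)^k * ∑ ω : Om k N, B ω := by
    rw [Finset.sum_comm]
    have : ∀ τ : Perm (Fin k), ∑ ω : Om k N, ∑ z ∈ Z, B (actE m' τ z ω) = (N-1)^k * ∑ ω : Om k N, B ω := by
      intro τ
      rw [Finset.sum_comm, Finset.sum_congr rfl (fun z _ => Equiv.sum_comp (actE m' τ z) B), Finset.sum_const,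
        hZc, smul_eq_mul]
    rw [Finset.sum_congr rfl (fun τ _ => this τ), Finset.sum_const, Finset.card_univ, Fintype.card_perm,
      Fintype.card_fin, smul_eq_mul, mul_assoc]
  rw [heq] at htot
  have hBc : (Finset.univ.filter (fun ω : Om k N => ∀ t, wrd V ω m' t = wrd V ω m (t + i))).card = ∑ ω, B ω := by
    rw [Finset.card_filter]
  rw [hBc]
  push_cast [Nat.cast_sub (show 1 ≤ N by omega)] at htot ⊢
  have hpos : (0:ℝ) < k.factorial * ((N:ℝ)-1)^k := by
    have : (0:ℝ) < k.factorial := by exact_mod_cast k.factorial_pos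
    positivity
  refine le_of_mul_le_mul_left ?_ hpos
  linarith

def arr (ω : Om k N) : Fin N × Fin k ≃ Fin k × Fin N where
  toFun mt := (ω.2 mt.1 mt.2, ω.1 (ω.2 mt.1 mt.2) mt.1)
  invFun jx := ((ω.1 jx.1)⁻¹ jx.2, (ω.2 ((ω.1 jx.1)⁻¹ jx.2))⁻¹ jx.1)
  left_inv := by rintro ⟨m, t⟩; simp only [ias]
  right_inv := by rintro ⟨j, x⟩; simp only [ais]

theorem core_design {W : ℕ → ℝ} {H : ℝ} (hW0 : W 0 = 0)
    (hc : ∀ c, c ≠ 0 → Real.exp 1 * cntV V c ≤ k * ((N:ℝ) - 1) * Real.exp (- W c / 2))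
    (hH : ∀ f : Fin k → Fin N, H ≤ ∑ j, W (V j (f j)))
    (hu : (N:ℝ) ^ 2 * k * Real.exp (- H / 2) < 1) :
    ∃ π : Fin N × Fin k ≃ Fin k × Fin N, ∀ m m' : Fin N, m ≠ m' → ∀ i : Fin k,
      ∃ t, V (π (m', t)).1 (π (m', t)).2 ≠ V (π (m, t + i)).1 (π (m, t + i)).2 := by
  classical
  by_contra hcon
  push Not at hcon
  have hcov : (Finset.univ : Finset (Om k N)) ⊆
      ((Finset.univ : Finset (Fin N × Fin N × Fin k)).filter (fun x => x.1 ≠ x.2.1)).biUnion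
        (fun x => Finset.univ.filter (fun ω : Om k N => ∀ t, wrd V ω x.2.1 t = wrd V ω x.1 (t + x.2.2))) := by
    intro ω _
    obtain ⟨m, m', hm, i, h⟩ := hcon (arr ω)
    rw [Finset.mem_biUnion]
    refine ⟨(m, m', i), Finset.mem_filter.2 ⟨Finset.mem_univ _, hm⟩, Finset.mem_filter.2 ⟨Finset.mem_univ _, ?_⟩⟩
    exact h
  have h1 := (Finset.card_le_card hcov).trans Finset.card_biUnion_le
  rw [Finset.card_univ] at h1
  have h2 := (Nat.cast_le (α := ℝ)).2 h1
  rw [Nat.cast_sum] at h2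
  have h3 := h2.trans (Finset.sum_le_card_nsmul _ _ _ (fun x hx => bad_count V hW0 hc hH (Finset.mem_filter.1 hx).2 x.2.2))
  rw [nsmul_eq_mul] at h3
  have h4 : (((Finset.univ : Finset (Fin N × Fin N × Fin k)).filter (fun x => x.1 ≠ x.2.1)).card : ℝ) ≤ (N:ℝ)^2 * k := by
    have := Finset.card_le_univ ((Finset.univ : Finset (Fin N × Fin N × Fin k)).filter (fun x => x.1 ≠ x.2.1))
    rw [Fintype.card_prod, Fintype.card_prod, Fintype.card_fin, Fintype.card_fin] at this
    calc _ ≤ ((N * (N * k) : ℕ) : ℝ) := by exact_mod_cast this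
      _ = _ := by push_cast; ring
  have h5 : (0:ℝ) < Fintype.card (Om k N) := by exact_mod_cast Fintype.card_pos
  have h6 := mul_le_mul_of_nonneg_right h4 (show 0 ≤ (Fintype.card (Om k N) : ℝ) * Real.exp (- H / 2) by positivity)
  nlinarith

end core
end McKayGraphs

open scoped BigOperators
namespace McKayGraphs
open Equiv

lemma rot_const {k : ℕ} [NeZero k] {α : Type*} [LinearOrder α] (f : Fin k → α) (hf : Monotone f) {i : Fin k} (hi : i ≠ 0)
    (h : ∀ t, f t = f (t + i)) : ∀ a b, f a = f b := by
  obtain ⟨k', rfl⟩ : ∃ k', k = k' + 1 := ⟨k - 1, by have := NeZero.ne k; omega⟩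
  have h0 : f 0 = f i := by have := h 0; rwa [zero_add] at this
  have h1 := h (Fin.last k')
  have h2 : Fin.last k' + i ≤ i := by
    rw [Fin.le_iff_val_le_val, Fin.val_add, Fin.val_last]
    have : i.val ≠ 0 := fun h => hi (Fin.ext h)
    have h3 := i.isLt
    have : k' + i.val = (i.val - 1) + (k' + 1) := by omega
    rw [this, Nat.add_mod_right, Nat.mod_eq_of_lt (by omega)]
    omega
  have h3 : f (Fin.last k') ≤ f 0 := by rw [h1, h0]; exact hf h2
  have h4 : ∀ a, f a = f 0 := fun a => le_antisymm ((hf (Fin.le_last a)).trans h3) (hf (Fin.zero_le a))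
  intro a b; rw [h4 a, h4 b]

lemma exists_sort {X : Type*} [Fintype X] {α : Type*} [LinearOrder α] (K : X → α) {n : ℕ} (hn : Fintype.card X = n) :
    ∃ s : Fin n ≃ X, Monotone (K ∘ s) := by
  let e : Fin n ≃ X := (Fintype.equivFinOfCardEq hn).symm
  exact ⟨(Tuple.sort (K ∘ e)).trans e, Tuple.monotone_sort (K ∘ e)⟩

def SepBy {X : Type*} (v : X → ℕ) (l : List (Perm X)) (a b : X) : Prop := ∃ h ∈ l, v (h a) ≠ v (h b)

lemma SepBy.mono {X : Type*} {v : X → ℕ} {l l' : List (Perm X)} {a b : X} (h : SepBy v l a b) (hl : l ⊆ l') :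
    SepBy v l' a b := by
  obtain ⟨g, hg, h⟩ := h
  exact ⟨g, hl hg, h⟩

section grid
variable {X : Type*} [Fintype X] [DecidableEq X] {k N r : ℕ} [NeZero k]

def gidx (j : Fin k) (m : Fin N) : Fin (k * N + r) := Fin.castAdd r (finProdFinEquiv (j, m))

lemma gidx_val (j : Fin k) (m : Fin N) : (gidx (r := r) j m).val = m.val + N * j.val := by
  simp [gidx, finProdFinEquiv]

theorem grid_family (s : Fin (k * N + r) ≃ X) (v : X → ℕ) (R : Finset X) (hR : R.card = r)
    (π : Fin N × Fin k ≃ Fin k × Fin N)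
    (hπ : ∀ m m' : Fin N, m ≠ m' → ∀ i : Fin k, ∃ t, v (s (gidx (π (m', t)).1 (π (m', t)).2)) ≠
      v (s (gidx (π (m, t + i)).1 (π (m, t + i)).2)))
    (hper : ∀ m : Fin N, ∀ i : Fin k, i ≠ 0 → ∃ t, v (s (gidx t m)) ≠ v (s (gidx (t + i) m))) :
    ∃ l : List (Perm X), l.length = 2 * k ∧ ∀ a b, a ∉ R → b ∉ R → a ≠ b → SepBy v l a b := by
  classical
  have hcX : Fintype.card X = k * N + r := by
    rw [← Fintype.card_congr s, Fintype.card_fin]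
  have eR : Fin r ≃ {x // x ∈ R} := (Finset.equivFinOfCardEq hR).symm
  have eC : Nonempty (Fin N × Fin k ≃ {x // ¬ x ∈ R}) := by
    rw [← Fintype.card_eq]
    rw [Fintype.card_subtype_compl, Fintype.card_coe, hR, hcX, Fintype.card_prod, Fintype.card_fin, Fintype.card_fin]
    rw [Nat.add_sub_cancel, mul_comm]
  obtain ⟨eC⟩ := eC
  let E : (Fin N × Fin k) ⊕ Fin r ≃ X :=
    ((Equiv.sumCongr eC eR).trans (Equiv.sumComm _ _)).trans (Equiv.sumCompl (fun x => x ∈ R))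
  have hE : ∀ a, a ∉ R → ∃ m t, a = E (Sum.inl (m, t)) := by
    intro a ha
    refine ⟨(eC.symm ⟨a, ha⟩).1, (eC.symm ⟨a, ha⟩).2, ?_⟩
    simp [E]
  let E' : (Fin k × Fin N) ⊕ Fin r ≃ X :=
    ((Equiv.sumCongr finProdFinEquiv (Equiv.refl _)).trans finSumFinEquiv).trans s
  have hE' : ∀ j m, E' (Sum.inl (j, m)) = s (gidx j m) := fun j m => rfl
  let hh : (Fin N × Fin k ≃ Fin k × Fin N) → Fin k → Perm X := fun π' i =>
    E.symm.trans ((Equiv.sumCongr (((Equiv.prodCongr (Equiv.refl _) (Equiv.addRight i))).trans π') (Equiv.refl _)).trans E')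
  have hhv : ∀ π' i m t, hh π' i (E (Sum.inl (m, t))) = s (gidx (π' (m, t + i)).1 (π' (m, t + i)).2) := by
    intro π' i m t
    simp only [hh, Equiv.trans_apply, Equiv.symm_apply_apply]
    rfl
  refine ⟨List.ofFn (hh π) ++ List.ofFn (hh (Equiv.prodComm _ _)), by simp; ring, ?_⟩
  intro a b ha hb hab
  obtain ⟨m, t0, rfl⟩ := hE a ha
  obtain ⟨m', t1, rfl⟩ := hE b hb
  by_cases hm : m = m'
  · subst hm
    have ht : t0 - t1 ≠ 0 := by
      intro h
      apply hab
      rw [sub_eq_zero.1 h]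
    obtain ⟨t, ht⟩ := hper m (t0 - t1) ht
    refine ⟨hh (Equiv.prodComm _ _) (t - t1), List.mem_append_right _ (List.mem_ofFn.2 ⟨_, rfl⟩), ?_⟩
    rw [hhv, hhv]
    have e1 : t1 + (t - t1) = t := by abel
    have e2 : t0 + (t - t1) = t + (t0 - t1) := by abel
    rw [e1, e2]
    exact fun h => ht h.symm
  · obtain ⟨t, ht⟩ := hπ m m' hm (t0 - t1)
    refine ⟨hh π (t - t1), List.mem_append_left _ (List.mem_ofFn.2 ⟨_, rfl⟩), ?_⟩
    rw [hhv, hhv]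
    have e1 : t1 + (t - t1) = t := by abel
    have e2 : t0 + (t - t1) = t + (t0 - t1) := by abel
    rw [e1, e2]
    exact fun h => ht h.symm

theorem three_families (v : X → ℕ) (hr : 3 * r ≤ Fintype.card X) {c : ℕ}
    (h : ∀ R : Finset X, R.card = r → ∃ l : List (Perm X), l.length = c ∧ ∀ a b, a ∉ R → b ∉ R → a ≠ b → SepBy v l a b) :
    ∃ l : List (Perm X), l.length = 3 * c ∧ ∀ a b, a ≠ b → SepBy v l a b := by
  classical
  obtain ⟨R1, -, h1⟩ := Finset.exists_subset_card_eq (s := (Finset.univ : Finset X)) (n := r) (by rw [Finset.card_univ]; omega)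
  obtain ⟨R2, s2, h2⟩ := Finset.exists_subset_card_eq (s := (Finset.univ \ R1 : Finset X)) (n := r)
    (by rw [Finset.card_sdiff_of_subset (Finset.subset_univ _), Finset.card_univ]; omega)
  obtain ⟨R3, s3, h3⟩ := Finset.exists_subset_card_eq (s := (Finset.univ \ (R1 ∪ R2) : Finset X)) (n := r)
    (by rw [Finset.card_sdiff_of_subset (Finset.subset_univ _), Finset.card_univ]
        have := Finset.card_union_le R1 R2
        omega)
  obtain ⟨l1, c1, S1⟩ := h R1 h1
  obtain ⟨l2, c2, S2⟩ := h R2 h2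
  obtain ⟨l3, c3, S3⟩ := h R3 h3
  have d12 : ∀ x, x ∈ R2 → x ∉ R1 := fun x hx => (Finset.mem_sdiff.1 (s2 hx)).2
  have d3 : ∀ x, x ∈ R3 → x ∉ R1 ∧ x ∉ R2 := fun x hx => by
    have := (Finset.mem_sdiff.1 (s3 hx)).2
    rw [Finset.mem_union] at this
    tauto
  refine ⟨l1 ++ (l2 ++ l3), by simp [c1, c2, c3]; ring, ?_⟩
  intro a b hab
  have m1 : l1 ⊆ l1 ++ (l2 ++ l3) := List.subset_append_left _ _
  have m2 : l2 ⊆ l1 ++ (l2 ++ l3) := List.Subset.trans (List.subset_append_left _ _) (List.subset_append_right _ _)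
  have m3 : l3 ⊆ l1 ++ (l2 ++ l3) := List.Subset.trans (List.subset_append_right _ _) (List.subset_append_right _ _)
  have da1 := d12 a
  have db1 := d12 b
  have da3 := d3 a
  have db3 := d3 b
  by_cases A1 : a ∉ R1 ∧ b ∉ R1
  · exact (S1 a b A1.1 A1.2 hab).mono m1
  · by_cases A2 : a ∉ R2 ∧ b ∉ R2
    · exact (S2 a b A2.1 A2.2 hab).mono m2
    · exact (S3 a b (by tauto) (by tauto) hab).mono m3

end grid

lemma sum_blocks (F : ℕ → ℝ) (hF : Antitone F) (M k : ℕ) :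
    ∑ i ∈ Finset.range (k * M), F i ≤ M * ∑ b ∈ Finset.range k, F (M * b) := by
  induction k with
  | zero => simp
  | succ k ih =>
    rw [Nat.succ_mul, Finset.sum_range_add, Finset.sum_range_succ, mul_add]
    refine add_le_add ih ?_
    refine (Finset.sum_le_card_nsmul _ _ (F (M * k)) (fun i _ => hF (by rw [mul_comm]; omega))).trans ?_
    rw [Finset.card_range, nsmul_eq_mul]

lemma sum_strata (F : ℕ → ℝ) (hF : Antitone F) (h0 : ∀ i, 0 ≤ F i) {N k n : ℕ} (hn : n ≤ k * (2 * N)) :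
    ∑ i ∈ Finset.range n, F i ≤ 2 * N * (F 0 + ∑ j ∈ Finset.range k, F (N * (j + 1))) := by
  have h1 : ∑ i ∈ Finset.range n, F i ≤ ∑ i ∈ Finset.range (k * (2 * N)), F i :=
    Finset.sum_le_sum_of_subset_of_nonneg (Finset.range_mono hn) (fun i _ _ => h0 i)
  refine (h1.trans (sum_blocks F hF _ _)).trans ?_
  push_cast
  refine mul_le_mul_of_nonneg_left ?_ (by positivity)
  calc ∑ b ∈ Finset.range k, F (2 * N * b) ≤ ∑ b ∈ Finset.range k, F (N * b) :=
        Finset.sum_le_sum (fun b _ => hF (by rw [mul_assoc, Nat.two_mul]; omega))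
    _ ≤ ∑ b ∈ Finset.range (k+1), F (N * b) :=
        Finset.sum_le_sum_of_subset_of_nonneg (Finset.range_mono (by omega)) (fun i _ _ => h0 _)
    _ = _ := by rw [Finset.sum_range_succ']; simp [add_comm]

lemma rot_family {X : Type*} [Fintype X] [DecidableEq X] (u : X → ℕ) (hu : ∃ a b, u a ≠ u b) :
    ∃ l : List (Perm X), l.length = Fintype.card X ∧ ∀ a b, a ≠ b → SepBy u l a b := by
  obtain ⟨a0, b0, hab0⟩ := hu
  set n := Fintype.card X with hn
  have hnpos : 0 < n := Fintype.card_pos_iff.2 ⟨a0⟩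
  haveI : NeZero n := ⟨by omega⟩
  obtain ⟨s, hs⟩ := exists_sort u hn.symm
  refine ⟨List.ofFn (fun i : Fin n => s.symm.trans ((Equiv.addRight i).trans s)), by simp, ?_⟩
  intro a b hab
  by_contra hcon
  unfold SepBy at hcon
  push Not at hcon
  have h1 : ∀ i : Fin n, u (s (s.symm a + i)) = u (s (s.symm b + i)) := fun i =>
    hcon _ (List.mem_ofFn.2 ⟨i, rfl⟩)
  have h2 := rot_const (u ∘ s) hs (i := s.symm a - s.symm b)
    (by intro h; apply hab; exact s.symm.injective (sub_eq_zero.1 h)) (by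
      intro t
      have := h1 (t - s.symm b)
      have e1 : s.symm b + (t - s.symm b) = t := by abel
      have e2 : s.symm a + (t - s.symm b) = t + (s.symm a - s.symm b) := by abel
      rw [e1, e2] at this
      exact this.symm)
  apply hab0
  have := h2 (s.symm a0) (s.symm b0)
  simpa using this

end McKayGraphs

open scoped BigOperators
namespace McKayGraphs
open Equiv
variable {X : Type*} [Fintype X] [DecidableEq X]

def vact (u : X → ℕ) (x : X) : ℕ := if 500 * rl u (u x) ≤ Fintype.card X then u x + 1 else 0
noncomputable def Wact (X : Type*) [Fintype X] [DecidableEq X] (u : X → ℕ) (c : ℕ) : ℝ := 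
  if c = 0 then 0 else if rl u (c - 1) = 0 then 0 else Real.log ((Fintype.card X : ℝ) / rl u (c - 1))
noncomputable def EntA (u : X → ℕ) : ℝ := ∑ x, Wact X u (vact u x)

lemma Wact_act {u : X → ℕ} {x : X} (h : 500 * rl u (u x) ≤ Fintype.card X) : Wact X u (vact u x) = wv u x := by
  unfold vact Wact wv
  rw [if_pos h, if_neg (by omega), Nat.add_sub_cancel, if_neg (rl_pos_of u x).ne']

lemma Wact_inact {u : X → ℕ} {x : X} (h : ¬ 500 * rl u (u x) ≤ Fintype.card X) : Wact X u (vact u x) = 0 := by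
  unfold vact Wact
  rw [if_neg h, if_pos rfl]

lemma Wact_nonneg (u : X → ℕ) (c : ℕ) : 0 ≤ Wact X u c := by
  unfold Wact
  split_ifs with h1 h2
  · exact le_rfl
  · exact le_rfl
  · apply Real.log_nonneg
    rw [le_div_iff₀ (by exact_mod_cast Nat.pos_of_ne_zero h2), one_mul]
    exact_mod_cast rl_le_card u _

lemma Wact_le (u : X → ℕ) (c : ℕ) : Wact X u c ≤ Real.log (Fintype.card X) := by
  unfold Wact
  have h0 : 0 ≤ Real.log (Fintype.card X) := Real.log_natCast_nonneg _
  split_ifs with h1 h2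
  · exact h0
  · exact h0
  · have h3 : 0 < rl u (c-1) := Nat.pos_of_ne_zero h2
    have h4 : (1:ℝ) ≤ rl u (c-1) := by exact_mod_cast h3
    have h5 : 0 < Fintype.card X := lt_of_lt_of_le h3 (rl_le_card u _)
    have h6 : (0:ℝ) < Fintype.card X := by exact_mod_cast h5
    apply Real.log_le_log (by positivity)
    exact div_le_self h6.le h4

lemma EntA_le (u : X → ℕ) : EntA u ≤ Fintype.card X * Real.log (Fintype.card X) := by
  unfold EntA
  refine (Finset.sum_le_card_nsmul _ _ _ (fun x _ => Wact_le u _)).trans ?_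
  rw [Finset.card_univ, nsmul_eq_mul]

/-- sorting key: class sizes ascending, inactive last -/
def Kact (u : X → ℕ) (x : X) : ℕ ×ₗ ℕ :=
  toLex (if 500 * rl u (u x) ≤ Fintype.card X then rl u (u x) else Fintype.card X + 1, vact u x)

lemma Kact_v {u : X → ℕ} {x y : X} (h : Kact u x = Kact u y) : vact u x = vact u y := by
  unfold Kact at h
  have := toLex.injective h
  exact (Prod.ext_iff.1 this).2

lemma v_Kact {u : X → ℕ} {x y : X} (h : vact u x = vact u y) : Kact u x = Kact u y := by
  have h' := h
  unfold vact at h'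
  unfold Kact
  rw [h]
  by_cases h1 : 500 * rl u (u x) ≤ Fintype.card X <;> by_cases h2 : 500 * rl u (u y) ≤ Fintype.card X
  · rw [if_pos h1, if_pos h2] at h'
    rw [if_pos h1, if_pos h2, (by omega : u x = u y)]
  · rw [if_pos h1, if_neg h2] at h'; omega
  · rw [if_neg h1, if_pos h2] at h'; omega
  · rw [if_neg h1, if_neg h2]

lemma W_anti {u : X → ℕ} {x y : X} (h : Kact u x ≤ Kact u y) : Wact X u (vact u y) ≤ Wact X u (vact u x) := by
  by_cases h2 : 500 * rl u (u y) ≤ Fintype.card X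
  · have h3 := (Prod.Lex.monotone_fst _ _ h)
    simp only [Kact, ofLex_toLex] at h3
    rw [if_pos h2] at h3
    have h1 : 500 * rl u (u x) ≤ Fintype.card X := by
      by_contra h1
      rw [if_neg h1] at h3
      have := rl_le_card u (u y)
      omega
    rw [if_pos h1] at h3
    rw [Wact_act h1, Wact_act h2]
    unfold wv
    have p1 : (0:ℝ) < rl u (u x) := by exact_mod_cast rl_pos_of u x
    have p2 : (0:ℝ) < rl u (u y) := by exact_mod_cast rl_pos_of u y
    have p3 : (rl u (u x) : ℝ) ≤ rl u (u y) := by exact_mod_cast h3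
    have p4 : (0:ℝ) < Fintype.card X := by exact_mod_cast Fintype.card_pos_iff.2 ⟨x⟩
    apply Real.log_le_log (by positivity)
    gcongr
  · rw [Wact_inact h2]; exact Wact_nonneg _ _

theorem design_main (u : X → ℕ) {k : ℕ} (hk : 0 < k) (hn2 : 2 ≤ Fintype.card X)
    (hk3 : 3 * k ≤ Fintype.card X) 
    (hkE : 16 * (Fintype.card X : ℝ) * Real.log (Fintype.card X) ≤ k * EntA u) :
    ∃ l : List (Perm X), l.length = 6 * k ∧ ∀ a b, a ≠ b → SepBy u l a b := by
  classical
  haveI : NeZero k := ⟨by omega⟩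
  obtain ⟨n, hn⟩ : ∃ n, n = Fintype.card X := ⟨_, rfl⟩
  obtain ⟨N, hN⟩ : ∃ N, N = n / k := ⟨_, rfl⟩
  obtain ⟨r, hr⟩ : ∃ r, r = n % k := ⟨_, rfl⟩
  have hnk : n = k * N + r := by rw [hN, hr]; exact (Nat.div_add_mod n k).symm
  have hrk : r < k := by rw [hr]; exact Nat.mod_lt _ hk
  have hN3 : 3 ≤ N := by rw [hN, Nat.le_div_iff_mul_le hk, hn]; exact hk3
  rw [← hn] at hkE hn2
  have hnr : (2:ℝ) ≤ n := by exact_mod_cast hn2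
  have hlog : 0 < Real.log n := Real.log_pos (by linarith)
  have hkr : (0:ℝ) < k := by exact_mod_cast hk
  have hNr : (3:ℝ) ≤ N := by exact_mod_cast hN3
  have hcX : Fintype.card X = k * N + r := by omega
  obtain ⟨s, hs⟩ := exists_sort (Kact u) hcX
  have hkN : (k:ℝ) * N ≤ n := by
    have : k * N ≤ n := by omega
    exact_mod_cast this
  have hn3 : (n:ℝ) ≤ 3 * (k * ((N:ℝ) - 1)) := by
    have : (n:ℝ) ≤ k * N + k := by
      have : n ≤ k * N + k := by omega
      exact_mod_cast this
    nlinarith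
  set V : Fin k → Fin N → ℕ := fun j m => vact u (s (gidx j m)) with hV
  -- counts
  have hcnt : ∀ c, c ≠ 0 → cntV V c ≤ rl u (c - 1) := by
    intro c hc
    unfold cntV rl
    refine Finset.card_le_card_of_injOn (fun jx => s (gidx jx.1 jx.2)) ?_ ?_
    · intro jx h
      simp only [Finset.coe_filter, Finset.mem_univ, true_and, Set.mem_setOf_eq] at h
      simp only [Finset.mem_coe, mem_cl]
      rw [hV] at h
      simp only [vact] at h
      split_ifs at h <;> omega
    · intro a _ b _ h
      have h1 := s.injective h
      have h2 : (gidx (r := r) a.1 a.2) = gidx b.1 b.2 := h1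
      unfold gidx at h2
      have h3 := finProdFinEquiv.injective (Fin.castAdd_injective _ _ h2)
      exact h3
  have hact : ∀ c, c ≠ 0 → cntV V c ≠ 0 → 500 * rl u (c - 1) ≤ n := by
    intro c hc h0
    obtain ⟨jx, hjx⟩ := Finset.card_pos.1 (Nat.pos_of_ne_zero h0)
    have h := (Finset.mem_filter.1 hjx).2
    rw [hV] at h
    simp only [vact] at h
    split_ifs at h with h1
    · rw [← h, Nat.add_sub_cancel, hn]; exact h1
    · omega
  have hc : ∀ c, c ≠ 0 → Real.exp 1 * cntV V c ≤ k * ((N:ℝ) - 1) * Real.exp (- Wact X u c / 2) := by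
    intro c hc
    have hpos : 0 ≤ k * ((N:ℝ) - 1) * Real.exp (- Wact X u c / 2) :=
      mul_nonneg (mul_nonneg hkr.le (by linarith)) (Real.exp_pos _).le
    by_cases h0 : cntV V c = 0
    · rw [h0]; simpa using hpos
    · have ha := hact c hc h0
      have hle := hcnt c hc
      have hrp : rl u (c-1) ≠ 0 := by omega
      have hW : Wact X u c = Real.log ((n : ℝ) / rl u (c - 1)) := by
        unfold Wact; rw [if_neg hc, if_neg hrp, ← hn]
      have hsp : (0:ℝ) < rl u (c-1) := by exact_mod_cast Nat.pos_of_ne_zero hrp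
      set y := Real.exp (- Wact X u c / 2) with hy
      have hy0 : 0 < y := Real.exp_pos _
      have hy2 : (n:ℝ) * y ^ 2 = rl u (c-1) := by
        rw [hy, ← Real.exp_nat_mul]
        have : ((2:ℕ):ℝ) * (- Wact X u c / 2) = - Wact X u c := by push_cast; ring
        rw [this, hW, Real.exp_neg, Real.exp_log (by positivity)]
        field_simp
      have ha' : 500 * (rl u (c-1) : ℝ) ≤ n := by exact_mod_cast ha
      have hle' : (cntV V c : ℝ) ≤ rl u (c-1) := by exact_mod_cast hle
      have hy20 : y ≤ 1 / 20 := by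
        by_contra h
        push Not at h
        have : 1 / 400 < y ^ 2 := by nlinarith
        nlinarith
      have he : Real.exp 1 < 3 := lt_trans Real.exp_one_lt_d9 (by norm_num)
      calc Real.exp 1 * cntV V c ≤ 3 * (rl u (c-1) : ℝ) := by
            have := (Real.exp_pos 1).le
            have h9 : (0:ℝ) ≤ cntV V c := by positivity
            nlinarith
        _ = 3 * y * n * y := by rw [← hy2]; ring
        _ ≤ (1/3) * n * y := by
            refine mul_le_mul_of_nonneg_right ?_ hy0.le
            nlinarith
        _ ≤ _ := by
            refine mul_le_mul_of_nonneg_right ?_ hy0.le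
            linarith
  -- strata
  set F : ℕ → ℝ := fun i => if h : i < k * N + r then Wact X u (vact u (s ⟨i, h⟩)) else 0 with hF
  have hF0 : ∀ i, 0 ≤ F i := by
    intro i; simp only [hF]; split_ifs
    · exact Wact_nonneg _ _
    · exact le_rfl
  have hFa : Antitone F := by
    intro i j hij
    by_cases hj : j < k * N + r
    · have hi : i < k * N + r := by omega
      simp only [hF, dif_pos hi, dif_pos hj]
      exact W_anti (hs (show (⟨i, hi⟩ : Fin _) ≤ ⟨j, hj⟩ from hij))
    · have : F j = 0 := by simp only [hF, dif_neg hj]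
      rw [this]; exact hF0 i
  have hFs : ∑ i ∈ Finset.range n, F i = EntA u := by
    rw [hnk, Finset.sum_range]
    unfold EntA
    rw [← Equiv.sum_comp s]
    refine Finset.sum_congr rfl (fun i _ => ?_)
    simp only [hF, dif_pos i.isLt]
  have hF1 : F 0 ≤ Real.log n := by
    simp only [hF]; split_ifs
    · rw [hn]; exact Wact_le _ _
    · exact hlog.le
  have hst := sum_strata F hFa hF0 (N := N) (k := k) (n := n) (by nlinarith)
  rw [hFs] at hst
  have hrow : ∀ f : Fin k → Fin N, ∑ j ∈ Finset.range k, F (N * (j + 1)) ≤ ∑ j, Wact X u (V j (f j)) := by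
    intro f
    rw [Finset.sum_range]
    refine Finset.sum_le_sum (fun j _ => ?_)
    have h1 : Wact X u (V j (f j)) = F (gidx (r := r) j (f j)).val := by
      simp only [hF, dif_pos (gidx (r := r) j (f j)).isLt, hV]
    rw [h1]
    apply hFa
    rw [gidx_val]
    have := (f j).isLt
    have : N * (j.val + 1) = N * j.val + N := by ring
    omega
  have hH : ∀ f : Fin k → Fin N, 7 * Real.log n ≤ ∑ j, Wact X u (V j (f j)) := by
    intro f
    refine le_trans ?_ (hrow f)
    have hNp : (0:ℝ) < 2 * N := by linarith
    have h1 : 8 * Real.log n ≤ F 0 + ∑ j ∈ Finset.range k, F (N * (j + 1)) := by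
      refine le_of_mul_le_mul_left ?_ hNp
      refine le_trans ?_ hst
      have h2 : k * (2 * (N:ℝ) * (8 * Real.log n)) ≤ k * EntA u := by
        refine le_trans ?_ hkE
        nlinarith
      exact le_of_mul_le_mul_left h2 hkr
    linarith
  have hu : (N:ℝ) ^ 2 * k * Real.exp (- (7 * Real.log n) / 2) < 1 := by
    have h1 : (N:ℝ) ^ 2 * k ≤ n ^ 2 := by
      have : (1:ℝ) ≤ k := by exact_mod_cast hk
      have h3 : (N:ℝ)^2 * k ≤ (k * N)^2 := by
        have : (0:ℝ) ≤ (N:ℝ)^2 := by positivity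
        nlinarith
      refine h3.trans ?_
      exact pow_le_pow_left₀ (by positivity) hkN 2
    have h2 : (n:ℝ)^2 = Real.exp (2 * Real.log n) := by
      rw [mul_comm, Real.exp_mul, Real.exp_log (by linarith)]; norm_cast
    calc _ ≤ Real.exp (2 * Real.log n) * Real.exp (- (7 * Real.log n) / 2) := by
          rw [← h2]; exact mul_le_mul_of_nonneg_right h1 (Real.exp_pos _).le
      _ = Real.exp (2 * Real.log n + - (7 * Real.log n) / 2) := by rw [Real.exp_add]
      _ < 1 := by
          rw [Real.exp_lt_one_iff]; linarith
  obtain ⟨π, hπ⟩ := core_design V (W := Wact X u) (by unfold Wact; rw [if_pos rfl]) hc hH hu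
  have hper : ∀ m : Fin N, ∀ i : Fin k, i ≠ 0 → ∃ t, vact u (s (gidx t m)) ≠ vact u (s (gidx (t + i) m)) := by
    intro m i hi
    by_contra hcon
    push Not at hcon
    have hmon : Monotone (fun t : Fin k => Kact u (s (gidx t m))) := by
      intro a b hab
      refine hs ?_
      rw [Fin.le_iff_val_le_val, gidx_val, gidx_val]
      have : N * a.val ≤ N * b.val := Nat.mul_le_mul_left _ hab
      omega
    have hconst := rot_const _ hmon hi (fun t => v_Kact (hcon t))
    have hk2 : 2 ≤ k := by
      by_contra h
      have := i.isLt
      apply hi; ext; simp; omega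
    obtain ⟨c, hcd⟩ : ∃ c, c = vact u (s (gidx (0 : Fin k) m)) := ⟨_, rfl⟩
    have hall : ∀ t, V t m = c := fun t => by rw [hcd]; exact Kact_v (hconst t 0)
    have hc0 : c ≠ 0 := by
      intro h
      have h1 := hH (fun _ => m)
      have : ∀ j ∈ Finset.univ, Wact X u (V j m) = 0 := by
        intro j _
        rw [hall j, h]; unfold Wact; rw [if_pos rfl]
      rw [Finset.sum_eq_zero this] at h1
      linarith
    have ha := hact c hc0 (by
      unfold cntV
      exact (Finset.card_pos.2 ⟨(0, m), Finset.mem_filter.2 ⟨Finset.mem_univ _, hall 0⟩⟩).ne')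
    have hlast : (k - 1) < k := by omega
    have hbig : (k - 1) * N ≤ rl u (c - 1) := by
      have : (k-1) * N = (Finset.Ico m.val (m.val + (k-1) * N)).card := by rw [Nat.card_Ico]; omega
      rw [this]
      have hm := m.isLt
      have hkN' : (k-1) * N + N = k * N := by
        rw [← Nat.succ_mul]; congr 1; omega
      have hlt : ∀ y ∈ Finset.Ico m.val (m.val + (k-1) * N), y < k * N + r := by
        intro y hy; rw [Finset.mem_Ico] at hy; omega
      refine Finset.card_le_card_of_injOn (fun y => if h : y < k * N + r then s ⟨y, h⟩ else s (gidx (0 : Fin k) m)) ?_ ?_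
      · intro y hy
        have hy' := hlt y hy
        rw [Finset.mem_coe, Finset.mem_Ico] at hy
        simp only [dif_pos hy', Finset.mem_coe, mem_cl]
        have k1 : Kact u (s (gidx (0 : Fin k) m)) ≤ Kact u (s ⟨y, hy'⟩) := by
          refine hs ?_
          rw [Fin.le_iff_val_le_val, gidx_val]
          simp; omega
        have k2 : Kact u (s ⟨y, hy'⟩) ≤ Kact u (s (gidx (⟨k-1, hlast⟩ : Fin k) m)) := by
          refine hs ?_
          rw [Fin.le_iff_val_le_val, gidx_val]
          simp only
          rw [mul_comm N]; omega
        have k3 := hconst ⟨k-1, hlast⟩ 0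
        have k4 : Kact u (s ⟨y, hy'⟩) = Kact u (s (gidx (0 : Fin k) m)) := le_antisymm (k2.trans (le_of_eq k3)) k1
        have k5 := Kact_v k4
        rw [← hcd] at k5
        unfold vact at k5
        split_ifs at k5 <;> omega
      · intro y hy y' hy' h
        have a1 := hlt y hy
        have a2 := hlt y' hy'
        simp only [dif_pos a1, dif_pos a2] at h
        have := s.injective h
        simpa using this
    have : k * N ≤ 2 * ((k-1) * N) := by
      have : k ≤ 2 * (k-1) := by omega
      calc k * N ≤ 2 * (k-1) * N := Nat.mul_le_mul_right _ this
        _ = _ := by ring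
    have h9 : k ≤ k * N := Nat.le_mul_of_pos_right _ (by omega)
    omega
  obtain ⟨l, hl, hsep⟩ := three_families (vact u) (r := r) (c := 2 * k) (by omega)
    (fun R hR => grid_family s (vact u) R hR π hπ hper)
  refine ⟨l, by rw [hl]; ring, fun a b hab => ?_⟩
  obtain ⟨h, hh, hne⟩ := hsep a b hab
  refine ⟨h, hh, fun he => hne ?_⟩
  unfold vact; rw [he]

end McKayGraphs

open scoped BigOperators
namespace McKayGraphs
open Equiv
variable {X : Type*} [Fintype X] [DecidableEq X]

lemma pair_avg (u : X → ℕ) {s : ℕ} (hs : ∀ x, 500 * rl u (u x) ≤ 499 * Fintype.card X) {a b : X} (hab : a ≠ b) :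
    500 * ∑ h : Perm X, (if u (h a) = u (h b) then 1 else 0) ≤ 499 * Fintype.card (Perm X) := by
  classical
  set N := ∑ h : Perm X, (if u (h a) = u (h b) then 1 else 0) with hN
  have h1 : ∀ z, z ≠ a → ∑ h : Perm X, (if u (h a) = u (h z) then 1 else 0) = N := by
    intro z hz
    rw [hN, ← Equiv.sum_comp (Equiv.mulRight (Equiv.swap b z))]
    apply Finset.sum_congr rfl
    intro h _
    have e1 : (Equiv.mulRight (Equiv.swap b z)) h a = h a := by
      simp [Equiv.swap_apply_of_ne_of_ne hab hz.symm]
    have e2 : (Equiv.mulRight (Equiv.swap b z)) h z = h b := by simp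
    rw [e1, e2]
  have h2 : ∑ z, ∑ h : Perm X, (if u (h a) = u (h z) then 1 else 0) = Fintype.card (Perm X) + (Fintype.card X - 1) * N := by
    rw [← Finset.add_sum_erase _ _ (Finset.mem_univ a)]
    congr 1
    · simp [Finset.card_univ]
    · rw [Finset.sum_congr rfl (fun z hz => h1 z (Finset.ne_of_mem_erase hz))]
      rw [Finset.sum_const, Finset.card_erase_of_mem (Finset.mem_univ a), Finset.card_univ, smul_eq_mul]
  rw [Finset.sum_comm] at h2
  have h3 : ∀ h : Perm X, ∑ z, (if u (h a) = u (h z) then 1 else 0) = rl u (u (h a)) := by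
    intro h
    rw [Equiv.sum_comp h (fun z => if u (h a) = u z then 1 else 0)]
    rw [← Finset.card_filter]
    unfold rl cl
    congr 1
    ext z
    simp [eq_comm]
  rw [Finset.sum_congr rfl (fun h _ => h3 h)] at h2
  have h4 : ∑ h : Perm X, 500 * rl u (u (h a)) ≤ ∑ h : Perm X, 499 * Fintype.card X := Finset.sum_le_sum fun h _ => hs _
  rw [← Finset.mul_sum, h2, Finset.sum_const, Finset.card_univ, smul_eq_mul] at h4
  have hn : 2 ≤ Fintype.card X := by
    have := Fintype.one_lt_card_iff.2 ⟨a, b, hab⟩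
    omega
  obtain ⟨m, hm⟩ : ∃ m, Fintype.card X = m + 1 := ⟨Fintype.card X - 1, by omega⟩
  rw [hm] at h4
  simp only [Nat.add_sub_cancel] at h4
  have hm1 : 1 ≤ m := by omega
  have : m * (500 * N) ≤ m * (499 * Fintype.card (Perm X)) := by nlinarith
  exact Nat.le_of_mul_le_mul_left this hm1

lemma greedy_step (u : X → ℕ) (hs : ∀ x, 500 * rl u (u x) ≤ 499 * Fintype.card X) (P : Finset (X × X))
    (hP : ∀ z ∈ P, z.1 ≠ z.2) : ∃ h : Perm X, 500 * (P.filter (fun z => u (h z.1) = u (h z.2))).card ≤ 499 * P.card := by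
  classical
  by_contra hc
  push Not at hc
  have h1 : ∑ h : Perm X, 499 * P.card < ∑ h : Perm X, 500 * (P.filter (fun z => u (h z.1) = u (h z.2))).card :=
    Finset.sum_lt_sum_of_nonempty Finset.univ_nonempty (fun h _ => hc h)
  rw [← Finset.mul_sum Finset.univ (fun h : Perm X => (P.filter (fun z => u (h z.1) = u (h z.2))).card)] at h1
  simp_rw [Finset.card_filter] at h1
  rw [Finset.sum_comm, Finset.mul_sum] at h1
  have h2 := Finset.sum_le_sum (s := P) (fun z hz => pair_avg (s := 0) u hs (hP z hz))
  have h3 := lt_of_lt_of_le h1 h2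
  rw [Finset.sum_const, Finset.sum_const, Finset.card_univ, smul_eq_mul, smul_eq_mul] at h3
  apply absurd h3
  rw [not_lt]
  apply le_of_eq; ring

lemma greedy (u : X → ℕ) (hs : ∀ x, 500 * rl u (u x) ≤ 499 * Fintype.card X) (t : ℕ) :
    ∃ l : List (Perm X), l.length = t ∧ ∃ P : Finset (X × X), (∀ z ∈ P, z.1 ≠ z.2) ∧ (∀ a b, a ≠ b → (a, b) ∉ P → SepBy u l a b)
      ∧ 500 ^ t * P.card ≤ 499 ^ t * (Fintype.card X) ^ 2 := by
  classical
  induction t with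
  | zero =>
    refine ⟨[], rfl, Finset.univ.filter (fun z => z.1 ≠ z.2), by simp, ?_, ?_⟩
    · intro a b hab h; exact absurd (by simpa using hab) h
    · simp only [pow_zero, one_mul]
      refine (Finset.card_le_univ _).trans ?_
      rw [Fintype.card_prod, sq]
  | succ t ih =>
    obtain ⟨l, hl, P, hP, hS, hc⟩ := ih
    obtain ⟨h, hh⟩ := greedy_step u hs P hP
    refine ⟨h :: l, by simp [hl], P.filter (fun z => u (h z.1) = u (h z.2)), ?_, ?_, ?_⟩
    · intro z hz; exact hP z (Finset.mem_filter.1 hz).1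
    · intro a b hab hn
      by_cases hm : (a, b) ∈ P
      · refine ⟨h, by simp, fun he => hn (Finset.mem_filter.2 ⟨hm, he⟩)⟩
      · exact (hS a b hab hm).mono (by simp)
    · calc 500 ^ (t+1) * (P.filter (fun z => u (h z.1) = u (h z.2))).card
          = 500 ^ t * (500 * (P.filter (fun z => u (h z.1) = u (h z.2))).card) := by ring
        _ ≤ 500 ^ t * (499 * P.card) := Nat.mul_le_mul_left _ hh
        _ = 499 * (500 ^ t * P.card) := by ring
        _ ≤ 499 * (499 ^ t * (Fintype.card X) ^ 2) := Nat.mul_le_mul_left _ hc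
        _ = _ := by ring

lemma greedy_log (u : X → ℕ) (hn : 2 ≤ Fintype.card X) (hs : ∀ x, 500 * rl u (u x) ≤ 499 * Fintype.card X) :
    ∃ l : List (Perm X), (l.length : ℝ) ≤ 1002 * Real.log (Fintype.card X) ∧ ∀ a b, a ≠ b → SepBy u l a b := by
  set n := Fintype.card X
  have hn' : (2:ℝ) ≤ n := by exact_mod_cast hn
  have hlog : 0.69 ≤ Real.log n := by
    have := Real.log_two_gt_d9
    have := Real.log_le_log (by norm_num) hn'
    linarith
  obtain ⟨t, ht⟩ : ∃ t : ℕ, t = ⌊1000 * Real.log n⌋₊ + 1 := ⟨_, rfl⟩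
  have ht1 : 1000 * Real.log n < t := by rw [ht]; push_cast; exact Nat.lt_floor_add_one _
  have ht2 : (t:ℝ) ≤ 1000 * Real.log n + 1 := by
    rw [ht]; push_cast
    have := Nat.floor_le (a := 1000 * Real.log n) (by linarith)
    linarith
  obtain ⟨l, hl, P, hP, hS, hc⟩ := greedy u hs t
  refine ⟨l, by rw [hl]; linarith, ?_⟩
  have hP0 : P.card = 0 := by
    by_contra h0
    have h1 : 1 ≤ P.card := Nat.one_le_iff_ne_zero.2 h0
    have h2 : 500 ^ t ≤ 499 ^ t * n ^ 2 := (Nat.le_mul_of_pos_right _ h1).trans hc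
    have h3 : (500:ℝ) ^ t ≤ 499 ^ t * n ^ 2 := by exact_mod_cast h2
    have h4 := Real.log_le_log (by positivity) h3
    rw [Real.log_mul (by positivity) (by positivity), Real.log_pow, Real.log_pow, Real.log_pow] at h4
    have h5 : Real.log (499/500) ≤ 499/500 - 1 := Real.log_le_sub_one_of_pos (by norm_num)
    rw [Real.log_div (by norm_num) (by norm_num)] at h5
    have h6 : (t:ℝ) * (Real.log 500 - Real.log 499) ≤ 2 * Real.log n := by push_cast at h4; linarith
    have h7 : (t:ℝ) * (1/500) ≤ t * (Real.log 500 - Real.log 499) := by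
      apply mul_le_mul_of_nonneg_left _ (by positivity)
      linarith
    linarith
  intro a b hab
  exact hS a b hab (by rw [Finset.card_eq_zero.1 hP0]; simp)

lemma entA_of_big (u : X → ℕ) {x₀ : X} (h : 499 * Fintype.card X < 500 * rl u (u x₀)) : Ent u ≤ 2 * EntA u := by
  classical
  have hpos := rl_pos_of u x₀
  set n := Fintype.card X with hn
  set s := rl u (u x₀) with hs
  have hsn : s ≤ n := rl_le_card u _
  have hdisj : ∀ x, u x ≠ u x₀ → 500 * rl u (u x) ≤ n ∧ rl u (u x) + s ≤ n := by
    intro x hx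
    have : (cl u (u x) ∪ cl u (u x₀)).card ≤ n := Finset.card_le_univ _
    rw [Finset.card_union_of_disjoint] at this
    · have h2 : rl u (u x) + s ≤ n := this
      omega
    · rw [Finset.disjoint_left]; intro z h1 h2
      rw [mem_cl] at h1 h2; exact hx (h1.symm.trans h2)
  have hn0 : 0 < n := by omega
  have hx0 : ¬ 500 * rl u (u x₀) ≤ n := by omega
  have hsplit : ∀ f : X → ℝ, ∑ x, f x = ∑ x ∈ cl u (u x₀), f x + ∑ x ∈ Finset.univ \ cl u (u x₀), f x := by
    intro f; rw [add_comm]; exact (Finset.sum_sdiff (Finset.subset_univ _)).symm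
  have hA : ∑ x ∈ Finset.univ \ cl u (u x₀), wv u x ≤ EntA u := by
    unfold EntA
    rw [hsplit]
    have : ∑ x ∈ Finset.univ \ cl u (u x₀), wv u x = ∑ x ∈ Finset.univ \ cl u (u x₀), Wact X u (vact u x) := by
      apply Finset.sum_congr rfl
      intro x hx
      rw [Wact_act]
      exact (hdisj x (by simpa using hx)).1
    rw [this]
    have := Finset.sum_nonneg (s := cl u (u x₀)) (fun x _ => Wact_nonneg u (vact u x))
    linarith
  have hB : ((n:ℝ) - s) ≤ ∑ x ∈ Finset.univ \ cl u (u x₀), wv u x := by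
    have : ∀ x ∈ Finset.univ \ cl u (u x₀), (1:ℝ) ≤ wv u x := by
      intro x hx
      have h1 := (hdisj x (by simpa using hx)).1
      have h2 := rl_pos_of u x
      have h2' : (0:ℝ) < rl u (u x) := by exact_mod_cast h2
      have h1' : (500:ℝ) * rl u (u x) ≤ n := by exact_mod_cast h1
      unfold wv
      rw [Real.le_log_iff_exp_le (by positivity)]
      rw [le_div_iff₀ h2']
      have := Real.exp_one_lt_d9
      nlinarith
    have h3 := Finset.card_nsmul_le_sum _ _ _ this
    rw [nsmul_eq_mul, mul_one, Finset.card_sdiff_of_subset (Finset.subset_univ _), Finset.card_univ] at h3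
    have h4 : ((n - s : ℕ) : ℝ) = n - s := by rw [Nat.cast_sub hsn]
    rw [← h4]; exact h3
  have hC : ∑ x ∈ cl u (u x₀), wv u x ≤ (n:ℝ) - s := by
    have hs0 : (0:ℝ) < s := by exact_mod_cast hpos
    have hn0' : (0:ℝ) < n := by exact_mod_cast hn0
    have : ∀ x ∈ cl u (u x₀), wv u x ≤ (n:ℝ)/s - 1 := by
      intro x hx
      unfold wv
      rw [mem_cl.1 hx]
      exact Real.log_le_sub_one_of_pos (by positivity)
    refine (Finset.sum_le_card_nsmul _ _ _ this).trans ?_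
    rw [nsmul_eq_mul]
    have : (((cl u (u x₀)).card : ℕ) : ℝ) = s := rfl
    rw [this]; apply le_of_eq; field_simp
  have : Ent u = _ := hsplit (wv u)
  rw [this]; linarith

theorem design (u : X → ℕ) (hn2 : 2 ≤ Fintype.card X) (hE : 0 < Ent u) :
    ∃ l : List (Perm X), (l.length : ℝ) ≤ 20000 * (Fintype.card X * Real.log (Fintype.card X)) / Ent u ∧
      ∀ a b, a ≠ b → SepBy u l a b := by
  classical
  have hn2' : (2:ℝ) ≤ Fintype.card X := by exact_mod_cast hn2
  have hlog : 0 < Real.log (Fintype.card X) := Real.log_pos (by linarith)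
  by_cases hA : Ent u ≤ 2 * EntA u
  · have hEA : 0 < EntA u := by linarith
    obtain ⟨k, hk⟩ : ∃ k : ℕ, k = ⌈16 * (Fintype.card X : ℝ) * Real.log (Fintype.card X) / EntA u⌉₊ := ⟨_, rfl⟩
    have hk1 : 16 * (Fintype.card X : ℝ) * Real.log (Fintype.card X) / EntA u ≤ k := by rw [hk]; exact Nat.le_ceil _
    have hk0 : (1:ℝ) ≤ Fintype.card X * Real.log (Fintype.card X) / EntA u := by
      rw [le_div_iff₀ hEA, one_mul]; exact EntA_le u
    have hk2 : (k:ℝ) ≤ 17 * (Fintype.card X * Real.log (Fintype.card X) / EntA u) := by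
      have h1 : (k:ℝ) < 16 * (Fintype.card X : ℝ) * Real.log (Fintype.card X) / EntA u + 1 := by
        rw [hk]; apply Nat.ceil_lt_add_one; positivity
      have h2 : 16 * (Fintype.card X : ℝ) * Real.log (Fintype.card X) / EntA u = 16 * (Fintype.card X * Real.log (Fintype.card X) / EntA u) := by ring
      rw [h2] at h1; linarith
    have hkpos : 0 < k := by
      have : (0:ℝ) < k := lt_of_lt_of_le (by positivity) hk1
      exact_mod_cast this
    have hfin : 102 * (Fintype.card X * Real.log (Fintype.card X) / EntA u) ≤ 20000 * (Fintype.card X * Real.log (Fintype.card X)) / Ent u := by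
      rw [mul_div_assoc 20000]
      have : Fintype.card X * Real.log (Fintype.card X) / EntA u ≤ 2 * (Fintype.card X * Real.log (Fintype.card X) / Ent u) := by
        rw [← mul_div_assoc, div_le_div_iff₀ hEA hE]
        have : 0 ≤ Fintype.card X * Real.log (Fintype.card X) := by positivity
        nlinarith
      have h3 : 0 ≤ Fintype.card X * Real.log (Fintype.card X) / Ent u := by positivity
      linarith
    by_cases h3 : 3 * k ≤ Fintype.card X
    · obtain ⟨l, hl, hS⟩ := design_main u hkpos hn2 h3 (by rwa [div_le_iff₀ hEA] at hk1)
      refine ⟨l, le_trans ?_ hfin, hS⟩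
      rw [hl]; push_cast; linarith
    · have hu : ∃ a b, u a ≠ u b := by
        by_contra hc
        push Not at hc
        apply hE.ne'
        unfold Ent
        apply Finset.sum_eq_zero
        intro x _
        unfold wv
        have : rl u (u x) = Fintype.card X := by
          unfold rl
          rw [← Finset.card_univ]; congr 1
          ext y; simp [hc y x]
        rw [this, div_self (by positivity), Real.log_one]
      obtain ⟨l, hl, hS⟩ := rot_family u hu
      refine ⟨l, le_trans ?_ hfin, hS⟩
      rw [hl]
      have : (Fintype.card X : ℝ) ≤ 3 * k := by
        push Not at h3
        exact_mod_cast h3.le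
      linarith
  · have hs : ∀ x, 500 * rl u (u x) ≤ 499 * Fintype.card X := by
      intro x
      by_contra hc
      push Not at hc
      exact hA (entA_of_big u hc)
    push Not at hA
    obtain ⟨l, hl, hS⟩ := greedy_log u hn2 hs
    refine ⟨l, hl.trans ?_, hS⟩
    rw [le_div_iff₀ hE]
    have hx : ∀ x, wv u x - Wact X u (vact u x) ≤ 8 := by
      intro x
      by_cases hx : 500 * rl u (u x) ≤ Fintype.card X
      · rw [Wact_act hx]; norm_num
      · rw [Wact_inact hx]
        push Not at hx
        have hp : (0:ℝ) < rl u (u x) := by exact_mod_cast rl_pos_of u x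
        have h1 : (Fintype.card X : ℝ) / rl u (u x) ≤ 500 := by
          rw [div_le_iff₀ hp]; exact_mod_cast hx.le
        have h2 : wv u x ≤ Real.log 500 := Real.log_le_log (by positivity) h1
        have h3 : Real.log 500 ≤ 8 := by
          rw [Real.log_le_iff_le_exp (by norm_num)]
          have h4 : Real.exp 8 = (Real.exp 1)^8 := by rw [← Real.exp_nat_mul]; norm_num
          have h5 := Real.exp_one_gt_d9
          have h6 : (2.5:ℝ)^8 ≤ (Real.exp 1)^8 := by gcongr; linarith
          rw [h4]; refine le_trans (by norm_num) h6
        linarith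
    have h1 := Finset.sum_le_card_nsmul Finset.univ _ _ (fun x _ => hx x)
    rw [Finset.sum_sub_distrib, Finset.card_univ, nsmul_eq_mul] at h1
    have h2 : Ent u - EntA u ≤ Fintype.card X * 8 := h1
    nlinarith [mul_pos hlog hE]
end McKayGraphs

open scoped BigOperators
namespace McKayGraphs
open Equiv
variable {X : Type*} [Fintype X] [DecidableEq X]

open Classical in
/-- the delta function at the identity -/
noncomputable def dl {G : Type*} [Group G] (g : G) : ℂ := if g = 1 then 1 else 0

lemma dl_mem {R : Submodule ℂ (Perm X → ℂ)} (hR : BiInv R) {u : X → ℕ} {c : ℕ} (hu : ind u ∈ R ^ c)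
    (l : List (Perm X)) (hl : ∀ a b, a ≠ b → SepBy u l a b) : (dl : Perm X → ℂ) ∈ R ^ (c * l.length) := by
  classical
  have h1 : ∏ j : Fin l.length, tl (l.get j) (l.get j)⁻¹ (ind u) ∈ (R ^ c) ^ l.length :=
    prod_mem_pow fun j => hR.pow c _ _ _ hu
  rw [← pow_mul] at h1
  convert h1 using 1
  funext g
  rw [Finset.prod_apply]
  simp only [tl_apply]
  unfold dl
  by_cases hg : g = 1
  · rw [if_pos hg]
    symm
    apply Finset.prod_eq_one
    intro j _
    subst hg
    unfold ind
    rw [if_pos]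
    simp
  · rw [if_neg hg]
    symm
    obtain ⟨y, hy⟩ : ∃ y, g y ≠ y := by
      by_contra hc
      push Not at hc
      exact hg (Equiv.ext hc)
    obtain ⟨h, hh, hne⟩ := hl _ _ hy
    obtain ⟨j, hj⟩ := List.get_of_mem hh
    apply Finset.prod_eq_zero (Finset.mem_univ j)
    rw [hj]
    unfold ind
    rw [if_neg]
    intro he
    apply hne
    have := congrFun he (h y)
    simpa using this

lemma opt_max {m : ℕ} (P : Fin m → Prop) (E : Fin m → ℝ) (hE : ∀ i, 0 ≤ E i) :
    ∃ M, 0 ≤ M ∧ (∀ i, P i → E i ≤ M) ∧ (M = 0 ∨ ∃ i, P i ∧ E i = M) := by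
  classical
  by_cases h : (Finset.univ.filter P).Nonempty
  · obtain ⟨i, hi, hmax⟩ := Finset.exists_max_image _ E h
    exact ⟨E i, hE i, fun j hj => hmax j (by simpa using hj), Or.inr ⟨i, by simpa using hi, rfl⟩⟩
  · refine ⟨0, le_rfl, fun i hi => absurd ⟨i, by simpa using hi⟩ h, Or.inl rfl⟩

lemma num_L {n : ℕ} (hn : 2 ^ 64 ≤ n) : ∃ L : ℕ, 12 ≤ L ∧ n ≤ L ^ 4 ∧
    2 * ((2 * (L:ℝ)) ^ 2 * Real.log n) ≤ (n : ℝ) ^ (3 / 4 : ℝ) ∧ (n : ℝ) ^ (3 / 4 : ℝ) ≤ (n : ℝ) / 4 := by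
  set w : ℝ := (n:ℝ) ^ (1/8 : ℝ) with hw
  have hn' : ((2:ℝ)^64) ≤ n := by exact_mod_cast hn
  have hn0 : (0:ℝ) ≤ n := by positivity
  have hn1 : (0:ℝ) < n := lt_of_lt_of_le (by positivity) hn'
  have hw1 : (256:ℝ) ≤ w := by
    have : ((2:ℝ)^64) ^ (1/8:ℝ) ≤ w := Real.rpow_le_rpow (by positivity) hn' (by norm_num)
    have h2 : ((2:ℝ)^64) ^ (1/8:ℝ) = 256 := by
      rw [show ((2:ℝ)^64) = (256:ℝ)^((8:ℕ):ℝ) by rw [Real.rpow_natCast]; norm_num, ← Real.rpow_mul (by norm_num)]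
      norm_num
    rwa [h2] at this
  have hw8 : w ^ 8 = n := by
    rw [hw, ← Real.rpow_natCast, ← Real.rpow_mul hn0]; norm_num
  have hw6 : (n:ℝ) ^ (3/4:ℝ) = w ^ 6 := by
    rw [hw, ← Real.rpow_natCast, ← Real.rpow_mul hn0]; norm_num
  have hlog : Real.log n ≤ 8 * w := by
    rw [← hw8, Real.log_pow]
    have := Real.log_le_sub_one_of_pos (x := w) (by linarith)
    push_cast; linarith
  have hw2 : (1:ℝ) ≤ w ^ 2 := by nlinarith
  refine ⟨⌈w ^ 2⌉₊, ?_, ?_, ?_, ?_⟩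
  · have : (12:ℝ) ≤ ⌈w ^ 2⌉₊ := le_trans (by nlinarith) (Nat.le_ceil _)
    exact_mod_cast this
  · have : (n:ℝ) ≤ (⌈w ^ 2⌉₊ : ℝ) ^ 4 := by
      have h := Nat.le_ceil (w^2)
      calc (n:ℝ) = (w^2)^4 := by rw [← hw8]; ring
        _ ≤ _ := by gcongr
    exact_mod_cast this
  · have h : (⌈w ^ 2⌉₊ : ℝ) ≤ 2 * w ^ 2 := by
      have := Nat.ceil_lt_add_one (a := w^2) (by positivity)
      linarith
    rw [hw6]
    calc 2 * ((2 * (⌈w ^ 2⌉₊:ℝ)) ^ 2 * Real.log n) ≤ 2 * ((2 * (2 * w^2)) ^ 2 * (8 * w)) := by gcongr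
      _ = 256 * w^5 := by ring
      _ ≤ w * w^5 := by gcongr
      _ = w^6 := by ring
  · rw [hw6, ← hw8]
    have : (4:ℝ) ≤ w^2 := by nlinarith
    have h6 : 0 ≤ w^6 := by positivity
    nlinarith

theorem comb {p q : X → ℕ} (hT : YT p q) (hn : 2 ^ 64 ≤ Fintype.card X) :
    ∃ L : ℕ, Real.log (((Fintype.card X).factorial : ℝ) / stc (kap p q L)) ≤ 0 ∨ ∃ (k : ℕ) (M : ℝ), 1 ≤ k ∧ 0 < M ∧
      (dl : Perm X → ℂ) ∈ (tr (fT p q)) ^ k ∧ k * M ≤ (2832 * 2832 * 20000) * (Fintype.card X * Real.log (Fintype.card X)) ∧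
      Real.log (((Fintype.card X).factorial : ℝ) / stc (kap p q L)) ≤ 200 * M ∧
      (2 * rl q 0 ≤ Fintype.card X + 1 → 2 * rl p 0 ≤ Fintype.card X + 1 → (Fintype.card X : ℝ) ≤ 200 * M) := by
  classical
  obtain ⟨L, hL12, hL4, hnum, hnum2⟩ := num_L hn
  obtain ⟨K, hK⟩ : ∃ K, K = 2832 * 2832 := ⟨_, rfl⟩
  have hKe : Even K := by rw [hK]; decide
  have h2n : 2 ≤ Fintype.card X := le_trans (by norm_num) hn
  refine ⟨L, ?_⟩
  let P : Fin 4 → Prop := ![L ≤ rl q 0, 2 * rl q 1 ≤ rl q 0, L ≤ rl p 0, 2 * rl p 1 ≤ rl p 0]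
  let U : Fin 4 → X → ℕ := ![trn q L, two q, trn p L, two p]
  obtain ⟨M, hM0, hM, hM'⟩ := opt_max P (fun i => Ent (U i)) (fun i => Ent_nonneg _)
  obtain ⟨hb1, hb2⟩ := ent_bound hT hM0 (by omega) (hM 0) (hM 1) (hM 2) (hM 3) hnum hnum2 (le_trans (by norm_num) hn)
  have hb1' := (log_stc p q L (by omega)).trans hb1
  rcases hM' with h0 | ⟨i, hi, hEi⟩
  · left; rw [h0, mul_zero] at hb1'; exact hb1'
  rcases hM0.eq_or_lt with h0 | hMpos
  · left; rw [← h0, mul_zero] at hb1'; exact hb1'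
  right
  have hav : ∃ c, 1 ≤ c ∧ c ≤ K ∧ ind (U i) ∈ (tr (fT p q)) ^ c := by
    have e4 : Even 4 := by decide
    have h4K : 4 ≤ K := by rw [hK]; norm_num
    have key : (P 0 → ind (U 0) ∈ (tr (fT p q)) ^ K) ∧ (P 1 → ind (U 1) ∈ (tr (fT p q)) ^ 4) ∧
        (P 2 → ind (U 2) ∈ (tr (fT p q)) ^ K) ∧ (P 3 → ind (U 3) ∈ (tr (fT p q)) ^ 4) := by
      refine ⟨fun h => ?_, fun h => ?_, fun h => ?_, fun h => ?_⟩
      · have := trunc_mem hT hL12 hL4 h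
        rw [← hK] at this
        exact flip_mem hT.flip.1 hKe (ind_inv _) this
      · exact cut_mem hT h
      · have := trunc_mem hT.flip hL12 hL4 h
        rw [← hK] at this
        exact this
      · exact flip_mem hT.flip.1 e4 (ind_inv _) (cut_mem hT.flip h)
    fin_cases i
    · exact ⟨K, by omega, le_rfl, key.1 hi⟩
    · exact ⟨4, by omega, h4K, key.2.1 hi⟩
    · exact ⟨K, by omega, le_rfl, key.2.2.1 hi⟩
    · exact ⟨4, by omega, h4K, key.2.2.2 hi⟩
  obtain ⟨c, hc1, hcK, hc⟩ := hav
  obtain ⟨l, hl, hS⟩ := design (U i) h2n (by rw [hEi]; exact hMpos)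
  have hlpos : 1 ≤ l.length := by
    obtain ⟨a, b, hab⟩ := Fintype.one_lt_card_iff.1 (show 1 < Fintype.card X by omega)
    obtain ⟨h, hh, -⟩ := hS a b hab
    exact List.length_pos_of_mem hh
  refine ⟨c * l.length, M, Nat.mul_pos hc1 hlpos, hMpos, dl_mem (tr_biInv _) hc l hS, ?_, hb1', hb2⟩
  rw [hEi, le_div_iff₀ hMpos] at hl
  have hcK' : (c:ℝ) ≤ 2832 * 2832 := by
    have := (Nat.cast_le (α := ℝ)).2 hcK
    rw [hK] at this; norm_num at this ⊢; exact this
  push_cast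
  have hlM : (0:ℝ) ≤ l.length * M := by positivity
  calc (c:ℝ) * l.length * M = c * (l.length * M) := by ring
    _ ≤ (2832 * 2832) * (20000 * (Fintype.card X * Real.log (Fintype.card X))) :=
        mul_le_mul hcK' hl hlM (by positivity)
    _ = _ := by ring
end McKayGraphs

open scoped BigOperators
namespace McKayGraphs
open Equiv

section reps
open Matrix
open scoped Kronecker
variable {G : Type*} [Group G] [Fintype G]
variable {I J : Type*} [Fintype I] [DecidableEq I] [Fintype J] [DecidableEq J]

lemma idem_trace (E : Matrix J J ℂ) (h : E * E = E) : Matrix.trace E = (E.rank : ℂ) := by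
  have h1 : LinearMap.IsProj (LinearMap.range (Matrix.toLin' E)) (Matrix.toLin' E) := by
    constructor
    · intro x; exact ⟨x, rfl⟩
    · rintro _ ⟨x, rfl⟩
      rw [← LinearMap.comp_apply, ← Matrix.toLin'_mul, h]
  have h2 := h1.trace
  rw [Matrix.trace_toLin'_eq] at h2
  rw [h2, Matrix.rank_eq_finrank_range_toLin E (Pi.basisFun ℂ J) (Pi.basisFun ℂ J)]
  rfl

noncomputable def avg (R : G →* Matrix J J ℂ) : Matrix J J ℂ := (Fintype.card G : ℂ)⁻¹ • ∑ g, R g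

lemma cardG_ne (G : Type*) [Group G] [Fintype G] : (Fintype.card G : ℂ) ≠ 0 := by
  exact_mod_cast Fintype.card_ne_zero

lemma mul_avg (R : G →* Matrix J J ℂ) (h : G) : R h * avg R = avg R := by
  unfold avg
  rw [Matrix.mul_smul, Finset.mul_sum]
  congr 1
  simp_rw [← map_mul]
  exact Equiv.sum_comp (Equiv.mulLeft h) (fun g => R g)

lemma avg_idem (R : G →* Matrix J J ℂ) : avg R * avg R = avg R := by
  conv_lhs => enter [1]; unfold avg
  rw [Matrix.smul_mul, Finset.sum_mul, Finset.sum_congr rfl (fun g _ => mul_avg R g), Finset.sum_const, Finset.card_univ,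
    ← Nat.cast_smul_eq_nsmul ℂ, smul_smul, inv_mul_cancel₀ (cardG_ne G), one_smul]

lemma sum_trace (R : G →* Matrix J J ℂ) : ∑ g, Matrix.trace (R g) = Fintype.card G * ((avg R).rank : ℂ) := by
  rw [← idem_trace _ (avg_idem R)]
  unfold avg
  rw [Matrix.trace_smul, Matrix.trace_sum, smul_eq_mul, mul_inv_cancel_left₀ (cardG_ne G)]

noncomputable def kr (R : G →* Matrix I I ℂ) (S : G →* Matrix J J ℂ) : G →* Matrix (I × J) (I × J) ℂ where
  toFun g := R g ⊗ₖ S g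
  map_one' := by rw [map_one, map_one, Matrix.one_kronecker_one]
  map_mul' g h := by rw [map_mul, map_mul, Matrix.mul_kronecker_mul]

lemma kr_apply (R : G →* Matrix I I ℂ) (S : G →* Matrix J J ℂ) (g : G) : kr R S g = R g ⊗ₖ S g := rfl

lemma kr_trace (R : G →* Matrix I I ℂ) (S : G →* Matrix J J ℂ) (g : G) :
    Matrix.trace (kr R S g) = Matrix.trace (R g) * Matrix.trace (S g) := Matrix.trace_kronecker _ _

/-- space of matrix coefficients -/
noncomputable def mcfm (R : G →* Matrix I I ℂ) : Matrix I I ℂ →ₗ[ℂ] (G → ℂ) where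
  toFun A g := Matrix.trace (A * R g)
  map_add' A B := by funext g; simp [Matrix.add_mul]
  map_smul' c A := by funext g; simp

noncomputable def mcf (R : G →* Matrix I I ℂ) : Submodule ℂ (G → ℂ) := LinearMap.range (mcfm R)

lemma mem_mcf {R : G →* Matrix I I ℂ} {F : G → ℂ} : F ∈ mcf R ↔ ∃ A, ∀ g, F g = Matrix.trace (A * R g) := by
  constructor
  · rintro ⟨A, rfl⟩; exact ⟨A, fun g => rfl⟩
  · rintro ⟨A, h⟩; exact ⟨A, funext fun g => (h g).symm⟩

lemma mcf_mul (R : G →* Matrix I I ℂ) (S : G →* Matrix J J ℂ) : mcf R * mcf S ≤ mcf (kr R S) := by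
  rw [Submodule.mul_le]
  intro F hF H hH
  obtain ⟨A, hA⟩ := mem_mcf.1 hF
  obtain ⟨B, hB⟩ := mem_mcf.1 hH
  refine mem_mcf.2 ⟨A ⊗ₖ B, fun g => ?_⟩
  rw [kr_apply, ← Matrix.mul_kronecker_mul, Matrix.trace_kronecker, ← hA, ← hB]; rfl

universe ww
lemma exists_pow {I : Type ww} [Fintype I] [DecidableEq I] (R : G →* Matrix I I ℂ) (k : ℕ) :
    ∃ (J : Type ww) (_ : Fintype J) (_ : DecidableEq J) (T : G →* Matrix J J ℂ), (mcf R) ^ k ≤ mcf T ∧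
      (∀ g, Matrix.trace (T g) = Matrix.trace (R g) ^ k) ∧ Fintype.card J = Fintype.card I ^ k := by
  induction k with
  | zero =>
    refine ⟨PUnit, inferInstance, inferInstance, 1, ?_, ?_, ?_⟩
    · rw [pow_zero, Submodule.one_le]
      refine mem_mcf.2 ⟨1, fun g => ?_⟩
      simp
    · intro g; simp
    · simp
  | succ k ih =>
    obtain ⟨J, i1, i2, T, h1, h2, h3⟩ := ih
    refine ⟨J × I, inferInstance, inferInstance, kr T R, ?_, ?_, ?_⟩
    · rw [pow_succ]
      exact (mul_le_mul' h1 le_rfl).trans (mcf_mul _ _)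
    · intro g; rw [kr_trace, h2, pow_succ]
    · rw [Fintype.card_prod, h3, pow_succ]

lemma rank_add_le' {m n : Type*} [Fintype m] [Fintype n] [DecidableEq n] [DecidableEq m] (A B : Matrix m n ℂ) : (A + B).rank ≤ A.rank + B.rank := by
  unfold Matrix.rank
  refine (Submodule.finrank_mono (t := LinearMap.range A.mulVecLin ⊔ LinearMap.range B.mulVecLin) ?_).trans (Submodule.finrank_add_le_finrank_add_finrank _ _)
  rintro _ ⟨x, rfl⟩
  rw [Matrix.mulVecLin_add]
  exact Submodule.add_mem_sup ⟨x, rfl⟩ ⟨x, rfl⟩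

lemma rank_sum_le' {m n ι : Type*} [Fintype m] [Fintype n] [DecidableEq n] [DecidableEq m] (s : Finset ι) (A : ι → Matrix m n ℂ) (r : ℕ) 
    (h : ∀ i, (A i).rank ≤ r) : (∑ i ∈ s, A i).rank ≤ s.card * r := by
  classical
  induction s using Finset.induction_on with
  | empty => simp
  | insert a s ha ih =>
    rw [Finset.sum_insert ha, Finset.card_insert_of_notMem ha]
    refine (rank_add_le' _ _).trans ?_
    have := h a
    rw [add_mul, one_mul]; omega

theorem rank_bound (V : G →* Matrix J J ℂ) (Z : G →* Matrix I I ℂ) (hd : (dl : G → ℂ) ∈ mcf V) :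
    ∃ r : ℕ, ∑ g, Matrix.trace (V g) * Matrix.trace (Z g) = Fintype.card G * (r : ℂ) ∧
      Fintype.card I ≤ Fintype.card J * r := by
  classical
  obtain ⟨B, hB⟩ := mem_mcf.1 hd
  refine ⟨(avg (kr V Z)).rank, ?_, ?_⟩
  · rw [← sum_trace]; exact Finset.sum_congr rfl fun g _ => (kr_trace _ _ _).symm
  set E := avg (kr V Z) with hE
  let S : J → Matrix I (J × I) ℂ := fun j => Matrix.of fun i z => if z = (j, i) then 1 else 0
  let Q : J → Matrix (J × I) I ℂ := fun j => Matrix.of fun z i => if z.2 = i then B z.1 j else 0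
  have hSQ : ∀ M : Matrix (J × I) (J × I) ℂ, ∀ i i', (∑ j, S j * M * Q j) i i' = ∑ j, ∑ j', M (j, i) (j', i') * B j' j := by
    intro M i i'
    rw [Matrix.sum_apply]
    apply Finset.sum_congr rfl
    intro j _
    have e1 : ∀ z, (S j * M) i z = M (j, i) z := by
      intro z
      rw [Matrix.mul_apply, Finset.sum_eq_single (j, i)]
      · simp [S]
      · intro b _ hb; simp [S, hb]
      · simp
    rw [Matrix.mul_apply]
    simp_rw [e1]
    rw [Fintype.sum_prod_type]
    apply Finset.sum_congr rfl
    intro j' _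
    rw [Finset.sum_eq_single i']
    · simp [Q]
    · intro b _ hb; simp [Q, hb]
    · simp
  have hP : ∑ j, S j * E * Q j = (Fintype.card G : ℂ)⁻¹ • (1 : Matrix I I ℂ) := by
    have h1 : ∑ j, S j * E * Q j = (Fintype.card G : ℂ)⁻¹ • ∑ g, ∑ j, S j * kr V Z g * Q j := by
      rw [hE]; unfold avg
      rw [Finset.sum_comm (s := (Finset.univ : Finset G))]
      conv_rhs => rw [Finset.smul_sum]
      apply Finset.sum_congr rfl
      intro j _
      rw [Matrix.mul_smul, Matrix.smul_mul, Matrix.mul_sum, Matrix.sum_mul]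
    rw [h1]
    congr 1
    have h2 : ∀ g, ∑ j, S j * kr V Z g * Q j = dl g • Z g := by
      intro g
      ext i i'
      rw [hSQ, hB g, Matrix.smul_apply, Matrix.trace, Finset.sum_comm]
      simp only [Matrix.diag_apply, Matrix.mul_apply, smul_eq_mul]
      rw [Finset.sum_mul]
      apply Finset.sum_congr rfl; intro j _
      rw [Finset.sum_mul]
      apply Finset.sum_congr rfl; intro j' _
      rw [kr_apply, Matrix.kroneckerMap_apply]; ring
    rw [Finset.sum_congr rfl (fun g _ => h2 g), Finset.sum_eq_single 1]
    · simp [dl]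
    · intro g _ hg; simp [dl, hg]
    · simp
  have h3 : (∑ j, S j * E * Q j).rank ≤ (Finset.univ : Finset J).card * E.rank := by
    apply rank_sum_le'
    intro j
    exact (Matrix.rank_mul_le_left _ _).trans (Matrix.rank_mul_le_right _ _)
  rw [Finset.card_univ, hP] at h3
  refine le_trans (le_of_eq ?_) h3
  symm
  apply Matrix.rank_of_isUnit
  rw [Matrix.isUnit_iff_isUnit_det, Matrix.det_smul, Matrix.det_one, mul_one]
  exact (IsUnit.mk0 _ (inv_ne_zero (cardG_ne G))).pow _

/-- complex conjugate representation -/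
noncomputable def cj (R : G →* Matrix I I ℂ) : G →* Matrix I I ℂ :=
  ((starRingEnd ℂ).mapMatrix : Matrix I I ℂ →+* Matrix I I ℂ).toMonoidHom.comp R

lemma cj_trace (R : G →* Matrix I I ℂ) (g : G) : Matrix.trace (cj R g) = starRingEnd ℂ (Matrix.trace (R g)) := by
  unfold cj
  simp [Matrix.trace, map_sum]

open scoped ComplexOrder in
lemma trace_inv_conj (R : G →* Matrix I I ℂ) (g : G) : Matrix.trace (R g⁻¹) = starRingEnd ℂ (Matrix.trace (R g)) := by
  classical
  set H : Matrix I I ℂ := ∑ h, (R h)ᴴ * R h with hH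
  have hpos : H.PosDef := by
    rw [hH, ← Finset.add_sum_erase _ _ (Finset.mem_univ 1)]
    apply Matrix.PosDef.add_posSemidef
    · rw [map_one]; simp [Matrix.PosDef.one]
    · exact Matrix.posSemidef_sum _ (fun h _ => Matrix.posSemidef_conjTranspose_mul_self _)
  have hu : IsUnit H := hpos.isUnit
  have hinv : (R g)ᴴ * H * R g = H := by
    rw [hH, Finset.mul_sum, Finset.sum_mul]
    refine Eq.trans ?_ (Equiv.sum_comp (Equiv.mulRight g) (fun h => (R h)ᴴ * R h))
    apply Finset.sum_congr rfl
    intro h _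
    simp only [Equiv.coe_mulRight, map_mul, Matrix.conjTranspose_mul]
    noncomm_ring
  obtain ⟨U, hU⟩ := hu
  have h1 : R g * R g⁻¹ = 1 := by rw [← map_mul, mul_inv_cancel, map_one]
  have h2 : (R g)ᴴ * H = H * R g⁻¹ := by
    calc (R g)ᴴ * H = (R g)ᴴ * H * (R g * R g⁻¹) := by rw [h1, mul_one]
      _ = ((R g)ᴴ * H * R g) * R g⁻¹ := by noncomm_ring
      _ = _ := by rw [hinv]
  have h3 : (R g)ᴴ = H * R g⁻¹ * (↑U⁻¹ : Matrix I I ℂ) := by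
    rw [← h2, mul_assoc, ← hU, Units.mul_inv, mul_one]
  have h4 : Matrix.trace ((R g)ᴴ) = Matrix.trace (R g⁻¹) := by
    rw [h3, Matrix.trace_mul_comm, ← mul_assoc, ← hU, Units.inv_mul, one_mul]
  rw [← h4, Matrix.trace_conjTranspose]; rfl
end reps
end McKayGraphs

open scoped BigOperators
namespace McKayGraphs
open Equiv

section reps2
open Matrix
open scoped Kronecker
variable {G : Type*} [Group G] [Fintype G]
variable {I J : Type*} [Fintype I] [DecidableEq I] [Fintype J] [DecidableEq J]

/-- irreducibility by norm -/
def Irr (R : G →* Matrix I I ℂ) : Prop := ∑ g, Matrix.trace (R g) * Matrix.trace (R g⁻¹) = (Fintype.card G : ℂ)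

noncomputable def du (R : G →* Matrix I I ℂ) : G →* Matrix I I ℂ where
  toFun g := (R g⁻¹)ᵀ
  map_one' := by simp
  map_mul' g h := by rw [_root_.mul_inv_rev, map_mul, Matrix.transpose_mul]

lemma du_apply (R : G →* Matrix I I ℂ) (g : G) : du R g = (R g⁻¹)ᵀ := rfl

lemma rep_inv (R : G →* Matrix I I ℂ) (g : G) : R g * R g⁻¹ = 1 := by rw [← map_mul, mul_inv_cancel, map_one]
lemma rep_inv' (R : G →* Matrix I I ℂ) (g : G) : R g⁻¹ * R g = 1 := by rw [← map_mul, inv_mul_cancel, map_one]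

lemma Irr.nonempty {R : G →* Matrix I I ℂ} (h : Irr R) : Nonempty I := by
  by_contra hc
  rw [not_nonempty_iff] at hc
  unfold Irr at h
  simp [Matrix.trace] at h
  exact cardG_ne G h.symm

lemma Irr.card_ne {R : G →* Matrix I I ℂ} (h : Irr R) : (Fintype.card I : ℂ) ≠ 0 := by
  haveI := h.nonempty
  exact_mod_cast Fintype.card_ne_zero

theorem schur {R : G →* Matrix I I ℂ} (h : Irr R) (X : Matrix I I ℂ) :
    ∑ g, R g * X * R g⁻¹ = ((Fintype.card G : ℂ) * Matrix.trace X / Fintype.card I) • (1 : Matrix I I ℂ) := by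
  haveI := h.nonempty
  set E := avg (kr (du R) R) with hE
  have hr : E.rank = 1 := by
    have h1 := sum_trace (kr (du R) R)
    have h2 : ∑ g, Matrix.trace (kr (du R) R g) = Fintype.card G := by
      rw [← h]
      apply Finset.sum_congr rfl
      intro g _
      rw [kr_trace, du_apply, Matrix.trace_transpose, mul_comm]
    rw [h2] at h1
    have h3 : ((E.rank : ℕ) : ℂ) = 1 := by
      have := cardG_ne G
      field_simp at h1
      exact h1.symm
    exact_mod_cast h3
  have hvec : ∀ Y : Matrix I I ℂ, E *ᵥ Matrix.vec Y = Matrix.vec ((Fintype.card G : ℂ)⁻¹ • ∑ g, R g * Y * R g⁻¹) := by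
    intro Y
    rw [hE]; unfold avg
    rw [Matrix.smul_mulVec, Matrix.sum_mulVec, Matrix.vec_smul, Matrix.vec_sum]
    congr 1
    apply Finset.sum_congr rfl
    intro g _
    rw [kr_apply, Matrix.kronecker_mulVec_vec, du_apply, Matrix.transpose_transpose]
  have hone : E *ᵥ Matrix.vec (1 : Matrix I I ℂ) = Matrix.vec 1 := by
    rw [hvec]
    congr 1
    simp only [mul_one, rep_inv]
    rw [Finset.sum_const, Finset.card_univ, ← Nat.cast_smul_eq_nsmul ℂ, smul_smul, inv_mul_cancel₀ (cardG_ne G), one_smul]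
  have hv0 : Matrix.vec (1 : Matrix I I ℂ) ≠ 0 := by
    intro hc
    have := congrFun hc (Classical.arbitrary I, Classical.arbitrary I)
    simp [Matrix.vec] at this
  have hfr : Module.finrank ℂ (LinearMap.range E.mulVecLin) = 1 := hr
  have hmem : Matrix.vec (1 : Matrix I I ℂ) ∈ LinearMap.range E.mulVecLin := ⟨_, hone⟩
  obtain ⟨c, hc⟩ := (finrank_eq_one_iff_of_nonzero' (⟨_, hmem⟩ : LinearMap.range E.mulVecLin)
    (by intro hh; exact hv0 (congrArg Subtype.val hh))).1 hfr ⟨E *ᵥ Matrix.vec X, ⟨_, rfl⟩⟩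
  have hc' : c • Matrix.vec (1 : Matrix I I ℂ) = E *ᵥ Matrix.vec X := congrArg Subtype.val hc
  rw [hvec, ← Matrix.vec_smul] at hc'
  have h5 := Matrix.vec_inj.1 hc'
  have h6 : ∑ g, R g * X * R g⁻¹ = ((Fintype.card G : ℂ) * c) • (1 : Matrix I I ℂ) := by
    rw [mul_smul, h5, smul_smul, mul_inv_cancel₀ (cardG_ne G), one_smul]
  have h7 := congrArg Matrix.trace h6
  rw [Matrix.trace_sum, Matrix.trace_smul, Matrix.trace_one] at h7
  have h8 : ∀ g, Matrix.trace (R g * X * R g⁻¹) = Matrix.trace X := by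
    intro g; rw [Matrix.trace_mul_comm, ← mul_assoc, rep_inv', one_mul]
  rw [Finset.sum_congr rfl (fun g _ => h8 g), Finset.sum_const, Finset.card_univ, nsmul_eq_mul, smul_eq_mul] at h7
  rw [h6, h7, mul_div_assoc, div_self h.card_ne, mul_one]

/-- Schur orthogonality, entries -/
lemma schur_entry {R : G →* Matrix I I ℂ} (h : Irr R) (i j k l : I) :
    ∑ g, R g i j * R g⁻¹ k l = if i = l ∧ j = k then (Fintype.card G : ℂ) / Fintype.card I else 0 := by
  have h1 := congrFun (congrFun (schur h (Matrix.single j k 1)) i) l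
  rw [Matrix.sum_apply] at h1
  have h2 : ∀ g, (R g * (Matrix.single j k 1 : Matrix I I ℂ) * R g⁻¹) i l = R g i j * R g⁻¹ k l := by
    intro g
    rw [Matrix.mul_apply, Finset.sum_eq_single k]
    · rw [Matrix.mul_apply, Finset.sum_eq_single j]
      · simp
      · intro b _ hb; simp [Matrix.single, hb.symm]
      · simp
    · intro b _ hb
      rw [Matrix.mul_apply, Finset.sum_eq_zero, zero_mul]
      intro x _; simp [Matrix.single, hb.symm]
    · simp
  rw [Finset.sum_congr rfl (fun g _ => h2 g)] at h1
  rw [h1, Matrix.smul_apply, Matrix.one_apply]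
  by_cases hjk : j = k
  · subst hjk
    by_cases hil : i = l
    · simp [hil]
    · simp [hil]
  · rw [Matrix.trace_single_eq_of_ne _ _ _ hjk]; simp [hjk]

/-- expansion of a matrix -/
lemma expand {R : G →* Matrix I I ℂ} (h : Irr R) (X : Matrix I I ℂ) :
    ∑ g, Matrix.trace (X * R g⁻¹) • R g = ((Fintype.card G : ℂ) / Fintype.card I) • X := by
  ext i j
  rw [Matrix.sum_apply]
  simp only [Matrix.smul_apply, smul_eq_mul, Matrix.trace, Matrix.diag_apply, Matrix.mul_apply]
  simp_rw [Finset.sum_mul]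
  rw [Finset.sum_comm]
  rw [Finset.sum_eq_single i]
  · rw [Finset.sum_comm, Finset.sum_eq_single j]
    · have : ∀ g, X i j * R g⁻¹ j i * R g i j = X i j * (R g i j * R g⁻¹ j i) := fun g => by ring
      simp_rw [this]
      rw [← Finset.mul_sum, schur_entry h, if_pos ⟨rfl, rfl⟩]; ring
    · intro b _ hb
      have : ∀ g, X i b * R g⁻¹ b i * R g i j = X i b * (R g i j * R g⁻¹ b i) := fun g => by ring
      simp_rw [this]
      rw [← Finset.mul_sum, schur_entry h, if_neg (fun hh => hb hh.2.symm), mul_zero]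
    · simp
  · intro b _ hb
    rw [Finset.sum_comm]
    apply Finset.sum_eq_zero
    intro c _
    have : ∀ g, X b c * R g⁻¹ c b * R g i j = X b c * (R g i j * R g⁻¹ c b) := fun g => by ring
    simp_rw [this]
    rw [← Finset.mul_sum, schur_entry h, if_neg (fun hh => hb hh.1.symm), mul_zero]
  · simp

/-- the coefficient space is determined by the character -/
lemma mcf_le_of_trace {R : G →* Matrix I I ℂ} (h : Irr R) {S : G →* Matrix J J ℂ}
    (hRS : ∀ g, Matrix.trace (R g) = Matrix.trace (S g)) : mcf R ≤ mcf S := by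
  intro F hF
  obtain ⟨A, hA⟩ := mem_mcf.1 hF
  have hc : (Fintype.card G : ℂ) / Fintype.card I ≠ 0 := div_ne_zero (cardG_ne G) h.card_ne
  refine mem_mcf.2 ⟨((Fintype.card G : ℂ) / Fintype.card I)⁻¹ • ∑ g, Matrix.trace (A * R g⁻¹) • S g, fun x => ?_⟩
  have h1 : A = ((Fintype.card G : ℂ) / Fintype.card I)⁻¹ • ∑ g, Matrix.trace (A * R g⁻¹) • R g := by
    rw [expand h, smul_smul, inv_mul_cancel₀ hc, one_smul]
  rw [hA]
  conv_lhs => rw [h1]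
  simp only [Matrix.smul_mul, Matrix.trace_smul, Matrix.sum_mul, Matrix.trace_sum, ← map_mul, hRS]

/-- convolution by the character acts on coefficient space as a scalar -/
lemma char_conv {R : G →* Matrix I I ℂ} (h : Irr R) {F : G → ℂ} (hF : F ∈ mcf R) (x : G) :
    ∑ g, Matrix.trace (R g) * F (g⁻¹ * x) = ((Fintype.card G : ℂ) / Fintype.card I) * F x := by
  obtain ⟨A, hA⟩ := mem_mcf.1 hF
  have h1 : ∑ g, Matrix.trace (R g) • R g⁻¹ = ((Fintype.card G : ℂ) / Fintype.card I) • (1 : Matrix I I ℂ) := by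
    rw [← expand h, ← Equiv.sum_comp (Equiv.inv G)]
    apply Finset.sum_congr rfl; intro g _
    simp
  have h2 : ∀ g, Matrix.trace (R g) * F (g⁻¹ * x) = Matrix.trace (A * (Matrix.trace (R g) • R g⁻¹) * R x) := by
    intro g
    rw [hA, map_mul, Matrix.mul_smul, Matrix.smul_mul, Matrix.trace_smul, smul_eq_mul, mul_assoc]
  rw [Finset.sum_congr rfl (fun g _ => h2 g), ← Matrix.trace_sum, ← Matrix.sum_mul, ← Matrix.mul_sum, h1]
  rw [Matrix.mul_smul, Matrix.smul_mul, Matrix.trace_smul, mul_one, smul_eq_mul, hA]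

lemma trace_class (R : G →* Matrix I I ℂ) (g h : G) : Matrix.trace (R (h * g * h⁻¹)) = Matrix.trace (R g) := by
  rw [map_mul, map_mul, Matrix.trace_mul_comm, ← mul_assoc, rep_inv', one_mul]

/-- orthogonality for different characters -/
lemma char_conv_zero {R : G →* Matrix I I ℂ} (h : Irr R) {S : G →* Matrix J J ℂ} (hS : Irr S)
    (hne : ∃ g, Matrix.trace (R g) ≠ Matrix.trace (S g)) {F : G → ℂ} (hF : F ∈ mcf R) (x : G) :
    ∑ g, Matrix.trace (S g) * F (g⁻¹ * x) = 0 := by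
  obtain ⟨A, hA⟩ := mem_mcf.1 hF
  -- inner product vanishes
  have hin : ∑ g, Matrix.trace (S g) * Matrix.trace (R g⁻¹) = 0 := by
    have h1 := sum_trace (kr S (du R))
    simp_rw [kr_trace, du_apply, Matrix.trace_transpose] at h1
    obtain ⟨r, hr⟩ : ∃ r, r = (avg (kr S (du R))).rank := ⟨_, rfl⟩
    rw [← hr] at h1
    rcases Nat.eq_zero_or_pos r with h0 | h0
    · rw [h1, h0]; simp
    exfalso
    -- sum |R - S|^2 = |G| (2 - 2 r)
    have e1 : ∀ g, Matrix.trace (R g⁻¹) = starRingEnd ℂ (Matrix.trace (R g)) := trace_inv_conj R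
    have e2 : ∀ g, Matrix.trace (S g⁻¹) = starRingEnd ℂ (Matrix.trace (S g)) := trace_inv_conj S
    have hh := h
    have hhS := hS
    unfold Irr at hh hhS
    simp_rw [e1] at hh h1
    simp_rw [e2] at hhS
    have h1' := congrArg (starRingEnd ℂ) h1
    rw [map_sum] at h1'
    simp only [map_mul, Complex.conj_conj, map_natCast] at h1'
    have hsum : ∑ g, (Matrix.trace (R g) - Matrix.trace (S g)) * starRingEnd ℂ (Matrix.trace (R g) - Matrix.trace (S g))
        = Fintype.card G * (2 - 2 * (r:ℂ)) := by
      have : ∀ g, (Matrix.trace (R g) - Matrix.trace (S g)) * starRingEnd ℂ (Matrix.trace (R g) - Matrix.trace (S g)) =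
          Matrix.trace (R g) * starRingEnd ℂ (Matrix.trace (R g)) + Matrix.trace (S g) * starRingEnd ℂ (Matrix.trace (S g))
          - Matrix.trace (S g) * starRingEnd ℂ (Matrix.trace (R g)) - starRingEnd ℂ (Matrix.trace (S g)) * Matrix.trace (R g) := by
        intro g; rw [map_sub]; ring
      rw [Finset.sum_congr rfl (fun g _ => this g), Finset.sum_sub_distrib, Finset.sum_sub_distrib, Finset.sum_add_distrib,
        hh, hhS, h1, h1']; ring
    simp_rw [Complex.mul_conj] at hsum
    have hsum' : ∑ g, Complex.normSq (Matrix.trace (R g) - Matrix.trace (S g)) = Fintype.card G * (2 - 2 * (r:ℝ)) := by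
      exact_mod_cast hsum
    have hle : ∑ g, Complex.normSq (Matrix.trace (R g) - Matrix.trace (S g)) ≤ 0 := by
      rw [hsum']
      have : (1:ℝ) ≤ r := by exact_mod_cast h0
      apply mul_nonpos_of_nonneg_of_nonpos
      · positivity
      · linarith
    obtain ⟨g, hg⟩ := hne
    have hpos : 0 < Complex.normSq (Matrix.trace (R g) - Matrix.trace (S g)) := Complex.normSq_pos.2 (sub_ne_zero.2 hg)
    have := Finset.single_le_sum (f := fun g => Complex.normSq (Matrix.trace (R g) - Matrix.trace (S g)))
      (fun g _ => Complex.normSq_nonneg _) (Finset.mem_univ g)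
    linarith
  -- the operator is central
  set W : Matrix I I ℂ := ∑ g, Matrix.trace (S g) • R g⁻¹ with hW
  have hW0 : W = 0 := by
    have hcen : ∀ y, R y * W * R y⁻¹ = W := by
      intro y
      rw [hW, Matrix.mul_sum, Matrix.sum_mul]
      refine Eq.trans ?_ (Equiv.sum_comp (MulAut.conj y).toEquiv (fun g => Matrix.trace (S g) • R g⁻¹))
      apply Finset.sum_congr rfl
      intro g _
      have : (MulAut.conj y).toEquiv g = y * g * y⁻¹ := rfl
      rw [this, trace_class, Matrix.mul_smul, Matrix.smul_mul]
      congr 1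
      rw [← map_mul, ← map_mul]; congr 1; group
    have h1 := schur h W
    rw [Finset.sum_congr rfl (fun y _ => hcen y), Finset.sum_const, Finset.card_univ, ← Nat.cast_smul_eq_nsmul ℂ] at h1
    have h2 : Matrix.trace W = 0 := by
      rw [hW, Matrix.trace_sum, ← hin]
      apply Finset.sum_congr rfl; intro g _
      rw [Matrix.trace_smul, smul_eq_mul]
    rw [h2, mul_zero, zero_div, zero_smul] at h1
    exact (smul_eq_zero.1 h1).resolve_left (cardG_ne G)
  have h2 : ∀ g, Matrix.trace (S g) * F (g⁻¹ * x) = Matrix.trace (A * (Matrix.trace (S g) • R g⁻¹) * R x) := by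
    intro g
    rw [hA, map_mul, Matrix.mul_smul, Matrix.smul_mul, Matrix.trace_smul, smul_eq_mul, mul_assoc]
  rw [Finset.sum_congr rfl (fun g _ => h2 g), ← Matrix.trace_sum, ← Matrix.sum_mul, ← Matrix.mul_sum, ← hW, hW0]
  simp
end reps2
end McKayGraphs

open scoped BigOperators
namespace McKayGraphs
open Equiv

section ds
variable {G : Type*} [Group G] [Fintype G]
variable {I J : Type*} [Fintype I] [DecidableEq I] [Fintype J] [DecidableEq J]

lemma trace_fB (A : Matrix I I ℂ) (B : Matrix I J ℂ) (C : Matrix J I ℂ) (D : Matrix J J ℂ) :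
    Matrix.trace (Matrix.fromBlocks A B C D) = Matrix.trace A + Matrix.trace D := by
  simp [Matrix.trace]

/-- direct sum of representations -/
noncomputable def ds (R : G →* Matrix I I ℂ) (S : G →* Matrix J J ℂ) : G →* Matrix (I ⊕ J) (I ⊕ J) ℂ where
  toFun g := Matrix.fromBlocks (R g) 0 0 (S g)
  map_one' := by rw [map_one, map_one, Matrix.fromBlocks_one]
  map_mul' g h := by rw [map_mul, map_mul, Matrix.fromBlocks_multiply]; simp

lemma ds_apply (R : G →* Matrix I I ℂ) (S : G →* Matrix J J ℂ) (g : G) : ds R S g = Matrix.fromBlocks (R g) 0 0 (S g) := rfl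

lemma ds_trace (R : G →* Matrix I I ℂ) (S : G →* Matrix J J ℂ) (g : G) :
    Matrix.trace (ds R S g) = Matrix.trace (R g) + Matrix.trace (S g) := by
  rw [ds_apply, trace_fB]

lemma mcf_ds (R : G →* Matrix I I ℂ) (S : G →* Matrix J J ℂ) : mcf (ds R S) = mcf R ⊔ mcf S := by
  apply le_antisymm
  · intro F hF
    obtain ⟨A, hA⟩ := mem_mcf.1 hF
    have h1 : (fun g => Matrix.trace (A.toBlocks₁₁ * R g)) ∈ mcf R := mem_mcf.2 ⟨_, fun g => rfl⟩
    have h2 : (fun g => Matrix.trace (A.toBlocks₂₂ * S g)) ∈ mcf S := mem_mcf.2 ⟨_, fun g => rfl⟩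
    have : F = (fun g => Matrix.trace (A.toBlocks₁₁ * R g)) + (fun g => Matrix.trace (A.toBlocks₂₂ * S g)) := by
      funext g
      rw [hA, ds_apply]
      conv_lhs => rw [← Matrix.fromBlocks_toBlocks A]
      rw [Matrix.fromBlocks_multiply, trace_fB]; simp
    rw [this]
    exact Submodule.add_mem_sup h1 h2
  · apply sup_le
    · intro F hF
      obtain ⟨A, hA⟩ := mem_mcf.1 hF
      refine mem_mcf.2 ⟨Matrix.fromBlocks A 0 0 0, fun g => ?_⟩
      rw [ds_apply, Matrix.fromBlocks_multiply, trace_fB, hA]; simp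
    · intro F hF
      obtain ⟨A, hA⟩ := mem_mcf.1 hF
      refine mem_mcf.2 ⟨Matrix.fromBlocks 0 0 0 A, fun g => ?_⟩
      rw [ds_apply, Matrix.fromBlocks_multiply, trace_fB, hA]; simp

lemma mcf_biInv (R : G →* Matrix I I ℂ) : BiInv (mcf R) := by
  intro a b F hF
  obtain ⟨A, hA⟩ := mem_mcf.1 hF
  refine mem_mcf.2 ⟨R b * A * R a, fun g => ?_⟩
  rw [tl_apply, hA, map_mul, map_mul, mul_assoc (R b), mul_assoc (R b), Matrix.trace_mul_comm (R b)]
  simp only [mul_assoc]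
end ds

section link
variable {X : Type*} [Fintype X] [DecidableEq X]
variable {I : Type*} [Fintype I] [DecidableEq I]

/-- twisted representation -/
noncomputable def tw (R : alternatingGroup X →* Matrix I I ℂ) (h : Perm X) : alternatingGroup X →* Matrix I I ℂ :=
  R.comp (MulAut.conjNormal h : MulAut (alternatingGroup X)).toMonoidHom

lemma tw_apply (R : alternatingGroup X →* Matrix I I ℂ) (h : Perm X) (g : alternatingGroup X) :
    tw R h g = R (MulAut.conjNormal h g) := rfl

lemma tw_tw (R : alternatingGroup X →* Matrix I I ℂ) (a b : Perm X) : tw (tw R a) b = tw R (a * b) := by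
  ext g : 1
  rw [tw_apply, tw_apply, tw_apply, map_mul]; rfl

lemma tw_irr {R : alternatingGroup X →* Matrix I I ℂ} (h : Irr R) (a : Perm X) : Irr (tw R a) := by
  unfold Irr at *
  rw [← h]
  refine Eq.trans ?_ (Equiv.sum_comp (MulAut.conjNormal a : MulAut (alternatingGroup X)).toEquiv
    (fun g => Matrix.trace (R g) * Matrix.trace (R g⁻¹)))
  apply Finset.sum_congr rfl
  intro g _
  rw [tw_apply, tw_apply, map_inv]; rfl

lemma tw_even (R : alternatingGroup X →* Matrix I I ℂ) {a : Perm X} (ha : a ∈ alternatingGroup X) :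
    mcf (tw R a) ≤ mcf R := by
  intro F hF
  obtain ⟨A, hA⟩ := mem_mcf.1 hF
  have := mcf_biInv R ⟨a, ha⟩ (⟨a, ha⟩ : alternatingGroup X)⁻¹ (fun g => Matrix.trace (A * R g)) (mem_mcf.2 ⟨A, fun g => rfl⟩)
  convert this using 1
  funext g
  rw [hA, tw_apply, tl_apply]
  congr 3

lemma tw_trace_even (R : alternatingGroup X →* Matrix I I ℂ) {a : Perm X} (ha : a ∈ alternatingGroup X) (g) :
    Matrix.trace (tw R a g) = Matrix.trace (R g) := by
  rw [tw_apply, ← trace_class R g ⟨a, ha⟩]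
  congr 2

/-- the two-block representation -/
noncomputable def VV (R : alternatingGroup X →* Matrix I I ℂ) (t : Perm X) := ds R (tw R t)

lemma inv_mul_mem_of {t a : Perm X} (ht : t ∉ alternatingGroup X) (ha : a ∉ alternatingGroup X) :
    t⁻¹ * a ∈ alternatingGroup X := by
  rw [Equiv.Perm.mem_alternatingGroup] at *
  have h1 := (Int.units_eq_one_or (Perm.sign t)).resolve_left ht
  have h2 := (Int.units_eq_one_or (Perm.sign a)).resolve_left ha
  simp [h1, h2]

lemma tw_le (R : alternatingGroup X →* Matrix I I ℂ) {t : Perm X} (ht : t ∉ alternatingGroup X) (a : Perm X) :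
    mcf (tw R a) ≤ mcf (VV R t) := by
  unfold VV
  rw [mcf_ds]
  by_cases ha : a ∈ alternatingGroup X
  · exact (tw_even R ha).trans le_sup_left
  · have : a = t * (t⁻¹ * a) := by group
    rw [this, ← tw_tw]
    exact (tw_even _ (inv_mul_mem_of ht ha)).trans le_sup_right

/-- restriction to the alternating group -/
def rs : (Perm X → ℂ) →ₐ[ℂ] (alternatingGroup X → ℂ) := pb Subtype.val
@[simp] lemma rs_apply (F : Perm X → ℂ) (g : alternatingGroup X) : rs F g = F g := rfl

def RR (D : Submodule ℂ (alternatingGroup X → ℂ)) : Submodule ℂ (Perm X → ℂ) where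
  carrier := {F | ∀ a b, rs (tl a b F) ∈ D}
  zero_mem' := fun a b => by rw [map_zero, map_zero]; exact D.zero_mem
  add_mem' := fun {F F'} h h' a b => by rw [map_add, map_add]; exact D.add_mem (h a b) (h' a b)
  smul_mem' := fun c F h a b => by rw [map_smul, map_smul]; exact D.smul_mem c (h a b)

lemma mem_RR {D : Submodule ℂ (alternatingGroup X → ℂ)} {F : Perm X → ℂ} : F ∈ RR D ↔ ∀ a b, rs (tl a b F) ∈ D := Iff.rfl

lemma RR_biInv (D : Submodule ℂ (alternatingGroup X → ℂ)) : BiInv (RR D) := by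
  intro a b F hF c d
  have := hF (a * c) (d * b)
  convert this using 1
  funext g
  simp only [rs_apply, tl_apply, mul_assoc]

/-- extension by zero -/
noncomputable def ex (f : alternatingGroup X → ℂ) (g : Perm X) : ℂ :=
  open Classical in if h : g ∈ alternatingGroup X then f ⟨g, h⟩ else 0

lemma ex_pos (f : alternatingGroup X → ℂ) {g : Perm X} (h : g ∈ alternatingGroup X) : ex f g = f ⟨g, h⟩ := dif_pos h
lemma ex_neg (f : alternatingGroup X → ℂ) {g : Perm X} (h : g ∉ alternatingGroup X) : ex f g = 0 := dif_neg h
lemma ex_coe (f : alternatingGroup X → ℂ) (g : alternatingGroup X) : ex f g = f g := by rw [ex_pos f g.2]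

noncomputable def xi (R : alternatingGroup X →* Matrix I I ℂ) (g : Perm X) : ℂ :=
  ∑ h : Perm X, ex (fun g => Matrix.trace (R g)) (h * g * h⁻¹)

lemma xi_class (R : alternatingGroup X →* Matrix I I ℂ) (g h : Perm X) : xi R (h * g * h⁻¹) = xi R g := by
  unfold xi
  refine Eq.trans ?_ (Equiv.sum_comp (Equiv.mulRight h) (fun k => ex (fun g => Matrix.trace (R g)) (k * g * k⁻¹)))
  apply Finset.sum_congr rfl
  intro k _
  simp only [Equiv.coe_mulRight, mul_inv_rev, mul_assoc]

lemma xi_ne {R : alternatingGroup X →* Matrix I I ℂ} (h : Irr R) : xi R ≠ 0 := by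
  intro hc
  have h1 := congrFun hc 1
  unfold xi at h1
  have : ∀ k : Perm X, ex (fun g => Matrix.trace (R g)) (k * 1 * k⁻¹) = Fintype.card I := by
    intro k
    rw [mul_one, mul_inv_cancel, ex_pos _ (Subgroup.one_mem _)]
    have : (⟨1, Subgroup.one_mem _⟩ : alternatingGroup X) = 1 := rfl
    simp only [this, map_one, Matrix.trace_one]
  rw [Finset.sum_congr rfl (fun k _ => this k), Finset.sum_const, nsmul_eq_mul, Pi.zero_apply] at h1
  rcases mul_eq_zero.1 h1 with h2 | h2
  · rw [Finset.card_univ] at h2; exact cardG_ne _ h2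
  · exact h.card_ne h2

lemma xi_mem (R : alternatingGroup X →* Matrix I I ℂ) {t : Perm X} (ht : t ∉ alternatingGroup X) :
    xi R ∈ RR (mcf (VV R t)) := by
  intro a b
  have : rs (tl a b (xi R)) = ∑ h : Perm X, (fun g : alternatingGroup X => ex (fun g => Matrix.trace (R g)) (h * (a * g * b) * h⁻¹)) := by
    funext g
    rw [Finset.sum_apply]; rfl
  rw [this]
  apply Submodule.sum_mem
  intro h _
  by_cases hab : a * b ∈ alternatingGroup X
  · apply tw_le R ht (h * a)
    have hm : h * (a * b) * h⁻¹ ∈ alternatingGroup X := (alternatingGroup.normal).conj_mem _ hab h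
    refine mem_mcf.2 ⟨R ⟨_, hm⟩, fun g => ?_⟩
    rw [tw_apply, Matrix.trace_mul_comm, ← map_mul, ← ex_coe (fun g => Matrix.trace (R g))]
    congr 1
    rw [Subgroup.coe_mul, MulAut.conjNormal_apply]
    simp only [mul_inv_rev, mul_assoc, inv_mul_cancel_left]
  · convert (mcf (VV R t)).zero_mem using 1
    funext g
    apply ex_neg
    intro hc
    apply hab
    have hg := g.2
    rw [Equiv.Perm.mem_alternatingGroup] at *
    have h1 : Perm.sign (g : Perm X) = 1 := hg
    simp only [map_mul, map_inv, h1, mul_one] at hc ⊢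
    rw [mul_comm, ← mul_assoc, inv_mul_cancel, one_mul] at hc
    exact hc

theorem link {R : alternatingGroup X →* Matrix I I ℂ} (h : Irr R) {t : Perm X} (ht : t ∉ alternatingGroup X) :
    ∃ p q : X → ℕ, YT p q ∧ fT p q ∈ RR (mcf (VV R t)) := by
  obtain ⟨p, q, hT, hs⟩ := exists_YT (xi R) (fun g h => xi_class R g h) (xi_ne h)
  exact ⟨p, q, hT, ML hT.1 hT.hin (RR_biInv _) (xi_mem R ht) hs⟩

lemma link_pow {D : Submodule ℂ (alternatingGroup X → ℂ)} {f : Perm X → ℂ} (hf : f ∈ RR D) {k : ℕ}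
    (hd : (dl : Perm X → ℂ) ∈ (tr f) ^ k) : (dl : alternatingGroup X → ℂ) ∈ D ^ k := by
  have h1 : (tr f).map (rs : (Perm X → ℂ) →ₐ[ℂ] _).toLinearMap ≤ D := by
    rw [Submodule.map_le_iff_le_comap]
    intro F hF
    have := tr_le (RR_biInv D) hf hF 1 1
    have e : tl (1 : Perm X) 1 F = F := by funext g; simp
    rw [e] at this
    exact this
  have h2 := Submodule.mem_map_of_mem (f := (rs : (Perm X → ℂ) →ₐ[ℂ] (alternatingGroup X → ℂ)).toLinearMap) hd
  rw [Submodule.map_pow] at h2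
  have h3 := pow_le_pow_left' h1 k h2
  convert h3 using 1
  funext g
  simp only [AlgHom.toLinearMap_apply, rs_apply]
  unfold dl
  by_cases hg : g = 1
  · rw [if_pos hg, if_pos (by rw [hg]; rfl)]
  · rw [if_neg hg, if_neg (by intro hc; exact hg (Subtype.ext hc))]
end link
end McKayGraphs

open scoped BigOperators
namespace McKayGraphs
open Equiv

section dim
open Matrix
variable {G : Type*} [Group G] [Fintype G]
variable {I : Type*} [Fintype I] [DecidableEq I]

lemma dim_le {R : G →* Matrix I I ℂ} (h : Irr R) (H : Subgroup G) {e : Matrix I I ℂ} (he : e ≠ 0)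
    (hc : ∀ z ∈ H, ∃ c : ℂ, R z * e = c • e) : Fintype.card I ≤ H.index := by
  classical
  obtain ⟨i, j, hij⟩ : ∃ i j, e i j ≠ 0 := by
    by_contra hcon
    push Not at hcon
    exact he (by ext i j; exact hcon i j)
  set v : I → ℂ := e *ᵥ Pi.single j 1 with hv
  have hvi : v i ≠ 0 := by rw [hv]; simpa using hij
  have hcv : ∀ z ∈ H, ∃ c : ℂ, R z *ᵥ v = c • v := by
    intro z hz
    obtain ⟨c, hc⟩ := hc z hz
    exact ⟨c, by rw [hv, Matrix.mulVec_mulVec, hc, Matrix.smul_mulVec]⟩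
  set U := Submodule.span ℂ (Set.range (fun x : G ⧸ H => R x.out *ᵥ v)) with hU
  have hg : ∀ g, R g *ᵥ v ∈ U := by
    intro g
    have hm : (QuotientGroup.mk g : G ⧸ H).out⁻¹ * g ∈ H := by
      rw [← QuotientGroup.eq]; simp
    obtain ⟨c, hc⟩ := hcv _ hm
    have : R g *ᵥ v = c • (R (QuotientGroup.mk g : G ⧸ H).out *ᵥ v) := by
      rw [← Matrix.mulVec_smul, ← hc, Matrix.mulVec_mulVec v, ← map_mul, mul_inv_cancel_left]
    rw [this]
    exact U.smul_mem _ (Submodule.subset_span ⟨_, rfl⟩)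
  have htop : U = ⊤ := by
    rw [eq_top_iff]
    intro u _
    have hx := congrArg (fun Y : Matrix I I ℂ => Y *ᵥ v) (expand h (Matrix.vecMulVec u (Pi.single i 1)))
    simp only [Matrix.sum_mulVec, Matrix.smul_mulVec] at hx
    have h2 : Matrix.vecMulVec u (Pi.single i (1:ℂ)) *ᵥ v = v i • u := by
      ext k
      simp [Matrix.mulVec, Matrix.vecMulVec, dotProduct, Pi.single_apply, mul_comm]
    rw [h2, smul_smul] at hx
    have hne : (Fintype.card G : ℂ) / Fintype.card I * v i ≠ 0 := mul_ne_zero (div_ne_zero (cardG_ne G) h.card_ne) hvi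
    have : u = ((Fintype.card G : ℂ) / Fintype.card I * v i)⁻¹ • (((Fintype.card G : ℂ) / Fintype.card I * v i) • u) := by
      rw [smul_smul, inv_mul_cancel₀ hne, one_smul]
    rw [this, ← hx]
    apply U.smul_mem
    apply Submodule.sum_mem
    intro g _
    exact U.smul_mem _ (hg g)
  have h3 := finrank_range_le_card (R := ℂ) (fun x : G ⧸ H => R x.out *ᵥ v)
  unfold Set.finrank at h3
  rw [← hU, htop, finrank_top, Module.finrank_fintype_fun_eq_card, ← Nat.card_eq_fintype_card (α := G ⧸ H)] at h3
  exact h3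
end dim

section dim2
variable {X : Type*} [Fintype X] [DecidableEq X]
variable {I : Type*} [Fintype I] [DecidableEq I]

def stS {β : Type*} (u : X → β) : Subgroup (Perm X) where
  carrier := {y | u ∘ y = u}
  one_mem' := rfl
  mul_mem' := fun h h' => comp_mul_of h h'
  inv_mem' := fun h => comp_inv_of h

lemma mem_stS {β : Type*} {u : X → β} {y : Perm X} : y ∈ stS u ↔ u ∘ y = u := Iff.rfl

lemma stS_index {β : Type*} [DecidableEq β] (u : X → β) : stc u * (stS u).index = (Fintype.card X).factorial := by
  classical
  have h1 := Subgroup.card_mul_index (stS u)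
  rw [Nat.card_eq_fintype_card (α := Perm X), Fintype.card_perm] at h1
  rw [← h1]
  congr 1
  unfold stc
  rw [Nat.card_eq_fintype_card, Fintype.card_subtype]
  congr 1
  ext r
  simp [mem_stS]

theorem dim_bound {R : alternatingGroup X →* Matrix I I ℂ} (h : Irr R) {t : Perm X} {p q : X → ℕ} (hJ : JI p q)
    (hf : fT p q ∈ RR (mcf (VV R t))) (L : ℕ) :
    (Fintype.card I : ℝ) ≤ ((Fintype.card X).factorial : ℝ) / stc (kap p q L) := by
  classical
  set S := stS (kap p q L) with hS
  set H := S.subgroupOf (alternatingGroup X) with hH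
  have hidx : H.index ≤ S.index := by
    have : H.index = S.relIndex (alternatingGroup X) := rfl
    rw [this]
    rw [← Subgroup.relIndex_top_right S]
    exact Subgroup.relIndex_le_of_le_right le_top (by rw [Subgroup.relIndex_top_right]; exact Subgroup.index_ne_zero_of_finite)
  have key : Fintype.card I ≤ H.index := by
    have hf' := hf 1 1
    have e : tl (1 : Perm X) 1 (fT p q) = fT p q := by funext g; simp
    rw [e] at hf'
    unfold VV at hf'
    rw [mcf_ds] at hf'
    obtain ⟨F1, h1, F2, h2, h12⟩ := Submodule.mem_sup.1 hf'
    obtain ⟨A1, hA1⟩ := mem_mcf.1 h1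
    obtain ⟨A2, hA2⟩ := mem_mcf.1 h2
    have hinv : ∀ (R' : alternatingGroup X →* Matrix I I ℂ) (z : alternatingGroup X), z ∈ H →
        R' z * (∑ y : alternatingGroup X, (if y ∈ H then fT p q y else 0) • R' y) =
        fT p q z • (∑ y : alternatingGroup X, (if y ∈ H then fT p q y else 0) • R' y) := by
      intro R' z hz
      rw [Finset.mul_sum, Finset.smul_sum]
      rw [← Equiv.sum_comp (Equiv.mulLeft z) (fun y => fT p q z • ((if y ∈ H then fT p q y else 0) • R' y))]
      apply Finset.sum_congr rfl
      intro y _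
      rw [Equiv.coe_mulLeft, map_mul, Matrix.mul_smul, smul_smul]
      congr 1
      by_cases hy : y ∈ H
      · rw [if_pos hy, if_pos (H.mul_mem hz hy)]
        have hz' : kap p q L ∘ ⇑(z : Perm X) = kap p q L := hz
        have hy' : kap p q L ∘ ⇑(y : Perm X) = kap p q L := hy
        rw [Subgroup.coe_mul, fT_kap_mul hJ hz' hy', ← mul_assoc, fT_kap_ne hJ hz', one_mul]
      · rw [if_neg hy, if_neg (fun hc => hy ((H.mul_mem_cancel_left hz).1 hc)), mul_zero]
    by_cases hz1 : (∑ y : alternatingGroup X, (if y ∈ H then fT p q y else 0) • R y) = 0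
    · by_cases hz2 : (∑ y : alternatingGroup X, (if y ∈ H then fT p q y else 0) • tw R t y) = 0
      · exfalso
        have hsum : ∑ y : alternatingGroup X, (if y ∈ H then fT p q y else 0) * fT p q y = 0 := by
          have : ∀ y : alternatingGroup X, (if y ∈ H then fT p q y else 0) * fT p q y =
              Matrix.trace (A1 * ((if y ∈ H then fT p q y else 0) • R y)) +
              Matrix.trace (A2 * ((if y ∈ H then fT p q y else 0) • tw R t y)) := by
            intro y
            have h3 : fT p q y = F1 y + F2 y := (congrFun h12 y).symm
            rw [Matrix.mul_smul, Matrix.trace_smul, Matrix.mul_smul, Matrix.trace_smul, ← hA1, ← hA2, smul_eq_mul, smul_eq_mul,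
              ← mul_add, ← h3]
          rw [Finset.sum_congr rfl (fun y _ => this y), Finset.sum_add_distrib, ← Matrix.trace_sum, ← Matrix.trace_sum,
            ← Matrix.mul_sum, ← Matrix.mul_sum, hz1, hz2]
          simp
        have hsum2 : ∀ y : alternatingGroup X, (if y ∈ H then fT p q y else 0) * fT p q y = if y ∈ H then 1 else 0 := by
          intro y
          by_cases hy : y ∈ H
          · have hy' : kap p q L ∘ ⇑(y : Perm X) = kap p q L := hy
            rw [if_pos hy, if_pos hy, fT_kap_ne hJ hy']
          · rw [if_neg hy, if_neg hy, zero_mul]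
        rw [Finset.sum_congr rfl (fun y _ => hsum2 y), Finset.sum_boole] at hsum
        have h0 : (Finset.univ.filter (fun y : alternatingGroup X => y ∈ H)).card = 0 := by exact_mod_cast hsum
        rw [Finset.card_eq_zero] at h0
        have : (1 : alternatingGroup X) ∈ Finset.univ.filter (fun y : alternatingGroup X => y ∈ H) := by
          simp [H.one_mem]
        rw [h0] at this
        simp at this
      · exact dim_le (tw_irr h t) H hz2 (fun z hz => ⟨_, hinv (tw R t) z hz⟩)
    · exact dim_le h H hz1 (fun z hz => ⟨_, hinv R z hz⟩)
  have h5 := stS_index (kap p q L)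
  have h6 : 0 < stc (kap p q L) := stc_pos _
  rw [le_div_iff₀ (by exact_mod_cast h6)]
  have : Fintype.card I * stc (kap p q L) ≤ (Fintype.card X).factorial := by
    rw [← h5, mul_comm]
    exact Nat.mul_le_mul_left _ (key.trans hidx)
  exact_mod_cast this
end dim2
end McKayGraphs

open scoped BigOperators
namespace McKayGraphs
open Equiv

section split
variable {X : Type*} [Fintype X] [DecidableEq X]
variable {I : Type*} [Fintype I] [DecidableEq I]

noncomputable def tN (R : alternatingGroup X →* Matrix I I ℂ) (t : Perm X) (g : alternatingGroup X) : ℂ :=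
  Matrix.trace (R g) - Matrix.trace (tw R t g)

noncomputable def th (R : alternatingGroup X →* Matrix I I ℂ) (t : Perm X) : Perm X → ℂ := ex (tN R t)

lemma tw_trace_odd (R : alternatingGroup X →* Matrix I I ℂ) {t : Perm X} (ht : t ∉ alternatingGroup X) {a : Perm X}
    (ha : a ∉ alternatingGroup X) (g) : Matrix.trace (tw R a g) = Matrix.trace (tw R t g) := by
  have : a = t * (t⁻¹ * a) := by group
  rw [this, ← tw_tw, tw_trace_even _ (inv_mul_mem_of ht ha)]

lemma sg_even {a : Perm X} (ha : a ∈ alternatingGroup X) : sg a = 1 := by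
  rw [Equiv.Perm.mem_alternatingGroup] at ha
  simp [sg, ha]
lemma sg_odd {a : Perm X} (ha : a ∉ alternatingGroup X) : sg a = -1 := by
  rw [Equiv.Perm.mem_alternatingGroup] at ha
  simp [sg, (Int.units_eq_one_or (Perm.sign a)).resolve_left ha]

lemma mul_mem_odd {t a : Perm X} (ht : t ∉ alternatingGroup X) (ha : a ∉ alternatingGroup X) :
    t * a ∈ alternatingGroup X := by
  have := inv_mul_mem_of (t := t⁻¹) (fun h => ht ((Subgroup.inv_mem_iff _).1 h)) ha
  rwa [inv_inv] at this

lemma th_sg (R : alternatingGroup X →* Matrix I I ℂ) (t : Perm X) (g : Perm X) : sg g * th R t g = th R t g := by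
  by_cases hg : g ∈ alternatingGroup X
  · rw [sg_even hg, one_mul]
  · unfold th; rw [ex_neg _ hg, mul_zero]

lemma th_conj (R : alternatingGroup X →* Matrix I I ℂ) {t : Perm X} (ht : t ∉ alternatingGroup X) (h g : Perm X) :
    th R t (h * g * h⁻¹) = sg h * th R t g := by
  unfold th
  by_cases hg : g ∈ alternatingGroup X
  · have hm : h * g * h⁻¹ ∈ alternatingGroup X := (alternatingGroup.normal).conj_mem _ hg h
    rw [ex_pos _ hm, ex_pos _ hg]
    have e : (⟨h * g * h⁻¹, hm⟩ : alternatingGroup X) = MulAut.conjNormal h ⟨g, hg⟩ := by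
      apply Subtype.ext; rw [MulAut.conjNormal_apply]
    rw [e]
    unfold tN
    rw [← tw_apply, ← tw_apply (tw R t), tw_tw]
    by_cases hh : h ∈ alternatingGroup X
    · rw [sg_even hh, tw_trace_even _ hh, tw_trace_odd R ht (a := t * h), one_mul]
      intro hc
      exact ht ((Subgroup.mul_mem_cancel_right _ hh).1 hc)
    · rw [sg_odd hh, tw_trace_odd R ht hh, tw_trace_even R (mul_mem_odd ht hh)]; ring
  · have hm : h * g * h⁻¹ ∉ alternatingGroup X := by
      intro hc
      apply hg
      have := (alternatingGroup.normal).conj_mem _ hc h⁻¹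
      convert this using 1; group
    rw [ex_neg _ hm, ex_neg _ hg, mul_zero]

noncomputable def cvN (R : alternatingGroup X →* Matrix I I ℂ) (t : Perm X) (F : alternatingGroup X → ℂ) (x : alternatingGroup X) : ℂ :=
  ∑ g, tN R t g * F (g⁻¹ * x)

noncomputable def cv (R : alternatingGroup X →* Matrix I I ℂ) (t : Perm X) (F : Perm X → ℂ) (x : Perm X) : ℂ :=
  ∑ g, th R t g * F (g⁻¹ * x)

lemma cv_eq (R : alternatingGroup X →* Matrix I I ℂ) (t : Perm X) (F : Perm X → ℂ) (x : Perm X) (y : alternatingGroup X) :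
    cv R t F (y * x) = cvN R t (rs (tl 1 x F)) y := by
  classical
  unfold cv cvN
  rw [← Finset.sum_subset (Finset.subset_univ (Finset.univ.filter (fun g : Perm X => g ∈ alternatingGroup X)))]
  · refine (Finset.sum_subtype (p := fun g => g ∈ alternatingGroup X) (F := (inferInstance : Fintype (alternatingGroup X))) _ (fun g => by
      rw [Finset.mem_filter]; simp) _).trans ?_
    apply Finset.sum_congr
    · ext g; simp
    intro g _
    unfold th
    rw [ex_coe, rs_apply, tl_apply]
    congr 2
  · intro g _ hg
    unfold th
    rw [ex_neg _ (by simpa using hg), zero_mul]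

lemma cvN_cvN {R : alternatingGroup X →* Matrix I I ℂ} (h : Irr R) {t : Perm X}
    (hne : ∃ g, Matrix.trace (R g) ≠ Matrix.trace (tw R t g)) {F : alternatingGroup X → ℂ} (hF : F ∈ mcf (VV R t)) (x) :
    cvN R t (cvN R t F) x = ((Fintype.card (alternatingGroup X) : ℂ) / Fintype.card I) ^ 2 * F x := by
  unfold VV at hF
  rw [mcf_ds] at hF
  obtain ⟨A, hA, B, hB, rfl⟩ := Submodule.mem_sup.1 hF
  set c := (Fintype.card (alternatingGroup X) : ℂ) / Fintype.card I with hc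
  have hne' : ∃ g, Matrix.trace (tw R t g) ≠ Matrix.trace (R g) := by
    obtain ⟨g, hg⟩ := hne; exact ⟨g, hg.symm⟩
  have key : ∀ (u v : ℂ) y, cvN R t (u • A + v • B) y = c * u * A y - c * v * B y := by
    intro u v y
    unfold cvN tN
    have e1 := char_conv h hA y
    have e2 := char_conv_zero h (tw_irr h t) hne hA y
    have e3 := char_conv (tw_irr h t) hB y
    have e4 := char_conv_zero (tw_irr h t) h hne' hB y
    rw [← hc] at e1 e3
    have : ∀ g : alternatingGroup X, (Matrix.trace (R g) - Matrix.trace (tw R t g)) * (u • A + v • B) (g⁻¹ * y) =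
        u * (Matrix.trace (R g) * A (g⁻¹ * y)) - u * (Matrix.trace (tw R t g) * A (g⁻¹ * y))
        + v * (Matrix.trace (R g) * B (g⁻¹ * y)) - v * (Matrix.trace (tw R t g) * B (g⁻¹ * y)) := by
      intro g
      simp only [Pi.add_apply, Pi.smul_apply, smul_eq_mul]; ring
    rw [Finset.sum_congr rfl (fun g _ => this g), Finset.sum_sub_distrib, Finset.sum_add_distrib, Finset.sum_sub_distrib,
      ← Finset.mul_sum, ← Finset.mul_sum, ← Finset.mul_sum, ← Finset.mul_sum, e1, e2, e3, e4]
    ring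
  have h1 : cvN R t (A + B) = c • A + (-c) • B := by
    funext y
    have := key 1 1 y
    rw [one_smul, one_smul] at this
    rw [this]; simp only [Pi.add_apply, Pi.smul_apply, smul_eq_mul]; ring
  rw [h1, key]; simp only [Pi.add_apply]; ring

lemma cv_cv {R : alternatingGroup X →* Matrix I I ℂ} (h : Irr R) {t : Perm X}
    (hne : ∃ g, Matrix.trace (R g) ≠ Matrix.trace (tw R t g)) {F : Perm X → ℂ} (hF : F ∈ RR (mcf (VV R t))) (x : Perm X) :
    cv R t (cv R t F) x = ((Fintype.card (alternatingGroup X) : ℂ) / Fintype.card I) ^ 2 * F x := by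
  have h1 := cv_eq R t (cv R t F) x 1
  rw [Subgroup.coe_one, one_mul] at h1
  have h2 : rs (tl 1 x (cv R t F)) = cvN R t (rs (tl 1 x F)) := by
    funext y
    rw [rs_apply, tl_apply, one_mul, cv_eq]
  rw [h1, h2, cvN_cvN h hne (hF 1 x)]
  simp

lemma cv_right (R : alternatingGroup X →* Matrix I I ℂ) {t : Perm X} (ht : t ∉ alternatingGroup X) (F : Perm X → ℂ) (x : Perm X) :
    ∑ v, th R t v * F (x * v⁻¹) = sg x * cv R t F x := by
  unfold cv
  rw [Finset.mul_sum]
  refine Eq.trans ?_ (Equiv.sum_comp (MulAut.conj x).toEquiv (fun g => sg x * (th R t g * F (g⁻¹ * x))))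
  apply Finset.sum_congr rfl
  intro v _
  have : (MulAut.conj x).toEquiv v = x * v * x⁻¹ := rfl
  rw [this, th_conj R ht]
  have e : (x * v * x⁻¹)⁻¹ * x = x * v⁻¹ := by group
  rw [e, ← mul_assoc, ← mul_assoc, sg_sq, one_mul]

lemma fT_sq_sum {p q : X → ℕ} (hJ : JI p q) : ∑ g, fT p q g * fT p q g ≠ 0 := by
  have h1 : ∀ g, fT p q g * fT p q g = ((if fT p q g = 0 then 0 else 1 : ℕ) : ℂ) := by
    intro g
    rcases fT_val hJ g with h | h | h <;> simp [h]
  rw [Finset.sum_congr rfl (fun g _ => h1 g), ← Nat.cast_sum]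
  have : 0 < ∑ g, (if fT p q g = 0 then 0 else 1 : ℕ) := by
    apply Finset.sum_pos'
    · intro g _; positivity
    · exact ⟨1, Finset.mem_univ _, by rw [fT_one hJ]; simp⟩
  exact_mod_cast this.ne'

lemma rl_le_of {p q : X → ℕ} (hT : YT p q) {g : Perm X} (h : JI p (p ∘ ⇑g)) : rl p 0 ≤ rl q 0 := by
  have h1 : (cl p 0).card ≤ (Finset.range (rl q 0)).card := by
    apply Finset.card_le_card_of_injOn (p ∘ ⇑g)
    · intro x _
      have := (hT.col_lt (g x)).trans_le (hT.rl_anti (Nat.zero_le _))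
      simpa using this
    · intro x hx y hy hxy
      have hx' := mem_cl.1 hx
      have hy' := mem_cl.1 hy
      exact h x y (hx'.trans hy'.symm) hxy
  rw [Finset.card_range] at h1
  exact h1

lemma rl_add_le {p q : X → ℕ} (hT : YT p q) : rl q 0 + rl p 0 ≤ Fintype.card X + 1 := by
  unfold rl
  rw [← Finset.card_union_add_card_inter]
  apply add_le_add (Finset.card_le_univ _)
  rw [Finset.card_le_one]
  intro a ha b hb
  rw [Finset.mem_inter, mem_cl, mem_cl] at ha hb
  exact hT.1 a b (ha.2.trans hb.2.symm) (ha.1.trans hb.1.symm)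

theorem split_rl {R : alternatingGroup X →* Matrix I I ℂ} (h : Irr R) {t : Perm X} (ht : t ∉ alternatingGroup X)
    (hne : ∃ g, Matrix.trace (R g) ≠ Matrix.trace (tw R t g)) {p q : X → ℕ} (hT : YT p q)
    (hf : fT p q ∈ RR (mcf (VV R t))) : 2 * rl q 0 ≤ Fintype.card X + 1 ∧ 2 * rl p 0 ≤ Fintype.card X + 1 := by
  obtain ⟨f, hfd⟩ : ∃ f, f = fT p q := ⟨_, rfl⟩
  rw [← hfd] at hf
  obtain ⟨φ, hφ⟩ : ∃ φ, φ = cv R t f := ⟨_, rfl⟩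
  obtain ⟨c, hc⟩ : ∃ c, c = ((Fintype.card (alternatingGroup X) : ℂ) / Fintype.card I) ^ 2 := ⟨_, rfl⟩
  have hc0 : c ≠ 0 := hc ▸ pow_ne_zero _ (div_ne_zero (cardG_ne _) h.card_ne)
  have hcc : ∀ x, cv R t φ x = c * f x := fun x => by rw [hφ, hc]; exact cv_cv h hne hf x
  have hsum : c * ∑ g, f g * f g ≠ 0 := mul_ne_zero hc0 (hfd ▸ fT_sq_sum hT.1)
  have φl : ∀ a : Perm X, p ∘ a = p → ∀ x, φ (a * x) = φ x := by
    intro a ha x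
    rw [hφ]; unfold cv
    refine (Equiv.sum_comp (MulAut.conj a).toEquiv (fun g => th R t g * f (g⁻¹ * (a * x)))).symm.trans ?_
    apply Finset.sum_congr rfl
    intro v _
    have : (MulAut.conj a).toEquiv v = a * v * a⁻¹ := rfl
    rw [this, th_conj R ht]
    have e : (a * v * a⁻¹)⁻¹ * (a * x) = a * (v⁻¹ * x) := by group
    rw [e, hfd, fT_left ha]
    linear_combination (th R t v * fT p q (v⁻¹ * x)) * sg_sq a
  have φr : ∀ a : Perm X, q ∘ a = q → ∀ x, φ (x * a) = φ x := by
    intro a ha x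
    rw [hφ]; unfold cv
    apply Finset.sum_congr rfl
    intro v _
    rw [← mul_assoc, hfd, fT_right ha]
  have h3 : rl p 0 ≤ rl q 0 := by
    obtain ⟨g, hg⟩ : ∃ g, ∑ x, f (g * x) * φ x ≠ 0 := by
      by_contra hcon
      push Not at hcon
      apply hsum
      have e1 : ∀ v, ∑ x, f x * φ (v⁻¹ * x) = 0 := by
        intro v
        rw [← hcon v, ← Equiv.sum_comp (Equiv.mulLeft v)]
        apply Finset.sum_congr rfl
        intro x _
        simp
      have e2 : ∑ v, th R t v * ∑ x, f x * φ (v⁻¹ * x) = 0 := by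
        apply Finset.sum_eq_zero; intro v _; rw [e1, mul_zero]
      rw [← e2]
      simp_rw [Finset.mul_sum]
      rw [Finset.sum_comm]
      apply Finset.sum_congr rfl
      intro x _
      have := hcc x
      unfold cv at this
      rw [← mul_assoc, ← this, Finset.sum_mul]
      apply Finset.sum_congr rfl; intro v _; ring
    have := vN_inj (p := p) (q := p) (F := fun g => ∑ x, f (g * x) * φ x) ?_ ?_ hg
    · exact rl_le_of hT this
    · intro a g ha
      show ∑ x, f (a * g * x) * φ x = _
      rw [Finset.mul_sum]
      apply Finset.sum_congr rfl; intro x _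
      rw [mul_assoc, hfd, fT_left ha, mul_assoc]
    · intro a g ha
      show ∑ x, f (g * a * x) * φ x = ∑ x, f (g * x) * φ x
      rw [← Equiv.sum_comp (Equiv.mulLeft a) (fun x => f (g * x) * φ x)]
      apply Finset.sum_congr rfl; intro x _
      rw [Equiv.coe_mulLeft, φl a ha, mul_assoc]
  have h4 : rl q 0 ≤ rl p 0 := by
    obtain ⟨g, hg⟩ : ∃ g, ∑ x, sg x * φ x * f (x * g) ≠ 0 := by
      by_contra hcon
      push Not at hcon
      apply hsum
      have e1 : ∀ v, ∑ x, sg x * sg v * φ (x * v⁻¹) * f x = 0 := by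
        intro v
        rw [← hcon v, ← Equiv.sum_comp (Equiv.mulRight v)]
        apply Finset.sum_congr rfl
        intro x _
        simp only [Equiv.coe_mulRight, mul_inv_cancel_right, sg_mul]
        linear_combination (sg x * φ x * f (x * v)) * sg_sq v
      have e2 : ∑ v, th R t v * ∑ x, sg x * sg v * φ (x * v⁻¹) * f x = 0 := by
        apply Finset.sum_eq_zero; intro v _; rw [e1, mul_zero]
      rw [← e2]
      simp_rw [Finset.mul_sum]
      rw [Finset.sum_comm]
      apply Finset.sum_congr rfl
      intro x _
      have h5 := cv_right R ht φ x
      rw [hcc] at h5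
      have h6 : ∀ v, th R t v * (sg x * sg v * φ (x * v⁻¹) * f x) = (sg x * f x) * (th R t v * φ (x * v⁻¹)) := by
        intro v
        linear_combination (sg x * φ (x * v⁻¹) * f x) * th_sg R t v
      rw [Finset.sum_congr rfl (fun v _ => h6 v), ← Finset.mul_sum, h5]
      linear_combination (- (c * f x * f x)) * sg_sq x
    have := vN_inj (p := q) (q := q) (F := fun g => ∑ x, sg x * φ x * f (x * g)) ?_ ?_ hg
    · exact rl_le_of hT.flip this
    · intro a g ha
      show ∑ x, sg x * φ x * f (x * (a * g)) = sg a * ∑ x, sg x * φ x * f (x * g)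
      rw [← Equiv.sum_comp (Equiv.mulRight a) (fun x => sg x * φ x * f (x * g)), Finset.mul_sum]
      apply Finset.sum_congr rfl; intro x _
      rw [Equiv.coe_mulRight, φr a ha, sg_mul, mul_assoc x]
      linear_combination (- (sg x * φ x * f (x * (a * g)))) * sg_sq a
    · intro a g ha
      show ∑ x, sg x * φ x * f (x * (g * a)) = ∑ x, sg x * φ x * f (x * g)
      apply Finset.sum_congr rfl; intro x _
      rw [← mul_assoc x, hfd, fT_right ha]
  have h5 := rl_add_le hT
  omega
end split
end McKayGraphs

open scoped BigOperators
namespace McKayGraphs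
open Equiv

section fin1
universe wx
variable {G : Type*} [Group G] [Fintype G]
variable {I : Type wx} [Fintype I] [DecidableEq I]
variable {I1 I2 : Type*} [Fintype I1] [DecidableEq I1] [Fintype I2] [DecidableEq I2]

theorem direct {R : G →* Matrix I I ℂ} {k : ℕ} (hd : (dl : G → ℂ) ∈ (mcf R) ^ k) {R1 : G →* Matrix I1 I1 ℂ} {R2 : G →* Matrix I2 I2 ℂ}
    (h1 : Irr R1) (h2 : Irr R2) :
    ∑ g, Matrix.trace (R g) ^ k * (Matrix.trace (R1 g) * starRingEnd ℂ (Matrix.trace (R2 g))) ≠ 0 := by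
  obtain ⟨J, _, _, T, hT1, hT2, hT3⟩ := exists_pow R k
  obtain ⟨r, hr1, hr2⟩ := rank_bound T (kr R1 (cj R2)) (hT1 hd)
  haveI := h1.nonempty
  haveI := h2.nonempty
  have hr : r ≠ 0 := by
    rintro rfl
    rw [mul_zero] at hr2
    have : 0 < Fintype.card (I1 × I2) := Fintype.card_pos
    omega
  have : ∑ g, Matrix.trace (R g) ^ k * (Matrix.trace (R1 g) * starRingEnd ℂ (Matrix.trace (R2 g))) = Fintype.card G * (r : ℂ) := by
    rw [← hr1]
    apply Finset.sum_congr rfl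
    intro g _
    rw [hT2, kr_trace, cj_trace]
  rw [this]
  exact mul_ne_zero (cardG_ne G) (by exact_mod_cast hr)

lemma irr_normSq {R : G →* Matrix I I ℂ} (h : Irr R) : ∑ g, Complex.normSq (Matrix.trace (R g)) = Fintype.card G := by
  unfold Irr at h
  simp_rw [trace_inv_conj R, Complex.mul_conj] at h
  exact_mod_cast h

lemma sq_le_card {R : G →* Matrix I I ℂ} (h : Irr R) : Fintype.card I ^ 2 ≤ Fintype.card G := by
  have h1 := irr_normSq h
  have h2 := Finset.single_le_sum (f := fun g => Complex.normSq (Matrix.trace (R g)))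
      (fun g _ => Complex.normSq_nonneg _) (Finset.mem_univ (1 : G))
  rw [h1] at h2
  simp only [map_one, Matrix.trace_one, Complex.normSq_natCast] at h2
  have : Fintype.card I * Fintype.card I ≤ Fintype.card G := by exact_mod_cast h2
  rw [sq]; exact this

theorem split_main {R R' : G →* Matrix I I ℂ} {k : ℕ} (hk : 1 ≤ k) (hd : (dl : G → ℂ) ∈ (mcf (ds R R')) ^ k)
    {R1 : G →* Matrix I1 I1 ℂ} {R2 : G →* Matrix I2 I2 ℂ} (h1 : Irr R1) (h2 : Irr R2) {B : ℝ} (hB0 : 0 < B)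
    (hB : ∀ g, Matrix.trace (R g) ≠ Matrix.trace (R' g) → ‖Matrix.trace (R g)‖ ^ 2 ≤ B ∧ ‖Matrix.trace (R' g)‖ ^ 2 ≤ B)
    (hd4 : 4 * B < Fintype.card I) :
    ∑ g, Matrix.trace (R g) ^ (4 * k) * (Matrix.trace (R1 g) * starRingEnd ℂ (Matrix.trace (R2 g))) ≠ 0 := by
  obtain ⟨J, _, _, T, hT1, hT2, hT3⟩ := exists_pow (ds R R') k
  obtain ⟨J', _, _, T', hT1', hT2', hT3'⟩ := exists_pow (ds R R') (3 * k)
  obtain ⟨r, hr1, hr2⟩ := rank_bound T (kr T' (kr R1 (cj R2))) (hT1 hd)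
  haveI := h1.nonempty
  haveI := h2.nonempty
  obtain ⟨x, hx⟩ : ∃ x : G → ℂ, ∀ g, x g = Matrix.trace (R1 g) * starRingEnd ℂ (Matrix.trace (R2 g)) := ⟨_, fun g => rfl⟩
  obtain ⟨a, ha⟩ : ∃ a : G → ℂ, ∀ g, a g = Matrix.trace (R g) := ⟨_, fun g => rfl⟩
  obtain ⟨b, hb⟩ : ∃ b : G → ℂ, ∀ g, b g = Matrix.trace (R' g) := ⟨_, fun g => rfl⟩
  simp_rw [← ha, ← hb] at hB
  simp_rw [← ha, ← hx]
  obtain ⟨d, hdd⟩ : ∃ d, d = Fintype.card I := ⟨_, rfl⟩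
  rw [← hdd] at hd4
  have e1 : ∑ g, (a g + b g) ^ (4 * k) * x g = Fintype.card G * (r : ℂ) := by
    rw [← hr1]
    apply Finset.sum_congr rfl
    intro g _
    rw [hT2, kr_trace, kr_trace, cj_trace, hT2', ds_trace, ← ha, ← hb, ← hx, ← mul_assoc, ← pow_add]
    congr 2; ring
  have hdpos : 0 < d := by
    have : (0:ℝ) < d := by linarith
    exact_mod_cast this
  have hr : (2 * d) ^ (2 * k) ≤ r := by
    have h3 : (2 * d) ^ (3 * k) ≤ (2 * d) ^ k * r := by
      refine le_trans ?_ (le_trans hr2 (le_of_eq ?_))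
      · rw [Fintype.card_prod, hT3', Fintype.card_sum, ← hdd, ← two_mul]
        exact Nat.le_mul_of_pos_right _ Fintype.card_pos
      · rw [hT3, Fintype.card_sum, ← hdd, ← two_mul]
    have h4 : (2 * d) ^ (3 * k) = (2 * d) ^ k * (2 * d) ^ (2 * k) := by rw [← pow_add]; congr 1; ring
    rw [h4] at h3
    exact Nat.le_of_mul_le_mul_left h3 (by positivity)
  -- the bound on X
  have hxs : ∑ g, ‖x g‖ ≤ Fintype.card G := by
    have h5 := irr_normSq h1
    have h6 := irr_normSq h2
    have h7 : ∀ g, ‖x g‖ ≤ (Complex.normSq (Matrix.trace (R1 g)) + Complex.normSq (Matrix.trace (R2 g))) / 2 := by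
      intro g
      rw [hx, norm_mul, RCLike.norm_conj, Complex.normSq_eq_norm_sq, Complex.normSq_eq_norm_sq]
      nlinarith [sq_nonneg (‖Matrix.trace (R1 g)‖ - ‖Matrix.trace (R2 g)‖)]
    refine (Finset.sum_le_sum (fun g _ => h7 g)).trans ?_
    rw [← Finset.sum_div, Finset.sum_add_distrib, h5, h6]
    linarith
  have hdiff : ∀ g, ‖(2 * a g) ^ (4 * k) - (a g + b g) ^ (4 * k)‖ ≤ 2 * (2:ℝ) ^ (4 * k) * B ^ (2 * k) := by
    intro g
    by_cases hab : a g = b g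
    · rw [← hab, ← two_mul, sub_self, norm_zero]; positivity
    · obtain ⟨h8, h9⟩ := hB g hab
      have q1 : ‖(2 * a g) ^ (4 * k)‖ ≤ (2:ℝ) ^ (4 * k) * B ^ (2 * k) := by
        rw [norm_pow, norm_mul, mul_pow]
        have : ‖a g‖ ^ (4 * k) = (‖a g‖ ^ 2) ^ (2 * k) := by rw [← pow_mul]; congr 1; ring
        rw [this]
        have := pow_le_pow_left₀ (by positivity) h8 (2 * k)
        have h22 : ‖(2:ℂ)‖ = 2 := by simp
        rw [h22]
        gcongr
      have q2 : ‖(a g + b g) ^ (4 * k)‖ ≤ (2:ℝ) ^ (4 * k) * B ^ (2 * k) := by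
        rw [norm_pow]
        have e5 : ‖a g + b g‖ ^ 2 ≤ 2 ^ 2 * B := by
          have := norm_add_le (a g) (b g)
          have h10 : ‖a g + b g‖ ^ 2 ≤ (‖a g‖ + ‖b g‖) ^ 2 := by gcongr
          nlinarith [sq_nonneg (‖a g‖ - ‖b g‖)]
        have : ‖a g + b g‖ ^ (4 * k) = (‖a g + b g‖ ^ 2) ^ (2 * k) := by rw [← pow_mul]; congr 1; ring
        rw [this]
        have := pow_le_pow_left₀ (by positivity) e5 (2 * k)
        refine this.trans (le_of_eq ?_)
        rw [mul_pow, ← pow_mul]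
        congr 2; ring
      refine (norm_sub_le _ _).trans ?_
      linarith
  intro hS
  have e2 : ∑ g, (2 * a g) ^ (4 * k) * x g = 0 := by
    have : ∀ g, (2 * a g) ^ (4 * k) * x g = 2 ^ (4 * k) * (a g ^ (4 * k) * x g) := by intro g; rw [mul_pow]; ring
    rw [Finset.sum_congr rfl (fun g _ => this g), ← Finset.mul_sum, hS, mul_zero]
  have e3 : ∑ g, ((2 * a g) ^ (4 * k) - (a g + b g) ^ (4 * k)) * x g = - (Fintype.card G * (r : ℂ)) := by
    simp_rw [sub_mul]
    rw [Finset.sum_sub_distrib, e1, e2, zero_sub]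
  have e4 : (Fintype.card G : ℝ) * r ≤ 2 * (2:ℝ) ^ (4 * k) * B ^ (2 * k) * Fintype.card G := by
    have h11 : ‖∑ g, ((2 * a g) ^ (4 * k) - (a g + b g) ^ (4 * k)) * x g‖ = (Fintype.card G : ℝ) * r := by
      rw [e3, norm_neg, norm_mul, Complex.norm_natCast, Complex.norm_natCast]
    rw [← h11]
    refine (norm_sum_le _ _).trans ?_
    refine (Finset.sum_le_sum (fun g _ => ?_)).trans (?_ : ∑ g, (2 * (2:ℝ) ^ (4 * k) * B ^ (2 * k)) * ‖x g‖ ≤ _)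
    · rw [norm_mul]; gcongr; exact hdiff g
    · rw [← Finset.mul_sum]; gcongr
  have hG : (0:ℝ) < Fintype.card G := by exact_mod_cast Fintype.card_pos
  have e5 : (r : ℝ) ≤ 2 * (2:ℝ) ^ (4 * k) * B ^ (2 * k) := by
    have : (Fintype.card G : ℝ) * r ≤ Fintype.card G * (2 * (2:ℝ) ^ (4 * k) * B ^ (2 * k)) := by linarith
    exact le_of_mul_le_mul_left this hG
  have e6 : ((2 * d : ℕ) : ℝ) ^ (2 * k) ≤ r := by exact_mod_cast hr
  have e7 : (8 * B) ^ (2 * k) < ((2 * d : ℕ) : ℝ) ^ (2 * k) := by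
    apply pow_lt_pow_left₀ _ (by positivity) (by omega)
    push_cast; linarith
  have e8 : 2 * (2:ℝ) ^ (4 * k) * B ^ (2 * k) ≤ (8 * B) ^ (2 * k) := by
    rw [mul_pow]
    have h12 : (2:ℝ) ^ (4 * k) = 4 ^ (2 * k) := by
      rw [show 4 * k = 2 * (2 * k) by ring, pow_mul]; norm_num
    have h13 : (8:ℝ) ^ (2 * k) = 2 ^ (2 * k) * 4 ^ (2 * k) := by rw [← mul_pow]; norm_num
    rw [h12, h13]
    have h14 : (2:ℝ) ≤ 2 ^ (2 * k) := by
      calc (2:ℝ) = 2 ^ 1 := by norm_num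
        _ ≤ 2 ^ (2 * k) := pow_le_pow_right₀ (by norm_num) (by omega)
    gcongr
  linarith

/-- second orthogonality type bound -/
lemma normSq_le_cent {R : G →* Matrix I I ℂ} (h : Irr R) (g : G) :
    ‖Matrix.trace (R g)‖ ^ 2 ≤ Nat.card (Subgroup.centralizer ({g} : Set G)) := by
  classical
  have h1 := irr_normSq h
  have h2 : ∑ y : G, Complex.normSq (Matrix.trace (R (y * g * y⁻¹))) = Fintype.card G * Complex.normSq (Matrix.trace (R g)) := by
    simp_rw [trace_class]
    rw [Finset.sum_const, Finset.card_univ, nsmul_eq_mul]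
  have h3 : ∑ y : G, Complex.normSq (Matrix.trace (R (y * g * y⁻¹))) =
      ∑ x : G, ((Finset.univ.filter (fun y : G => y * g * y⁻¹ = x)).card : ℝ) * Complex.normSq (Matrix.trace (R x)) := by
    rw [← Finset.sum_fiberwise (s := Finset.univ) (g := fun y : G => y * g * y⁻¹)]
    apply Finset.sum_congr rfl
    intro x _
    rw [Finset.sum_congr rfl (g := fun _ => Complex.normSq (Matrix.trace (R x)))]
    · rw [Finset.sum_const, nsmul_eq_mul]
    · intro y hy; rw [(Finset.mem_filter.1 hy).2]
  have h4 : ∀ x : G, (Finset.univ.filter (fun y : G => y * g * y⁻¹ = x)).card ≤ Nat.card (Subgroup.centralizer ({g} : Set G)) := by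
    intro x
    rcases Finset.eq_empty_or_nonempty (Finset.univ.filter (fun y : G => y * g * y⁻¹ = x)) with h0 | ⟨y0, hy0⟩
    · rw [h0]; simp
    · have hy0' := (Finset.mem_filter.1 hy0).2
      rw [Nat.card_eq_fintype_card, ← Finset.card_univ, ← Finset.card_map (Function.Embedding.subtype _)]
      apply Finset.card_le_card_of_injOn (fun y => y0⁻¹ * y)
      · intro y hy
        have hy' := (Finset.mem_filter.1 hy).2
        simp only [Finset.coe_map, Set.mem_image, Finset.coe_univ, Set.mem_univ, true_and]
        refine ⟨⟨y0⁻¹ * y, ?_⟩, rfl⟩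
        rw [Subgroup.mem_centralizer_singleton_iff]
        have h5 : y * g = y0 * g * y0⁻¹ * y := by rw [hy0', ← hy']; group
        calc y0⁻¹ * y * g = y0⁻¹ * (y * g) := by group
          _ = g * (y0⁻¹ * y) := by rw [h5]; group
      · intro a _ b _ hab
        exact mul_left_cancel hab
  have hG : (0:ℝ) < Fintype.card G := by exact_mod_cast Fintype.card_pos
  have h5 : (Fintype.card G : ℝ) * Complex.normSq (Matrix.trace (R g)) ≤ Fintype.card G * Nat.card (Subgroup.centralizer ({g} : Set G)) := by
    rw [← h2, h3]
    refine (Finset.sum_le_sum (fun x _ => mul_le_mul_of_nonneg_right (Nat.cast_le.2 (h4 x)) (Complex.normSq_nonneg _))).trans ?_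
    rw [← Finset.mul_sum, h1, mul_comm]
  have := le_of_mul_le_mul_left h5 hG
  rwa [Complex.normSq_eq_norm_sq] at this

/-- counting -/
lemma card_le_pow (V : G →* Matrix I I ℂ) {k : ℕ} (hd : (dl : G → ℂ) ∈ (mcf V) ^ k) :
    Fintype.card G ≤ Fintype.card I ^ (2 * k) := by
  classical
  obtain ⟨J, _, _, T, hT1, hT2, hT3⟩ := exists_pow V k
  have htop : mcf T = ⊤ := by
    rw [eq_top_iff]
    intro F _
    have : F = ∑ y : G, F y • tl y⁻¹ 1 (dl : G → ℂ) := by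
      funext x
      rw [Finset.sum_apply, Finset.sum_eq_single x]
      · simp [dl]
      · intro b _ hb
        have : b⁻¹ * x ≠ 1 := fun hc => hb (inv_mul_eq_one.1 hc)
        simp [dl, this]
      · simp
    rw [this]
    apply Submodule.sum_mem
    intro y _
    exact Submodule.smul_mem _ _ (mcf_biInv T _ _ _ (hT1 hd))
  have h1 : Module.finrank ℂ (mcf T) ≤ Module.finrank ℂ (Matrix J J ℂ) := LinearMap.finrank_range_le (mcfm T)
  rw [htop, finrank_top, Module.finrank_fintype_fun_eq_card, Module.finrank_matrix, Module.finrank_self, mul_one, hT3, ← pow_add] at h1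
  rw [two_mul]; exact h1
end fin1
end McKayGraphs

open scoped BigOperators
namespace McKayGraphs
open Equiv

section smalln
variable {G : Type*} [Group G] [Fintype G]
variable {I : Type*} [Fintype I] [DecidableEq I]

lemma sep_one (R : G →* Matrix I I ℂ) {g : G} (hg : ¬ ∃ c : ℂ, R g = c • (1 : Matrix I I ℂ)) :
    ∃ F ∈ mcf R, F 1 = 1 ∧ F g = 0 := by
  have key : ∃ A : Matrix I I ℂ, Matrix.trace (A * R g) = 0 ∧ Matrix.trace A ≠ 0 := by
    by_contra hcon
    push Not at hcon
    have hB : ∃ B : Matrix I I ℂ, Matrix.trace (B * R g) ≠ 0 := by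
      by_contra hB
      push Not at hB
      apply hg
      refine ⟨0, ?_⟩
      rw [zero_smul]
      rw [Matrix.ext_iff_trace_mul_left]
      intro x
      rw [hB, mul_zero, Matrix.trace_zero]
    obtain ⟨B, hB⟩ := hB
    have h2 : ∀ A : Matrix I I ℂ, Matrix.trace A = Matrix.trace (A * R g) / Matrix.trace (B * R g) * Matrix.trace B := by
      intro A
      have := hcon (A - (Matrix.trace (A * R g) / Matrix.trace (B * R g)) • B) (by
        rw [sub_mul, Matrix.trace_sub, Matrix.smul_mul, Matrix.trace_smul, smul_eq_mul, div_mul_cancel₀ _ hB, sub_self])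
      rw [Matrix.trace_sub, Matrix.trace_smul, smul_eq_mul, sub_eq_zero] at this
      exact this
    have h3 : (1 : Matrix I I ℂ) = (Matrix.trace B / Matrix.trace (B * R g)) • R g := by
      rw [Matrix.ext_iff_trace_mul_left]
      intro x
      rw [mul_one, h2 x, Matrix.mul_smul, Matrix.trace_smul, smul_eq_mul]
      ring
    rcases eq_or_ne (Matrix.trace B / Matrix.trace (B * R g)) 0 with h0 | h0
    · rw [h0, zero_smul] at h3
      apply hg
      refine ⟨0, ?_⟩
      rw [zero_smul, ← one_mul (R g), h3, zero_mul]
    · apply hg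
      refine ⟨(Matrix.trace B / Matrix.trace (B * R g))⁻¹, ?_⟩
      rw [h3, smul_smul, inv_mul_cancel₀ h0, one_smul]
  obtain ⟨A, hA0, hA⟩ := key
  refine ⟨fun x => Matrix.trace (((Matrix.trace A)⁻¹ • A) * R x), mem_mcf.2 ⟨_, fun _ => rfl⟩, ?_, ?_⟩
  · show Matrix.trace (((Matrix.trace A)⁻¹ • A) * R 1) = 1
    rw [map_one, mul_one, Matrix.trace_smul, smul_eq_mul, inv_mul_cancel₀ hA]
  · show Matrix.trace (((Matrix.trace A)⁻¹ • A) * R g) = 0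
    rw [Matrix.smul_mul, Matrix.trace_smul, hA0, smul_zero]

lemma small_dl (R : G →* Matrix I I ℂ) (hns : ∀ g, g ≠ 1 → ¬ ∃ c : ℂ, R g = c • (1 : Matrix I I ℂ)) :
    (dl : G → ℂ) ∈ (mcf R) ^ (Fintype.card G - 1) := by
  classical
  have key : ∀ s : Finset G, 1 ∉ s → ∃ F ∈ (mcf R) ^ s.card, F 1 = 1 ∧ ∀ g ∈ s, F g = 0 := by
    intro s
    induction s using Finset.induction_on with
    | empty =>
      intro _
      refine ⟨1, ?_, rfl, by simp⟩
      rw [Finset.card_empty, pow_zero]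
      exact Submodule.one_le.mp le_rfl
    | insert a s ha ih =>
      intro h1
      rw [Finset.mem_insert, not_or] at h1
      obtain ⟨F, hF, hF1, hF0⟩ := ih h1.2
      obtain ⟨E, hE, hE1, hE0⟩ := sep_one R (hns a (Ne.symm h1.1))
      refine ⟨F * E, ?_, ?_, ?_⟩
      · rw [Finset.card_insert_of_notMem ha, pow_succ]
        exact Submodule.mul_mem_mul hF hE
      · rw [Pi.mul_apply, hF1, hE1, one_mul]
      · intro g hg
        rw [Pi.mul_apply]
        rcases Finset.mem_insert.1 hg with rfl | hg
        · rw [hE0, mul_zero]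
        · rw [hF0 g hg, zero_mul]
  obtain ⟨F, hF, hF1, hF0⟩ := key (Finset.univ.erase 1) (by simp)
  rw [Finset.card_erase_of_mem (Finset.mem_univ _), Finset.card_univ] at hF
  have : (dl : G → ℂ) = F := by
    funext g
    by_cases hg : g = 1
    · rw [hg, hF1]; simp [dl]
    · rw [hF0 g (by simp [hg])]; simp [dl, hg]
  rw [this]
  exact hF

def scal (R : G →* Matrix I I ℂ) : Subgroup G where
  carrier := {g | ∃ c : ℂ, R g = c • (1 : Matrix I I ℂ)}
  one_mem' := ⟨1, by rw [map_one, one_smul]⟩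
  mul_mem' := by
    rintro a b ⟨c, hc⟩ ⟨d, hd⟩
    exact ⟨c * d, by rw [map_mul, hc, hd, smul_mul_smul_comm, one_mul]⟩
  inv_mem' := by
    rintro a ⟨c, hc⟩
    have h := rep_inv R a
    rw [hc, Matrix.smul_mul, one_mul] at h
    rcases eq_or_ne c 0 with h0 | h0
    · rw [h0, zero_smul] at h
      refine ⟨0, ?_⟩
      rw [zero_smul, ← one_mul (R a⁻¹), ← h, zero_mul]
    · exact ⟨c⁻¹, by rw [← h, smul_smul, inv_mul_cancel₀ h0, one_smul]⟩

instance scal_normal (R : G →* Matrix I I ℂ) : (scal R).Normal where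
  conj_mem := by
    rintro a ⟨c, hc⟩ g
    refine ⟨c, ?_⟩
    rw [map_mul, map_mul, hc, Matrix.mul_smul, mul_one, Matrix.smul_mul, rep_inv]

end smalln

section smallalt
variable {X : Type*} [Fintype X] [DecidableEq X]
variable {I : Type*} [Fintype I] [DecidableEq I]

lemma triv_of_scalar (h5 : 5 ≤ Nat.card X) {R : alternatingGroup X →* Matrix I I ℂ} (h : Irr R)
    (hs : ∀ g, ∃ c : ℂ, R g = c • (1 : Matrix I I ℂ)) (g : alternatingGroup X) : Matrix.trace (R g) = 1 := by
  have hk : commutator (alternatingGroup X) ≤ R.ker := by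
    unfold commutator
    rw [Subgroup.commutator_le]
    intro a _ b _
    rw [MonoidHom.mem_ker, commutatorElement_def, map_mul, map_mul, map_mul]
    obtain ⟨c, hc⟩ := hs b
    have hcomm : R a * R b = R b * R a := by
      rw [hc, Matrix.mul_smul, Matrix.smul_mul, mul_one, one_mul]
    rw [hcomm, mul_assoc (R b), rep_inv, mul_one, rep_inv]
  rw [commutator_alternatingGroup_eq_top h5] at hk
  have h1 : ∀ g, R g = 1 := fun g => hk (Subgroup.mem_top g)
  have h2 := h
  unfold Irr at h2
  simp only [h1, Matrix.trace_one] at h2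
  rw [Finset.sum_const, Finset.card_univ, nsmul_eq_mul] at h2
  have h3 : (Fintype.card I : ℂ) * Fintype.card I = 1 :=
    mul_left_cancel₀ (cardG_ne (alternatingGroup X)) (by rw [h2, mul_one])
  have h4 : Fintype.card I * Fintype.card I = 1 := by exact_mod_cast h3
  have h5 : Fintype.card I = 1 := Nat.eq_one_of_mul_eq_one_left h4
  rw [h1, Matrix.trace_one, h5, Nat.cast_one]

lemma two_le_dim (h5 : 5 ≤ Nat.card X) {R : alternatingGroup X →* Matrix I I ℂ} (h : Irr R)
    (hne : ∃ g, Matrix.trace (R g) ≠ 1) : 2 ≤ Fintype.card I := by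
  by_contra hlt
  haveI := h.nonempty
  have hpos : 0 < Fintype.card I := Fintype.card_pos
  have h1 : Fintype.card I = 1 := by omega
  obtain ⟨i, hi⟩ := Fintype.card_eq_one_iff.1 h1
  obtain ⟨g, hg⟩ := hne
  apply hg
  apply triv_of_scalar h5 h
  intro g
  refine ⟨R g i i, ?_⟩
  ext a b
  rw [hi a, hi b]
  simp

lemma alt_dl (h5 : 5 ≤ Nat.card X) {R : alternatingGroup X →* Matrix I I ℂ} (h : Irr R)
    (hne : ∃ g, Matrix.trace (R g) ≠ 1) :
    (dl : alternatingGroup X → ℂ) ∈ (mcf R) ^ (Fintype.card (alternatingGroup X) - 1) := by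
  apply small_dl
  intro g hg hc
  rcases alternatingGroup.normal_subgroup_eq_bot_or_eq_top h5 (N := scal R) with h0 | h0
  · have : g ∈ scal R := hc
    rw [h0] at this
    exact hg (Subgroup.mem_bot.1 this)
  · obtain ⟨g', hg'⟩ := hne
    apply hg'
    apply triv_of_scalar h5 h
    intro x
    have : x ∈ scal R := by rw [h0]; exact Subgroup.mem_top x
    exact this

lemma cent_le {R : alternatingGroup X →* Matrix I I ℂ} {t : Perm X} (ht : t ∉ alternatingGroup X) {g : alternatingGroup X}
    (hne : Matrix.trace (R g) ≠ Matrix.trace (tw R t g)) :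
    Subgroup.centralizer ({(g : Perm X)} : Set (Perm X)) ≤ alternatingGroup X := by
  intro s hs
  by_contra hodd
  apply hne
  rw [← tw_trace_odd R ht hodd g, tw_apply]
  congr 2
  apply Subtype.ext
  rw [MulAut.conjNormal_apply]
  rw [Subgroup.mem_centralizer_singleton_iff] at hs
  rw [hs, mul_inv_cancel_right]

lemma sum_distinct (s : Finset ℕ) : (∀ a ∈ s, 1 ≤ a) → s.card * s.card ≤ 2 * ∑ a ∈ s, a := by
  induction s using Finset.induction_on_max with
  | empty => simp
  | insert a s hmax ih =>
    intro h
    have ha : a ∉ s := fun ha => lt_irrefl _ (hmax a ha)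
    have h1 := ih (fun b hb => h b (Finset.mem_insert_of_mem hb))
    have h2 : s.card ≤ a - 1 := by
      have : s ⊆ Finset.Ico 1 a := fun b hb => Finset.mem_Ico.2 ⟨h b (Finset.mem_insert_of_mem hb), hmax b hb⟩
      have := Finset.card_le_card this
      rwa [Nat.card_Ico] at this
    have h3 := h a (Finset.mem_insert_self _ _)
    rw [Finset.card_insert_of_notMem ha, Finset.sum_insert ha]
    have h4 : s.card + 1 ≤ a := by omega
    nlinarith

lemma cent_card (g : Perm X) (hc : Subgroup.centralizer ({g} : Set (Perm X)) ≤ alternatingGroup X) :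
    Nat.card (Subgroup.centralizer ({g} : Set (Perm X))) ≤ (Fintype.card X) ^ (Nat.sqrt (2 * Fintype.card X)) := by
  have h1 := Perm.card_le_of_centralizer_le_alternating hc
  have h2 := Perm.count_le_one_of_centralizer_le_alternating hc
  have h3 : g.cycleType.sum ≤ Fintype.card X := by
    rw [Perm.sum_cycleType]; exact Finset.card_le_univ _
  rw [Perm.nat_card_centralizer]
  have h4 : (Fintype.card X - g.cycleType.sum).factorial = 1 := by
    have : Fintype.card X - g.cycleType.sum ≤ 1 := by omega
    interval_cases (Fintype.card X - g.cycleType.sum) <;> rfl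
  have h5 : ∏ n ∈ g.cycleType.toFinset, (Multiset.count n g.cycleType).factorial = 1 := by
    apply Finset.prod_eq_one
    intro i _
    have := h2 i
    interval_cases (Multiset.count i g.cycleType) <;> rfl
  rw [h4, h5, one_mul, mul_one]
  have h6 : g.cycleType.prod ≤ (Fintype.card X) ^ g.cycleType.card := by
    apply Multiset.prod_le_pow_card
    intro x hx
    exact (Multiset.le_sum_of_mem hx).trans h3
  have hnd : g.cycleType.Nodup := Multiset.nodup_iff_count_le_one.2 h2
  have h7 : g.cycleType.card * g.cycleType.card ≤ 2 * Fintype.card X := by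
    have h8 := sum_distinct (Multiset.toFinset g.cycleType) (by
      intro a ha
      have := Perm.one_lt_of_mem_cycleType (Multiset.mem_toFinset.1 ha)
      omega)
    rw [Multiset.toFinset_card_of_nodup hnd] at h8
    have h9 : ∑ a ∈ Multiset.toFinset g.cycleType, a = g.cycleType.sum := by
      rw [Finset.sum_multiset_count, ]
      apply Finset.sum_congr rfl
      intro a ha
      rw [Multiset.count_eq_one_of_mem hnd (Multiset.mem_toFinset.1 ha), one_smul]
    rw [h9] at h8
    omega
  refine h6.trans ?_
  rcases Nat.eq_zero_or_pos (Fintype.card X) with h0 | h0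
  · have : Nat.card (Perm X) = 1 := by
      haveI := Fintype.card_eq_zero_iff.1 h0
      simp
    rw [h0] at h7 ⊢
    have : g.cycleType.card = 0 := by
      rcases Nat.eq_zero_or_pos g.cycleType.card with h | h
      · exact h
      · nlinarith
    rw [this]; simp
  · exact Nat.pow_le_pow_right h0 (Nat.le_sqrt.2 h7)

lemma cent_card_alt (g : alternatingGroup X) : Nat.card (Subgroup.centralizer ({g} : Set (alternatingGroup X))) ≤
    Nat.card (Subgroup.centralizer ({(g : Perm X)} : Set (Perm X))) := by
  apply Nat.card_le_card_of_injective
    (fun s : Subgroup.centralizer ({g} : Set (alternatingGroup X)) =>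
      (⟨((s : alternatingGroup X) : Perm X), by
        have := Subgroup.mem_centralizer_singleton_iff.1 s.2
        rw [Subgroup.mem_centralizer_singleton_iff]
        exact congrArg Subtype.val this⟩ : Subgroup.centralizer ({(g : Perm X)} : Set (Perm X))))
  intro a b hab
  have := congrArg Subtype.val hab
  exact Subtype.ext (Subtype.ext this)

theorem split_bound {R : alternatingGroup X →* Matrix I I ℂ} (h : Irr R) {t : Perm X} (ht : t ∉ alternatingGroup X)
    (g : alternatingGroup X) (hne : Matrix.trace (R g) ≠ Matrix.trace (tw R t g)) :
    ‖Matrix.trace (R g)‖ ^ 2 ≤ (Fintype.card X : ℝ) ^ (Nat.sqrt (2 * Fintype.card X)) ∧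
    ‖Matrix.trace (tw R t g)‖ ^ 2 ≤ (Fintype.card X : ℝ) ^ (Nat.sqrt (2 * Fintype.card X)) := by
  have h1 : (Nat.card (Subgroup.centralizer ({g} : Set (alternatingGroup X))) : ℝ) ≤
      (Fintype.card X : ℝ) ^ (Nat.sqrt (2 * Fintype.card X)) := by
    exact_mod_cast (cent_card_alt g).trans (cent_card _ (cent_le ht hne))
  exact ⟨(normSq_le_cent h g).trans h1, (normSq_le_cent (tw_irr h t) g).trans h1⟩

end smallalt
end McKayGraphs

open scoped BigOperators
namespace McKayGraphs
open Equiv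

lemma num_sqrt (c : ℝ) (hc : 0 < c) : ∃ n0 : ℕ, ∀ n : ℕ, n0 ≤ n → 3 + (Nat.sqrt (2 * n) : ℝ) * Real.log n < c * n := by
  have h1 := (isLittleO_log_rpow_atTop (r := 1/4) (by norm_num)).bound (c := 1) one_pos
  have h2 := (tendsto_rpow_atTop (y := 1/4) (by norm_num)).eventually_gt_atTop (5 / c)
  have h3 := tendsto_natCast_atTop_atTop (R := ℝ) |>.eventually (h1.and h2)
  obtain ⟨N, hN⟩ := Filter.eventually_atTop.1 h3
  refine ⟨max N 1, fun n hn => ?_⟩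
  obtain ⟨ha, hb⟩ := hN n (le_trans (le_max_left _ _) hn)
  have hn1 : (1 : ℝ) ≤ n := by exact_mod_cast le_trans (le_max_right _ _) hn
  obtain ⟨y, hy⟩ : ∃ y : ℝ, y = (n : ℝ) ^ (1/4 : ℝ) := ⟨_, rfl⟩
  have hy0 : 0 < y := by rw [hy]; positivity
  have hy1 : 1 ≤ y := by rw [hy]; exact Real.one_le_rpow hn1 (by norm_num)
  have hy4 : y ^ 4 = n := by
    rw [hy, ← Real.rpow_natCast, ← Real.rpow_mul (by positivity)]; norm_num
  have hlog : Real.log n ≤ y := by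
    rw [one_mul, Real.norm_eq_abs, Real.norm_eq_abs, ← hy, abs_of_pos hy0] at ha
    exact (le_abs_self _).trans ha
  have hlog0 : 0 ≤ Real.log n := Real.log_nonneg hn1
  rw [← hy] at hb
  have hs : (Nat.sqrt (2 * n) : ℝ) ≤ 2 * y ^ 2 := by
    have : ((Nat.sqrt (2 * n) : ℕ) : ℝ) ^ 2 ≤ (2 * y ^ 2) ^ 2 := by
      have h := Nat.sqrt_le' (2 * n)
      have h' : ((Nat.sqrt (2 * n) : ℕ) : ℝ) ^ 2 ≤ 2 * n := by exact_mod_cast h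
      rw [← hy4] at h'
      nlinarith [pow_pos hy0 4]
    exact abs_le_of_sq_le_sq' this (by positivity) |>.2
  have hm : (Nat.sqrt (2 * n) : ℝ) * Real.log n ≤ 2 * y ^ 2 * y := mul_le_mul hs hlog hlog0 (by positivity)
  rw [div_lt_iff₀ hc] at hb
  have hy3 : 1 ≤ y ^ 3 := one_le_pow₀ hy1
  have : 5 * y ^ 3 < c * y ^ 4 := by
    have := mul_lt_mul_of_pos_right hb (pow_pos hy0 3)
    calc 5 * y ^ 3 < y * c * y ^ 3 := this
      _ = c * y ^ 4 := by ring
  rw [hy4] at this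
  nlinarith

lemma log_alt {X : Type*} [Fintype X] [DecidableEq X] (hn : 2 ^ 64 ≤ Fintype.card X) :
    (Fintype.card X : ℝ) * Real.log (Fintype.card X) ≤ 2 * Real.log (Fintype.card (alternatingGroup X)) := by
  obtain ⟨n, hnn⟩ : ∃ n, n = Fintype.card X := ⟨_, rfl⟩
  haveI : Nontrivial X := Fintype.one_lt_card_iff_nontrivial.1 (by omega)
  have h2 := two_mul_nat_card_alternatingGroup (α := X)
  rw [Nat.card_perm, Nat.card_eq_fintype_card, Nat.card_eq_fintype_card, ← hnn] at h2
  rw [← hnn] at hn ⊢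
  have hnR : (2 : ℝ) ^ 64 ≤ n := by exact_mod_cast hn
  have hn0 : (0 : ℝ) < n := lt_of_lt_of_le (by positivity) hnR
  have h3 := Real.pow_div_factorial_le_exp (n : ℝ) hn0.le n
  have hA : (0 : ℝ) < Fintype.card (alternatingGroup X) := by exact_mod_cast Fintype.card_pos
  have h4 : ((n.factorial : ℕ) : ℝ) = 2 * (Fintype.card (alternatingGroup X) : ℝ) := by exact_mod_cast h2.symm
  rw [h4, div_le_iff₀ (by positivity)] at h3
  have h5 := Real.log_le_log (by positivity) h3
  rw [Real.log_pow, Real.log_mul (by positivity) (by positivity), Real.log_exp, Real.log_mul (by norm_num) hA.ne'] at h5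
  have hl2 : Real.log 2 ≤ 1 := by have := Real.log_two_lt_d9; linarith
  have hl2' : (1:ℝ)/2 ≤ Real.log 2 := by have := Real.log_two_gt_d9; linarith
  have hln : 4 ≤ Real.log n := by
    have := Real.log_le_log (by positivity) hnR
    rw [Real.log_pow] at this
    push_cast at this
    linarith
  have hn1 : (1 : ℝ) ≤ n := le_trans (by norm_num) hnR
  nlinarith

section large
variable {X : Type*} [Fintype X] [DecidableEq X]
variable {I : Type*} [Fintype I] [DecidableEq I]
variable {I1 I2 : Type*} [Fintype I1] [DecidableEq I1] [Fintype I2] [DecidableEq I2]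

theorem large {K : ℝ} (hK : K = 2832 * 2832 * 20000) (hn : 2 ^ 64 ≤ Fintype.card X)
    (hnum : 3 + (Nat.sqrt (2 * Fintype.card X) : ℝ) * Real.log (Fintype.card X) < 1 / (800 * K) * Fintype.card X)
    {R : alternatingGroup X →* Matrix I I ℂ} (h : Irr R) (hd2 : 2 ≤ Fintype.card I)
    {R1 : alternatingGroup X →* Matrix I1 I1 ℂ} {R2 : alternatingGroup X →* Matrix I2 I2 ℂ} (h1 : Irr R1) (h2 : Irr R2) :
    ∃ k : ℕ, 1 ≤ k ∧ (k : ℝ) * Real.log (Fintype.card I) ≤ 1600 * K * Real.log (Fintype.card (alternatingGroup X)) ∧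
      ∑ g, Matrix.trace (R g) ^ k * (Matrix.trace (R1 g) * starRingEnd ℂ (Matrix.trace (R2 g))) ≠ 0 := by
  obtain ⟨t, ht⟩ : ∃ t : Perm X, t ∉ alternatingGroup X := by
    obtain ⟨a, b, hab⟩ := Fintype.one_lt_card_iff.1 (show 1 < Fintype.card X by omega)
    refine ⟨Equiv.swap a b, ?_⟩
    rw [Perm.mem_alternatingGroup, Perm.sign_swap hab]
    decide
  obtain ⟨p, q, hT, hf⟩ := link h ht
  have hK0 : 0 < K := by rw [hK]; norm_num
  have hlogA := log_alt hn
  obtain ⟨L, hL⟩ := comb hT hn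
  have hdim := dim_bound h hT.1 hf L
  have hdR : (2 : ℝ) ≤ Fintype.card I := by exact_mod_cast hd2
  have hld := Real.log_le_log (by linarith) hdim
  have hld0 : 0 < Real.log (Fintype.card I) := Real.log_pos (by linarith)
  rw [← hK] at hL
  rcases hL with hL | ⟨k, M, hk, hM, hdl, hkM, hLM, hsp⟩
  · exact absurd hL (by linarith)
  have hdl' := link_pow hf hdl
  have hkR : (1 : ℝ) ≤ k := by exact_mod_cast hk
  have hbase : (k : ℝ) * Real.log (Fintype.card I) ≤ 400 * K * Real.log (Fintype.card (alternatingGroup X)) := by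
    calc (k : ℝ) * Real.log (Fintype.card I) ≤ k * (200 * M) :=
          mul_le_mul_of_nonneg_left (hld.trans hLM) (by linarith)
      _ = 200 * (k * M) := by ring
      _ ≤ 200 * (K * (Fintype.card X * Real.log (Fintype.card X))) := by linarith
      _ ≤ 200 * (K * (2 * Real.log (Fintype.card (alternatingGroup X)))) := by
          have := mul_le_mul_of_nonneg_left hlogA hK0.le
          linarith
      _ = 400 * K * Real.log (Fintype.card (alternatingGroup X)) := by ring
  have hA0 : 0 < Real.log (Fintype.card (alternatingGroup X)) := by
    by_contra hc
    push Not at hc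
    have : 400 * K * Real.log (Fintype.card (alternatingGroup X)) ≤ 0 := mul_nonpos_of_nonneg_of_nonpos (by positivity) hc
    have : 0 < (k : ℝ) * Real.log (Fintype.card I) := by positivity
    linarith
  by_cases hne : ∃ g, Matrix.trace (R g) ≠ Matrix.trace (tw R t g)
  · -- split case
    obtain ⟨hq, hp⟩ := split_rl h ht hne hT hf
    have hnM := hsp hq hp
    have hcard := card_le_pow _ hdl'
    rw [Fintype.card_sum] at hcard
    have hnR : (2 : ℝ) ^ 64 ≤ Fintype.card X := by exact_mod_cast hn
    have hn0 : (0 : ℝ) < Fintype.card X := lt_of_lt_of_le (by positivity) hnR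
    have hln : 0 < Real.log (Fintype.card X) := Real.log_pos (lt_of_lt_of_le (by norm_num) hnR)
    have hkb : (k : ℝ) ≤ 200 * K * Real.log (Fintype.card X) := by
      have h3 : (k : ℝ) * Fintype.card X ≤ (200 * K * Real.log (Fintype.card X)) * Fintype.card X := by
        calc (k : ℝ) * Fintype.card X ≤ k * (200 * M) := mul_le_mul_of_nonneg_left hnM (by linarith)
          _ = 200 * (k * M) := by ring
          _ ≤ 200 * (K * (Fintype.card X * Real.log (Fintype.card X))) := by linarith
          _ = _ := by ring
      exact le_of_mul_le_mul_right h3 hn0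
    have hcR : (Fintype.card (alternatingGroup X) : ℝ) ≤ (2 * Fintype.card I : ℝ) ^ (2 * k) := by
      rw [two_mul (Fintype.card I : ℝ)]
      exact_mod_cast hcard
    have hlc := Real.log_le_log (by exact_mod_cast Fintype.card_pos) hcR
    rw [Real.log_pow] at hlc
    push_cast at hlc
    have hl2d0 : 0 < Real.log (2 * Fintype.card I) := Real.log_pos (by linarith)
    have hl2d : 1 / (800 * K) * Fintype.card X ≤ Real.log (2 * Fintype.card I) := by
      rw [one_div, inv_mul_le_iff₀ (by positivity)]
      have h3 : (Fintype.card X : ℝ) * Real.log (Fintype.card X) ≤ (800 * K * Real.log (2 * Fintype.card I)) * Real.log (Fintype.card X) := by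
        have := mul_le_mul_of_nonneg_right hkb hl2d0.le
        nlinarith
      exact le_of_mul_le_mul_right h3 hln
    have h8 : Real.log 8 ≤ 3 := by
      have : (8 : ℝ) = 2 ^ 3 := by norm_num
      rw [this, Real.log_pow]
      have := Real.log_two_lt_d9
      push_cast
      linarith
    have hB0 : (0 : ℝ) < (Fintype.card X : ℝ) ^ (Nat.sqrt (2 * Fintype.card X)) := by positivity
    have hd4 : 4 * (Fintype.card X : ℝ) ^ (Nat.sqrt (2 * Fintype.card X)) < Fintype.card I := by
      have h3 : Real.log (8 * (Fintype.card X : ℝ) ^ (Nat.sqrt (2 * Fintype.card X))) < Real.log (2 * Fintype.card I) := by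
        rw [Real.log_mul (by norm_num) hB0.ne', Real.log_pow]
        linarith
      have := (Real.log_lt_log_iff (by positivity) (by linarith)).1 h3
      linarith
    refine ⟨4 * k, by omega, ?_, split_main hk hdl' h1 h2 hB0 (split_bound h ht) hd4⟩
    push_cast
    linarith
  · push Not at hne
    have hm : mcf (VV R t) = mcf R := by
      unfold VV
      rw [mcf_ds]
      exact sup_eq_left.2 (mcf_le_of_trace (tw_irr h t) (fun g => (hne g).symm))
    rw [hm] at hdl'
    refine ⟨k, hk, ?_, direct hdl' h1 h2⟩
    have : 0 ≤ K * Real.log (Fintype.card (alternatingGroup X)) := by positivity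
    linarith

end large

section final

lemma irr_of {G : Type*} [Group G] [Fintype G] {χ : G → ℂ} (h : IsIrrChar χ) :
    ∃ (d : ℕ) (R : G →* Matrix (Fin d) (Fin d) ℂ), Irr R ∧ ∀ g, χ g = Matrix.trace (R g) := by
  obtain ⟨⟨d, ρ, hρ⟩, h1⟩ := h
  refine ⟨d, (Units.coeHom _).comp ρ, ?_, hρ⟩
  unfold Irr
  unfold charInner at h1
  rw [finsum_eq_sum_of_fintype, Nat.card_eq_fintype_card, inv_mul_eq_one₀ (cardG_ne G)] at h1
  rw [h1]
  apply Finset.sum_congr rfl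
  intro g _
  rw [trace_inv_conj, hρ]
  rfl

lemma cons_of {G : Type*} [Group G] [Fintype G] {φ ψ : G → ℂ} (h : ∑ g, φ g * starRingEnd ℂ (ψ g) ≠ 0) :
    IsConstituent ψ φ := by
  unfold IsConstituent charInner
  rw [finsum_eq_sum_of_fintype, Nat.card_eq_fintype_card]
  exact mul_ne_zero (inv_ne_zero (cardG_ne G)) h

/-- **McKay graphs for alternating groups** (Theorem 2 of Liebeck–Shalev–Tiep).
There is an absolute constant `C > 0` such that for all `n ≥ 5` and all nontrivial
irreducible characters `α` of `G = A_n`, and all irreducible `χ₁, χ₂`, there is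
`1 ≤ k ≤ C·log|G|/log α(1)` with `χ₂` a constituent of `α^k · χ₁`. -/
theorem mckay_diameter_alternating :
    ∃ C : ℝ, 0 < C ∧ ∀ n : ℕ, 5 ≤ n →
      ∀ α : alternatingGroup (Fin n) → ℂ, IsIrrChar α → α ≠ 1 →
      ∀ χ₁ χ₂ : alternatingGroup (Fin n) → ℂ, IsIrrChar χ₁ → IsIrrChar χ₂ →
      ∃ k : ℕ, 1 ≤ k ∧
        (k : ℝ) ≤ C * Real.log (Nat.card (alternatingGroup (Fin n))) /
          Real.log (α 1).re ∧
        IsConstituent χ₂ (α ^ k * χ₁) := by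
  obtain ⟨K, hK⟩ : ∃ K : ℝ, K = 2832 * 2832 * 20000 := ⟨_, rfl⟩
  have hK0 : 0 < K := by rw [hK]; norm_num
  obtain ⟨n1, hn1⟩ := num_sqrt (1 / (800 * K)) (by positivity)
  obtain ⟨n0, hn0⟩ : ∃ n0 : ℕ, n0 = max n1 (2 ^ 64) := ⟨_, rfl⟩
  refine ⟨1600 * K + n0.factorial, by positivity, ?_⟩
  intro n hn α hα hα1 χ₁ χ₂ hχ₁ hχ₂
  obtain ⟨d, R, hR, hRα⟩ := irr_of hα
  obtain ⟨d1, R1, hR1, hRχ₁⟩ := irr_of hχ₁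
  obtain ⟨d2, R2, hR2, hRχ₂⟩ := irr_of hχ₂
  have h5 : 5 ≤ Nat.card (Fin n) := by rw [Nat.card_eq_fintype_card, Fintype.card_fin]; exact hn
  have hne : ∃ g, Matrix.trace (R g) ≠ 1 := by
    by_contra hc
    push Not at hc
    apply hα1
    funext g
    rw [hRα, hc, Pi.one_apply]
  have hd2 := two_le_dim h5 hR hne
  have hα1 : (α 1).re = Fintype.card (Fin d) := by
    rw [hRα, map_one, Matrix.trace_one, Complex.natCast_re]
  have hdR : (2 : ℝ) ≤ Fintype.card (Fin d) := by exact_mod_cast hd2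
  have hld : 0 < Real.log (Fintype.card (Fin d)) := Real.log_pos (by linarith)
  have hsq : ((Fintype.card (Fin d) : ℝ)) ^ 2 ≤ Fintype.card (alternatingGroup (Fin n)) := by
    exact_mod_cast sq_le_card hR
  have hlsq := Real.log_le_log (by positivity) hsq
  rw [Real.log_pow] at hlsq
  push_cast at hlsq
  have main : ∃ k : ℕ, 1 ≤ k ∧ (k : ℝ) * Real.log (Fintype.card (Fin d)) ≤
      (1600 * K + n0.factorial) * Real.log (Fintype.card (alternatingGroup (Fin n))) ∧
      ∑ g, Matrix.trace (R g) ^ k * (Matrix.trace (R1 g) * starRingEnd ℂ (Matrix.trace (R2 g))) ≠ 0 := by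
    by_cases hnn : n0 ≤ n
    · have hb : 2 ^ 64 ≤ Fintype.card (Fin n) := by
        rw [Fintype.card_fin]
        exact le_trans (by rw [hn0]; exact le_max_right _ _) hnn
      have ha : n1 ≤ n := le_trans (by rw [hn0]; exact le_max_left _ _) hnn
      have hnum := hn1 n ha
      rw [← Fintype.card_fin n] at hnum
      obtain ⟨k, hk, hk2, hk3⟩ := large hK hb (by simpa only [Fintype.card_fin] using hnum) hR hd2 hR1 hR2
      refine ⟨k, hk, hk2.trans ?_, hk3⟩
      have : 0 ≤ (n0.factorial : ℝ) * Real.log (Fintype.card (alternatingGroup (Fin n))) :=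
        mul_nonneg (by positivity) (by linarith)
      linarith
    · push Not at hnn
      have hdl := alt_dl h5 hR hne
      have h4 : 4 ≤ Fintype.card (alternatingGroup (Fin n)) := by
        have := sq_le_card hR
        nlinarith
      refine ⟨_, ?_, ?_, direct hdl hR1 hR2⟩
      · omega
      · have hc : Fintype.card (alternatingGroup (Fin n)) - 1 ≤ n0.factorial := by
          have h6 : Fintype.card (alternatingGroup (Fin n)) ≤ Fintype.card (Perm (Fin n)) :=
            Fintype.card_le_of_injective _ Subtype.val_injective
          rw [Fintype.card_perm, Fintype.card_fin] at h6
          exact (Nat.sub_le _ _).trans (h6.trans (Nat.factorial_le hnn.le))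
        have hcR : ((Fintype.card (alternatingGroup (Fin n)) - 1 : ℕ) : ℝ) ≤ n0.factorial := Nat.cast_le.2 hc
        have h7 : ((Fintype.card (alternatingGroup (Fin n)) - 1 : ℕ) : ℝ) * Real.log (Fintype.card (Fin d)) ≤
            n0.factorial * Real.log (Fintype.card (alternatingGroup (Fin n))) :=
          mul_le_mul hcR (by linarith) hld.le (by positivity)
        have h8 : 0 ≤ K * Real.log (Fintype.card (alternatingGroup (Fin n))) := mul_nonneg hK0.le (by linarith)
        linarith
  obtain ⟨k, hk, hk2, hk3⟩ := main
  refine ⟨k, hk, ?_, ?_⟩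
  · rw [hα1, Nat.card_eq_fintype_card, le_div_iff₀ hld]
    exact hk2
  · apply cons_of
    convert hk3 using 2 with g
    rw [Pi.mul_apply, Pi.pow_apply, hRα, hRχ₁, hRχ₂, mul_assoc]

end final
end McKayGraphs
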